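/- Each of the Table W algebras W₄, W₆, W₇, …, W₃₄ over an algebraically closed field K is τ-tilting finite, with number of isomorphism classes of basic support τ-tilting modules: W₄: 5, W₆: 6, W₇: 8, W₈: 8, W₉: 6, W₁₀: 6, W₁₁: 7, W₁₂: 5, W₁₃: 5, W₁₄: 10, W₁₅: 9, W₁₆: 8, W₁₇: 9, W₁₈: 8, W₁₉: 7, W₂₀: 7, W₂₁: 7, W₂₂: 7, W₂₃: 8, W₂₄: 10, W₂₅: 7, W₂₆: 7, W₂₇: 8, W₂₈: 8, W₂₉: 8, W₃₀: 8, W₃₁: 6, W₃₂: 6, W₃₃: 6, W₃₄: 6; the Hasse quiver types are respectively H_{1,2}, H_{1,3}, H_{1,5}, H_{1,5}, H_{1,3}, H_{1,3}, H_{1,4}, H_{1,2}, H_{1,2}, H_{3,5}, H_{2,5}, H_{3,3}, H_{2,5}, H_{3,3}, H_{2,3}, H_{2,3}, H_{2,3}, H_{2,3}, H_{3,3}, H_{3,5}, H_{2,3}, H_{2,3}, H_{2,4}, H_{3,3}, H_{3,3}, H_{2,4}, H_{2,2}, H_{2,2}, H_{2,2}, H_{2,2}. -/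

import Mathlib

/-!
Core definitions for τ-tilting theory of finite dimensional algebras.

Throughout, for an algebra `Λ`, *right* `Λ`-modules are formalized as left modules
over the opposite ring `Λᵐᵒᵖ` (the category `RMod Λ := ModuleCat Λᵐᵒᵖ`).

τ-rigidity is formalized via the standard projective-presentation criterion of
Auslander–Smalø/Adachi–Iyama–Reiten: a finitely generated module `M` is τ-rigid iff it admits
a (finite) projective presentation `P₁ → P₀ → M → 0` such that
`Hom(P₀, M) → Hom(P₁, M)` is surjective.
-/

noncomputable section

namespace TwoPoint

/-- A module is indecomposable if it is nonzero and admits no nontrivial direct sum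
decomposition. -/
def IsIndecModule (R : Type) [Ring R] (M : Type) [AddCommGroup M] [Module R M] : Prop :=
  Nontrivial M ∧ ∀ N₁ N₂ : Submodule R M, IsCompl N₁ N₂ → N₁ = ⊥ ∨ N₂ = ⊥

/-- `M` decomposes as a finite direct sum of indecomposable submodules having exactly `n`
isomorphism classes. -/
def HasIndecClassCount (R : Type) [Ring R] (M : ModuleCat.{0} R) (n : ℕ) : Prop :=
  ∃ (k : ℕ) (N : Fin k → Submodule R M),
    DirectSum.IsInternal N ∧ (∀ i, IsIndecModule R (N i)) ∧
    ∃ c : Fin k → Fin n, Function.Surjective c ∧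
      ∀ i j, (c i = c j ↔ Nonempty ((N i) ≃ₗ[R] (N j)))

/-- `M` is basic: it decomposes as a finite direct sum of pairwise nonisomorphic
indecomposable submodules. -/
def IsBasicModuleCat (R : Type) [Ring R] (M : ModuleCat.{0} R) : Prop :=
  ∃ (k : ℕ) (N : Fin k → Submodule R M),
    DirectSum.IsInternal N ∧ (∀ i, IsIndecModule R (N i)) ∧
    ∀ i j, i ≠ j → IsEmpty ((N i) ≃ₗ[R] (N j))

/-- τ-rigidity, via the projective presentation criterion: there is a finite projective
presentation `P₁ —f→ P₀ —g→ M → 0` such that `Hom(—, M)` applied to `f` is surjective,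
i.e. `Hom_Λ(M, τM) = 0`. -/
def IsTauRigidCat (R : Type) [Ring R] (M : ModuleCat.{0} R) : Prop :=
  Module.Finite R M ∧
  ∃ (P₁ P₀ : ModuleCat.{0} R) (f : P₁ →ₗ[R] P₀) (g : P₀ →ₗ[R] M),
    Module.Finite R P₁ ∧ Module.Projective R P₁ ∧
    Module.Finite R P₀ ∧ Module.Projective R P₀ ∧
    Function.Surjective g ∧ LinearMap.range f = LinearMap.ker g ∧
    ∀ h : P₁ →ₗ[R] M, ∃ h' : P₀ →ₗ[R] M, h = h'.comp f

/-- Support τ-tilting module, via support τ-tilting pairs `(M, P)` (Adachi–Iyama–Reiten):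
`M` is τ-rigid, `P` is finitely generated projective with `Hom(P, M) = 0`, and
`|M| + |P| = |R|` where `|X|` is the number of isomorphism classes of indecomposable
direct summands. -/
def IsSupportTauTiltingCat (R : Type) [Ring R] (M : ModuleCat.{0} R) : Prop :=
  IsTauRigidCat R M ∧
  ∃ (P : ModuleCat.{0} R) (p q r : ℕ),
    Module.Finite R P ∧ Module.Projective R P ∧
    (∀ f : P →ₗ[R] M, f = 0) ∧
    HasIndecClassCount R M p ∧ HasIndecClassCount R P q ∧
    HasIndecClassCount R (ModuleCat.of R R) r ∧ p + q = r

/-- The category of (finitely generated) right `Λ`-modules, as left `Λᵐᵒᵖ`-modules. -/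
abbrev RMod (Λ : Type) [Ring Λ] := ModuleCat.{0} Λᵐᵒᵖ

/-- Basic support τ-tilting right `Λ`-module. -/
def IsBasicSupportTauTilting (Λ : Type) [Ring Λ] (M : RMod Λ) : Prop :=
  IsSupportTauTiltingCat Λᵐᵒᵖ M ∧ IsBasicModuleCat Λᵐᵒᵖ M

/-- `Λ` is τ-tilting finite: there are only finitely many isomorphism classes of basic
support τ-tilting right `Λ`-modules. -/
def IsTauTiltingFinite (Λ : Type) [Ring Λ] : Prop :=
  ∃ (n : ℕ) (L : Fin n → RMod Λ),
    ∀ M : RMod Λ, IsBasicSupportTauTilting Λ M → ∃ i, Nonempty (M ≃ₗ[Λᵐᵒᵖ] L i)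

/-- `Λ` has exactly `n` isomorphism classes of basic support τ-tilting modules. -/
def SupportTauTiltingCount (Λ : Type) [Ring Λ] (n : ℕ) : Prop :=
  ∃ L : Fin n → RMod Λ,
    (∀ i, IsBasicSupportTauTilting Λ (L i)) ∧
    (∀ i j, Nonempty ((L i) ≃ₗ[Λᵐᵒᵖ] (L j)) → i = j) ∧
    ∀ M : RMod Λ, IsBasicSupportTauTilting Λ M → ∃ i, Nonempty (M ≃ₗ[Λᵐᵒᵖ] L i)

/-- `Fac M ⊆ Fac N`: every factor module of a finite direct sum of copies of `M` is also a
factor module of a finite direct sum of copies of `N`.  This is the partial order on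
support τ-tilting modules. -/
def FacLE (Λ : Type) [Ring Λ] (M N : RMod Λ) : Prop :=
  ∀ X : RMod Λ,
    (∃ (k : ℕ) (f : (Fin k → M) →ₗ[Λᵐᵒᵖ] X), Function.Surjective f) →
    (∃ (k : ℕ) (f : (Fin k → N) →ₗ[Λᵐᵒᵖ] X), Function.Surjective f)

/-- The Hasse quiver of the poset `sτ-tilt Λ` is of type `H_{m,n}`: the poset of
isomorphism classes of basic support τ-tilting modules is isomorphic to the poset
consisting of a greatest element, a least element, and two incomparable chains with `m`
resp. `n` elements in between (hence two directed paths from `Λ` to `0` with `m` resp. `n`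
intermediate vertices). -/
def HasseType (Λ : Type) [Ring Λ] (m n : ℕ) : Prop :=
  ∃ T : WithTop (WithBot (Fin m ⊕ Fin n)) → RMod Λ,
    (∀ x, IsBasicSupportTauTilting Λ (T x)) ∧
    (∀ x y, Nonempty ((T x) ≃ₗ[Λᵐᵒᵖ] (T y)) → x = y) ∧
    (∀ M : RMod Λ, IsBasicSupportTauTilting Λ M → ∃ x, Nonempty (M ≃ₗ[Λᵐᵒᵖ] T x)) ∧
    ∀ x y, x ≤ y ↔ FacLE Λ (T x) (T y)

/-- `Λ` is τ-tilting finite with exactly `N` basic support τ-tilting modules and Hasse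
quiver of type `H_{m,n}`. -/
def TauTiltingData (Λ : Type) [Ring Λ] (N m n : ℕ) : Prop :=
  IsTauTiltingFinite Λ ∧ SupportTauTiltingCount Λ N ∧ HasseType Λ m n

/-- `B` is a factor algebra of `Λ`: there is a surjective `K`-algebra homomorphism
`Λ → B`. -/
def IsFactorAlgebra (K : Type) [CommRing K] (B Λ : Type) [Ring B] [Ring Λ]
    [Algebra K B] [Algebra K Λ] : Prop :=
  ∃ φ : Λ →ₐ[K] B, Function.Surjective φ

/-- `Λ` is a basic algebra: the regular right module decomposes into pairwise
nonisomorphic indecomposables. -/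
def IsBasicAlgebra (Λ : Type) [Ring Λ] : Prop :=
  IsBasicModuleCat Λᵐᵒᵖ (ModuleCat.of Λᵐᵒᵖ Λᵐᵒᵖ)

/-- `Λ` is representation-finite: finitely many isomorphism classes of indecomposable
finitely generated right modules. -/
def IsRepFinite (Λ : Type) [Ring Λ] : Prop :=
  ∃ (n : ℕ) (L : Fin n → RMod Λ), ∀ M : RMod Λ,
    Module.Finite Λᵐᵒᵖ M → IsIndecModule Λᵐᵒᵖ M → ∃ i, Nonempty (M ≃ₗ[Λᵐᵒᵖ] L i)

end TwoPoint

namespace TwoPoint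

/-! ### Bound quiver algebras on two-point quivers

A two-point quiver is given by an arrow type `σ` together with source and target functions
`s t : σ → Fin 2`.  The corresponding bound quiver algebra `KQ/I` is presented as the
quotient of the free algebra on the two vertex idempotents and the arrows, by the path
algebra relations together with the defining relations of `I` (paths are composed from
left to right, so a relation like `αμβ` is the product `α * μ * β`). -/

/-- Generators for the path algebra of a two-point quiver: two vertex idempotents and the
arrows. -/
inductive TPGen (σ : Type) : Type
  | v : Fin 2 → TPGen σ
  | ar : σ → TPGen σ

/-- The vertex idempotent generator. -/
def vtx (K : Type) [Field K] {σ : Type} (i : Fin 2) : FreeAlgebra K (TPGen σ) :=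
  FreeAlgebra.ι K (TPGen.v i)

/-- The arrow generator. -/
def arr (K : Type) [Field K] {σ : Type} (a : σ) : FreeAlgebra K (TPGen σ) :=
  FreeAlgebra.ι K (TPGen.ar a)

/-- The defining relations of a bound quiver algebra on a two-point quiver:
`e_i e_j = δ_{ij} e_i`, `e_1 + e_2 = 1`, `e_{s(a)} a = a = a e_{t(a)}`, together with the
prescribed relations `rels` (each pair `(x, y) ∈ rels` imposes `x = y`). -/
inductive QuivRel (K : Type) [Field K] (σ : Type) (s t : σ → Fin 2)
    (rels : Set (FreeAlgebra K (TPGen σ) × FreeAlgebra K (TPGen σ))) :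
    FreeAlgebra K (TPGen σ) → FreeAlgebra K (TPGen σ) → Prop
  | idem (i : Fin 2) : QuivRel K σ s t rels (vtx K i * vtx K i) (vtx K i)
  | orth (i j : Fin 2) : i ≠ j → QuivRel K σ s t rels (vtx K i * vtx K j) 0
  | vsum : QuivRel K σ s t rels (vtx K 0 + vtx K 1) 1
  | src (a : σ) : QuivRel K σ s t rels (vtx K (s a) * arr K a) (arr K a)
  | tgt (a : σ) : QuivRel K σ s t rels (arr K a * vtx K (t a)) (arr K a)
  | rel (p : FreeAlgebra K (TPGen σ) × FreeAlgebra K (TPGen σ)) :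
      p ∈ rels → QuivRel K σ s t rels p.1 p.2

/-- The bound quiver algebra of a two-point quiver with relations `rels`. -/
abbrev BoundQuiverAlgebra (K : Type) [Field K] (σ : Type) (s t : σ → Fin 2)
    (rels : Set (FreeAlgebra K (TPGen σ) × FreeAlgebra K (TPGen σ))) : Type :=
  RingQuot (QuivRel K σ s t rels)

/-! Concrete two-point quivers used below.  Vertices are `0` ("1") and `1` ("2"). -/

/- Quiver `μ : 1 → 2`, loop `β` at `2`. -/
namespace QA
def s : Fin 2 → Fin 2 := ![0, 1]
def t : Fin 2 → Fin 2 := ![1, 1]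
def mu (K : Type) [Field K] : FreeAlgebra K (TPGen (Fin 2)) := arr K (0 : Fin 2)
def be (K : Type) [Field K] : FreeAlgebra K (TPGen (Fin 2)) := arr K (1 : Fin 2)
end QA

/- Quiver: loop `α` at `1`, `μ : 1 → 2`, loop `β` at `2`. -/
namespace QB
def s : Fin 3 → Fin 2 := ![0, 0, 1]
def t : Fin 3 → Fin 2 := ![0, 1, 1]
def al (K : Type) [Field K] : FreeAlgebra K (TPGen (Fin 3)) := arr K (0 : Fin 3)
def mu (K : Type) [Field K] : FreeAlgebra K (TPGen (Fin 3)) := arr K (1 : Fin 3)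
def be (K : Type) [Field K] : FreeAlgebra K (TPGen (Fin 3)) := arr K (2 : Fin 3)
end QB

/- Quiver: `μ : 1 → 2`, loops `β₁, β₂` at `2`. -/
namespace QC
def s : Fin 3 → Fin 2 := ![0, 1, 1]
def t : Fin 3 → Fin 2 := ![1, 1, 1]
def mu (K : Type) [Field K] : FreeAlgebra K (TPGen (Fin 3)) := arr K (0 : Fin 3)
def b1 (K : Type) [Field K] : FreeAlgebra K (TPGen (Fin 3)) := arr K (1 : Fin 3)
def b2 (K : Type) [Field K] : FreeAlgebra K (TPGen (Fin 3)) := arr K (2 : Fin 3)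
end QC

/- Quiver: loop `α` at `1`, `μ : 1 → 2`, `ν : 2 → 1`. -/
namespace QD
def s : Fin 3 → Fin 2 := ![0, 0, 1]
def t : Fin 3 → Fin 2 := ![0, 1, 0]
def al (K : Type) [Field K] : FreeAlgebra K (TPGen (Fin 3)) := arr K (0 : Fin 3)
def mu (K : Type) [Field K] : FreeAlgebra K (TPGen (Fin 3)) := arr K (1 : Fin 3)
def nu (K : Type) [Field K] : FreeAlgebra K (TPGen (Fin 3)) := arr K (2 : Fin 3)
end QD

/- Quiver: loops `α` at `1` and `β` at `2`, `μ : 1 → 2`, `ν : 2 → 1`. -/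
namespace QE
def s : Fin 4 → Fin 2 := ![0, 1, 0, 1]
def t : Fin 4 → Fin 2 := ![0, 1, 1, 0]
def al (K : Type) [Field K] : FreeAlgebra K (TPGen (Fin 4)) := arr K (0 : Fin 4)
def be (K : Type) [Field K] : FreeAlgebra K (TPGen (Fin 4)) := arr K (1 : Fin 4)
def mu (K : Type) [Field K] : FreeAlgebra K (TPGen (Fin 4)) := arr K (2 : Fin 4)
def nu (K : Type) [Field K] : FreeAlgebra K (TPGen (Fin 4)) := arr K (3 : Fin 4)
end QE

/- Quiver: `μ : 1 → 2`, `ν : 2 → 1`. -/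
namespace QF
def s : Fin 2 → Fin 2 := ![0, 1]
def t : Fin 2 → Fin 2 := ![1, 0]
def mu (K : Type) [Field K] : FreeAlgebra K (TPGen (Fin 2)) := arr K (0 : Fin 2)
def nu (K : Type) [Field K] : FreeAlgebra K (TPGen (Fin 2)) := arr K (1 : Fin 2)
end QF

/- The Kronecker quiver: `μ₁, μ₂ : 1 → 2`. -/
namespace QG
def s : Fin 2 → Fin 2 := ![0, 0]
def t : Fin 2 → Fin 2 := ![1, 1]
end QG

/- Quiver: `μ₁, μ₂ : 1 → 2`, `ν₁, ν₂ : 2 → 1`. -/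
namespace QH
def s : Fin 4 → Fin 2 := ![0, 0, 1, 1]
def t : Fin 4 → Fin 2 := ![1, 1, 0, 0]
def mu1 (K : Type) [Field K] : FreeAlgebra K (TPGen (Fin 4)) := arr K (0 : Fin 4)
def mu2 (K : Type) [Field K] : FreeAlgebra K (TPGen (Fin 4)) := arr K (1 : Fin 4)
def nu1 (K : Type) [Field K] : FreeAlgebra K (TPGen (Fin 4)) := arr K (2 : Fin 4)
def nu2 (K : Type) [Field K] : FreeAlgebra K (TPGen (Fin 4)) := arr K (3 : Fin 4)
end QH

/- Quiver: loop `α` at `1`, `μ : 1 → 2`. -/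
namespace QI
def s : Fin 2 → Fin 2 := ![0, 0]
def t : Fin 2 → Fin 2 := ![0, 1]
def al (K : Type) [Field K] : FreeAlgebra K (TPGen (Fin 2)) := arr K (0 : Fin 2)
def mu (K : Type) [Field K] : FreeAlgebra K (TPGen (Fin 2)) := arr K (1 : Fin 2)
end QI

/- Quiver: loops `α₁, α₂` at `1`, `μ : 1 → 2`. -/
namespace QJ
def s : Fin 3 → Fin 2 := ![0, 0, 0]
def t : Fin 3 → Fin 2 := ![0, 0, 1]
def a1 (K : Type) [Field K] : FreeAlgebra K (TPGen (Fin 3)) := arr K (0 : Fin 3)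
def a2 (K : Type) [Field K] : FreeAlgebra K (TPGen (Fin 3)) := arr K (1 : Fin 3)
def mu (K : Type) [Field K] : FreeAlgebra K (TPGen (Fin 3)) := arr K (2 : Fin 3)
end QJ

/- Quiver: `μ₁, μ₂ : 1 → 2`, `ν : 2 → 1`. -/
namespace QK
def s : Fin 3 → Fin 2 := ![0, 0, 1]
def t : Fin 3 → Fin 2 := ![1, 1, 0]
def mu1 (K : Type) [Field K] : FreeAlgebra K (TPGen (Fin 3)) := arr K (0 : Fin 3)
def mu2 (K : Type) [Field K] : FreeAlgebra K (TPGen (Fin 3)) := arr K (1 : Fin 3)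
def nu (K : Type) [Field K] : FreeAlgebra K (TPGen (Fin 3)) := arr K (2 : Fin 3)
end QK

/- Quiver: `μ₁, μ₂, μ₃ : 1 → 2`. -/
namespace QL
def s : Fin 3 → Fin 2 := ![0, 0, 0]
def t : Fin 3 → Fin 2 := ![1, 1, 1]
end QL

/- Quiver: loop `α` at `1`, `μ₁, μ₂ : 1 → 2`. -/
namespace QM
def s : Fin 3 → Fin 2 := ![0, 0, 0]
def t : Fin 3 → Fin 2 := ![0, 1, 1]
def al (K : Type) [Field K] : FreeAlgebra K (TPGen (Fin 3)) := arr K (0 : Fin 3)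
def mu1 (K : Type) [Field K] : FreeAlgebra K (TPGen (Fin 3)) := arr K (1 : Fin 3)
def mu2 (K : Type) [Field K] : FreeAlgebra K (TPGen (Fin 3)) := arr K (2 : Fin 3)
end QM

end TwoPoint

namespace TwoPoint

/-! ### The algebras of Han's Table W -/

/-- `W₁`: three parallel arrows `1 → 2`, no relations. -/
abbrev TabW1 (K : Type) [Field K] : Type :=
  BoundQuiverAlgebra K (Fin 3) QL.s QL.t ∅

/-- `W₂`: `μ₁ν = μ₂ν = 0`. -/
abbrev TabW2 (K : Type) [Field K] : Type :=
  BoundQuiverAlgebra K (Fin 3) QK.s QK.t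
    {(QK.mu1 K * QK.nu K, 0), (QK.mu2 K * QK.nu K, 0)}

/-- `W₃`: `ν₂μ₁ = ν₁μ₂`, `μ₁ν₁ = μ₂ν₁ = μ₁ν₂ = μ₂ν₂ = ν₁μ₁ = 0`. -/
abbrev TabW3 (K : Type) [Field K] : Type :=
  BoundQuiverAlgebra K (Fin 4) QH.s QH.t
    {(QH.nu2 K * QH.mu1 K, QH.nu1 K * QH.mu2 K), (QH.mu1 K * QH.nu1 K, 0),
     (QH.mu2 K * QH.nu1 K, 0), (QH.mu1 K * QH.nu2 K, 0), (QH.mu2 K * QH.nu2 K, 0),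
     (QH.nu1 K * QH.mu1 K, 0)}

/-- `W₄`: `α₁² = α₂² = α₁α₂ = α₂α₁ = α₁μ = α₂μ = 0`. -/
abbrev TabW4 (K : Type) [Field K] : Type :=
  BoundQuiverAlgebra K (Fin 3) QJ.s QJ.t
    {(QJ.a1 K ^ 2, 0), (QJ.a2 K ^ 2, 0), (QJ.a1 K * QJ.a2 K, 0), (QJ.a2 K * QJ.a1 K, 0),
     (QJ.a1 K * QJ.mu K, 0), (QJ.a2 K * QJ.mu K, 0)}

/-- `W₅`: `α² = αμ₁ = αμ₂ = 0`. -/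
abbrev TabW5 (K : Type) [Field K] : Type :=
  BoundQuiverAlgebra K (Fin 3) QM.s QM.t
    {(QM.al K ^ 2, 0), (QM.al K * QM.mu1 K, 0), (QM.al K * QM.mu2 K, 0)}

/-- `W₆`: `α⁷ = α²μ = 0`. -/
abbrev TabW6 (K : Type) [Field K] : Type :=
  BoundQuiverAlgebra K (Fin 2) QI.s QI.t {(QI.al K ^ 7, 0), (QI.al K ^ 2 * QI.mu K, 0)}

/-- `W₇`: `α⁴ = α³μ = 0`. -/
abbrev TabW7 (K : Type) [Field K] : Type :=
  BoundQuiverAlgebra K (Fin 2) QI.s QI.t {(QI.al K ^ 4, 0), (QI.al K ^ 3 * QI.mu K, 0)}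

/-- `W₈`: `α² = β³ = αμ = 0`. -/
abbrev TabW8 (K : Type) [Field K] : Type :=
  BoundQuiverAlgebra K (Fin 3) QB.s QB.t
    {(QB.al K ^ 2, 0), (QB.be K ^ 3, 0), (QB.al K * QB.mu K, 0)}

/-- `W₉`: `α³ = β³ = αμ = μβ² = 0`. -/
abbrev TabW9 (K : Type) [Field K] : Type :=
  BoundQuiverAlgebra K (Fin 3) QB.s QB.t
    {(QB.al K ^ 3, 0), (QB.be K ^ 3, 0), (QB.al K * QB.mu K, 0), (QB.mu K * QB.be K ^ 2, 0)}

/-- `W₁₀`: `α² = β⁴ = αμ = μβ² = 0`. -/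
abbrev TabW10 (K : Type) [Field K] : Type :=
  BoundQuiverAlgebra K (Fin 3) QB.s QB.t
    {(QB.al K ^ 2, 0), (QB.be K ^ 4, 0), (QB.al K * QB.mu K, 0), (QB.mu K * QB.be K ^ 2, 0)}

/-- `W₁₁`: `α² = β³ = αμβ = μβ² = 0`. -/
abbrev TabW11 (K : Type) [Field K] : Type :=
  BoundQuiverAlgebra K (Fin 3) QB.s QB.t
    {(QB.al K ^ 2, 0), (QB.be K ^ 3, 0), (QB.al K * QB.mu K * QB.be K, 0),
     (QB.mu K * QB.be K ^ 2, 0)}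

/-- `W₁₂`: `α⁴ = β⁵ = μβ² = 0`, `αμ = μβ`. -/
abbrev TabW12 (K : Type) [Field K] : Type :=
  BoundQuiverAlgebra K (Fin 3) QB.s QB.t
    {(QB.al K ^ 4, 0), (QB.be K ^ 5, 0), (QB.mu K * QB.be K ^ 2, 0),
     (QB.al K * QB.mu K, QB.mu K * QB.be K)}

/-- `W₁₃`: `α³ = β⁷ = μβ² = 0`, `αμ = μβ`. -/
abbrev TabW13 (K : Type) [Field K] : Type :=
  BoundQuiverAlgebra K (Fin 3) QB.s QB.t
    {(QB.al K ^ 3, 0), (QB.be K ^ 7, 0), (QB.mu K * QB.be K ^ 2, 0),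
     (QB.al K * QB.mu K, QB.mu K * QB.be K)}

/-- `W₁₄`: `α³ = μν = νμ = α²μ = 0`. -/
abbrev TabW14 (K : Type) [Field K] : Type :=
  BoundQuiverAlgebra K (Fin 3) QD.s QD.t
    {(QD.al K ^ 3, 0), (QD.mu K * QD.nu K, 0), (QD.nu K * QD.mu K, 0),
     (QD.al K ^ 2 * QD.mu K, 0)}

/-- `W₁₅`: `α³ = μν = αμ = 0`. -/
abbrev TabW15 (K : Type) [Field K] : Type :=
  BoundQuiverAlgebra K (Fin 3) QD.s QD.t
    {(QD.al K ^ 3, 0), (QD.mu K * QD.nu K, 0), (QD.al K * QD.mu K, 0)}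

/-- `W₁₆`: `α³ = μν = ναμ = να² = α²μ = 0`. -/
abbrev TabW16 (K : Type) [Field K] : Type :=
  BoundQuiverAlgebra K (Fin 3) QD.s QD.t
    {(QD.al K ^ 3, 0), (QD.mu K * QD.nu K, 0), (QD.nu K * QD.al K * QD.mu K, 0),
     (QD.nu K * QD.al K ^ 2, 0), (QD.al K ^ 2 * QD.mu K, 0)}

/-- `W₁₇`: `α⁴ = μν = νμ = αμ = να³ = 0`. -/
abbrev TabW17 (K : Type) [Field K] : Type :=
  BoundQuiverAlgebra K (Fin 3) QD.s QD.t
    {(QD.al K ^ 4, 0), (QD.mu K * QD.nu K, 0), (QD.nu K * QD.mu K, 0),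
     (QD.al K * QD.mu K, 0), (QD.nu K * QD.al K ^ 3, 0)}

/-- `W₁₈`: `α⁴ = μν = νμ = ναμ = να² = α²μ = 0`. -/
abbrev TabW18 (K : Type) [Field K] : Type :=
  BoundQuiverAlgebra K (Fin 3) QD.s QD.t
    {(QD.al K ^ 4, 0), (QD.mu K * QD.nu K, 0), (QD.nu K * QD.mu K, 0),
     (QD.nu K * QD.al K * QD.mu K, 0), (QD.nu K * QD.al K ^ 2, 0),
     (QD.al K ^ 2 * QD.mu K, 0)}

/-- `W₁₉`: `α⁵ = μν = νμ = να = α²μ = 0`. -/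
abbrev TabW19 (K : Type) [Field K] : Type :=
  BoundQuiverAlgebra K (Fin 3) QD.s QD.t
    {(QD.al K ^ 5, 0), (QD.mu K * QD.nu K, 0), (QD.nu K * QD.mu K, 0),
     (QD.nu K * QD.al K, 0), (QD.al K ^ 2 * QD.mu K, 0)}

/-- `W₂₀`: `α² = να = νμν = αμν = 0`. -/
abbrev TabW20 (K : Type) [Field K] : Type :=
  BoundQuiverAlgebra K (Fin 3) QD.s QD.t
    {(QD.al K ^ 2, 0), (QD.nu K * QD.al K, 0), (QD.nu K * QD.mu K * QD.nu K, 0),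
     (QD.al K * QD.mu K * QD.nu K, 0)}

/-- `W₂₁`: `α² = να = μνμ = 0`. -/
abbrev TabW21 (K : Type) [Field K] : Type :=
  BoundQuiverAlgebra K (Fin 3) QD.s QD.t
    {(QD.al K ^ 2, 0), (QD.nu K * QD.al K, 0), (QD.mu K * QD.nu K * QD.mu K, 0)}

/-- `W₂₂`: `α³ = νμ = να = αμν = α²μ = 0`. -/
abbrev TabW22 (K : Type) [Field K] : Type :=
  BoundQuiverAlgebra K (Fin 3) QD.s QD.t
    {(QD.al K ^ 3, 0), (QD.nu K * QD.mu K, 0), (QD.nu K * QD.al K, 0),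
     (QD.al K * QD.mu K * QD.nu K, 0), (QD.al K ^ 2 * QD.mu K, 0)}

/-- `W₂₃`: `α² = μν`, `α³ = α²μ = 0`. -/
abbrev TabW23 (K : Type) [Field K] : Type :=
  BoundQuiverAlgebra K (Fin 3) QD.s QD.t
    {(QD.al K ^ 2, QD.mu K * QD.nu K), (QD.al K ^ 3, 0), (QD.al K ^ 2 * QD.mu K, 0)}

/-- `W₂₄`: `α³ = μν`, `α⁴ = νμ = ναμ = να² = 0`. -/
abbrev TabW24 (K : Type) [Field K] : Type :=
  BoundQuiverAlgebra K (Fin 3) QD.s QD.t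
    {(QD.al K ^ 3, QD.mu K * QD.nu K), (QD.al K ^ 4, 0), (QD.nu K * QD.mu K, 0),
     (QD.nu K * QD.al K * QD.mu K, 0), (QD.nu K * QD.al K ^ 2, 0)}

/-- `W₂₅`: `α³ = β² = νμ = μν = να = μβ = βν = α²μ = 0`. -/
abbrev TabW25 (K : Type) [Field K] : Type :=
  BoundQuiverAlgebra K (Fin 4) QE.s QE.t
    {(QE.al K ^ 3, 0), (QE.be K ^ 2, 0), (QE.nu K * QE.mu K, 0), (QE.mu K * QE.nu K, 0),
     (QE.nu K * QE.al K, 0), (QE.mu K * QE.be K, 0), (QE.be K * QE.nu K, 0),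
     (QE.al K ^ 2 * QE.mu K, 0)}

/-- `W₂₆`: `α² = β² = νμ = αμ = να = βν = 0`. -/
abbrev TabW26 (K : Type) [Field K] : Type :=
  BoundQuiverAlgebra K (Fin 4) QE.s QE.t
    {(QE.al K ^ 2, 0), (QE.be K ^ 2, 0), (QE.nu K * QE.mu K, 0), (QE.al K * QE.mu K, 0),
     (QE.nu K * QE.al K, 0), (QE.be K * QE.nu K, 0)}

/-- `W₂₇`: `α² = μν`, `β² = νμ = αμ = μβ = βνα = 0`. -/
abbrev TabW27 (K : Type) [Field K] : Type :=
  BoundQuiverAlgebra K (Fin 4) QE.s QE.t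
    {(QE.al K ^ 2, QE.mu K * QE.nu K), (QE.be K ^ 2, 0), (QE.nu K * QE.mu K, 0),
     (QE.al K * QE.mu K, 0), (QE.mu K * QE.be K, 0), (QE.be K * QE.nu K * QE.al K, 0)}

/-- `W₂₈`: `α² = μν`, `β² = νμ = αμ = βν = 0`. -/
abbrev TabW28 (K : Type) [Field K] : Type :=
  BoundQuiverAlgebra K (Fin 4) QE.s QE.t
    {(QE.al K ^ 2, QE.mu K * QE.nu K), (QE.be K ^ 2, 0), (QE.nu K * QE.mu K, 0),
     (QE.al K * QE.mu K, 0), (QE.be K * QE.nu K, 0)}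

/-- `W₂₉`: `α² = μν`, `β² = νμ = να = μβ = 0`. -/
abbrev TabW29 (K : Type) [Field K] : Type :=
  BoundQuiverAlgebra K (Fin 4) QE.s QE.t
    {(QE.al K ^ 2, QE.mu K * QE.nu K), (QE.be K ^ 2, 0), (QE.nu K * QE.mu K, 0),
     (QE.nu K * QE.al K, 0), (QE.mu K * QE.be K, 0)}

/-- `W₃₀`: `α² = μν`, `β² = νμ = να = βν = αμβ = 0`. -/
abbrev TabW30 (K : Type) [Field K] : Type :=
  BoundQuiverAlgebra K (Fin 4) QE.s QE.t
    {(QE.al K ^ 2, QE.mu K * QE.nu K), (QE.be K ^ 2, 0), (QE.nu K * QE.mu K, 0),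
     (QE.nu K * QE.al K, 0), (QE.be K * QE.nu K, 0), (QE.al K * QE.mu K * QE.be K, 0)}

/-- `W₃₁`: `αμ = μβ`, `α² = β³ = μν = να = βν = μβ² = 0`. -/
abbrev TabW31 (K : Type) [Field K] : Type :=
  BoundQuiverAlgebra K (Fin 4) QE.s QE.t
    {(QE.al K * QE.mu K, QE.mu K * QE.be K), (QE.al K ^ 2, 0), (QE.be K ^ 3, 0),
     (QE.mu K * QE.nu K, 0), (QE.nu K * QE.al K, 0), (QE.be K * QE.nu K, 0),
     (QE.mu K * QE.be K ^ 2, 0)}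

/-- `W₃₂`: `αμ = μβ`, `α² = β² = να = βν = μνμ = νμν = 0`. -/
abbrev TabW32 (K : Type) [Field K] : Type :=
  BoundQuiverAlgebra K (Fin 4) QE.s QE.t
    {(QE.al K * QE.mu K, QE.mu K * QE.be K), (QE.al K ^ 2, 0), (QE.be K ^ 2, 0),
     (QE.nu K * QE.al K, 0), (QE.be K * QE.nu K, 0), (QE.mu K * QE.nu K * QE.mu K, 0),
     (QE.nu K * QE.mu K * QE.nu K, 0)}

/-- `W₃₃`: `αμ = μβ`, `α³ = β³ = νμ = μν = να = βν = μβ² = α²μ = 0`. -/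
abbrev TabW33 (K : Type) [Field K] : Type :=
  BoundQuiverAlgebra K (Fin 4) QE.s QE.t
    {(QE.al K * QE.mu K, QE.mu K * QE.be K), (QE.al K ^ 3, 0), (QE.be K ^ 3, 0),
     (QE.nu K * QE.mu K, 0), (QE.mu K * QE.nu K, 0), (QE.nu K * QE.al K, 0),
     (QE.be K * QE.nu K, 0), (QE.mu K * QE.be K ^ 2, 0), (QE.al K ^ 2 * QE.mu K, 0)}

/-- `W₃₄`: `αμ = μβ`, `α³ = β² = νμ = να = βν = α²μ = 0`. -/
abbrev TabW34 (K : Type) [Field K] : Type :=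
  BoundQuiverAlgebra K (Fin 4) QE.s QE.t
    {(QE.al K * QE.mu K, QE.mu K * QE.be K), (QE.al K ^ 3, 0), (QE.be K ^ 2, 0),
     (QE.nu K * QE.mu K, 0), (QE.nu K * QE.al K, 0), (QE.be K * QE.nu K, 0),
     (QE.al K ^ 2 * QE.mu K, 0)}

end TwoPoint

namespace TwoPoint

section ModuleTheory

variable {R : Type} [Ring R]

theorem IsIndecModule.congr {M N : Type} [AddCommGroup M] [Module R M] [AddCommGroup N]
    [Module R N] (φ : M ≃ₗ[R] N) (h : IsIndecModule R M) : IsIndecModule R N := by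
  refine ⟨have := h.1; φ.symm.toEquiv.nontrivial, fun N₁ N₂ hN => ?_⟩
  have := h.2 _ _ ((Submodule.orderIsoMapComap φ.symm).isCompl hN)
  simpa using this

theorem IsIndecModule.idem {M : Type} [AddCommGroup M] [Module R M] (h : IsIndecModule R M)
    (p : Module.End R M) (hp : p * p = p) : p = 0 ∨ p = 1 := by
  have hc := LinearMap.IsIdempotentElem.isCompl (f := p) hp
  rcases h.2 _ _ hc with h0 | h0
  · left; exact LinearMap.range_eq_bot.1 h0
  · right
    have hk := LinearMap.ker_eq_bot.1 h0
    ext x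
    apply hk
    exact congrArg (fun f : Module.End R M => f x) hp

theorem isIndecModule_of_idem {M : Type} [AddCommGroup M] [Module R M] [Nontrivial M]
    (h : ∀ p : Module.End R M, p * p = p → p = 0 ∨ p = 1) : IsIndecModule R M := by
  refine ⟨inferInstance, fun N₁ N₂ hc => ?_⟩
  have hN := h (N₁.projection N₂ hc) (Submodule.isIdempotentElem_projection hc)
  have hr := Submodule.range_projection hc
  have hk := Submodule.ker_projection hc
  rcases hN with h0 | h0
  · left; rw [← hr, h0]; exact LinearMap.range_zero
  · right; rw [← hk, h0]; exact LinearMap.ker_id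

theorem IsIndecModule.isUnit_or {M : Type} [AddCommGroup M] [Module R M] [IsNoetherian R M]
    [IsArtinian R M] (h : IsIndecModule R M) (f : Module.End R M) :
    IsUnit f ∨ IsNilpotent f := by
  obtain ⟨n, hn, hpos⟩ := ((LinearMap.eventually_isCompl_ker_pow_range_pow f).and
    (Filter.eventually_ge_atTop 1)).exists
  rcases h.2 _ _ hn with h0 | h0
  · left
    have hr : LinearMap.range (f ^ n) = ⊤ := by simpa [h0] using hn.sup_eq_top
    have hu : IsUnit (f ^ n) :=
      (Module.End.isUnit_iff _).2 ⟨LinearMap.ker_eq_bot.1 h0, LinearMap.range_eq_top.1 hr⟩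
    exact (isUnit_pow_iff (by omega)).1 hu
  · right; exact ⟨n, LinearMap.range_eq_bot.1 h0⟩

theorem IsIndecModule.isLocalRing {M : Type} [AddCommGroup M] [Module R M] [IsNoetherian R M]
    [IsArtinian R M] (h : IsIndecModule R M) : IsLocalRing (Module.End R M) := by
  have := h.1
  refine ⟨fun {a b} hab => ?_⟩
  rcases h.isUnit_or a with ha | ha
  · exact Or.inl ha
  · right
    rw [← eq_sub_iff_add_eq'] at hab
    rw [hab]; exact ha.isUnit_one_sub

theorem exists_isUnit_of_isUnit_sum {S : Type} [Ring S] [IsLocalRing S] {ι : Type}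
    (s : Finset ι) (f : ι → S) (h : IsUnit (∑ i ∈ s, f i)) : ∃ i ∈ s, IsUnit (f i) := by
  classical
  induction s using Finset.induction_on with
  | empty => simp at h
  | insert a s ha ih =>
    rw [Finset.sum_insert ha] at h
    rcases IsLocalRing.isUnit_or_isUnit_of_isUnit_add h with h | h
    · exact ⟨a, by simp, h⟩
    · obtain ⟨i, hi, hu⟩ := ih h
      exact ⟨i, by simp [hi], hu⟩

/-- A nonzero direct summand of an indecomposable module is everything. -/
theorem equiv_of_isUnit_comp {X Y : Type} [AddCommGroup X] [Module R X] [AddCommGroup Y]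
    [Module R Y] [Nontrivial X] (hY : IsIndecModule R Y) (a : X →ₗ[R] Y) (b : Y →ₗ[R] X)
    (h : IsUnit (b ∘ₗ a : Module.End R X)) : Nonempty (X ≃ₗ[R] Y) := by
  obtain ⟨c, hc1⟩ := h.exists_left_inv
  have hc : ∀ x, c (b (a x)) = x := fun x => congrArg (fun f : Module.End R X => f x) hc1
  have hp : (a ∘ₗ c ∘ₗ b : Module.End R Y) * (a ∘ₗ c ∘ₗ b) = a ∘ₗ c ∘ₗ b := by
    ext y; simp [hc]
  rcases hY.idem _ hp with h0 | h0
  · exfalso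
    obtain ⟨x, hx⟩ := exists_ne (0 : X)
    have h1 : a x = 0 := by
      have := congrArg (fun f : Module.End R Y => f (a x)) h0
      simpa [hc] using this
    exact hx (by rw [← hc x, h1]; simp)
  · refine ⟨LinearEquiv.ofLinearMap a (c ∘ₗ b) h0 (by ext x; simp [hc])⟩

/-- Exchange: an indecomposable summand of a finite product of indecomposables is isomorphic to
one of the factors. -/
theorem IsIndecModule.exists_equiv_of_summand {X : Type} [AddCommGroup X] [Module R X]
    [IsNoetherian R X] [IsArtinian R X] (hX : IsIndecModule R X) {ι : Type} [Finite ι]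
    {Y : ι → Type} [∀ i, AddCommGroup (Y i)] [∀ i, Module R (Y i)]
    (hY : ∀ i, IsIndecModule R (Y i)) (a : X →ₗ[R] (∀ i, Y i)) (b : (∀ i, Y i) →ₗ[R] X)
    (h : b ∘ₗ a = LinearMap.id) : ∃ i, Nonempty (X ≃ₗ[R] Y i) := by
  classical
  have := Fintype.ofFinite ι
  have := hX.isLocalRing
  have := hX.1
  let f : ι → Module.End R X := fun i =>
    (b ∘ₗ LinearMap.single R Y i) ∘ₗ (LinearMap.proj i ∘ₗ a)
  have hs : ∑ i, f i = 1 := by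
    ext x
    have : (b (∑ i, Pi.single i (a x i))) = x := by
      rw [Finset.univ_sum_single]; exact congrArg (fun f => f x) h
    rw [map_sum] at this
    simpa [f] using this
  obtain ⟨i, -, hi⟩ := exists_isUnit_of_isUnit_sum Finset.univ f (by rw [hs]; exact isUnit_one)
  exact ⟨i, equiv_of_isUnit_comp (hY i) _ _ hi⟩

/-- `X` is a factor module of a finite power of `Y`. -/
def InFac (R : Type) [Ring R] (X Y : Type) [AddCommGroup X] [Module R X] [AddCommGroup Y]
    [Module R Y] : Prop :=
  ∃ (k : ℕ) (f : (Fin k → Y) →ₗ[R] X), Function.Surjective f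

theorem InFac.of_surj {X Y : Type} [AddCommGroup X] [Module R X] [AddCommGroup Y]
    [Module R Y] {ι : Type} [Fintype ι] (f : (ι → Y) →ₗ[R] X) (hf : Function.Surjective f) :
    InFac R X Y :=
  ⟨Fintype.card ι, f ∘ₗ (LinearEquiv.funCongrLeft R Y (Fintype.equivFin ι)).toLinearMap,
    hf.comp (LinearEquiv.funCongrLeft R Y (Fintype.equivFin ι)).surjective⟩

theorem InFac.of_surj_one {X Y : Type} [AddCommGroup X] [Module R X] [AddCommGroup Y]
    [Module R Y] (f : Y →ₗ[R] X) (hf : Function.Surjective f) : InFac R X Y :=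
  InFac.of_surj (ι := Unit) (f ∘ₗ LinearMap.proj ()) fun x => by
    obtain ⟨y, rfl⟩ := hf x; exact ⟨fun _ => y, rfl⟩

theorem InFac.refl (X : Type) [AddCommGroup X] [Module R X] : InFac R X X :=
  InFac.of_surj_one LinearMap.id Function.surjective_id

theorem InFac.trans {X Y Z : Type} [AddCommGroup X] [Module R X] [AddCommGroup Y]
    [Module R Y] [AddCommGroup Z] [Module R Z] (h : InFac R X Y) (h' : InFac R Y Z) :
    InFac R X Z := by
  obtain ⟨k, f, hf⟩ := h
  obtain ⟨l, g, hg⟩ := h'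
  let G : (Fin k × Fin l → Z) →ₗ[R] (Fin k → Y) :=
    LinearMap.pi fun i => g ∘ₗ LinearMap.pi fun j => LinearMap.proj (i, j)
  refine InFac.of_surj (f ∘ₗ G) (hf.comp fun y => ?_)
  choose z hz using fun i => hg (y i)
  exact ⟨fun p => z p.1 p.2, funext fun i => hz i⟩

theorem InFac.prod {X X' Y : Type} [AddCommGroup X] [Module R X] [AddCommGroup X']
    [Module R X'] [AddCommGroup Y] [Module R Y] (h : InFac R X Y) (h' : InFac R X' Y) :
    InFac R (X × X') Y := by
  obtain ⟨k, f, hf⟩ := h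
  obtain ⟨l, g, hg⟩ := h'
  refine InFac.of_surj (ι := Fin k ⊕ Fin l)
    ((f ∘ₗ LinearMap.funLeft R Y Sum.inl).prod (g ∘ₗ LinearMap.funLeft R Y Sum.inr)) ?_
  rintro ⟨x, x'⟩
  obtain ⟨y, rfl⟩ := hf x
  obtain ⟨y', rfl⟩ := hg x'
  exact ⟨Sum.elim y y', rfl⟩

theorem InFac.pi {ι : Type} [Finite ι] {X : ι → Type} [∀ i, AddCommGroup (X i)]
    [∀ i, Module R (X i)] {Y : Type} [AddCommGroup Y] [Module R Y]
    (h : ∀ i, InFac R (X i) Y) : InFac R (∀ i, X i) Y := by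
  have := Fintype.ofFinite ι
  choose k f hf using h
  refine InFac.of_surj (ι := Σ i, Fin (k i))
    (LinearMap.pi fun i => f i ∘ₗ LinearMap.pi fun j => LinearMap.proj ⟨i, j⟩) fun x => ?_
  choose y hy using fun i => hf i (x i)
  exact ⟨fun p => y p.1 p.2, funext hy⟩

theorem InFac.of_equiv {X Y : Type} [AddCommGroup X] [Module R X] [AddCommGroup Y]
    [Module R Y] (f : Y ≃ₗ[R] X) : InFac R X Y :=
  InFac.of_surj_one f.toLinearMap f.surjective

theorem InFac.fst (X Y : Type) [AddCommGroup X] [Module R X] [AddCommGroup Y]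
    [Module R Y] : InFac R X (X × Y) :=
  InFac.of_surj_one (LinearMap.fst R X Y) LinearMap.fst_surjective

theorem InFac.snd (X Y : Type) [AddCommGroup X] [Module R X] [AddCommGroup Y]
    [Module R Y] : InFac R Y (X × Y) :=
  InFac.of_surj_one (LinearMap.snd R X Y) LinearMap.snd_surjective

theorem facLE_iff {Λ : Type} [Ring Λ] (M N : RMod Λ) : FacLE Λ M N ↔ InFac Λᵐᵒᵖ M N :=
  ⟨fun h => h M (InFac.refl (R := Λᵐᵒᵖ) M), fun h X hX => InFac.trans (R := Λᵐᵒᵖ) (X := X) hX h⟩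

theorem IsIndecModule.mem_jacobson {M : Type} [AddCommGroup M] [Module R M] [IsNoetherian R M]
    [IsArtinian R M] (h : IsIndecModule R M) {f : Module.End R M} (hf : ¬ IsUnit f) :
    f ∈ Ring.jacobson (Module.End R M) := by
  have := h.1
  rw [← Ideal.jacobson_bot, Ideal.mem_jacobson_iff]
  intro y
  have hfn := (h.isUnit_or f).resolve_left hf
  have hu : ¬ IsUnit (y * f) := by
    intro hu
    obtain ⟨n, hn⟩ := hfn
    obtain ⟨c, hc⟩ := hu.exists_left_inv
    have h1 : (c * y) ^ n * f ^ n = 1 := by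
      clear hn
      induction n with
      | zero => simp
      | succ n ih =>
        rw [pow_succ, pow_succ', mul_assoc, ← mul_assoc (c * y) f, mul_assoc c y f, hc, one_mul,
          ih]
    rw [hn, mul_zero] at h1
    exact zero_ne_one h1
  obtain ⟨z, hz⟩ := ((h.isUnit_or (y * f)).resolve_left hu).isUnit_one_add.exists_left_inv
  refine ⟨z, ?_⟩
  rw [mul_assoc, ← hz]
  simp [mul_add, add_comm]

/-- Antisymmetry of the factor order on indecomposable modules. -/
theorem IsIndecModule.equiv_of_inFac (K : Type) [Field K] [Algebra K R] [Module.Finite K R]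
    {X Y : Type} [AddCommGroup X] [Module R X] [AddCommGroup Y] [Module R Y]
    [Module.Finite R X] [IsNoetherian R X] [IsArtinian R X]
    (hX : IsIndecModule R X) (hY : IsIndecModule R Y) (h : InFac R X Y) (h' : InFac R Y X) :
    Nonempty (X ≃ₗ[R] Y) := by
  by_contra hne
  have := hX.1
  obtain ⟨k, g, hg⟩ := h
  obtain ⟨l, p, hp⟩ := h'
  let _ : Module K X := Module.compHom X (algebraMap K R)
  have : IsScalarTower K R X :=
    ⟨fun a r x => by
      change (a • r) • x = algebraMap K R a • r • x
      rw [Algebra.smul_def, mul_smul]⟩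
  have : SMulCommClass K R X :=
    ⟨fun a r x => by
      change algebraMap K R a • r • x = r • algebraMap K R a • x
      rw [← mul_smul, ← mul_smul, Algebra.commutes]⟩
  have : SMulCommClass R K X := SMulCommClass.symm _ _ _
  have : Module.Finite K X := Module.Finite.trans R X
  have : IsScalarTower K (Module.End R X) X := ⟨fun a f x => rfl⟩
  have : Module.Finite (Module.End R X) X := Module.Finite.of_restrictScalars_finite K _ X
  have key := Submodule.FG.eq_bot_of_le_jacobson_smul (R := Module.End R X) (M := X) (N := ⊤)
    Module.Finite.fg_top ?_
  · exact top_ne_bot key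
  intro x _
  obtain ⟨y, rfl⟩ := hg x
  choose z hz using fun i => hp (y i)
  have e1 : g y = ∑ i, ∑ j, (g ∘ₗ LinearMap.single R (fun _ => Y) i ∘ₗ p ∘ₗ
      LinearMap.single R (fun _ => X) j : Module.End R X) (z i j) := by
    conv_lhs => rw [← Finset.univ_sum_single y, map_sum]
    refine Finset.sum_congr rfl fun i _ => ?_
    have h1 := map_sum (g ∘ₗ LinearMap.single R (fun _ => Y) i ∘ₗ p)
      (fun j => Pi.single (M := fun _ => X) j (z i j)) Finset.univ
    rw [Finset.univ_sum_single] at h1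
    simpa [hz] using h1
  rw [e1]
  refine Submodule.sum_mem _ fun i _ => Submodule.sum_mem _ fun j _ => ?_
  refine Submodule.smul_mem_smul (hX.mem_jacobson fun hu => hne ?_) Submodule.mem_top
  exact equiv_of_isUnit_comp hY (p ∘ₗ LinearMap.single R (fun _ => X) j)
    (g ∘ₗ LinearMap.single R (fun _ => Y) i) hu

end ModuleTheory
end TwoPoint

namespace TwoPoint

section Decompositions

variable {R : Type} [Ring R]

theorem exists_isInternal {M : Type} [AddCommGroup M] [Module R M] {k : ℕ} {X : Fin k → Type}
    [∀ i, AddCommGroup (X i)] [∀ i, Module R (X i)] (φ : M ≃ₗ[R] (∀ i, X i)) :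
    ∃ N : Fin k → Submodule R M, DirectSum.IsInternal N ∧ ∀ i, Nonempty (X i ≃ₗ[R] N i) := by
  let f : ∀ i, X i →ₗ[R] M := fun i => φ.symm.toLinearMap ∘ₗ LinearMap.single R X i
  have hf : ∀ i, Function.Injective (f i) := fun i =>
    φ.symm.injective.comp (Pi.single_injective (M := X) i)
  let ψ : ∀ i, X i ≃ₗ[R] LinearMap.range (f i) := fun i => LinearEquiv.ofInjective (f i) (hf i)
  refine ⟨fun i => LinearMap.range (f i), ?_, fun i => ⟨ψ i⟩⟩
  have hk : Function.Bijective ((φ.symm.toLinearMap ∘ₗ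
      (LinearEquiv.piCongrRight fun i => (ψ i).symm).toLinearMap) ∘ₗ
      (DirectSum.linearEquivFunOnFintype R (Fin k)
        (fun i => LinearMap.range (f i))).toLinearMap) :=
    (φ.symm.bijective.comp (LinearEquiv.piCongrRight fun i => (ψ i).symm).bijective).comp
      (DirectSum.linearEquivFunOnFintype R (Fin k) (fun i => LinearMap.range (f i))).bijective
  have he : ((φ.symm.toLinearMap ∘ₗ
      (LinearEquiv.piCongrRight fun i => (ψ i).symm).toLinearMap) ∘ₗ
      (DirectSum.linearEquivFunOnFintype R (Fin k)
        (fun i => LinearMap.range (f i))).toLinearMap) =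
      DirectSum.coeLinearMap (fun i => LinearMap.range (f i)) := by
    refine DirectSum.linearMap_ext R fun i => ?_
    ext ⟨y, x, rfl⟩
    have h1 : (⟨f i x, ⟨x, rfl⟩⟩ : LinearMap.range (f i)) = ψ i x := rfl
    rw [h1]
    simp only [LinearMap.comp_apply, LinearEquiv.coe_coe, DirectSum.coeLinearMap_lof,
      DirectSum.linearEquivFunOnFintype_lof]
    change φ.symm _ = φ.symm (Pi.single i x)
    congr 1
    ext j
    by_cases hj : j = i
    · subst hj; simp
    · simp [hj]
  rw [he] at hk
  exact hk

theorem IsInternal.nonempty_equiv {M : Type} [AddCommGroup M] [Module R M] {k : ℕ}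
    {N : Fin k → Submodule R M} (h : DirectSum.IsInternal N) :
    Nonempty (M ≃ₗ[R] (∀ i, N i)) :=
  ⟨(LinearEquiv.ofBijective (DirectSum.coeLinearMap N) h).symm.trans
    (DirectSum.linearEquivFunOnFintype R (Fin k) (fun i => N i))⟩

theorem HasIndecClassCount.le {M : ModuleCat.{0} R} [IsNoetherian R M] [IsArtinian R M]
    {p q : ℕ} (hp : HasIndecClassCount R M p) (hq : HasIndecClassCount R M q) : p ≤ q := by
  obtain ⟨k, N, hN, hi, c, hc, hcc⟩ := hp
  obtain ⟨k', N', hN', hi', c', -, hcc'⟩ := hq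
  obtain ⟨φ⟩ := IsInternal.nonempty_equiv hN
  obtain ⟨φ'⟩ := IsInternal.nonempty_equiv hN'
  have hex : ∀ i, ∃ j, Nonempty (N i ≃ₗ[R] N' j) := fun i =>
    (hi i).exists_equiv_of_summand hi'
      (φ'.toLinearMap ∘ₗ φ.symm.toLinearMap ∘ₗ LinearMap.single R (fun i => N i) i)
      (LinearMap.proj i ∘ₗ φ.toLinearMap ∘ₗ φ'.symm.toLinearMap) (by ext x; simp)
  choose g hg using hex
  choose s hs using hc
  have hinj : Function.Injective fun a => c' (g (s a)) := fun a b hab => by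
    obtain ⟨e1⟩ := (hcc' _ _).1 hab
    obtain ⟨e2⟩ := hg (s a)
    obtain ⟨e3⟩ := hg (s b)
    rw [← hs a, ← hs b]
    exact (hcc _ _).2 ⟨(e2.trans e1).trans e3.symm⟩
  simpa using Fintype.card_le_of_injective _ hinj

theorem HasIndecClassCount.unique {M : ModuleCat.{0} R} [IsNoetherian R M] [IsArtinian R M]
    {p q : ℕ} (hp : HasIndecClassCount R M p) (hq : HasIndecClassCount R M q) : p = q :=
  le_antisymm (hp.le hq) (hq.le hp)

theorem isBasic_and_classCount {M : ModuleCat.{0} R} {k : ℕ} {X : Fin k → Type}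
    [∀ i, AddCommGroup (X i)] [∀ i, Module R (X i)] (φ : M ≃ₗ[R] (∀ i, X i))
    (hX : ∀ i, IsIndecModule R (X i)) (hne : ∀ i j, i ≠ j → IsEmpty (X i ≃ₗ[R] X j)) :
    IsBasicModuleCat R M ∧ HasIndecClassCount R M k := by
  obtain ⟨N, hN, hψ⟩ := exists_isInternal φ
  have hNe : ∀ i j, i ≠ j → IsEmpty (N i ≃ₗ[R] N j) := fun i j hij => ⟨fun e => by
    obtain ⟨a⟩ := hψ i
    obtain ⟨b⟩ := hψ j
    exact (hne i j hij).false ((a.trans e).trans b.symm)⟩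
  have hNi : ∀ i, IsIndecModule R (N i) := fun i => (hX i).congr (hψ i).some
  refine ⟨⟨k, N, hN, hNi, hNe⟩, k, N, hN, hNi, id, Function.surjective_id, fun i j => ?_⟩
  refine ⟨fun h => ?_, fun h => ?_⟩
  · cases h; exact ⟨LinearEquiv.refl _ _⟩
  · by_contra hij; exact (hNe i j hij).false h.some

theorem basic_zero {M : ModuleCat.{0} R} [Subsingleton M] :
    IsBasicModuleCat R M ∧ HasIndecClassCount R M 0 :=
  isBasic_and_classCount (X := fun _ : Fin 0 => R)
    ((0 : M ≃ₗ[R] (Fin 0 → R))) (fun i => i.elim0) (fun i => i.elim0)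

theorem basic_one {M : ModuleCat.{0} R} (hM : IsIndecModule R M) :
    IsBasicModuleCat R M ∧ HasIndecClassCount R M 1 :=
  isBasic_and_classCount (X := fun _ : Fin 1 => M)
    ((LinearEquiv.funUnique (Fin 1) R M).symm) (fun _ => hM)
    (fun i j hij => (hij (Subsingleton.elim i j)).elim)

theorem basic_two {M : ModuleCat.{0} R} {X Y : Type} [AddCommGroup X] [Module R X]
    [AddCommGroup Y] [Module R Y] (φ : M ≃ₗ[R] X × Y) (hX : IsIndecModule R X)
    (hY : IsIndecModule R Y) (hne : IsEmpty (X ≃ₗ[R] Y)) :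
    IsBasicModuleCat R M ∧ HasIndecClassCount R M 2 := by
  let Z : Fin 2 → ModuleCat.{0} R := ![ModuleCat.of R X, ModuleCat.of R Y]
  refine isBasic_and_classCount (X := fun i => Z i)
    (φ.trans (LinearEquiv.piFinTwo R (fun i => Z i)).symm) (fun i => ?_) (fun i j hij => ?_)
  · fin_cases i
    · exact hX
    · exact hY
  · fin_cases i <;> fin_cases j
    · exact (hij rfl).elim
    · exact hne
    · exact ⟨fun e => hne.false e.symm⟩
    · exact (hij rfl).elim

end Decompositions
end TwoPoint

namespace TwoPoint

section FreeOnIdempotents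

variable {R : Type} [Ring R] {κ : Type} [Fintype κ] [DecidableEq κ]

/-- The projective module `⨁ R Eₖ` attached to a finite family of idempotents, realized by row
vectors. -/
def rowMod (E : κ → R) : Submodule R (κ → R) where
  carrier := {v | ∀ k, v k * E k = v k}
  add_mem' := fun ha hb k => by simp [add_mul, ha k, hb k]
  zero_mem' := fun k => by simp
  smul_mem' := fun r v hv k => by simp [mul_assoc, hv k]

/-- The `k`-th generator of `rowMod E`. -/
def rowGen {E : κ → R} (hE : ∀ k, E k * E k = E k) (k : κ) : rowMod E :=
  ⟨Pi.single k (E k), fun j => by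
    by_cases h : j = k
    · subst h; simp [hE]
    · simp [h]⟩

/-- The map out of `rowMod E` with prescribed images of the generators. -/
def rowLift {M : Type} [AddCommGroup M] [Module R M] (E : κ → R) (u : κ → M) : rowMod E →ₗ[R] M :=
  Fintype.linearCombination R u ∘ₗ (rowMod E).subtype

omit [DecidableEq κ] in
theorem rowLift_apply {M : Type} [AddCommGroup M] [Module R M] (E : κ → R) (u : κ → M)
    (v : rowMod E) : rowLift E u v = ∑ k, v.1 k • u k := by
  simp [rowLift, Fintype.linearCombination_apply]

theorem rowLift_gen {M : Type} [AddCommGroup M] [Module R M] {E : κ → R}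
    (hE : ∀ k, E k * E k = E k) (u : κ → M) (k : κ) :
    rowLift E u (rowGen hE k) = E k • u k := by
  rw [rowLift_apply, Finset.sum_eq_single k]
  · simp [rowGen]
  · intro j _ hj; simp [rowGen, hj]
  · simp

theorem row_eq_sum {E : κ → R} (hE : ∀ k, E k * E k = E k) (v : rowMod E) :
    v = ∑ k, v.1 k • rowGen hE k := by
  ext j
  rw [AddSubmonoidClass.coe_finsetSum, Finset.sum_apply, Finset.sum_eq_single j]
  · simp [rowGen, v.2 j]
  · intro k _ hk; simp [rowGen, hk.symm]
  · simp

omit [Fintype κ] in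
theorem smul_rowGen {E : κ → R} (hE : ∀ k, E k * E k = E k) (k : κ) :
    E k • rowGen hE k = rowGen hE k := by
  ext j
  by_cases h : j = k
  · subst h; simp [rowGen, hE]
  · simp [rowGen, h]

theorem rowMod_hom_ext {M : Type} [AddCommGroup M] [Module R M] {E : κ → R}
    (hE : ∀ k, E k * E k = E k) {f g : rowMod E →ₗ[R] M}
    (h : ∀ k, f (rowGen hE k) = g (rowGen hE k)) : f = g := by
  ext v
  rw [row_eq_sum hE v]
  simp [h]

theorem rowMod_projective {E : κ → R} (hE : ∀ k, E k * E k = E k) :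
    Module.Projective R (rowMod E) := by
  refine Module.Projective.of_split (rowMod E).subtype
    (Fintype.linearCombination R (rowGen hE)) ?_
  refine rowMod_hom_ext hE fun k => ?_
  change Fintype.linearCombination R (rowGen hE) _ = _
  rw [Fintype.linearCombination_apply]
  exact (row_eq_sum hE (rowGen hE k)).symm

theorem rowMod_finite {E : κ → R} (hE : ∀ k, E k * E k = E k) : Module.Finite R (rowMod E) :=
  Module.Finite.of_surjective (Fintype.linearCombination R (rowGen hE)) fun v =>
    ⟨v.1, by rw [Fintype.linearCombination_apply]; exact (row_eq_sum hE v).symm⟩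

/-- Lifting of maps out of `rowMod E` along surjections, colour by colour. -/
theorem rowMod_lifting {M N : Type} [AddCommGroup M] [Module R M] [AddCommGroup N] [Module R N]
    {E : κ → R} (hE : ∀ k, E k * E k = E k) (p : M →ₗ[R] N) (hp : Function.Surjective p)
    (h : rowMod E →ₗ[R] N) : ∃ h' : rowMod E →ₗ[R] M, p ∘ₗ h' = h := by
  have := rowMod_projective hE
  exact Module.projective_lifting_property p h hp

/-- The module presented by the rows of a matrix. -/
abbrev coker {ι : Type} (E : κ → R) (F : ι → κ → R) : Type :=
  rowMod E ⧸ (Submodule.span R (Set.range F)).comap (rowMod E).subtype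

end FreeOnIdempotents

/-- Structure constants of a basic split algebra with two simple modules: the primitive
idempotents and the two characters. -/
structure TwoVertex (K R : Type) [Field K] [Ring R] [Algebra K R] where
  /-- the vertex idempotents -/
  e : Fin 2 → R
  /-- the characters -/
  χ : Fin 2 → R →ₐ[K] K
  idem : ∀ i, e i * e i = e i
  orth : ∀ i j, i ≠ j → e i * e j = 0
  sum : e 0 + e 1 = 1
  χe : ∀ i j, χ i (e j) = if i = j then 1 else 0
  nil : ∀ r, χ 0 r = 0 → χ 1 r = 0 → IsNilpotent r

namespace TwoVertex

variable {K R : Type} [Field K] [Ring R] [Algebra K R] (D : TwoVertex K R)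

/-- The radical. -/
def J : Ideal R := RingHom.ker (D.χ 0) ⊓ RingHom.ker (D.χ 1)

theorem mem_J {r : R} : r ∈ D.J ↔ ∀ i, D.χ i r = 0 := by
  simp [J, RingHom.mem_ker, Fin.forall_fin_two]

theorem J_mul_left (a : R) {r : R} (h : r ∈ D.J) : a * r ∈ D.J := D.J.mul_mem_left a h

theorem J_mul_right {r : R} (h : r ∈ D.J) (a : R) : r * a ∈ D.J := by
  rw [mem_J] at *; intro i; simp [h i]

theorem nil_of_mem {r : R} (h : r ∈ D.J) : IsNilpotent r :=
  D.nil r (D.mem_J.1 h 0) (D.mem_J.1 h 1)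

theorem J_le_jacobson : D.J ≤ Ring.jacobson R := by
  intro x hx
  rw [← Ideal.jacobson_bot, Ideal.mem_jacobson_iff]
  intro y
  obtain ⟨z, hz⟩ := (D.nil_of_mem (D.J_mul_left y hx)).isUnit_one_add.exists_left_inv
  refine ⟨z, ?_⟩
  rw [mul_assoc, ← hz]
  simp [mul_add, add_comm]

theorem J_nilpotent [Module.Finite K R] : ∃ n, D.J ^ n = ⊥ := by
  have : IsArtinianRing R := isArtinian_of_tower K inferInstance
  obtain ⟨n, hn⟩ := IsSemiprimaryRing.isNilpotent (R := R)
  exact ⟨n, le_bot_iff.1 ((Ideal.pow_right_mono D.J_le_jacobson n).trans hn.le)⟩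

theorem e_notMem_J (i : Fin 2) : D.e i ∉ D.J := fun h => by
  have := D.mem_J.1 h i
  simp [D.χe] at this

theorem mul_e_sub_mem (c : Fin 2) (r : R) : r * D.e c - D.χ c r • D.e c ∈ D.J := by
  rw [mem_J]; intro i
  by_cases h : i = c
  · subst h; simp [D.χe]
  · simp [D.χe, h]

theorem e_mul_sub_mem (c : Fin 2) (r : R) : D.e c * r - D.χ c r • D.e c ∈ D.J := by
  rw [mem_J]; intro i
  by_cases h : i = c
  · subst h; simp [D.χe]
  · simp [D.χe, h]

theorem eq_top_of_sup {M : Type} [AddCommGroup M] [Module R M] [Module.Finite R M]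
    {N : Submodule R M} (h : N ⊔ D.J • (⊤ : Submodule R M) = ⊤) : N = ⊤ := by
  by_contra hN
  obtain ⟨m, hm, hNm⟩ := (eq_top_or_exists_le_coatom N).resolve_left hN
  have h1 : D.J • (⊤ : Submodule R M) ≤ m :=
    ((Submodule.smul_mono_left D.J_le_jacobson).trans (Ring.jacobson_smul_top_le R M)).trans
      (sInf_le hm)
  exact hm.1 (top_le_iff.1 (h ▸ sup_le hNm h1))

theorem surjective_of_congr {M N : Type} [AddCommGroup M] [Module R M] [AddCommGroup N]
    [Module R N] [Module.Finite R N] (f : M →ₗ[R] N)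
    (h : ∀ y, ∃ x, y - f x ∈ D.J • (⊤ : Submodule R N)) : Function.Surjective f := by
  rw [← LinearMap.range_eq_top]
  refine D.eq_top_of_sup (top_le_iff.1 fun y _ => ?_)
  obtain ⟨x, hx⟩ := h y
  rw [← add_sub_cancel (f x) y]
  exact Submodule.add_mem_sup ⟨x, rfl⟩ hx

theorem row_mem_J {κ : Type} [Fintype κ] [DecidableEq κ] {E : κ → R}
    (hE : ∀ k, E k * E k = E k) {v : rowMod E} (hv : ∀ k, v.1 k ∈ D.J) :
    v ∈ D.J • (⊤ : Submodule R (rowMod E)) := by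
  rw [row_eq_sum hE v]
  exact Submodule.sum_mem _ fun k _ => Submodule.smul_mem_smul (hv k) Submodule.mem_top

/-- Existence of projective covers by coloured generators. -/
theorem exists_cover {M : Type} [AddCommGroup M] [Module R M] [Module.Finite R M] :
    ∃ (κ : Type) (_ : Fintype κ) (_ : DecidableEq κ) (col : κ → Fin 2) (u : κ → M),
      (∀ k, D.e (col k) • u k = u k) ∧
      Function.Surjective (rowLift (fun k => D.e (col k)) u) ∧
      ∀ v : rowMod (fun k => D.e (col k)), rowLift _ u v = 0 → ∀ k, v.1 k ∈ D.J := by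
  classical
  let S : ℕ → Prop := fun n => ∃ (κ : Type) (_ : Fintype κ) (_ : DecidableEq κ)
    (col : κ → Fin 2) (u : κ → M), Fintype.card κ = n ∧ (∀ k, D.e (col k) • u k = u k) ∧
      Submodule.span R (Set.range u) = ⊤
  have hS : ∃ n, S n := by
    obtain ⟨m, g, hg⟩ := Module.Finite.exists_fin (R := R) (M := M)
    refine ⟨_, Fin 2 × Fin m, inferInstance, inferInstance, Prod.fst,
      fun p => D.e p.1 • g p.2, rfl, fun p => by rw [← mul_smul, D.idem], ?_⟩
    rw [← top_le_iff, ← hg, Submodule.span_le]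
    rintro _ ⟨j, rfl⟩
    have : g j = D.e 0 • g j + D.e 1 • g j := by rw [← add_smul, D.sum, one_smul]
    rw [this]
    exact Submodule.add_mem _ (Submodule.subset_span ⟨(0, j), rfl⟩)
      (Submodule.subset_span ⟨(1, j), rfl⟩)
  obtain ⟨κ, iF, iD, col, u, hcard, hcol, hspan⟩ := Nat.find_spec hS
  refine ⟨κ, iF, iD, col, u, hcol, ?_, ?_⟩
  · rw [← LinearMap.range_eq_top, ← top_le_iff, ← hspan, Submodule.span_le]
    rintro _ ⟨k, rfl⟩
    exact ⟨rowGen (fun k => D.idem (col k)) k, by rw [rowLift_gen]; exact hcol k⟩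
  · intro v hv k₀
    by_contra hk
    let N := Submodule.span R (Set.range fun k : {k // k ≠ k₀} => u k.1)
    have hmem : ∀ k, k ≠ k₀ → u k ∈ N := fun k h => Submodule.subset_span ⟨⟨k, h⟩, rfl⟩
    have h1 : v.1 k₀ • u k₀ ∈ N := by
      rw [rowLift_apply, ← Finset.add_sum_erase _ _ (Finset.mem_univ k₀)] at hv
      rw [eq_neg_of_add_eq_zero_left hv]
      exact Submodule.neg_mem _ (Submodule.sum_mem _ fun k hk =>
        Submodule.smul_mem _ _ (hmem k (Finset.ne_of_mem_erase hk)))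
    set c := col k₀
    have h2 : D.χ c (v.1 k₀) ≠ 0 := fun h0 => hk (by
      have := D.mul_e_sub_mem c (v.1 k₀)
      rwa [h0, zero_smul, sub_zero, v.2 k₀] at this)
    have h3 : u k₀ ∈ N ⊔ D.J • (⊤ : Submodule R M) := by
      have h4 : u k₀ = algebraMap K R (D.χ c (v.1 k₀))⁻¹ • (v.1 k₀ • u k₀) +
          -(algebraMap K R (D.χ c (v.1 k₀))⁻¹ • ((v.1 k₀ * D.e c - D.χ c (v.1 k₀) • D.e c) •
            u k₀)) := by
        rw [v.2 k₀, sub_smul, smul_sub, Algebra.smul_def, mul_smul, hcol, ← mul_smul,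
          ← mul_smul, ← map_mul, inv_mul_cancel₀ h2, map_one, one_smul]
        abel
      rw [h4]
      exact Submodule.add_mem_sup (Submodule.smul_mem _ _ h1) (Submodule.neg_mem _
        (Submodule.smul_mem _ _ (Submodule.smul_mem_smul (D.mul_e_sub_mem _ _)
          Submodule.mem_top)))
    have h5 : N = ⊤ := by
      apply D.eq_top_of_sup
      refine top_le_iff.1 (hspan.symm.le.trans (Submodule.span_le.2 ?_))
      rintro _ ⟨k, rfl⟩
      by_cases h : k = k₀
      · subst h; exact h3
      · exact Submodule.mem_sup_left (hmem k h)
    have h6 : S (Fintype.card {k // k ≠ k₀}) :=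
      ⟨_, inferInstance, inferInstance, fun k => col k.1, fun k => u k.1, rfl,
        fun k => hcol k.1, h5⟩
    have h7 := Nat.find_min' hS h6
    rw [← hcard] at h7
    exact absurd (Fintype.card_subtype_lt (p := fun k => k ≠ k₀) (x := k₀) (by simp)) (by omega)

end TwoVertex
end TwoPoint

namespace TwoPoint

theorem lift_of_range_eq {R : Type} [Ring R] {A B C E : Type} [AddCommGroup A] [Module R A]
    [AddCommGroup B] [Module R B] [AddCommGroup C] [Module R C] [AddCommGroup E] [Module R E]
    [Module.Projective R E] (f : A →ₗ[R] B) (g : B →ₗ[R] C)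
    (h : LinearMap.range f = LinearMap.ker g) (κ : E →ₗ[R] B) (hκ : g ∘ₗ κ = 0) :
    ∃ τ : E →ₗ[R] A, f ∘ₗ τ = κ := by
  have hm : ∀ x, κ x ∈ LinearMap.range f := fun x => by
    rw [h]; exact congrArg (fun t => t x) hκ
  obtain ⟨τ, hτ⟩ := Module.projective_lifting_property f.rangeRestrict (κ.codRestrict _ hm)
    f.surjective_rangeRestrict
  refine ⟨τ, ?_⟩
  ext x
  have := congrArg (fun t => (t x).1) hτ
  simpa using this

theorem linearMap_apply_of_eq {R A B : Type} [Ring R] [AddCommGroup A] [Module R A]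
    [AddCommGroup B] [Module R B] {f g : A →ₗ[R] B} (h : f = g) (x : A) : f x = g x := h ▸ rfl

/-- The Hom-surjectivity in a projective presentation passes to the presentation by
projective covers. -/
theorem TwoVertex.extend_along_cover {K R : Type} [Field K] [Ring R] [Algebra K R]
    (D : TwoVertex K R) {P₁ P₀ Q₁ Q₀ M : Type} [AddCommGroup P₁] [Module R P₁] [AddCommGroup P₀]
    [Module R P₀] [AddCommGroup Q₁] [Module R Q₁] [AddCommGroup Q₀] [Module R Q₀]
    [AddCommGroup M] [Module R M] [Module.Projective R P₁] [Module.Projective R P₀]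
    [Module.Projective R Q₁] [Module.Projective R Q₀] [IsNoetherian R Q₀] [IsNoetherian R Q₁]
    (f : P₁ →ₗ[R] P₀) (g : P₀ →ₗ[R] M) (hg : Function.Surjective g)
    (hfg : LinearMap.range f = LinearMap.ker g)
    (hext : ∀ h : P₁ →ₗ[R] M, ∃ h' : P₀ →ₗ[R] M, h = h' ∘ₗ f)
    (d : Q₁ →ₗ[R] Q₀) (π : Q₀ →ₗ[R] M) (hπ : Function.Surjective π)
    (hdπ : LinearMap.range d = LinearMap.ker π)
    (hJ₀ : ∀ x, π x = 0 → x ∈ D.J • (⊤ : Submodule R Q₀))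
    (hJ₁ : ∀ x, d x = 0 → x ∈ D.J • (⊤ : Submodule R Q₁)) (h : Q₁ →ₗ[R] M) :
    ∃ h' : Q₀ →ₗ[R] M, h = h' ∘ₗ d := by
  obtain ⟨v, hv⟩ := Module.projective_lifting_property π g hπ
  obtain ⟨u₀, hu₀⟩ := Module.projective_lifting_property g π hg
  have hvu : Function.Bijective (v ∘ₗ u₀) := by
    refine IsNoetherian.bijective_of_surjective_endomorphism _
      (D.surjective_of_congr _ fun y => ⟨y, hJ₀ _ ?_⟩)
    have h1 := linearMap_apply_of_eq hv (u₀ y)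
    have h2 := linearMap_apply_of_eq hu₀ y
    simp only [LinearMap.comp_apply] at h1 h2
    simp [h1, h2]
  let φ := LinearEquiv.ofBijective _ hvu
  have hφ : ∀ x, π (φ x) = π x := fun x => by
    have h1 := linearMap_apply_of_eq hv (u₀ x)
    have h2 := linearMap_apply_of_eq hu₀ x
    exact h1.trans h2
  let u : Q₀ →ₗ[R] P₀ := u₀ ∘ₗ φ.symm.toLinearMap
  have hvu1 : ∀ x, v (u x) = x := fun x => φ.apply_symm_apply x
  have hgu : ∀ x, g (u x) = π x := fun x => by
    have h2 := linearMap_apply_of_eq hu₀ (φ.symm x)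
    have h3 := hφ (φ.symm x)
    rw [LinearEquiv.apply_symm_apply] at h3
    exact h2.trans h3.symm
  have hπv : ∀ x, π (v x) = g x := fun x => linearMap_apply_of_eq hv x
  have hπd : ∀ x, π (d x) = 0 := fun x => by
    have : d x ∈ LinearMap.ker π := hdπ ▸ ⟨x, rfl⟩
    exact this
  have hgf : ∀ x, g (f x) = 0 := fun x => by
    have : f x ∈ LinearMap.ker g := hfg ▸ ⟨x, rfl⟩
    exact this
  obtain ⟨τ, hτ⟩ := lift_of_range_eq f g hfg (LinearMap.id - u ∘ₗ v) (by
    ext x; simp [hgu, hπv])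
  obtain ⟨w, hw⟩ := lift_of_range_eq d π hdπ (v ∘ₗ f) (by ext x; simp [hπv, hgf])
  have hws : Function.Surjective w := by
    refine D.surjective_of_congr _ fun y => ?_
    have h1 : u (d y) ∈ LinearMap.range f := by
      rw [hfg, LinearMap.mem_ker, hgu, hπd]
    obtain ⟨x, hx⟩ := h1
    refine ⟨x, hJ₁ _ ?_⟩
    have h2 := linearMap_apply_of_eq hw x
    simp only [LinearMap.comp_apply] at h2
    rw [map_sub, h2, hx, hvu1, sub_self]
  obtain ⟨s, hs⟩ := Module.projective_lifting_property w LinearMap.id hws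
  let s' : Q₁ →ₗ[R] P₁ := s - τ ∘ₗ f ∘ₗ s
  have hfs' : ∀ x, f (s' x) = u (d x) := fun x => by
    have h1 := linearMap_apply_of_eq hτ (f (s x))
    have h2 := linearMap_apply_of_eq hw (s x)
    have h3 := linearMap_apply_of_eq hs x
    simp only [LinearMap.comp_apply, LinearMap.sub_apply, LinearMap.id_apply] at h1 h2 h3
    simp only [s', LinearMap.sub_apply, LinearMap.comp_apply, map_sub, h1]
    rw [← h2, h3]; abel
  have hdθ : ∀ x, d (w (s' x)) = d x := fun x => by
    have h2 := linearMap_apply_of_eq hw (s' x)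
    simp only [LinearMap.comp_apply] at h2
    rw [h2, hfs', hvu1]
  have hθ : Function.Bijective (w ∘ₗ s') := by
    refine IsNoetherian.bijective_of_surjective_endomorphism _
      (D.surjective_of_congr _ fun y => ⟨y, hJ₁ _ ?_⟩)
    rw [map_sub, LinearMap.comp_apply, hdθ, sub_self]
  let θ := LinearEquiv.ofBijective _ hθ
  obtain ⟨h', hh'⟩ := hext (h ∘ₗ θ.symm.toLinearMap ∘ₗ w)
  refine ⟨h' ∘ₗ u, ?_⟩
  ext x
  have h1 := linearMap_apply_of_eq hh' (s' x)
  have h2 : θ.symm (w (s' x)) = x := θ.symm_apply_apply x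
  simp only [LinearMap.comp_apply, LinearEquiv.coe_coe, h2, hfs'] at h1
  exact h1

/-- A τ-rigid module has a minimal presentation by a rigid matrix. -/
theorem TwoVertex.exists_rigid_presentation {K R : Type} [Field K] [Ring R] [Algebra K R]
    [Module.Finite K R] (D : TwoVertex K R) {M : ModuleCat.{0} R} (hM : IsTauRigidCat R M) :
    ∃ (κ ι : Type) (_ : Fintype κ) (_ : Fintype ι) (_ : DecidableEq κ) (_ : DecidableEq ι)
      (col : κ → Fin 2) (col' : ι → Fin 2) (F : Matrix ι κ R),
      (∀ i k, D.e (col' i) * F i k * D.e (col k) = F i k) ∧ (∀ i k, F i k ∈ D.J) ∧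
      Nonempty (M ≃ₗ[R] coker (fun k => D.e (col k)) F) ∧
      ∀ X : Matrix ι κ R, (∀ i k, D.e (col' i) * X i k * D.e (col k) = X i k) →
        ∃ (Z : Matrix κ κ R) (Y : Matrix ι ι R),
          (∀ k k', D.e (col k) * Z k k' * D.e (col k') = Z k k') ∧
          (∀ i i', D.e (col' i) * Y i i' * D.e (col' i') = Y i i') ∧ X = F * Z + Y * F := by
  obtain ⟨hfin, P₁, P₀, f, g, hf1, hp1, hf0, hp0, hg, hfg, hext⟩ := hM
  have : IsNoetherianRing R := isNoetherian_of_tower K inferInstance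
  obtain ⟨κ, iF, iD, col, u, hcol, hπ, hJ0⟩ := D.exists_cover (M := M)
  set E : κ → R := fun k => D.e (col k) with hEdef
  have hE : ∀ k, E k * E k = E k := fun k => D.idem _
  set π := rowLift E u with hπdef
  have := rowMod_finite hE
  have := rowMod_projective hE
  obtain ⟨ι, iF', iD', col', d₀, hcol', hd, hJ1⟩ := D.exists_cover (M := LinearMap.ker π)
  set E' : ι → R := fun k => D.e (col' k) with hEdef'
  have hE' : ∀ k, E' k * E' k = E' k := fun k => D.idem _
  have := rowMod_finite hE'
  have := rowMod_projective hE'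
  set d : rowMod E' →ₗ[R] rowMod E := (LinearMap.ker π).subtype ∘ₗ rowLift E' d₀ with hddef
  have hrange : LinearMap.range d = LinearMap.ker π := by
    rw [hddef, LinearMap.range_comp, LinearMap.range_eq_top.2 hd]; simp
  have hdgen : ∀ i, d (rowGen hE' i) = (d₀ i).1 := fun i => by
    simp only [hddef, LinearMap.comp_apply, rowLift_gen]
    rw [hcol']; rfl
  let F : Matrix ι κ R := fun i k => (d₀ i).1.1 k
  have hFd : ∀ y : rowMod E', ∀ k, (d y).1 k = ∑ i, y.1 i * F i k := fun y k => by
    simp [hddef, rowLift_apply, F]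
  refine ⟨κ, ι, iF, iF', iD, iD', col, col', F, fun i k => ?_, fun i k => ?_, ?_, ?_⟩
  · have h1 := congrArg (fun t => t.1.1 k) (hcol' i)
    have h2 := (d₀ i).1.2 k
    simp only [SetLike.val_smul, Pi.smul_apply, smul_eq_mul] at h1
    change _ * (d₀ i).1.1 k * _ = _
    rw [h1]; exact h2
  · exact hJ0 _ (d₀ i).2 k
  · have hker : (Submodule.span R (Set.range F)).comap (rowMod E).subtype = LinearMap.ker π := by
      rw [← hrange]
      ext y
      rw [Submodule.mem_comap, LinearMap.mem_range]
      constructor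
      · intro hy
        obtain ⟨c, hc⟩ := (Submodule.mem_span_range_iff_exists_fun R).1 hy
        refine ⟨∑ i, c i • rowGen hE' i, ?_⟩
        ext k
        have := congrFun hc k
        simp only [map_sum, map_smul, hdgen]
        simpa [F] using this
      · rintro ⟨y, rfl⟩
        refine (Submodule.mem_span_range_iff_exists_fun R).2 ⟨y.1, ?_⟩
        ext k
        simp [hFd, F]
    exact ⟨((Submodule.quotEquivOfEq _ _ hker).trans (π.quotKerEquivOfSurjective hπ)).symm⟩
  · intro X hX
    let x : ι → rowMod E := fun i => ⟨X i, fun k => by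
      change X i k * D.e (col k) = X i k
      rw [← hX i k, mul_assoc, D.idem]⟩
    have hx : ∀ i, E' i • x i = x i := fun i => by
      ext k
      change D.e (col' i) * X i k = X i k
      rw [← hX i k, ← mul_assoc, ← mul_assoc, D.idem]
    obtain ⟨h', hh'⟩ := D.extend_along_cover f g hg hfg hext d π hπ hrange
      (fun y hy => D.row_mem_J hE (hJ0 y hy))
      (fun y hy => D.row_mem_J hE' (hJ1 y (Subtype.ext hy))) (π ∘ₗ rowLift E' x)
    obtain ⟨z, hz⟩ := rowMod_lifting hE π hπ h'
    have hmem : ∀ i, x i - z (d (rowGen hE' i)) ∈ LinearMap.range d := fun i => by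
      rw [hrange, LinearMap.mem_ker, map_sub, sub_eq_zero]
      have h1 := linearMap_apply_of_eq hh' (rowGen hE' i)
      simp only [LinearMap.comp_apply, rowLift_gen, hx] at h1
      rw [h1, ← hz]; rfl
    choose y hy using hmem
    refine ⟨fun k k' => (z (rowGen hE k)).1 k', fun i i' => E' i * (y i).1 i', ?_, ?_, ?_⟩
    · intro k k'
      have h1 := (z (rowGen hE k)).2 k'
      have h2 : E k • z (rowGen hE k) = z (rowGen hE k) := by rw [← map_smul, smul_rowGen]
      have h3 := congrArg (fun t => t.1 k') h2
      simp only [SetLike.val_smul, Pi.smul_apply, smul_eq_mul] at h3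
      change E k * _ * E k' = _
      rw [h3, h1]
    · intro i i'
      change E' i * (E' i * (y i).1 i') * E' i' = E' i * (y i).1 i'
      rw [← mul_assoc, hE', mul_assoc, (y i).2 i']
    · ext i k
      have hzF : z (d (rowGen hE' i)) = ∑ k', F i k' • z (rowGen hE k') := by
        rw [hdgen, row_eq_sum hE (d₀ i).1, map_sum]
        simp [F]
      have h0 : x i = ∑ k', F i k' • z (rowGen hE k') + E' i • d (y i) := by
        rw [← hzF, hy i, smul_sub, hx, ← map_smul, ← map_smul, smul_rowGen]; abel
      have h1 := congrArg (fun t => t.1 k) h0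
      simp only [Submodule.coe_add, AddSubmonoidClass.coe_finsetSum, Pi.add_apply,
        Finset.sum_apply, SetLike.val_smul, Pi.smul_apply, smul_eq_mul, hFd] at h1
      change X i k = _ at h1
      rw [h1, Finset.mul_sum]
      simp only [← mul_assoc]
      rfl

end TwoPoint

namespace TwoPoint

open Matrix

section Corner

variable {R : Type} [Ring R]

/-- Matrices with entries in the corner `a R b`. -/
def IsC {m n : Type} (a b : R) (M : Matrix m n R) : Prop :=
  (∀ i j, a * M i j = M i j) ∧ ∀ i j, M i j * b = M i j

variable {m n p q : Type} {a b c : R}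

theorem IsC.mul [Fintype n] {M : Matrix m n R} {N : Matrix n p R} (hM : IsC a b M)
    (hN : IsC b c N) : IsC a c (M * N) :=
  ⟨fun i j => by simp [Matrix.mul_apply, Finset.mul_sum, ← mul_assoc, hM.1],
    fun i j => by simp [Matrix.mul_apply, Finset.sum_mul, mul_assoc, hN.2]⟩

theorem IsC.add {M N : Matrix m n R} (hM : IsC a b M) (hN : IsC a b N) : IsC a b (M + N) :=
  ⟨fun i j => by simp [mul_add, hM.1, hN.1], fun i j => by simp [add_mul, hM.2, hN.2]⟩

theorem IsC.sub {M N : Matrix m n R} (hM : IsC a b M) (hN : IsC a b N) : IsC a b (M - N) :=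
  ⟨fun i j => by simp [mul_sub, hM.1, hN.1], fun i j => by simp [sub_mul, hM.2, hN.2]⟩

theorem IsC.neg {M : Matrix m n R} (hM : IsC a b M) : IsC a b (-M) :=
  ⟨fun i j => by simp [hM.1], fun i j => by simp [hM.2]⟩

theorem IsC.zero : IsC a b (0 : Matrix m n R) := by simp [IsC]

theorem IsC.submatrix {M : Matrix m n R} (hM : IsC a b M) (r : p → m) (s : q → n) :
    IsC a b (M.submatrix r s) := ⟨fun i j => hM.1 _ _, fun i j => hM.2 _ _⟩

/-- The scalar matrix of an idempotent. -/
def dg (n : Type) [DecidableEq n] (a : R) : Matrix n n R := diagonal fun _ => a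

theorem isC_dg [DecidableEq n] (ha : a * a = a) : IsC a a (dg n a) := by
  constructor <;> intro i j <;> by_cases h : i = j <;> simp [dg, h, ha]

theorem dg_mul [Fintype m] [DecidableEq m] {M : Matrix m n R} (hM : IsC a b M) :
    dg m a * M = M := by
  ext i j; simp [dg, hM.1]

theorem mul_dg [Fintype n] [DecidableEq n] {M : Matrix m n R} (hM : IsC a b M) :
    M * dg n b = M := by
  ext i j; simp [dg, hM.2]

/-- Every matrix over the corner `f R e` is of the form `F Z + Y F'`. -/
def EVan {ι κ ι' κ' : Type} [Fintype κ] [Fintype ι'] (e f : R) (F : Matrix ι κ R)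
    (F' : Matrix ι' κ' R) : Prop :=
  ∀ X : Matrix ι κ' R, IsC f e X → ∃ (Z : Matrix κ κ' R) (Y : Matrix ι ι' R),
    IsC e e Z ∧ IsC f f Y ∧ X = F * Z + Y * F'

/-- Equivalence of matrices over the corner `f R e`. -/
def MEquiv {ι κ ι' κ' : Type} [Fintype κ] [Fintype ι] [Fintype κ'] [Fintype ι'] [DecidableEq κ]
    [DecidableEq ι] [DecidableEq κ'] [DecidableEq ι'] (e f : R)
    (F : Matrix ι κ R) (F' : Matrix ι' κ' R) : Prop :=
  ∃ (U : Matrix ι' ι R) (U' : Matrix ι ι' R) (V : Matrix κ κ' R) (V' : Matrix κ' κ R),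
    IsC f f U ∧ IsC f f U' ∧ IsC e e V ∧ IsC e e V' ∧ U * U' = dg ι' f ∧ U' * U = dg ι f ∧
    V * V' = dg κ e ∧ V' * V = dg κ' e ∧ F' = U * F * V

section

variable {ι κ ι' κ' ι'' κ'' : Type} [Fintype κ] [Fintype ι] [Fintype κ'] [Fintype ι']
  [Fintype κ''] [Fintype ι''] [DecidableEq κ] [DecidableEq ι] [DecidableEq κ'] [DecidableEq ι']
  [DecidableEq κ''] [DecidableEq ι''] {e f : R} {F : Matrix ι κ R} {F' : Matrix ι' κ' R}
  {F'' : Matrix ι'' κ'' R}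

theorem MEquiv.refl (he : e * e = e) (hf : f * f = f) (hF : IsC f e F) : MEquiv e f F F :=
  ⟨dg ι f, dg ι f, dg κ e, dg κ e, isC_dg hf, isC_dg hf, isC_dg he, isC_dg he,
    dg_mul (isC_dg hf), dg_mul (isC_dg hf), dg_mul (isC_dg he), dg_mul (isC_dg he), by
      rw [dg_mul hF, mul_dg hF]⟩

theorem MEquiv.symm (hF : IsC f e F) (h : MEquiv e f F F') : MEquiv e f F' F := by
  obtain ⟨U, U', V, V', hU, hU', hV, hV', h1, h2, h3, h4, rfl⟩ := h
  refine ⟨U', U, V', V, hU', hU, hV', hV, h2, h1, h4, h3, ?_⟩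
  rw [Matrix.mul_assoc, Matrix.mul_assoc, h3, mul_dg (hU.mul hF), ← Matrix.mul_assoc, h2,
    dg_mul hF]

theorem MEquiv.isC (hF : IsC f e F) (h : MEquiv e f F F') : IsC f e F' := by
  obtain ⟨U, U', V, V', hU, hU', hV, hV', h1, h2, h3, h4, rfl⟩ := h
  exact (hU.mul hF).mul hV

theorem MEquiv.trans (h : MEquiv e f F F') (h' : MEquiv e f F' F'') : MEquiv e f F F'' := by
  obtain ⟨U, U', V, V', hU, hU', hV, hV', h1, h2, h3, h4, rfl⟩ := h
  obtain ⟨A, A', B, B', hA, hA', hB, hB', i1, i2, i3, i4, rfl⟩ := h'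
  refine ⟨A * U, U' * A', V * B, B' * V', hA.mul hU, hU'.mul hA', hV.mul hB, hB'.mul hV',
    ?_, ?_, ?_, ?_, ?_⟩
  · rw [Matrix.mul_assoc, ← Matrix.mul_assoc U, h1, dg_mul hA', i1]
  · rw [Matrix.mul_assoc, ← Matrix.mul_assoc A', i2, dg_mul hU, h2]
  · rw [Matrix.mul_assoc, ← Matrix.mul_assoc B, i3, dg_mul hV', h3]
  · rw [Matrix.mul_assoc, ← Matrix.mul_assoc V', h4, dg_mul hB, i4]
  · simp only [Matrix.mul_assoc]

theorem EVan.of_mEquiv {r₁ c₁ r₂ c₂ : Type} [Fintype r₁] [Fintype c₁] [Fintype r₂] [Fintype c₂]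
    [DecidableEq r₁] [DecidableEq c₁] [DecidableEq r₂] [DecidableEq c₂] {G : Matrix r₁ c₁ R}
    {G' : Matrix r₂ c₂ R} (h : MEquiv e f F F') (h' : MEquiv e f G G') (hE : EVan e f F G) :
    EVan e f F' G' := by
  obtain ⟨U, U', V, V', hU, hU', hV, hV', h1, h2, h3, h4, rfl⟩ := h
  obtain ⟨A, A', B, B', hA, hA', hB, hB', i1, i2, i3, i4, rfl⟩ := h'
  intro X hX
  obtain ⟨Z, Y, hZ, hY, hXe⟩ := hE (U' * X * B') ((hU'.mul hX).mul hB')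
  refine ⟨V' * Z * B, U * Y * A', (hV'.mul hZ).mul hB, (hU.mul hY).mul hA', ?_⟩
  have e1 : X = U * (U' * X * B') * B := by
    rw [Matrix.mul_assoc U' X, ← Matrix.mul_assoc U, h1, Matrix.mul_assoc, Matrix.mul_assoc, i4,
      mul_dg hX, dg_mul hX]
  have e2 : U * F * V * (V' * Z * B) = U * (F * Z) * B := by
    rw [Matrix.mul_assoc (U * F), ← Matrix.mul_assoc V, ← Matrix.mul_assoc V, h3, dg_mul hZ]
    simp only [Matrix.mul_assoc]
  have e3 : U * Y * A' * (A * G * B) = U * (Y * G) * B := by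
    rw [← Matrix.mul_assoc, ← Matrix.mul_assoc, Matrix.mul_assoc (U * Y), i2,
      mul_dg (hU.mul hY)]
    simp only [Matrix.mul_assoc]
  rw [e2, e3, ← Matrix.add_mul, ← Matrix.mul_add, ← hXe]
  exact e1

end

section Coker

variable {ι κ ι' κ' ι'' κ'' : Type} [Fintype κ] [Fintype ι] [Fintype κ'] [Fintype ι']
  [Fintype κ''] [Fintype ι''] {e f : R} {F : Matrix ι κ R} {F' : Matrix ι' κ' R}
  {F'' : Matrix ι'' κ'' R}

/-- The module presented by a matrix over a corner. -/
abbrev Cok (e : R) (F : Matrix ι κ R) : Type := coker (fun _ => e) fun i k => F i k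

/-- The class of a row vector. -/
def Cok.mk (e : R) (F : Matrix ι κ R) : rowMod (fun _ : κ => e) →ₗ[R] Cok e F :=
  Submodule.mkQ _

omit [Fintype κ] [Fintype ι] in
theorem Cok.mk_surjective (e : R) (F : Matrix ι κ R) : Function.Surjective (Cok.mk e F) :=
  Submodule.mkQ_surjective _

omit [Fintype κ] in
theorem Cok.mk_eq_zero {v : rowMod (fun _ : κ => e)} :
    Cok.mk e F v = 0 ↔ ∃ y : ι → R, v.1 = y ᵥ* F := by
  rw [Cok.mk, Submodule.mkQ_apply, Submodule.Quotient.mk_eq_zero, Submodule.mem_comap]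
  refine (Submodule.mem_span_range_iff_exists_fun R (v := fun i => F i)).trans ?_
  refine exists_congr fun y => ?_
  rw [Matrix.vecMul_eq_sum]
  exact eq_comm

/-- Right multiplication by a matrix. -/
def rowMul (Z : Matrix κ κ' R) (hZ : ∀ i j, Z i j * e = Z i j) :
    rowMod (fun _ : κ => e) →ₗ[R] rowMod (fun _ : κ' => e) where
  toFun v := ⟨v.1 ᵥ* Z, fun k => by
    simp [Matrix.vecMul, dotProduct, Finset.sum_mul, mul_assoc, hZ]⟩
  map_add' v w := by ext; simp [Matrix.add_vecMul]
  map_smul' r v := by ext; simp [Matrix.smul_vecMul]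

/-- The map of presented modules given by a matrix. -/
def Cok.map (Z : Matrix κ κ' R) (hZ : ∀ i j, Z i j * e = Z i j)
    (h : ∃ Y : Matrix ι ι' R, F * Z = Y * F') : Cok e F →ₗ[R] Cok e F' :=
  Submodule.liftQ _ (Cok.mk e F' ∘ₗ rowMul Z hZ) fun v hv => by
    have hv' : Cok.mk e F v = 0 := (Submodule.Quotient.mk_eq_zero _).2 hv
    obtain ⟨y, hy⟩ := Cok.mk_eq_zero.1 hv'
    obtain ⟨Y, hY⟩ := h
    refine Cok.mk_eq_zero.2 ⟨y ᵥ* Y, ?_⟩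
    change v.1 ᵥ* Z = _
    rw [hy, Matrix.vecMul_vecMul, hY, Matrix.vecMul_vecMul]

theorem Cok.map_mk (Z : Matrix κ κ' R) (hZ : ∀ i j, Z i j * e = Z i j)
    (h : ∃ Y : Matrix ι ι' R, F * Z = Y * F') (v : rowMod (fun _ : κ => e)) :
    Cok.map Z hZ h (Cok.mk e F v) = Cok.mk e F' (rowMul Z hZ v) := rfl

omit [Fintype κ] [Fintype ι] in
theorem Cok.induction {P : Cok e F → Prop} (h : ∀ v, P (Cok.mk e F v)) (x : Cok e F) : P x := by
  obtain ⟨v, rfl⟩ := Cok.mk_surjective e F x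
  exact h v

theorem rowMul_id [DecidableEq κ] {Z : Matrix κ κ R} (hZ : ∀ i j, Z i j * e = Z i j)
    (h : Z = dg κ e) (v : rowMod (fun _ : κ => e)) : rowMul Z hZ v = v := by
  subst h
  ext k
  change (v.1 ᵥ* diagonal fun _ => e) k = v.1 k
  rw [Matrix.vecMul_diagonal]; exact v.2 k

theorem rowMul_rowMul (Z : Matrix κ κ' R) (hZ : ∀ i j, Z i j * e = Z i j) (Z' : Matrix κ' κ'' R)
    (hZ' : ∀ i j, Z' i j * e = Z' i j) (h : ∀ i j, (Z * Z') i j * e = (Z * Z') i j)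
    (v : rowMod (fun _ : κ => e)) :
    rowMul Z' hZ' (rowMul Z hZ v) = rowMul (Z * Z') h v := by
  ext k
  change (v.1 ᵥ* Z ᵥ* Z') k = (v.1 ᵥ* (Z * Z')) k
  rw [Matrix.vecMul_vecMul]

theorem MEquiv.cok_equiv [DecidableEq κ] [DecidableEq ι] [DecidableEq κ'] [DecidableEq ι']
    (hF : IsC f e F) (h : MEquiv e f F F') : Nonempty (Cok e F ≃ₗ[R] Cok e F') := by
  obtain ⟨U, U', V, V', hU, hU', hV, hV', h1, h2, h3, h4, rfl⟩ := h
  refine ⟨LinearEquiv.ofLinearMap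
    (Cok.map V hV.2 ⟨U', by rw [Matrix.mul_assoc U, ← Matrix.mul_assoc, h2,
      dg_mul (hF.mul hV)]⟩)
    (Cok.map V' hV'.2 ⟨U, by rw [Matrix.mul_assoc, h3, mul_dg (hU.mul hF)]⟩) ?_ ?_⟩
  · refine LinearMap.ext fun x => ?_
    induction x using Cok.induction with
    | h v =>
      simp only [LinearMap.comp_apply, Cok.map_mk, LinearMap.id_apply]
      rw [rowMul_rowMul _ _ _ _ (hV'.mul hV).2, rowMul_id _ h4]
  · refine LinearMap.ext fun x => ?_
    induction x using Cok.induction with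
    | h v =>
      simp only [LinearMap.comp_apply, Cok.map_mk, LinearMap.id_apply]
      rw [rowMul_rowMul _ _ _ _ (hV.mul hV').2, rowMul_id _ h3]

/-- Every homomorphism of presented modules comes from a matrix. -/
theorem Cok.exists_map (he : e * e = e) (hf : f * f = f) (hF : IsC f e F) (hF' : IsC f e F')
    (φ : Cok e F →ₗ[R] Cok e F') :
    ∃ (Z : Matrix κ κ' R) (Y : Matrix ι ι' R) (hZ : IsC e e Z) (_ : IsC f f Y)
      (h : F * Z = Y * F'), φ = Cok.map Z hZ.2 ⟨Y, h⟩ := by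
  classical
  have hE : ∀ _ : κ, e * e = e := fun _ => he
  have hz : ∀ k : κ, ∃ z : rowMod (fun _ : κ' => e), e • z = z ∧
      Cok.mk e F' z = φ (Cok.mk e F (rowGen hE k)) := fun k => by
    obtain ⟨z, hz⟩ := Cok.mk_surjective e F' (φ (Cok.mk e F (rowGen hE k)))
    refine ⟨e • z, by rw [← mul_smul, he], ?_⟩
    have h1 := smul_rowGen hE k
    rw [map_smul, hz, ← map_smul, ← map_smul, h1]
  choose z hz1 hz2 using hz
  let Z : Matrix κ κ' R := fun k => (z k).1
  have hZ : IsC e e Z := ⟨fun k k' => congrFun (congrArg Subtype.val (hz1 k)) k',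
    fun k k' => (z k).2 k'⟩
  have hφ : ∀ v, φ (Cok.mk e F v) = Cok.mk e F' (rowMul Z hZ.2 v) := fun v => by
    have : φ ∘ₗ Cok.mk e F = Cok.mk e F' ∘ₗ rowMul Z hZ.2 := by
      refine rowMod_hom_ext hE fun k => ?_
      simp only [LinearMap.comp_apply]
      rw [← hz2]
      congr 1
      ext j
      change Z k j = (Pi.single k e ᵥ* Z) j
      rw [Matrix.single_vecMul]
      simp [hZ.1]
    exact linearMap_apply_of_eq this v
  have hy : ∀ i, ∃ y : ι' → R, F i ᵥ* Z = y ᵥ* F' := fun i => by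
    have h0 : Cok.mk e F ⟨F i, fun k => hF.2 i k⟩ = 0 :=
      Cok.mk_eq_zero.2 ⟨Pi.single i 1, by rw [Matrix.single_one_vecMul]; rfl⟩
    have h1 := hφ ⟨F i, fun k => hF.2 i k⟩
    rw [h0, map_zero] at h1
    exact Cok.mk_eq_zero.1 h1.symm
  choose y hy using hy
  have hFZ : F * Z = (Matrix.of fun i i' => f * y i i' * f : Matrix ι ι' R) * F' := by
    ext i k
    have h1 := congrFun (hy i) k
    have h2 := (hF.mul hZ).1 i k
    change (F * Z) i k = _ at h1
    rw [← h2, h1]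
    simp [Matrix.mul_apply, Matrix.vecMul, dotProduct, Finset.mul_sum, mul_assoc, hF'.1]
  refine ⟨Z, _, hZ, ⟨fun i j => ?_, fun i j => ?_⟩, hFZ, ?_⟩
  · simp [← mul_assoc, hf]
  · simp [mul_assoc, hf]
  · refine LinearMap.ext fun x => ?_
    induction x using Cok.induction with
    | h v => exact hφ v

theorem Cok.finite (he : e * e = e) (F : Matrix ι κ R) : Module.Finite R (Cok e F) := by
  classical
  have := rowMod_finite (κ := κ) (E := fun _ => e) fun _ => he
  exact Module.Finite.of_surjective (Cok.mk e F) (Cok.mk_surjective e F)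

/-- The block sum presents the product. -/
theorem cok_fromBlocks [DecidableEq κ] [DecidableEq ι] [DecidableEq κ'] [DecidableEq ι']
    (he : e * e = e) (hF : IsC f e F) (hF' : IsC f e F') :
    Nonempty (Cok e (fromBlocks F 0 0 F') ≃ₗ[R] Cok e F × Cok e F') := by
  have hr : ∀ i j, (fromRows (dg κ e) (0 : Matrix κ' κ R)) i j * e = fromRows (dg κ e) 0 i j := by
    rintro (i | i) j <;> simp [(isC_dg he).2]
  have hr' : ∀ i j, (fromRows (0 : Matrix κ κ' R) (dg κ' e)) i j * e =
      fromRows 0 (dg κ' e) i j := by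
    rintro (i | i) j <;> simp [(isC_dg he).2]
  have hc : ∀ i j, (fromCols (dg κ e) (0 : Matrix κ κ' R)) i j * e = fromCols (dg κ e) 0 i j := by
    rintro i (j | j) <;> simp [(isC_dg he).2]
  have hc' : ∀ i j, (fromCols (0 : Matrix κ' κ R) (dg κ' e)) i j * e =
      fromCols 0 (dg κ' e) i j := by
    rintro i (j | j) <;> simp [(isC_dg he).2]
  refine ⟨LinearEquiv.ofLinearMap
    ((Cok.map (fromRows (dg κ e) 0) hr ⟨fromRows (dg ι f) 0, ?_⟩).prod
      (Cok.map (fromRows 0 (dg κ' e)) hr' ⟨fromRows 0 (dg ι' f), ?_⟩))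
    ((Cok.map (fromCols (dg κ e) 0) hc ⟨fromCols (dg ι f) 0, ?_⟩).coprod
      (Cok.map (fromCols 0 (dg κ' e)) hc' ⟨fromCols 0 (dg ι' f), ?_⟩)) ?_ ?_⟩
  · rw [fromBlocks_mul_fromRows, fromRows_mul, mul_dg hF, dg_mul hF]; simp
  · rw [fromBlocks_mul_fromRows, fromRows_mul, mul_dg hF', dg_mul hF']; simp
  · rw [mul_fromCols, fromCols_mul_fromBlocks, mul_dg hF, dg_mul hF]; simp
  · rw [mul_fromCols, fromCols_mul_fromBlocks, mul_dg hF', dg_mul hF']; simp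
  · apply LinearMap.prod_ext
    · rw [LinearMap.comp_assoc, LinearMap.coprod_inl, LinearMap.id_comp]
      refine LinearMap.ext fun x => ?_
      induction x using Cok.induction with | h v => ?_
      refine Prod.ext ?_ ?_
      · change Cok.mk e F (rowMul _ hr (rowMul _ hc v)) = Cok.mk e F v
        congr 1
        ext j
        change (v.1 ᵥ* _ ᵥ* _) j = v.1 j
        rw [Matrix.vecMul_vecMul, fromCols_mul_fromRows, dg_mul (isC_dg he), Matrix.mul_zero,
          add_zero, dg, Matrix.vecMul_diagonal]
        exact v.2 j
      · change Cok.mk e F' (rowMul _ hr' (rowMul _ hc v)) = 0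
        convert map_zero (Cok.mk e F')
        ext j
        change (v.1 ᵥ* _ ᵥ* _) j = 0
        rw [Matrix.vecMul_vecMul, fromCols_mul_fromRows]
        simp
    · rw [LinearMap.comp_assoc, LinearMap.coprod_inr, LinearMap.id_comp]
      refine LinearMap.ext fun x => ?_
      induction x using Cok.induction with | h v => ?_
      refine Prod.ext ?_ ?_
      · change Cok.mk e F (rowMul _ hr (rowMul _ hc' v)) = 0
        convert map_zero (Cok.mk e F)
        ext j
        change (v.1 ᵥ* _ ᵥ* _) j = 0
        rw [Matrix.vecMul_vecMul, fromCols_mul_fromRows]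
        simp
      · change Cok.mk e F' (rowMul _ hr' (rowMul _ hc' v)) = Cok.mk e F' v
        congr 1
        ext j
        change (v.1 ᵥ* _ ᵥ* _) j = v.1 j
        rw [Matrix.vecMul_vecMul, fromCols_mul_fromRows, dg_mul (isC_dg he), Matrix.mul_zero,
          zero_add, dg, Matrix.vecMul_diagonal]
        exact v.2 j
  · refine LinearMap.ext fun x => ?_
    induction x using Cok.induction with | h v => ?_
    change Cok.mk e _ (rowMul _ hc (rowMul _ hr v)) + Cok.mk e _ (rowMul _ hc' (rowMul _ hr' v)) =
      Cok.mk e _ v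
    rw [← map_add]
    congr 1
    ext j
    change (v.1 ᵥ* _ ᵥ* _) j + (v.1 ᵥ* _ ᵥ* _) j = v.1 j
    rw [Matrix.vecMul_vecMul, Matrix.vecMul_vecMul, ← Pi.add_apply, ← Matrix.vecMul_add, fromRows_mul_fromCols,
      fromRows_mul_fromCols, fromBlocks_add]
    simp only [dg_mul (isC_dg he), Matrix.zero_mul, Matrix.mul_zero, add_zero, zero_add]
    have : fromBlocks (dg κ e) 0 0 (dg κ' e) = dg (κ ⊕ κ') e := by
      simp only [dg, fromBlocks_diagonal]
      congr 1; ext i; cases i <;> rfl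
    rw [this, dg, Matrix.vecMul_diagonal]
    exact v.2 j

/-- The block diagonal matrix with all blocks equal. -/
def kron (τ : Type) [DecidableEq τ] (F : Matrix ι κ R) : Matrix (τ × ι) (τ × κ) R :=
  of fun p q => if p.1 = q.1 then F p.2 q.2 else 0

omit [Fintype κ] [Fintype ι] in
theorem isC_kron {τ : Type} [DecidableEq τ] (hF : IsC f e F) : IsC f e (kron τ F) := by
  constructor <;> rintro ⟨i, j⟩ ⟨k, l⟩ <;> by_cases h : i = k <;> simp [kron, h, hF.1, hF.2]

/-- The `t`-th row of blocks of the identity. -/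
def blockRow {τ : Type} [DecidableEq τ] [DecidableEq κ] (a : R) (t : τ) : Matrix κ (τ × κ) R :=
  of fun k q => if t = q.1 ∧ k = q.2 then a else 0

/-- The `t`-th column of blocks of the identity. -/
def blockCol {τ : Type} [DecidableEq τ] [DecidableEq κ] (a : R) (t : τ) : Matrix (τ × κ) κ R :=
  of fun q k => if t = q.1 ∧ k = q.2 then a else 0

theorem cok_kron {τ : Type} [Fintype τ] [DecidableEq τ] [DecidableEq κ] [DecidableEq ι]
    (he : e * e = e) (hF : IsC f e F) :
    Nonempty (Cok e (kron τ F) ≃ₗ[R] (τ → Cok e F)) := by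
  have hc : ∀ (t : τ) i j, (blockCol e t : Matrix (τ × κ) κ R) i j * e = blockCol e t i j := by
    intro t i j; simp [blockCol, he]
  have hr : ∀ (t : τ) i j, (blockRow e t : Matrix κ (τ × κ) R) i j * e = blockRow e t i j := by
    intro t i j; simp [blockRow, he]
  have h1 : ∀ t, kron τ F * (blockCol e t : Matrix (τ × κ) κ R) =
      (blockCol f t : Matrix (τ × ι) ι R) * F := fun t => by
    ext ⟨s, i⟩ k
    simp only [kron, blockCol, Matrix.mul_apply, of_apply, Fintype.sum_prod_type]
    rw [Finset.sum_eq_single t, Finset.sum_eq_single k, Finset.sum_eq_single i]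
    · by_cases h : s = t
      · simp [h, hF.1, hF.2]
      · simp [h, Ne.symm h]
    · intro j _ hj; simp [hj]
    · simp
    · intro j _ hj; simp [hj.symm]
    · simp
    · intro j _ hj; simp [hj.symm]
    · simp
  have h2 : ∀ t, F * (blockRow e t : Matrix κ (τ × κ) R) =
      (blockRow f t : Matrix ι (τ × ι) R) * kron τ F := fun t => by
    ext i ⟨s, k⟩
    simp only [kron, blockRow, Matrix.mul_apply, of_apply, Fintype.sum_prod_type]
    rw [Finset.sum_eq_single k, Finset.sum_eq_single t, Finset.sum_eq_single i]
    · by_cases h : t = s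
      · simp [h, hF.1, hF.2]
      · simp [h]
    · intro j _ hj; simp [hj.symm]
    · simp
    · intro j _ hj; simp [hj.symm]
    · simp
    · intro j _ hj; simp [hj]
    · simp
  refine ⟨LinearEquiv.ofLinearMap
    (LinearMap.pi fun t => Cok.map (blockCol e t) (hc t) ⟨blockCol f t, h1 t⟩)
    (∑ t, Cok.map (blockRow e t) (hr t) ⟨blockRow f t, h2 t⟩ ∘ₗ LinearMap.proj t) ?_ ?_⟩
  · apply LinearMap.pi_ext'
    intro t
    refine LinearMap.ext fun x => funext fun s => ?_
    induction x using Cok.induction with | h v => ?_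
    simp only [LinearMap.comp_apply, LinearMap.pi_apply, LinearMap.sum_apply, LinearMap.proj_apply,
      LinearMap.single_apply, LinearMap.id_apply]
    rw [Finset.sum_eq_single t]
    · simp only [Pi.single_eq_same, Cok.map_mk]
      by_cases h : s = t
      · subst h
        rw [Pi.single_eq_same]
        congr 1
        ext k
        change (v.1 ᵥ* _ ᵥ* _) k = v.1 k
        rw [Matrix.vecMul_vecMul]
        have : (blockRow e s : Matrix κ (τ × κ) R) * (blockCol e s : Matrix (τ × κ) κ R) = dg κ e := by
          ext i j
          simp only [blockRow, blockCol, Matrix.mul_apply, of_apply, Fintype.sum_prod_type]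
          rw [Finset.sum_eq_single s, Finset.sum_eq_single i]
          · by_cases hij : i = j
            · simp [hij, dg, he]
            · simp [hij, Ne.symm hij, dg]
          · intro j _ hj; simp [hj.symm]
          · simp
          · intro j _ hj; simp [hj.symm]
          · simp
        rw [this, dg, Matrix.vecMul_diagonal]
        exact v.2 k
      · rw [Pi.single_eq_of_ne h]
        convert map_zero (Cok.mk e F)
        ext k
        change (v.1 ᵥ* _ ᵥ* _) k = 0
        rw [Matrix.vecMul_vecMul]
        have : (blockRow e t : Matrix κ (τ × κ) R) * (blockCol e s : Matrix (τ × κ) κ R) = 0 := by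
          ext i j
          simp only [blockRow, blockCol, Matrix.mul_apply, of_apply, Fintype.sum_prod_type]
          refine Finset.sum_eq_zero fun a _ => Finset.sum_eq_zero fun b _ => ?_
          by_cases ha : t = a
          · subst ha; simp [h]
          · simp [ha]
        rw [this]; simp
    · intro j _ hj; simp [hj]
    · simp
  · refine LinearMap.ext fun x => ?_
    induction x using Cok.induction with | h v => ?_
    simp only [LinearMap.comp_apply, LinearMap.pi_apply, LinearMap.sum_apply, LinearMap.proj_apply,
      LinearMap.id_apply, Cok.map_mk]
    rw [← map_sum]
    congr 1
    ext ⟨s, k⟩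
    rw [AddSubmonoidClass.coe_finsetSum, Finset.sum_apply, Finset.sum_eq_single s]
    · change (v.1 ᵥ* _ ᵥ* _) (s, k) = _
      simp only [Matrix.vecMul, dotProduct, blockRow, blockCol, of_apply]
      rw [Finset.sum_eq_single k, Finset.sum_eq_single (s, k)]
      · have := v.2 (s, k)
        simp only [] at this
        simp [this]
      · rintro ⟨a, b⟩ _ hab
        have : ¬ (s = a ∧ k = b) := fun ⟨h, h'⟩ => hab (by rw [h, h'])
        simp [this]
      · simp
      · intro j _ hj; simp [hj]
      · simp
    · intro t _ ht
      change (v.1 ᵥ* _ ᵥ* _) (s, k) = 0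
      simp [Matrix.vecMul, dotProduct, blockRow, ht]
    · simp

end Coker
end Corner
end TwoPoint

namespace TwoPoint

open Matrix

theorem IsTauRigidCat.congr {R : Type} [Ring R] {M N : ModuleCat.{0} R} (φ : M ≃ₗ[R] N)
    (h : IsTauRigidCat R M) : IsTauRigidCat R N := by
  obtain ⟨hM, P₁, P₀, f, g, h1, h2, h3, h4, hg, hfg, hext⟩ := h
  refine ⟨Module.Finite.equiv φ, P₁, P₀, f, φ.toLinearMap ∘ₗ g, h1, h2, h3, h4,
    φ.surjective.comp hg, ?_, fun h => ?_⟩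
  · rw [hfg, LinearMap.ker_comp_of_ker_eq_bot _ (LinearEquiv.ker φ)]
  · obtain ⟨h', hh⟩ := hext (φ.symm.toLinearMap ∘ₗ h)
    refine ⟨φ.toLinearMap ∘ₗ h', ?_⟩
    rw [LinearMap.comp_assoc, ← hh]
    ext x; simp

theorem isTauRigidCat_of_projective {R : Type} [Ring R] (M : ModuleCat.{0} R)
    [Module.Finite R M] [Module.Projective R M] : IsTauRigidCat R M := by
  refine ⟨inferInstance, ModuleCat.of R PUnit, M, 0, LinearMap.id, ?_, ?_, inferInstance,
    inferInstance, Function.surjective_id, ?_, fun h => ⟨0, ?_⟩⟩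
  · exact inferInstanceAs (Module.Finite R PUnit)
  · exact inferInstanceAs (Module.Projective R PUnit)
  · simp
  · have : Subsingleton (ModuleCat.of R PUnit) := inferInstanceAs (Subsingleton PUnit)
    ext x
    rw [Subsingleton.elim x 0]; simp

/-- A matrix with vanishing self-extensions presents a τ-rigid module. -/
theorem isTauRigidCat_cok {R : Type} [Ring R] {ι κ : Type} [Fintype ι] [Fintype κ] {e f : R}
    (he : e * e = e) (hf : f * f = f) {F : Matrix ι κ R} (hF : IsC f e F) (hE : EVan e f F F) :
    IsTauRigidCat R (ModuleCat.of R (Cok e F)) := by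
  classical
  have hE' : ∀ _ : κ, e * e = e := fun _ => he
  have hf' : ∀ _ : ι, f * f = f := fun _ => hf
  let rows : ι → rowMod (fun _ : κ => e) := fun i => ⟨F i, fun k => hF.2 i k⟩
  have hrow : ∀ i, f • rows i = rows i := fun i => by
    ext k; exact hF.1 i k
  refine ⟨Cok.finite he F, ModuleCat.of R (rowMod fun _ : ι => f),
    ModuleCat.of R (rowMod fun _ : κ => e), rowLift _ rows, Cok.mk e F, rowMod_finite hf',
    rowMod_projective hf', rowMod_finite hE', rowMod_projective hE', Cok.mk_surjective e F, ?_,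
    fun h => ?_⟩
  · ext v
    constructor
    · rintro ⟨y, rfl⟩
      refine Cok.mk_eq_zero.2 ⟨y.1, ?_⟩
      rw [rowLift_apply, Matrix.vecMul_eq_sum, AddSubmonoidClass.coe_finsetSum]
      rfl
    · intro hv
      obtain ⟨y, hy⟩ := Cok.mk_eq_zero.1 (LinearMap.mem_ker.1 hv)
      refine ⟨⟨fun i => y i * f, fun i => by simp [mul_assoc, hf]⟩, ?_⟩
      refine Subtype.ext ?_
      rw [rowLift_apply, hy, Matrix.vecMul_eq_sum, AddSubmonoidClass.coe_finsetSum]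
      refine Finset.sum_congr rfl fun i _ => ?_
      change ((y i * f) • rows i).1 = _
      rw [mul_smul, hrow]; rfl
  · have hx : ∀ i : ι, ∃ x : rowMod (fun _ : κ => e), f • x = x ∧
        Cok.mk e F x = h (rowGen hf' i) := fun i => by
      obtain ⟨x, hx⟩ := Cok.mk_surjective e F (h (rowGen hf' i))
      refine ⟨f • x, by rw [← mul_smul, hf], ?_⟩
      have h1 := smul_rowGen hf' i
      rw [map_smul, hx, ← map_smul, h1]
    choose x hx1 hx2 using hx
    let X : Matrix ι κ R := fun i => (x i).1
    obtain ⟨Z, Y, hZ, hY, hX⟩ := hE X ⟨fun i k => congrFun (congrArg Subtype.val (hx1 i)) k,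
      fun i k => (x i).2 k⟩
    refine ⟨Cok.mk e F ∘ₗ rowMul Z hZ.2, rowMod_hom_ext hf' fun i => ?_⟩
    rw [← hx2]
    change _ = Cok.mk e F (rowMul Z hZ.2 (rowLift _ rows (rowGen hf' i)))
    rw [rowLift_gen, hrow, ← sub_eq_zero, ← map_sub]
    refine Cok.mk_eq_zero.2 ⟨Y i, ?_⟩
    change X i - F i ᵥ* Z = Y i ᵥ* F
    rw [sub_eq_iff_eq_add, add_comm]
    exact congrFun hX i

theorem EVan.fromBlocks {R : Type} [Ring R] {e f : R} {ι κ ι' κ' b a b' a' : Type} [Fintype κ]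
    [Fintype κ'] [Fintype b] [Fintype b'] {F : Matrix ι κ R} {F' : Matrix ι' κ' R}
    {G : Matrix b a R} {G' : Matrix b' a' R} (h1 : EVan e f F G) (h2 : EVan e f F G')
    (h3 : EVan e f F' G) (h4 : EVan e f F' G') :
    EVan e f (fromBlocks F 0 0 F') (fromBlocks G 0 0 G') := by
  intro X hX
  obtain ⟨Z1, Y1, a1, b1, c1⟩ := h1 X.toBlocks₁₁ (hX.submatrix Sum.inl Sum.inl)
  obtain ⟨Z2, Y2, a2, b2, c2⟩ := h2 X.toBlocks₁₂ (hX.submatrix Sum.inl Sum.inr)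
  obtain ⟨Z3, Y3, a3, b3, c3⟩ := h3 X.toBlocks₂₁ (hX.submatrix Sum.inr Sum.inl)
  obtain ⟨Z4, Y4, a4, b4, c4⟩ := h4 X.toBlocks₂₂ (hX.submatrix Sum.inr Sum.inr)
  refine ⟨Matrix.fromBlocks Z1 Z2 Z3 Z4, Matrix.fromBlocks Y1 Y2 Y3 Y4, ⟨?_, ?_⟩, ⟨?_, ?_⟩, ?_⟩
  · rintro (i | i) (j | j) <;> simp [a1.1, a2.1, a3.1, a4.1]
  · rintro (i | i) (j | j) <;> simp [a1.2, a2.2, a3.2, a4.2]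
  · rintro (i | i) (j | j) <;> simp [b1.1, b2.1, b3.1, b4.1]
  · rintro (i | i) (j | j) <;> simp [b1.2, b2.2, b3.2, b4.2]
  · rw [fromBlocks_multiply, fromBlocks_multiply, fromBlocks_add]
    simp only [Matrix.zero_mul, Matrix.mul_zero, add_zero, zero_add, ← c1, ← c2, ← c3, ← c4]
    exact (fromBlocks_toBlocks X).symm

/-- A basic module which is a sum of copies of the pairwise nonisomorphic modules `Q s`, each
occurring, is the product of the `Q s`. -/
theorem IsBasicModuleCat.equiv_pi {R : Type} [Ring R] {M : ModuleCat.{0} R} [IsNoetherian R M]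
    [IsArtinian R M] (hM : IsBasicModuleCat R M) {κ S : Type} [Finite κ] {Q : S → Type}
    [∀ s, AddCommGroup (Q s)] [∀ s, Module R (Q s)] (hQ : ∀ s, IsIndecModule R (Q s))
    (hne : ∀ s t, Nonempty (Q s ≃ₗ[R] Q t) → s = t) (q : κ → S) (hq : Function.Surjective q)
    (ψ : M ≃ₗ[R] ∀ k, Q (q k)) : Nonempty (M ≃ₗ[R] ∀ s, Q s) := by
  classical
  obtain ⟨n, N, hN, hi, hd⟩ := hM
  obtain ⟨φ⟩ := IsInternal.nonempty_equiv hN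
  have hg : ∀ j, ∃ k, Nonempty (N j ≃ₗ[R] Q (q k)) := fun j =>
    (hi j).exists_equiv_of_summand (fun k => hQ (q k))
      (ψ.toLinearMap ∘ₗ φ.symm.toLinearMap ∘ₗ LinearMap.single R (fun i => N i) j)
      (LinearMap.proj j ∘ₗ φ.toLinearMap ∘ₗ ψ.symm.toLinearMap) (by ext x; simp)
  choose g hg using hg
  have hinj : Function.Injective fun j => q (g j) := fun j j' hj => by
    by_contra hjj
    obtain ⟨a⟩ := hg j
    obtain ⟨b⟩ := hg j'
    have hj : q (g j) = q (g j') := hj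
    rw [← hj] at b
    exact (hd j j' hjj).false (a.trans b.symm)
  have hsurj : Function.Surjective fun j => q (g j) := fun s => by
    obtain ⟨k, rfl⟩ := hq s
    let a := ψ.symm.toLinearMap ∘ₗ LinearMap.single R (fun k => Q (q k)) k
    have ha : Function.Injective a := ψ.symm.injective.comp (Pi.single_injective (M := fun k => Q (q k)) k)
    have := isNoetherian_of_injective a ha
    have := isArtinian_of_injective a ha
    obtain ⟨j, ⟨b⟩⟩ := (hQ (q k)).exists_equiv_of_summand hi (φ.toLinearMap ∘ₗ a)
      (LinearMap.proj k ∘ₗ ψ.toLinearMap ∘ₗ φ.symm.toLinearMap) (by ext x; simp [a])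
    obtain ⟨b'⟩ := hg j
    exact ⟨j, (hne _ _ ⟨b.trans b'⟩).symm⟩
  let σ := Equiv.ofBijective _ ⟨hinj, hsurj⟩
  exact ⟨(φ.trans (LinearEquiv.piCongrRight fun j => (hg j).some)).trans
    (LinearEquiv.piCongrLeft R Q σ)⟩

section Gen

variable {R : Type} [Ring R]

/-- `X` is generated by `e X`. -/
def Gen (e : R) (X : Type) [AddCommGroup X] [Module R X] : Prop :=
  Submodule.span R (Set.range fun x : X => e • x) = ⊤

theorem Gen.of_inFac {e : R} {X Y : Type} [AddCommGroup X] [Module R X] [AddCommGroup Y]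
    [Module R Y] (h : InFac R X Y) (hY : Gen e Y) : Gen e X := by
  obtain ⟨k, f, hf⟩ := h
  rw [Gen, eq_top_iff]
  intro x _
  obtain ⟨y, rfl⟩ := hf x
  have h1 : ∀ (i : Fin k) (z : Y), f (Pi.single i z) ∈
      Submodule.span R (Set.range fun x : X => e • x) := fun i z => by
    have hz : z ∈ Submodule.span R (Set.range fun x : Y => e • x) := by rw [hY]; trivial
    refine Submodule.span_induction
      (p := fun z _ => f (Pi.single i z) ∈ Submodule.span R (Set.range fun x : X => e • x))
      ?_ ?_ ?_ ?_ hz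
    · rintro _ ⟨x, rfl⟩
      refine Submodule.subset_span ⟨f (Pi.single i x), ?_⟩
      change e • f (Pi.single i x) = f (Pi.single i (e • x))
      rw [← map_smul, Pi.single_smul]
    · simp
    · intro x y _ _ hx hy
      rw [Pi.single_add, map_add]; exact add_mem hx hy
    · intro a x _ hx
      rw [Pi.single_smul, map_smul]; exact Submodule.smul_mem _ _ hx
  rw [← Finset.univ_sum_single y, map_sum]
  exact Submodule.sum_mem _ fun i _ => h1 i _

theorem gen_cok {ι κ : Type} [Fintype κ] {e : R} (he : e * e = e)
    (F : Matrix ι κ R) : Gen e (Cok e F) := by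
  classical
  rw [Gen, eq_top_iff]
  intro x _
  induction x using Cok.induction with | h v => ?_
  have hE : ∀ _ : κ, e * e = e := fun _ => he
  rw [row_eq_sum hE v, map_sum]
  refine Submodule.sum_mem _ fun k _ => ?_
  rw [map_smul]
  refine Submodule.smul_mem _ _ (Submodule.subset_span ⟨Cok.mk e F (rowGen hE k), ?_⟩)
  have h1 := smul_rowGen hE k
  change e • Cok.mk e F (rowGen hE k) = _
  rw [← map_smul, h1]

end Gen

namespace TwoVertex

variable {K R : Type} [Field K] [Ring R] [Algebra K R] (D : TwoVertex K R)

theorem mem_J_of_corner {c d : Fin 2} (h : c ≠ d) {r : R} (hr : D.e d * r = r)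
    (hr' : r * D.e c = r) : r ∈ D.J := by
  rw [mem_J]
  intro i
  by_cases hi : i = c
  · have := congrArg (D.χ i) hr
    rw [map_mul, D.χe, if_neg (by rintro rfl; exact h hi.symm), zero_mul] at this
    exact this.symm
  · have := congrArg (D.χ i) hr'
    rw [map_mul, D.χe, if_neg hi, mul_zero] at this
    exact this.symm

theorem subsingleton_of_gen {c d : Fin 2} (h : c ≠ d) {X : Type} [AddCommGroup X] [Module R X]
    [Module.Finite R X] (h1 : Gen (D.e c) X) (h2 : Gen (D.e d) X) : Subsingleton X := by
  rw [← Submodule.subsingleton_iff R, ← subsingleton_iff_bot_eq_top]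
  refine D.eq_top_of_sup ?_
  rw [bot_sup_eq]
  refine top_le_iff.1 (h1.symm.le.trans (Submodule.span_le.2 ?_))
  rintro _ ⟨x, rfl⟩
  have hx : x ∈ Submodule.span R (Set.range fun x : X => D.e d • x) := by rw [h2]; trivial
  refine Submodule.span_induction (p := fun z _ => D.e c • z ∈ D.J • (⊤ : Submodule R X))
    ?_ ?_ ?_ ?_ hx
  · rintro _ ⟨y, rfl⟩
    change D.e c • D.e d • y ∈ _
    rw [← mul_smul, D.orth _ _ h, zero_smul]; exact zero_mem _
  · rw [smul_zero]; exact zero_mem _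
  · intro x y _ _ hx hy
    rw [smul_add]; exact add_mem hx hy
  · intro a x _ hx
    have : D.e c • a • x = (D.e c * a - D.χ c a • D.e c) • x +
        algebraMap K R (D.χ c a) • D.e c • x := by
      rw [sub_smul, mul_smul, Algebra.smul_def, mul_smul, sub_add_cancel]
    rw [this]
    exact add_mem (Submodule.smul_mem_smul (D.e_mul_sub_mem c a) Submodule.mem_top)
      (Submodule.smul_mem _ _ hx)

/-- τ-rigid modules are projective with full support on top, or presented by a matrix over a
corner. -/
theorem rigid_cases [Module.Finite K R] {M : ModuleCat.{0} R} (hM : IsTauRigidCat R M) :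
    (∃ (κ : Type) (_ : Fintype κ) (col : κ → Fin 2), Function.Surjective col ∧
      Nonempty (M ≃ₗ[R] rowMod fun k => D.e (col k))) ∨
    ∃ c d : Fin 2, c ≠ d ∧ ∃ (κ ι : Type) (_ : Fintype κ) (_ : Fintype ι) (_ : DecidableEq κ)
      (_ : DecidableEq ι) (F : Matrix ι κ R), IsC (D.e d) (D.e c) F ∧
      EVan (D.e c) (D.e d) F F ∧ Nonempty (M ≃ₗ[R] Cok (D.e c) F) := by
  obtain ⟨κ, ι, iκ, iι, dκ, dι, col, col', F, hF, hJ, ⟨φ⟩, hE⟩ := D.exists_rigid_presentation hM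
  have key : ∀ i k, col' i ≠ col k := fun i k hik => by
    obtain ⟨Z, Y, -, -, hX⟩ := hE (Matrix.of fun i' k' => if i' = i ∧ k' = k then D.e (col k) else 0)
      (fun i' k' => by
        by_cases h : i' = i ∧ k' = k
        · obtain ⟨rfl, rfl⟩ := h
          simp [hik, D.idem]
        · simp [h])
    have h1 := congrFun (congrFun hX i) k
    simp only [of_apply, and_self, if_true, Matrix.add_apply, Matrix.mul_apply] at h1
    refine D.e_notMem_J (col k) (h1 ▸ add_mem (sum_mem fun j _ => D.J_mul_right (hJ _ _) _)
      (sum_mem fun j _ => D.J_mul_left _ (hJ _ _)))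
  by_cases hs : Function.Surjective col
  · left
    have : IsEmpty ι := ⟨fun i => by
      obtain ⟨k, hk⟩ := hs (col' i)
      exact key i k hk.symm⟩
    have hbot : (Submodule.span R (Set.range fun i k => F i k)).comap
        (rowMod fun k => D.e (col k)).subtype = ⊥ := by
      rw [Set.range_eq_empty, Submodule.span_empty, Submodule.comap_bot, Submodule.ker_subtype]
    have ψ := Submodule.quotEquivOfEqBot _ hbot
    exact ⟨κ, iκ, col, hs, ⟨φ.trans ψ⟩⟩
  · right
    have hcd : ∃ c d : Fin 2, c ≠ d ∧ ∀ k, col k = c := by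
      simp only [Function.Surjective, not_forall, not_exists] at hs
      obtain ⟨d, hd⟩ := hs
      exact ⟨1 - d, d, (by decide : ∀ d : Fin 2, 1 - d ≠ d) d, fun k =>
        (by decide : ∀ a d : Fin 2, a ≠ d → a = 1 - d) _ _ (hd k)⟩
    obtain ⟨c, d, hcd, hc⟩ := hcd
    obtain rfl : col = fun _ => c := funext hc
    refine ⟨c, d, hcd, κ, ?_⟩
    rcases isEmpty_or_nonempty κ with hκ | ⟨⟨k₀⟩⟩
    · refine ⟨Empty, inferInstance, inferInstance, inferInstance, inferInstance, 0, IsC.zero,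
        fun X _ => ⟨0, 0, IsC.zero, IsC.zero, by ext i; exact i.elim⟩, ⟨?_⟩⟩
      have : Subsingleton M := φ.toEquiv.subsingleton
      have : Subsingleton (Cok (D.e c) (0 : Matrix Empty κ R)) :=
        ⟨fun x y => by
          induction x using Cok.induction with | h v => ?_
          induction y using Cok.induction with | h w => ?_
          congr 1
          ext k; exact hκ.elim k⟩
      exact 0
    · have hd : ∀ i, col' i = d := fun i =>
        (by decide : ∀ a c d : Fin 2, c ≠ d → a ≠ c → a = d) _ _ _ hcd (key i k₀)
      obtain rfl : col' = fun _ => d := funext hd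
      have conv : ∀ {m n : Type} {a b : Fin 2} {X : Matrix m n R},
          IsC (D.e a) (D.e b) X ↔ ∀ i j, D.e a * X i j * D.e b = X i j := by
        intro m n a b X
        refine ⟨fun h i j => by rw [h.1, h.2], fun h => ⟨fun i j => ?_, fun i j => ?_⟩⟩
        · rw [← h i j, ← mul_assoc, ← mul_assoc, D.idem]
        · rw [← h i j, mul_assoc, D.idem]
      refine ⟨ι, iκ, iι, dκ, dι, F, conv.2 hF, fun X hX => ?_, ⟨φ⟩⟩
      obtain ⟨Z, Y, hZ, hY, h⟩ := hE X (conv.1 hX)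
      exact ⟨Z, Y, conv.2 hZ, conv.2 hY, h⟩

/-- The indecomposable projective module at a vertex. -/
abbrev pmod (c : Fin 2) : Type := Cok (D.e c) (0 : Matrix (Fin 0) (Fin 1) R)

theorem rowMod_equiv_pi {κ : Type} [Finite κ] (col : κ → Fin 2) :
    Nonempty ((rowMod fun k => D.e (col k)) ≃ₗ[R] ∀ k, D.pmod (col k)) := by
  let ent : ∀ k, (rowMod fun k => D.e (col k)) →ₗ[R] rowMod (fun _ : Fin 1 => D.e (col k)) :=
    fun k => 
      { toFun := fun v => ⟨fun _ => v.1 k, fun _ => v.2 k⟩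
        map_add' := fun v w => rfl
        map_smul' := fun r v => rfl }
  refine ⟨LinearEquiv.ofBijective (LinearMap.pi fun k => Cok.mk _ _ ∘ₗ ent k) ⟨?_, fun y => ?_⟩⟩
  · refine (injective_iff_map_eq_zero _).2 fun v hv => ?_
    ext k
    obtain ⟨y, hy⟩ := Cok.mk_eq_zero.1 (congrFun hv k)
    have h0 : v.1 k = (y ᵥ* (0 : Matrix (Fin 0) (Fin 1) R)) 0 := congrFun hy 0
    rw [h0]; simp
  · choose v hv using fun k => Cok.mk_surjective _ _ (y k)
    refine ⟨⟨fun k => (v k).1 0, fun k => (v k).2 0⟩, funext fun k => ?_⟩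
    rw [← hv]
    refine congrArg (Cok.mk (D.e (col k)) (0 : Matrix (Fin 0) (Fin 1) R))
      (Subtype.ext (funext fun j => ?_))
    rw [Subsingleton.elim j 0]; rfl

theorem self_equiv : Nonempty (R ≃ₗ[R] ∀ c, D.pmod c) := by
  obtain ⟨φ⟩ := D.rowMod_equiv_pi (fun c : Fin 2 => c)
  let g : R →ₗ[R] rowMod (fun c : Fin 2 => D.e c) :=
    { toFun := fun r => ⟨fun c => r * D.e c, fun c => by rw [mul_assoc, D.idem]⟩
      map_add' := fun a b => by ext c; simp [add_mul]
      map_smul' := fun a b => by ext c; simp [mul_assoc] }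
  refine ⟨(LinearEquiv.ofBijective g ⟨?_, fun v => ⟨v.1 0 + v.1 1, ?_⟩⟩).trans φ⟩
  · refine (injective_iff_map_eq_zero _).2 fun r hr => ?_
    have h := fun c => congrFun (congrArg Subtype.val hr) c
    have h0 : r * D.e 0 = 0 := h 0
    have h1 : r * D.e 1 = 0 := h 1
    rw [← mul_one r, ← D.sum, mul_add, h0, h1, add_zero]
  · ext c
    have h0 := v.2 0
    have h1 := v.2 1
    change (v.1 0 + v.1 1) * D.e c = v.1 c
    fin_cases c
    · change (v.1 0 + v.1 1) * D.e 0 = v.1 0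
      rw [add_mul, h0, ← h1, mul_assoc, D.orth 1 0 (by decide), mul_zero, add_zero]
    · change (v.1 0 + v.1 1) * D.e 1 = v.1 1
      rw [add_mul, h1, ← h0, mul_assoc, D.orth 0 1 (by decide), mul_zero, zero_add]

section Criteria

variable {c d : Fin 2} (hcd : c ≠ d) {ι κ ι' κ' : Type} [Fintype κ] [Fintype ι] [Fintype κ']
  [Fintype ι'] [DecidableEq κ]

include hcd

omit [Fintype κ] [DecidableEq κ] in
theorem map_eq_zero_entries {F : Matrix ι κ R} (hF : IsC (D.e d) (D.e c) F)
    {v : rowMod (fun _ : κ => D.e c)} (h : Cok.mk _ F v = 0) (k : κ) : v.1 k ∈ D.J := by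
  obtain ⟨y, hy⟩ := Cok.mk_eq_zero.1 h
  rw [hy]
  exact sum_mem fun i _ => D.J_mul_left _ (D.mem_J_of_corner hcd (hF.1 i k) (hF.2 i k))

theorem nontrivial_cok [Nonempty κ] {F : Matrix ι κ R} (hF : IsC (D.e d) (D.e c) F) :
    Nontrivial (Cok (D.e c) F) := by
  obtain ⟨k⟩ := ‹Nonempty κ›
  by_contra hn
  rw [not_nontrivial_iff_subsingleton] at hn
  have hE : ∀ _ : κ, D.e c * D.e c = D.e c := fun _ => D.idem c
  refine D.e_notMem_J c ?_
  have := D.map_eq_zero_entries hcd hF (v := rowGen hE k) (Subsingleton.elim _ _) k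
  simpa [rowGen] using this

omit hcd [DecidableEq κ] [Fintype ι] in
theorem mk_mem_smul {F : Matrix ι κ R} {v : rowMod (fun _ : κ => D.e c)}
    (hv : ∀ k, v.1 k ∈ D.J) :
    Cok.mk _ F v ∈ D.J • (⊤ : Submodule R (Cok (D.e c) F)) := by
  classical
  have h1 := Submodule.mem_map_of_mem (f := Cok.mk (D.e c) F)
    (D.row_mem_J (fun _ => D.idem c) hv)
  rw [Submodule.map_smul''] at h1
  exact Submodule.smul_mono le_rfl le_top h1

/-- Indecomposability of a presented module from the top of its endomorphism ring. -/
theorem isIndecModule_cok [Nonempty κ] {F : Matrix ι κ R}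
    (hF : IsC (D.e d) (D.e c) F)
    (h : ∀ (Z : Matrix κ κ R) (Y : Matrix ι ι R), IsC (D.e c) (D.e c) Z → IsC (D.e d) (D.e d) Y →
      F * Z = Y * F → ∃ (t : K) (n : ℕ), (Z.map (D.χ c) - Matrix.scalar κ t) ^ n = 0) :
    IsIndecModule R (Cok (D.e c) F) := by
  have := D.nontrivial_cok hcd hF
  have hfin := Cok.finite (D.idem c) F
  have hE : ∀ _ : κ, D.e c * D.e c = D.e c := fun _ => D.idem c
  refine isIndecModule_of_idem fun p hp => ?_
  obtain ⟨Z, Y, hZ, hY, hZY, rfl⟩ := Cok.exists_map (D.idem c) (D.idem d) hF hF p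
  obtain ⟨t, n, hn⟩ := h Z Y hZ hY hZY
  set z := Z.map (D.χ c)
  have hzz : z * z = z := by
    ext k k'
    have h1 := LinearMap.congr_fun hp (Cok.mk _ F (rowGen hE k))
    change Cok.mk _ F (rowMul Z hZ.2 (rowMul Z hZ.2 (rowGen hE k))) =
      Cok.mk _ F (rowMul Z hZ.2 (rowGen hE k)) at h1
    rw [← sub_eq_zero, ← map_sub] at h1
    have h2 := D.map_eq_zero_entries hcd hF h1 k'
    change (Pi.single k (D.e c) ᵥ* Z ᵥ* Z) k' - (Pi.single k (D.e c) ᵥ* Z) k' ∈ _ at h2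
    rw [Matrix.vecMul_vecMul, Matrix.single_vecMul, Matrix.single_vecMul] at h2
    have h3 := D.mem_J.1 h2 c
    simp only [Pi.smul_apply, smul_eq_mul, map_sub, map_mul, D.χe, if_true, one_mul] at h3
    rw [sub_eq_zero] at h3
    have h4 : (z * z) = (Z * Z).map (D.χ c) :=
      (Matrix.map_mul (f := (D.χ c : R →+* K)) (L := Z) (M := Z)).symm
    rw [h4]
    exact h3
  have hz : z = 0 ∨ z = 1 := by
    have hnil : IsNilpotent (z - Matrix.scalar κ t) := ⟨n, hn⟩
    by_cases ht : t = 0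
    · left
      subst ht
      rw [map_zero, sub_zero] at hnil
      obtain ⟨m, hm⟩ := hnil
      have : ∀ m, z ^ (m + 1) = z := fun m => by
        induction m with
        | zero => simp
        | succ m ih => rw [pow_succ, ih, hzz]
      rw [← this m, pow_succ, hm, zero_mul]
    · right
      have hu : IsUnit z := by
        have h1 : IsUnit (Matrix.scalar κ t) := (IsUnit.mk0 t ht).map (Matrix.scalar κ)
        have h2 := (Matrix.scalar_commute t (fun r => mul_comm _ _) (z - Matrix.scalar κ t)).symm
        have := hnil.isUnit_add_right_of_commute h1 h2
        rwa [sub_add_cancel] at this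
      exact hu.mul_left_cancel (by rw [hzz, mul_one])
  set p := Cok.map (F := F) (F' := F) Z hZ.2 ⟨Y, hZY⟩
  have hpp : ∀ x, p (p x) = p x := LinearMap.congr_fun hp
  have hentry : ∀ (v : rowMod (fun _ : κ => D.e c)) (s : K), z = Matrix.scalar κ s → ∀ k,
      (v.1 ᵥ* Z) k - s • v.1 k ∈ D.J := fun v s hs k => by
    have h1 : ∀ i, v.1 i * Z i k - (if i = k then s • v.1 i else 0) ∈ D.J := fun i => by
      have h2 : D.χ c (Z i k) = if i = k then s else 0 := by
        have := congrFun (congrFun hs i) k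
        simpa [z, Matrix.scalar_apply, Matrix.diagonal_apply] using this
      have h3 := D.J_mul_left (v.1 i) (D.mul_e_sub_mem c (Z i k))
      rw [hZ.2, h2, mul_sub, mul_smul_comm, v.2 i] at h3
      split_ifs at h3 ⊢ <;> simpa using h3
    have : ∑ i, (v.1 i * Z i k - (if i = k then s • v.1 i else 0)) ∈ D.J :=
      sum_mem fun i _ => h1 i
    rw [Finset.sum_sub_distrib, Finset.sum_ite_eq' Finset.univ k] at this
    simpa [Matrix.vecMul, dotProduct] using this
  rcases hz with hz | hz
  · left
    have hs : Function.Surjective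
        ⇑(LinearMap.id - p : Cok (D.e c) F →ₗ[R] Cok (D.e c) F) := by
      refine D.surjective_of_congr _ fun (y : Cok (D.e c) F) => ⟨y, ?_⟩
      induction y using Cok.induction with | h v => ?_
      change Cok.mk _ F v - (Cok.mk _ F v - Cok.mk _ F (rowMul Z hZ.2 v)) ∈ _
      rw [sub_sub_cancel]
      refine D.mk_mem_smul fun k => ?_
      have := hentry v 0 (by rw [hz, map_zero]) k
      rw [zero_smul, sub_zero] at this
      exact this
    refine LinearMap.ext fun x => ?_
    obtain ⟨y, rfl⟩ := hs x
    change p (y - p y) = 0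
    rw [map_sub, hpp, sub_self]
  · right
    have hs : Function.Surjective ⇑p := by
      refine D.surjective_of_congr _ fun (y : Cok (D.e c) F) => ⟨y, ?_⟩
      induction y using Cok.induction with | h v => ?_
      rw [Cok.map_mk, ← map_sub]
      refine D.mk_mem_smul fun k => ?_
      have := hentry v 1 (by rw [hz, map_one]) k
      rw [one_smul, ← neg_mem_iff, neg_sub] at this
      exact this
    refine LinearMap.ext fun x => ?_
    obtain ⟨y, rfl⟩ := hs x
    exact hpp y

end Criteria

end TwoVertex
end TwoPoint

namespace TwoPoint

open Matrix

section CornerCriteria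

variable {R : Type} [Ring R] {ι κ ι' κ' : Type} [Fintype κ] [Fintype ι] [Fintype κ']
  [Fintype ι'] {e f : R} {F : Matrix ι κ R} {F' : Matrix ι' κ' R}

theorem Cok.inFac [DecidableEq κ'] (he : e * e = e) {τ : Type} [Fintype τ] (Z : τ → Matrix κ κ' R)
    (hZ : ∀ l, IsC e e (Z l)) (hY : ∀ l, ∃ Y : Matrix ι ι' R, F * Z l = Y * F')
    (hs : ∀ k', ∃ l k, ∀ j, Z l k j = if j = k' then e else 0) :
    InFac R (Cok e F') (Cok e F) := by
  classical
  have hE : ∀ _ : κ, e * e = e := fun _ => he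
  have hE' : ∀ _ : κ', e * e = e := fun _ => he
  let φ : (τ → Cok e F) →ₗ[R] Cok e F' := ∑ l, Cok.map (Z l) (hZ l).2 (hY l) ∘ₗ LinearMap.proj l
  refine InFac.of_surj φ fun x => ?_
  rw [← LinearMap.mem_range]
  induction x using Cok.induction with | h v => ?_
  rw [row_eq_sum hE' v, map_sum]
  refine Submodule.sum_mem _ fun k' _ => ?_
  rw [map_smul]
  refine Submodule.smul_mem _ _ ?_
  obtain ⟨l, k, hk⟩ := hs k'
  refine ⟨Pi.single l (Cok.mk e F (rowGen hE k)), ?_⟩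
  simp only [φ, LinearMap.sum_apply, LinearMap.comp_apply, LinearMap.proj_apply]
  rw [Finset.sum_eq_single l (fun l' _ h => by rw [Pi.single_eq_of_ne h, map_zero]) (by simp),
    Pi.single_eq_same, Cok.map_mk]
  refine congrArg (Cok.mk e F') (Subtype.ext (funext fun j => ?_))
  change (Pi.single k e ᵥ* Z l) j = (Pi.single k' e : κ' → R) j
  rw [Matrix.single_vecMul]
  change e * Z l k j = _
  rw [hk, Pi.single_apply]
  split_ifs <;> simp [he]

theorem smul_cok_eq_zero (he : e * e = e) (hf : f * f = f) {ι₀ κ₀ : Type} [Fintype ι₀]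
    [Fintype κ₀] [IsEmpty κ₀] [Nonempty ι₀] {F₀ : Matrix ι₀ κ₀ R}
    (h : EVan e f F₀ F) (x : Cok e F) : f • x = 0 := by
  obtain ⟨i₀⟩ := ‹Nonempty ι₀›
  induction x using Cok.induction with | h v => ?_
  obtain ⟨Z, Y, -, -, hX⟩ := h (fun _ k => f * v.1 k) ⟨fun i k => by rw [← mul_assoc, hf],
    fun i k => by rw [mul_assoc, v.2 k]⟩
  rw [← map_smul]
  refine Cok.mk_eq_zero.2 ⟨Y i₀, ?_⟩
  rw [show F₀ * Z = 0 from Matrix.ext fun i j => by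
    rw [Matrix.mul_apply, Fintype.sum_empty]; rfl, zero_add] at hX
  exact congrFun hX i₀

theorem Cok.inFac_of_smul_eq_zero (he : e * e = e) [Nonempty κ] (hF : IsC f e F)
    (h : ∀ x : Cok e F', f • x = 0) : InFac R (Cok e F') (Cok e F) := by
  classical
  obtain ⟨k₀⟩ := ‹Nonempty κ›
  refine Cok.inFac he (τ := κ')
    (fun l => Matrix.of fun k j => if k = k₀ ∧ j = l then e else 0)
    (fun l => ⟨fun i j => ?_, fun i j => ?_⟩) (fun l => ?_) (fun k' => ⟨k', k₀, fun j => ?_⟩)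
  · rw [of_apply]; split_ifs <;> simp [he]
  · rw [of_apply]; split_ifs <;> simp [he]
  · have h1 : ∀ i, ∃ y : ι' → R, Pi.single l (F i k₀) = y ᵥ* F' := fun i => by
      let v : rowMod (fun _ : κ' => e) := ⟨Pi.single l (F i k₀), fun j => by
        by_cases hj : j = l
        · subst hj; simp [hF.2]
        · simp [hj]⟩
      have hv : f • v = v := by
        ext j
        change f * (Pi.single l (F i k₀) : κ' → R) j = (Pi.single l (F i k₀) : κ' → R) j
        by_cases hj : j = l
        · subst hj; simp [hF.1]
        · simp [hj]
      have h0 : Cok.mk e F' v = 0 := by rw [← hv, map_smul, h]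
      exact Cok.mk_eq_zero.1 h0
    choose Y hY using h1
    refine ⟨Y, ?_⟩
    ext i j
    have h2 := congrFun (hY i) j
    change _ = (Y i ᵥ* F') j
    rw [← h2, Matrix.mul_apply, Finset.sum_eq_single k₀]
    · by_cases hj : j = l
      · subst hj; simp [hF.2]
      · simp [hj]
    · intro k _ hk; simp [hk]
    · simp
  · simp

end CornerCriteria

namespace TwoVertex

variable {K R : Type} [Field K] [Ring R] [Algebra K R] (D : TwoVertex K R)

section

variable {c d : Fin 2} (hcd : c ≠ d) {ι κ ι' κ' : Type} [Fintype κ] [Fintype ι] [Fintype κ']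
  [Fintype ι'] [DecidableEq κ]

include hcd

theorem cok_comp_eq_one {F : Matrix ι κ R} (hF : IsC (D.e d) (D.e c) F)
    {Z : Matrix κ κ' R} (hZ : IsC (D.e c) (D.e c) Z) {Z' : Matrix κ' κ R}
    (hZ' : IsC (D.e c) (D.e c) Z')
    (h : ∀ v, Cok.mk (D.e c) F (rowMul Z' hZ'.2 (rowMul Z hZ.2 v)) = Cok.mk _ F v) :
    Z.map (D.χ c) * Z'.map (D.χ c) = 1 := by
  have hE : ∀ _ : κ, D.e c * D.e c = D.e c := fun _ => D.idem c
  ext k k'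
  have h1 := h (rowGen hE k)
  rw [← sub_eq_zero, ← map_sub] at h1
  have h2 := D.map_eq_zero_entries hcd hF h1 k'
  change (Pi.single k (D.e c) ᵥ* Z ᵥ* Z') k' - (Pi.single k (D.e c) : κ → R) k' ∈ _ at h2
  rw [Matrix.vecMul_vecMul, Matrix.single_vecMul] at h2
  have h3 := D.mem_J.1 h2 c
  simp only [Pi.smul_apply, smul_eq_mul, map_sub, map_mul, D.χe, if_true, one_mul] at h3
  rw [sub_eq_zero] at h3
  have h4 : Z.map (D.χ c) * Z'.map (D.χ c) = ((Z * Z').map (D.χ c) : Matrix κ κ K) :=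
    (Matrix.map_mul (f := (D.χ c : R →+* K)) (L := Z) (M := Z')).symm
  rw [h4, Matrix.map_apply]
  refine Eq.trans h3 ?_
  rw [Pi.single_apply, Matrix.one_apply]
  by_cases hk : k = k'
  · simp [hk, D.χe]
  · simp [hk, Ne.symm hk]

theorem matrices_of_equiv [DecidableEq κ'] {F : Matrix ι κ R} {F' : Matrix ι' κ' R}
    (hF : IsC (D.e d) (D.e c) F) (hF' : IsC (D.e d) (D.e c) F')
    (φ : Cok (D.e c) F ≃ₗ[R] Cok (D.e c) F') :
    ∃ (Z : Matrix κ κ' R) (Y : Matrix ι ι' R) (Z' : Matrix κ' κ R), IsC (D.e c) (D.e c) Z ∧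
      IsC (D.e d) (D.e d) Y ∧ F * Z = Y * F' ∧ Z.map (D.χ c) * Z'.map (D.χ c) = 1 ∧
      Z'.map (D.χ c) * Z.map (D.χ c) = 1 := by
  obtain ⟨Z, Y, hZ, hY, h, hφ⟩ := Cok.exists_map (D.idem c) (D.idem d) hF hF' φ.toLinearMap
  obtain ⟨Z', Y', hZ', hY', h', hφ'⟩ :=
    Cok.exists_map (D.idem c) (D.idem d) hF' hF φ.symm.toLinearMap
  refine ⟨Z, Y, Z', hZ, hY, h, D.cok_comp_eq_one hcd hF hZ hZ' fun v => ?_,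
    D.cok_comp_eq_one hcd hF' hZ' hZ fun v => ?_⟩
  · rw [← Cok.map_mk Z' hZ'.2 ⟨Y', h'⟩, ← Cok.map_mk Z hZ.2 ⟨Y, h⟩, ← hφ', ← hφ]
    simp
  · rw [← Cok.map_mk Z hZ.2 ⟨Y, h⟩, ← Cok.map_mk Z' hZ'.2 ⟨Y', h'⟩, ← hφ', ← hφ]
    simp

theorem isEmpty_equiv_of_card [DecidableEq κ'] {F : Matrix ι κ R} {F' : Matrix ι' κ' R}
    (hF : IsC (D.e d) (D.e c) F) (hF' : IsC (D.e d) (D.e c) F')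
    (h : Fintype.card κ ≠ Fintype.card κ') : IsEmpty (Cok (D.e c) F ≃ₗ[R] Cok (D.e c) F') :=
  ⟨fun φ => by
    obtain ⟨Z, Y, Z', -, -, -, h1, h2⟩ := D.matrices_of_equiv hcd hF hF' φ
    exact h (Matrix.square_of_invertible _ _ h1 h2)⟩

theorem isEmpty_equiv_of_map_eq_zero [Nonempty κ] [DecidableEq κ'] {F : Matrix ι κ R}
    {F' : Matrix ι' κ' R} (hF : IsC (D.e d) (D.e c) F) (hF' : IsC (D.e d) (D.e c) F')
    (h : ∀ (Z : Matrix κ κ' R) (Y : Matrix ι ι' R), IsC (D.e c) (D.e c) Z →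
      IsC (D.e d) (D.e d) Y → F * Z = Y * F' → Z.map (D.χ c) = 0) :
    IsEmpty (Cok (D.e c) F ≃ₗ[R] Cok (D.e c) F') :=
  ⟨fun φ => by
    obtain ⟨Z, Y, Z', hZ, hY, hZY, h1, -⟩ := D.matrices_of_equiv hcd hF hF' φ
    rw [h Z Y hZ hY hZY, Matrix.zero_mul] at h1
    exact zero_ne_one h1⟩

omit [DecidableEq κ] [Fintype κ] in
theorem isIndecModule_cok_one {F : Matrix ι (Fin 1) R} (hF : IsC (D.e d) (D.e c) F) :
    IsIndecModule R (Cok (D.e c) F) :=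
  D.isIndecModule_cok hcd hF fun Z _ _ _ _ => ⟨D.χ c (Z 0 0), 1, by
    ext i j
    simp [Subsingleton.elim i 0, Subsingleton.elim j 0]⟩

end

theorem pmod_indec (c : Fin 2) : IsIndecModule R (D.pmod c) :=
  D.isIndecModule_cok_one (d := 1 - c) ((by decide : ∀ c : Fin 2, c ≠ 1 - c) c) IsC.zero

theorem gen_pmod (c : Fin 2) : Gen (D.e c) (D.pmod c) := gen_cok (D.idem c) _

theorem eq_of_gen {c d : Fin 2} {X : Type} [AddCommGroup X] [Module R X]
    [Module.Finite R X] [Nontrivial X] (h1 : Gen (D.e c) X) (h2 : Gen (D.e d) X) : c = d := by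
  by_contra h
  have := D.subsingleton_of_gen h h1 h2
  exact false_of_nontrivial_of_subsingleton X

theorem eq_of_pmod_equiv {c d : Fin 2} (φ : D.pmod c ≃ₗ[R] D.pmod d) : c = d := by
  have := (D.pmod_indec c).1
  have := Cok.finite (D.idem c) (0 : Matrix (Fin 0) (Fin 1) R)
  exact D.eq_of_gen (D.gen_pmod c) ((D.gen_pmod d).of_inFac (InFac.of_equiv φ.symm))

theorem exists_smul_eq_zero {P : Type} [AddCommGroup P] [Module R P] [Module.Finite R P]
    [Module.Projective R P] [Nontrivial P] : ∃ d, ∀ (M : Type) [AddCommGroup M] [Module R M],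
      (∀ f : P →ₗ[R] M, f = 0) → ∀ x : M, D.e d • x = 0 := by
  obtain ⟨κ, iκ, dκ, col, u, hu, hs, hk⟩ := D.exists_cover (M := P)
  have hE : ∀ k : κ, D.e (col k) * D.e (col k) = D.e (col k) := fun k => D.idem _
  set g := rowLift (fun k => D.e (col k)) u with hg
  obtain ⟨s, hs'⟩ := Module.projective_lifting_property g LinearMap.id hs
  have hgs : ∀ x, g (s x) = x := LinearMap.congr_fun hs'
  have := rowMod_finite hE
  have hsurj : Function.Surjective s := D.surjective_of_congr s fun v => ⟨g v, by
    refine D.row_mem_J hE (hk _ ?_)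
    rw [map_sub, hgs, sub_self]⟩
  obtain ⟨k₀⟩ : Nonempty κ := by
    by_contra hκ
    rw [not_nonempty_iff] at hκ
    have : Subsingleton P := ⟨fun x y => by
      obtain ⟨v, rfl⟩ := hs x
      obtain ⟨w, rfl⟩ := hs y
      congr 1
      ext k; exact hκ.elim k⟩
    exact false_of_nontrivial_of_subsingleton P
  refine ⟨col k₀, fun M _ _ h x => ?_⟩
  obtain ⟨p, hp⟩ := hsurj (rowGen hE k₀)
  have h1 := LinearMap.congr_fun (h (rowLift (fun k => D.e (col k)) (fun _ => x) ∘ₗ s)) p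
  rw [LinearMap.comp_apply, hp, rowLift_gen] at h1
  exact h1

end TwoVertex
end TwoPoint

namespace TwoPoint

open Matrix

theorem IsC.fromBlocks {R : Type} [Ring R] {a b : R} {ι κ ι' κ' : Type} {F : Matrix ι κ R}
    {F' : Matrix ι' κ' R} (hF : IsC a b F) (hF' : IsC a b F') :
    IsC a b (fromBlocks F 0 0 F') := by
  constructor <;> rintro (i | i) (j | j) <;> simp [hF.1, hF.2, hF'.1, hF'.2]

theorem Cok.subsingleton {R : Type} [Ring R] {ι κ : Type} [IsEmpty κ] (e : R)
    (F : Matrix ι κ R) : Subsingleton (Cok e F) :=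
  have : Subsingleton (rowMod fun _ : κ => e) :=
    ⟨fun _ _ => Subtype.ext (Subsingleton.elim _ _)⟩
  (Cok.mk_surjective e F).subsingleton

/-- A matrix of finite size. -/
structure MatObj (R : Type) where
  b : Type
  a : Type
  [finb : Fintype b]
  [fina : Fintype a]
  [decb : DecidableEq b]
  [deca : DecidableEq a]
  F : Matrix b a R

attribute [instance] MatObj.finb MatObj.fina MatObj.decb MatObj.deca

namespace TwoVertex

variable {K R : Type} [Field K] [Ring R] [Algebra K R] (D : TwoVertex K R)

/-- The module presented by a matrix over a corner. -/
abbrev cok (c : Fin 2) (U : MatObj R) : Type := Cok (D.e c) U.F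

/-- A chain of matrices over the corner `e_d R e_c` which describes the nonzero support
τ-tilting modules generated by `e_c`. -/
structure MatChain (c d : Fin 2) (k : ℕ) (U : ℕ → MatObj R) : Prop where
  isC : ∀ j ≤ k + 1, IsC (D.e d) (D.e c) (U j).F
  ev : ∀ j ≤ k + 1, EVan (D.e c) (D.e d) (U j).F (U j).F
  ev1 : ∀ j ≤ k, EVan (D.e c) (D.e d) (U j).F (U (j + 1)).F
  ev2 : ∀ j ≤ k, EVan (D.e c) (D.e d) (U (j + 1)).F (U j).F
  fac : ∀ j ≤ k, InFac R (D.cok c (U (j + 1))) (D.cok c (U j))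
  ne : ∀ j ≤ k, IsEmpty (D.cok c (U j) ≃ₗ[R] D.cok c (U (j + 1)))
  last_a : IsEmpty (U (k + 1)).a
  last_b : Nonempty (U (k + 1)).b
  indec : ∀ j ≤ k, IsIndecModule R (D.cok c (U j))
  nf : ∀ {ι κ : Type} [Fintype ι] [Fintype κ] [DecidableEq ι] [DecidableEq κ]
    (F : Matrix ι κ R), IsC (D.e d) (D.e c) F → EVan (D.e c) (D.e d) F F →
    ∃ j ≤ k, ∃ (τ τ' : Type) (_ : Fintype τ) (_ : Fintype τ') (_ : DecidableEq τ)
      (_ : DecidableEq τ'), MEquiv (D.e c) (D.e d) F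
        (fromBlocks (kron τ (U j).F) 0 0 (kron τ' (U (j + 1)).F))

/-- The support τ-tilting module at a position of a chain. -/
abbrev pair (c : Fin 2) (U : ℕ → MatObj R) (j : ℕ) : Type :=
  D.cok c (U j) × D.cok c (U (j + 1))

instance cok_finite (c : Fin 2) (U : MatObj R) : Module.Finite R (D.cok c U) :=
  Cok.finite (D.idem c) U.F

include D in
theorem self_count : HasIndecClassCount R (ModuleCat.of R R) 2 := by
  obtain ⟨φ⟩ := D.self_equiv
  exact (isBasic_and_classCount (M := ModuleCat.of R R) (X := fun c : Fin 2 => D.pmod c) φ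
    (fun c => D.pmod_indec c)
    fun i j hij => ⟨fun f => hij (D.eq_of_pmod_equiv f)⟩).2

include D in
/-- Basic support τ-tilting modules from a pair. -/
theorem supportTauTilting_of {M : ModuleCat.{0} R} (hM : IsTauRigidCat R M) {p q : ℕ}
    (hp : IsBasicModuleCat R M ∧ HasIndecClassCount R M p) (P : ModuleCat.{0} R)
    (h1 : Module.Finite R P) (h2 : Module.Projective R P) (h3 : ∀ f : P →ₗ[R] M, f = 0)
    (hq : HasIndecClassCount R P q) (hpq : p + q = 2) :
    IsSupportTauTiltingCat R M ∧ IsBasicModuleCat R M :=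
  ⟨⟨hM, P, p, q, 2, h1, h2, h3, hp.2, hq, D.self_count, hpq⟩, hp.1⟩

theorem pmod_projective (c : Fin 2) : Module.Projective R (D.pmod c) := by
  obtain ⟨φ⟩ := D.self_equiv
  exact Module.Projective.of_split (φ.symm.toLinearMap ∘ₗ LinearMap.single R D.pmod c)
    (LinearMap.proj c ∘ₗ φ.toLinearMap) (LinearMap.ext fun x => by
      change φ (φ.symm (Pi.single c x)) c = x
      rw [φ.apply_symm_apply, Pi.single_eq_same])

section Chain

variable {D} {c d : Fin 2} (hcd : c ≠ d) {k : ℕ} {U : ℕ → MatObj R} (h : D.MatChain c d k U)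

include h

namespace MatChain

theorem fac_le {i j : ℕ} (hij : i ≤ j) (hj : j ≤ k + 1) :
    InFac R (D.cok c (U j)) (D.cok c (U i)) := by
  induction j, hij using Nat.le_induction with
  | base => exact InFac.refl _
  | succ n hn ih => exact (h.fac n (by omega)).trans (ih (by omega))

theorem pair_fac {j : ℕ} (hj : j ≤ k) : InFac R (D.pair c U j) (D.cok c (U j)) :=
  (InFac.refl _).prod (h.fac j hj)

theorem gen_pair {j : ℕ} (hj : j ≤ k) : Gen (D.e c) (D.pair c U j) :=
  (gen_cok (D.idem c) _).of_inFac (h.pair_fac hj)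

theorem pair_mono {i j : ℕ} (hij : i ≤ j) (hj : j ≤ k) :
    InFac R (D.pair c U j) (D.pair c U i) :=
  ((h.pair_fac hj).trans (h.fac_le hij (by omega))).trans (InFac.fst _ _)

theorem nontrivial_pair {j : ℕ} (hj : j ≤ k) : Nontrivial (D.pair c U j) :=
  have := (h.indec j hj).1
  inferInstance

theorem subsingleton_last : Subsingleton (D.cok c (U (k + 1))) := by
  have := h.last_a
  exact Cok.subsingleton _ _

theorem pair_last : Nonempty (D.pair c U k ≃ₗ[R] D.cok c (U k)) := by
  have := h.subsingleton_last
  refine ⟨LinearEquiv.ofBijective (LinearMap.fst R _ _) ⟨fun x y hxy => ?_, fun x => ⟨(x, 0), rfl⟩⟩⟩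
  exact Prod.ext hxy (Subsingleton.elim _ _)

theorem smul_last (x : D.cok c (U k)) : D.e d • x = 0 := by
  have := h.last_a
  have := h.last_b
  exact smul_cok_eq_zero (D.idem c) (D.idem d) (h.ev2 k le_rfl) x

theorem tauRigid_pair {j : ℕ} (hj : j ≤ k) : IsTauRigidCat R (ModuleCat.of R (D.pair c U j)) := by
  have c1 := h.isC j (by omega)
  have c2 := h.isC (j + 1) (by omega)
  obtain ⟨φ⟩ := cok_fromBlocks (D.idem c) c1 c2
  refine IsTauRigidCat.congr (M := ModuleCat.of R (Cok (D.e c) (fromBlocks (U j).F 0 0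
    (U (j + 1)).F))) φ (isTauRigidCat_cok (D.idem c) (D.idem d) (IsC.fromBlocks c1 c2)
    (EVan.fromBlocks (h.ev j (by omega)) (h.ev1 j hj) (h.ev2 j hj) (h.ev _ (by omega))))

theorem supportTauTilting {j : ℕ} (hj : j ≤ k) :
    IsSupportTauTiltingCat R (ModuleCat.of R (D.pair c U j)) ∧
      IsBasicModuleCat R (ModuleCat.of R (D.pair c U j)) := by
  rcases hj.lt_or_eq with hlt | rfl
  · refine D.supportTauTilting_of (h.tauRigid_pair hj) (basic_two (LinearEquiv.refl R _)
      (h.indec j hj) (h.indec (j + 1) hlt) (h.ne j hj)) (ModuleCat.of R PUnit)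
      (inferInstanceAs (Module.Finite R PUnit)) (inferInstanceAs (Module.Projective R PUnit))
      (fun f => ?_) (q := 0) ?_ rfl
    · refine LinearMap.ext fun x => ?_
      rw [show x = 0 from Subsingleton.elim (α := PUnit) _ _, map_zero, map_zero]
    · have : Subsingleton (ModuleCat.of R PUnit) := inferInstanceAs (Subsingleton PUnit)
      exact basic_zero.2
  · obtain ⟨φ⟩ := h.pair_last
    refine D.supportTauTilting_of (h.tauRigid_pair le_rfl)
      (basic_one ((h.indec j le_rfl).congr φ.symm)) (ModuleCat.of R (D.pmod d))
      (Cok.finite (D.idem d) _) (D.pmod_projective d) (fun f => ?_) (q := 1) 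
      (basic_one (D.pmod_indec d)).2 rfl
    have h0 : ∀ x : D.pair c U j, D.e d • x = 0 := fun x => by
      apply φ.injective
      rw [map_smul, h.smul_last, map_zero]
    refine LinearMap.ext fun x => ?_
    have hx : x ∈ Submodule.span R (Set.range fun x : D.pmod d => D.e d • x) := by
      rw [D.gen_pmod d]; trivial
    refine Submodule.span_induction (p := fun z _ => f z = 0) ?_ ?_ ?_ ?_ hx
    · rintro _ ⟨y, rfl⟩
      exact (map_smul f (D.e d) y).trans (h0 _)
    · exact map_zero f
    · intro x y _ _ hx hy
      exact (map_add f x y).trans (by rw [hx, hy, add_zero])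
    · intro a x _ hx
      exact (map_smul f a x).trans (by rw [hx, smul_zero])

variable [Module.Finite K R]

theorem pair_anti {i j : ℕ} (hi : i ≤ k) (hj : j ≤ k)
    (hij : InFac R (D.pair c U i) (D.pair c U j)) : j ≤ i := by
  have : IsArtinianRing R := IsArtinianRing.of_finite K R
  by_contra hlt
  rw [not_le] at hlt
  have h1 : InFac R (D.cok c (U i)) (D.cok c (U (i + 1))) :=
    (((InFac.fst _ _).trans hij).trans (h.pair_fac hj)).trans (h.fac_le hlt (by omega))
  obtain ⟨φ⟩ := (h.indec i hi).equiv_of_inFac K (h.indec (i + 1) (by omega)) h1 (h.fac i hi)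
  exact (h.ne i hi).false φ

include hcd

/-- Completeness of the chain. -/
theorem complete {M : ModuleCat.{0} R} (hM : IsSupportTauTiltingCat R M)
    (hb : IsBasicModuleCat R M) {ι κ : Type} [Fintype ι] [Fintype κ] [DecidableEq ι]
    [DecidableEq κ] {F : Matrix ι κ R} (hF : IsC (D.e d) (D.e c) F)
    (hE : EVan (D.e c) (D.e d) F F) (φ : M ≃ₗ[R] Cok (D.e c) F) :
    Subsingleton M ∨ ∃ j ≤ k, Nonempty (M ≃ₗ[R] D.pair c U j) := by
  have : IsArtinianRing R := IsArtinianRing.of_finite K R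
  have : Module.Finite R M := hM.1.1
  obtain ⟨j, hj, τ, τ', _, _, _, _, hm⟩ := h.nf F hF hE
  have c1 := h.isC j (by omega)
  have c2 := h.isC (j + 1) (by omega)
  obtain ⟨φ₁⟩ := hm.cok_equiv hF
  obtain ⟨φ₂⟩ := cok_fromBlocks (D.idem c) (isC_kron (τ := τ) c1) (isC_kron (τ := τ') c2)
  obtain ⟨φ₃⟩ := cok_kron (τ := τ) (D.idem c) c1
  obtain ⟨φ₄⟩ := cok_kron (τ := τ') (D.idem c) c2
  have ψ : M ≃ₗ[R] (τ → D.cok c (U j)) × (τ' → D.cok c (U (j + 1))) :=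
    φ.trans (φ₁.trans (φ₂.trans (φ₃.prodCongr φ₄)))
  have single : ∀ i ≤ k, Nonempty (M ≃ₗ[R] D.cok c (U i)) →
      Subsingleton M ∨ ∃ j ≤ k, Nonempty (M ≃ₗ[R] D.pair c U j) := by
    rintro i hi ⟨θ⟩
    have hMi : IsIndecModule R M := (h.indec i hi).congr θ.symm
    obtain ⟨-, P, p, q, r, hP1, hP2, hP3, hp, hq, hr, hpq⟩ := hM
    have e1 := hp.unique (basic_one hMi).2
    have : IsNoetherian R (ModuleCat.of R R) := inferInstanceAs (IsNoetherian R R)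
    have : IsArtinian R (ModuleCat.of R R) := inferInstanceAs (IsArtinian R R)
    have e2 := hr.unique D.self_count
    have hPn : Nontrivial P := by
      by_contra hn
      rw [not_nontrivial_iff_subsingleton] at hn
      have := hq.unique basic_zero.2
      omega
    obtain ⟨d', hd'⟩ := D.exists_smul_eq_zero (P := P)
    have h0 := hd' M hP3
    have hMg : Gen (D.e c) M := (gen_cok (D.idem c) _).of_inFac (InFac.of_equiv θ.symm)
    have := hMi.1
    have hne : d' ≠ c := by
      rintro rfl
      obtain ⟨x, hx⟩ := exists_ne (0 : M)
      have hx' : x ∈ Submodule.span R (Set.range fun x : M => D.e d' • x) := by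
        rw [hMg]; trivial
      have hs : Submodule.span R (Set.range fun x : M => D.e d' • x) ≤ ⊥ :=
        Submodule.span_le.2 (by rintro _ ⟨y, rfl⟩; simpa using h0 y)
      exact hx (by simpa using hs hx')
    obtain rfl : d' = d := (by decide : ∀ a c d : Fin 2, c ≠ d → a ≠ c → a = d) _ _ _ hcd hne
    have hkne : Nonempty (U k).a := by
      by_contra hn
      rw [not_nonempty_iff] at hn
      have : Subsingleton (D.cok c (U k)) := Cok.subsingleton _ _
      have := (h.indec k le_rfl).1
      exact false_of_nontrivial_of_subsingleton (D.cok c (U k))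
    have hfac : InFac R (D.cok c (U i)) (D.cok c (U k)) :=
      Cok.inFac_of_smul_eq_zero (D.idem c) (h.isC k (by omega)) fun x => by
        rw [← θ.apply_symm_apply x, ← map_smul, h0, map_zero]
    obtain ⟨θ'⟩ := (h.indec i hi).equiv_of_inFac K (h.indec k le_rfl) hfac
      (h.fac_le hi (by omega))
    obtain ⟨θ''⟩ := h.pair_last
    exact Or.inr ⟨k, le_rfl, ⟨θ.trans (θ'.trans θ''.symm)⟩⟩
  have left : ∀ i ≤ k, ∀ (σ : Type) [Finite σ], Nonempty (M ≃ₗ[R] (σ → D.cok c (U i))) →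
      Subsingleton M ∨ Nonempty (M ≃ₗ[R] D.cok c (U i)) := by
    rintro i hi σ _ ⟨θ⟩
    rcases isEmpty_or_nonempty σ with hσ | hσ
    · exact Or.inl θ.injective.subsingleton
    · obtain ⟨θ'⟩ := hb.equiv_pi (S := Unit) (Q := fun _ => D.cok c (U i)) (fun _ => h.indec i hi)
        (fun _ _ _ => rfl) (fun _ : σ => ()) (fun _ => ⟨hσ.some, rfl⟩) θ
      exact Or.inr ⟨θ'.trans (LinearEquiv.funUnique Unit R _)⟩
  have left' : ∀ i ≤ k, ∀ (σ : Type) [Finite σ], Nonempty (M ≃ₗ[R] (σ → D.cok c (U i))) →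
      Subsingleton M ∨ ∃ j ≤ k, Nonempty (M ≃ₗ[R] D.pair c U j) := fun i hi σ _ hσ =>
    (left i hi σ hσ).elim Or.inl (single i hi)
  rcases hj.lt_or_eq with hlt | rfl
  · rcases isEmpty_or_nonempty τ with hτ | hτ
    · exact left' (j + 1) hlt τ' ⟨ψ.trans (LinearEquiv.uniqueProd)⟩
    rcases isEmpty_or_nonempty τ' with hτ' | hτ'
    · exact left' j hj τ ⟨ψ.trans (LinearEquiv.prodUnique)⟩
    let Q : Bool → MatObj R := fun b => if b then U (j + 1) else U j
    let col : τ ⊕ τ' → Bool := Sum.elim (fun _ => false) fun _ => true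
    have e1 : ((τ → D.cok c (U j)) × (τ' → D.cok c (U (j + 1)))) ≃ₗ[R]
        ∀ s, D.cok c (Q (col s)) :=
      (LinearEquiv.sumPiEquivProdPi R τ τ' fun s => D.cok c (Q (col s))).symm
    have hne : ∀ s t, Nonempty (D.cok c (Q s) ≃ₗ[R] D.cok c (Q t)) → s = t := by
      rintro (_ | _) (_ | _) ⟨f⟩
      · rfl
      · exact ((h.ne j hj).false f).elim
      · exact ((h.ne j hj).false f.symm).elim
      · rfl
    obtain ⟨θ⟩ := hb.equiv_pi (S := Bool) (Q := fun s => D.cok c (Q s))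
      (by rintro (_ | _); exacts [h.indec j hj, h.indec (j + 1) hlt]) hne col
      (by rintro (_ | _); exacts [⟨Sum.inl hτ.some, rfl⟩, ⟨Sum.inr hτ'.some, rfl⟩]) (ψ.trans e1)
    have e2 : (∀ s, D.cok c (Q s)) ≃ₗ[R] D.pair c U j :=
      { toFun := fun f => (f false, f true)
        map_add' := fun f g => rfl
        map_smul' := fun r f => rfl
        invFun := fun p s => match s with
          | false => p.1
          | true => p.2
        left_inv := fun f => by ext (_ | _) <;> rfl
        right_inv := fun p => rfl }
    exact Or.inr ⟨j, hj, ⟨θ.trans e2⟩⟩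
  · have := h.subsingleton_last
    have : Unique (τ' → D.cok c (U (j + 1))) := ⟨⟨0⟩, fun _ => Subsingleton.elim _ _⟩
    exact left' j le_rfl τ ⟨ψ.trans (LinearEquiv.prodUnique)⟩

end MatChain

end Chain

end TwoVertex
end TwoPoint

namespace TwoPoint

open Matrix

theorem InFac.of_finite {R X : Type} [Ring R] [AddCommGroup X] [Module R X] [Module.Finite R X] :
    InFac R X R := by
  obtain ⟨n, f, hf⟩ := Module.Finite.exists_fin' R X
  exact ⟨n, f, hf⟩

theorem InFac.of_subsingleton {R : Type} [Ring R] (X Y : Type) [AddCommGroup X] [Module R X]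
    [Subsingleton X] [AddCommGroup Y] [Module R Y] : InFac R X Y :=
  InFac.of_surj_one 0 fun _ => ⟨0, Subsingleton.elim _ _⟩

theorem InFac.subsingleton {R : Type} [Ring R] {X Y : Type} [AddCommGroup X] [Module R X]
    [Subsingleton Y] [AddCommGroup Y] [Module R Y] (h : InFac R X Y) : Subsingleton X := by
  obtain ⟨k, f, hf⟩ := h
  exact hf.subsingleton

/-- The Hasse quiver may be read with the two paths exchanged. -/
theorem HasseType.swap {Λ : Type} [Ring Λ] {m n : ℕ} (h : HasseType Λ m n) : HasseType Λ n m := by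
  obtain ⟨T, h1, h2, h3, h4⟩ := h
  let e : WithTop (WithBot (Fin n ⊕ Fin m)) ≃o WithTop (WithBot (Fin m ⊕ Fin n)) :=
    OrderIso.withTopCongr (OrderIso.withBotCongr (OrderIso.sumComm _ _))
  refine ⟨T ∘ e, fun x => h1 _, fun x y hxy => e.injective (h2 _ _ hxy), fun M hM => ?_,
    fun x y => ?_⟩
  · obtain ⟨x, hx⟩ := h3 M hM
    exact ⟨e.symm x, by rwa [Function.comp_apply, OrderIso.apply_symm_apply]⟩
  · rw [← e.le_iff_le, h4]; rfl

theorem HasseType.count {Λ : Type} [Ring Λ] {m n N : ℕ} (h : HasseType Λ m n)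
    (hN : N = m + n + 2) : SupportTauTiltingCount Λ N := by
  obtain ⟨T, h1, h2, h3, -⟩ := h
  have e : Fin N ≃ WithTop (WithBot (Fin m ⊕ Fin n)) :=
    Fintype.equivOfCardEq (by
      rw [hN, Fintype.card_fin]
      exact (by simp : Fintype.card (Option (Option (Fin m ⊕ Fin n))) = m + n + 2).symm)
  refine ⟨T ∘ e, fun i => h1 _, fun i j hij => e.injective (h2 _ _ hij), fun M hM => ?_⟩
  obtain ⟨x, hx⟩ := h3 M hM
  exact ⟨e.symm x, by rwa [Function.comp_apply, Equiv.apply_symm_apply]⟩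

theorem HasseType.data {Λ : Type} [Ring Λ] {m n N : ℕ} (h : HasseType Λ m n)
    (hN : N = m + n + 2) : TauTiltingData Λ N m n := by
  refine ⟨?_, h.count hN, h⟩
  obtain ⟨L, -, -, h3⟩ := h.count hN
  exact ⟨N, L, h3⟩

namespace TwoVertex

variable {K R : Type} [Field K] [Ring R] [Algebra K R] (D : TwoVertex K R)

/-- The support τ-tilting modules, in terms of two chains of matrices. -/
def tiltingMod (k : Fin 2 → ℕ) (U : Fin 2 → ℕ → MatObj R) :
    Option (Option (Fin (k 0 + 1) ⊕ Fin (k 1 + 1))) → ModuleCat.{0} R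
  | none => ModuleCat.of R R
  | some none => ModuleCat.of R PUnit
  | some (some (Sum.inl j)) => ModuleCat.of R (D.pair 0 (U 0) (k 0 - j))
  | some (some (Sum.inr j)) => ModuleCat.of R (D.pair 1 (U 1) (k 1 - j))

variable {D} {k : Fin 2 → ℕ} {U : Fin 2 → ℕ → MatObj R}
  (h : ∀ c, D.MatChain c (1 - c) (k c) (U c))

theorem supportTauTilting_bot :
    IsSupportTauTiltingCat R (D.tiltingMod k U (some none)) ∧
      IsBasicModuleCat R (D.tiltingMod k U (some none)) := by
  have : Subsingleton (ModuleCat.of R PUnit) := inferInstanceAs (Subsingleton PUnit)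
  have : Module.Finite R (ModuleCat.of R PUnit) :=
    inferInstanceAs (Module.Finite R PUnit)
  have : Module.Projective R (ModuleCat.of R PUnit) :=
    inferInstanceAs (Module.Projective R PUnit)
  refine D.supportTauTilting_of (M := ModuleCat.of R PUnit) (isTauRigidCat_of_projective _)
    basic_zero
    (ModuleCat.of R R) (inferInstanceAs (Module.Finite R R))
    (inferInstanceAs (Module.Projective R R)) (fun f => ?_) D.self_count rfl
  exact LinearMap.ext fun x => Subsingleton.elim (α := PUnit) _ _

theorem supportTauTilting_top : IsSupportTauTiltingCat R (D.tiltingMod k U none) ∧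
    IsBasicModuleCat R (D.tiltingMod k U none) := by
  obtain ⟨φ⟩ := D.self_equiv
  have : Module.Finite R (ModuleCat.of R R) := inferInstanceAs (Module.Finite R R)
  have : Module.Projective R (ModuleCat.of R R) := inferInstanceAs (Module.Projective R R)
  have : Subsingleton (ModuleCat.of R PUnit) := inferInstanceAs (Subsingleton PUnit)
  refine D.supportTauTilting_of (M := ModuleCat.of R R) (isTauRigidCat_of_projective _)
    (p := 2) (isBasic_and_classCount (M := ModuleCat.of R R)
      (X := fun c : Fin 2 => D.pmod c) φ (fun c => D.pmod_indec c)
      fun i j hij => ⟨fun f => hij (D.eq_of_pmod_equiv f)⟩)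
    (ModuleCat.of R PUnit) (inferInstanceAs (Module.Finite R PUnit))
    (inferInstanceAs (Module.Projective R PUnit)) (fun f => ?_) basic_zero.2 rfl
  refine LinearMap.ext fun x => ?_
  rw [show x = 0 from Subsingleton.elim (α := PUnit) _ _, map_zero, map_zero]

include D in
theorem nontrivial_ring : Nontrivial R :=
  nontrivial_of_ne (D.e 0) 0 fun h0 => D.e_notMem_J 0 (h0 ▸ zero_mem _)

theorem not_top_inFac (c : Fin 2) {X : Type} [AddCommGroup X] [Module R X]
    (hX : Gen (D.e c) X) : ¬ InFac R R X := fun hf => by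
  have := Cok.finite (D.idem (1 - c)) (0 : Matrix (Fin 0) (Fin 1) R)
  have h1 : InFac R (D.pmod (1 - c)) X := InFac.of_finite.trans hf
  have := (D.pmod_indec (1 - c)).1
  exact (by decide : ∀ c : Fin 2, c ≠ 1 - c) c (D.eq_of_gen (Gen.of_inFac h1 hX) (D.gen_pmod _))

include h

theorem not_pair_inFac {c d : Fin 2} (hcd : c ≠ d) {i j : ℕ} (hi : i ≤ k c) (hj : j ≤ k d) :
    ¬ InFac R (D.pair c (U c) i) (D.pair d (U d) j) := fun hf => by
  have := (h c).nontrivial_pair hi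
  exact hcd (D.eq_of_gen ((h c).gen_pair hi) (Gen.of_inFac hf ((h d).gen_pair hj)))

theorem tiltingMod_le [Module.Finite K R]
    (x y : WithTop (WithBot (Fin (k 0 + 1) ⊕ Fin (k 1 + 1)))) :
    x ≤ y ↔ InFac R (D.tiltingMod k U x) (D.tiltingMod k U y) := by
  have hp : ∀ c j, k c - j ≤ k c := fun c j => Nat.sub_le _ _
  have hpair : ∀ c (i j : Fin (k c + 1)), i ≤ j ↔
      InFac R (D.pair c (U c) (k c - i)) (D.pair c (U c) (k c - j)) := fun c i j =>
    ⟨fun hij => (h c).pair_mono (by have := Fin.le_def.1 hij; omega) (hp _ _),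
      fun hij => Fin.le_def.2 (by have := (h c).pair_anti (hp _ _) (hp _ _) hij; omega)⟩
  have hbot : ∀ c (i : Fin (k c + 1)), ¬ InFac R (D.pair c (U c) (k c - i)) PUnit := fun c i hf => by
    have := (h c).nontrivial_pair (hp c i)
    have := hf.subsingleton
    exact false_of_nontrivial_of_subsingleton (D.pair c (U c) (k c - i))
  have htop : ¬ InFac R R PUnit := fun hf => by
    have := hf.subsingleton
    have := nontrivial_ring (D := D)
    exact false_of_nontrivial_of_subsingleton R
  induction y using WithTop.recTopCoe with
  | top =>
    refine iff_of_true le_top ?_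
    induction x using WithTop.recTopCoe with
    | top => exact InFac.refl _
    | coe x =>
      induction x using WithBot.recBotCoe with
      | bot => exact InFac.of_subsingleton PUnit _
      | coe x =>
        rcases x with i | i
        · exact ((h 0).pair_fac (hp 0 i)).trans InFac.of_finite
        · exact ((h 1).pair_fac (hp 1 i)).trans InFac.of_finite
  | coe y =>
    induction x using WithTop.recTopCoe with
    | top =>
      refine iff_of_false (by simp) ?_
      induction y using WithBot.recBotCoe with
      | bot => exact htop
      | coe y =>
        rcases y with i | i
        · exact not_top_inFac 0 ((h 0).gen_pair (hp 0 i))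
        · exact not_top_inFac 1 ((h 1).gen_pair (hp 1 i))
    | coe x =>
      rw [WithTop.coe_le_coe]
      induction x using WithBot.recBotCoe with
      | bot => exact iff_of_true bot_le (InFac.of_subsingleton PUnit _)
      | coe x =>
        induction y using WithBot.recBotCoe with
        | bot =>
          refine iff_of_false (by simp) ?_
          rcases x with i | i
          · exact hbot 0 i
          · exact hbot 1 i
        | coe y =>
          rw [WithBot.coe_le_coe]
          rcases x with i | i <;> rcases y with j | j
          · exact Sum.inl_le_inl_iff.trans (hpair 0 i j)
          · exact iff_of_false Sum.not_inl_le_inr (not_pair_inFac h (by decide) (hp 0 i) (hp 1 j))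
          · exact iff_of_false Sum.not_inr_le_inl (not_pair_inFac h (by decide) (hp 1 i) (hp 0 j))
          · exact Sum.inr_le_inr_iff.trans (hpair 1 i j)

theorem supportTauTilting_tiltingMod (x : Option (Option (Fin (k 0 + 1) ⊕ Fin (k 1 + 1)))) :
    IsSupportTauTiltingCat R (D.tiltingMod k U x) ∧ IsBasicModuleCat R (D.tiltingMod k U x) := by
  rcases x with _ | _ | i | i
  · exact supportTauTilting_top
  · exact supportTauTilting_bot
  · exact (h 0).supportTauTilting (Nat.sub_le _ _)
  · exact (h 1).supportTauTilting (Nat.sub_le _ _)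

theorem exists_tiltingMod [Module.Finite K R] {M : ModuleCat.{0} R}
    (hM : IsSupportTauTiltingCat R M) (hb : IsBasicModuleCat R M) :
    ∃ x, Nonempty (M ≃ₗ[R] D.tiltingMod k U x) := by
  have : IsArtinianRing R := IsArtinianRing.of_finite K _
  have : Module.Finite R M := hM.1.1
  rcases D.rigid_cases hM.1 with ⟨κ, _, col, hcol, ⟨φ⟩⟩ |
      ⟨c, d, hcd, κ, ι, _, _, _, _, F, hF, hE, ⟨φ⟩⟩
  · obtain ⟨ψ⟩ := D.rowMod_equiv_pi col
    obtain ⟨θ⟩ := hb.equiv_pi (S := Fin 2) (Q := D.pmod) (fun c => D.pmod_indec c)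
      (fun c d ⟨f⟩ => D.eq_of_pmod_equiv f) col hcol (φ.trans ψ)
    obtain ⟨θ'⟩ := D.self_equiv
    exact ⟨none, ⟨θ.trans θ'.symm⟩⟩
  · obtain rfl : d = 1 - c := (by decide : ∀ c d : Fin 2, c ≠ d → d = 1 - c) _ _ hcd
    rcases (h c).complete hcd hM hb hF hE φ with h0 | ⟨j, hj, ⟨θ⟩⟩
    · exact ⟨some none, ⟨LinearEquiv.ofBijective (M₂ := PUnit) 0
        ⟨fun _ _ _ => Subsingleton.elim _ _, fun _ => ⟨0, rfl⟩⟩⟩⟩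
    · have hi : j = k c - ((k c - j : ℕ)) := by omega
      rw [hi] at θ
      rcases (by decide : ∀ c : Fin 2, c = 0 ∨ c = 1) c with rfl | rfl
      · exact ⟨some (some (Sum.inl ⟨k 0 - j, by omega⟩)), ⟨θ⟩⟩
      · exact ⟨some (some (Sum.inr ⟨k 1 - j, by omega⟩)), ⟨θ⟩⟩

end TwoVertex

theorem TwoVertex.hasseType {K Λ : Type} [Field K] [Ring Λ] [Algebra K Λ]
    [Module.Finite K Λᵐᵒᵖ] {D : TwoVertex K Λᵐᵒᵖ} {k : Fin 2 → ℕ} {U : Fin 2 → ℕ → MatObj Λᵐᵒᵖ}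
    (h : ∀ c, D.MatChain c (1 - c) (k c) (U c)) : HasseType Λ (k 0 + 1) (k 1 + 1) := by
  refine ⟨D.tiltingMod k U, supportTauTilting_tiltingMod h, fun x y ⟨φ⟩ => ?_,
    fun M hM => exists_tiltingMod h hM.1 hM.2, fun x y => ?_⟩
  · exact le_antisymm ((tiltingMod_le h x y).2 (InFac.of_equiv φ.symm))
      ((tiltingMod_le h y x).2 (InFac.of_equiv φ))
  · rw [facLE_iff]
    exact tiltingMod_le h x y

end TwoPoint

namespace TwoPoint

open Matrix

section FieldMatrices

variable {K : Type} [Field K] {ι κ : Type} [Fintype ι] [Fintype κ] [DecidableEq ι] [DecidableEq κ]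

theorem exists_left_inverse_of_ker {G : Matrix ι κ K} (h : ∀ v, G *ᵥ v = 0 → v = 0) :
    ∃ L : Matrix κ ι K, L * G = 1 := by
  obtain ⟨g, hg⟩ := (Matrix.toLin' G).exists_leftInverse_of_injective
    (LinearMap.ker_eq_bot'.2 fun v hv => h v (by simpa using hv))
  refine ⟨LinearMap.toMatrix' g, Matrix.toLin'.injective ?_⟩
  rw [Matrix.toLin'_mul, Matrix.toLin'_toMatrix', hg, Matrix.toLin'_one]

theorem exists_right_inverse_of_ker {G : Matrix ι κ K} (h : ∀ w, w ᵥ* G = 0 → w = 0) :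
    ∃ L : Matrix κ ι K, G * L = 1 := by
  obtain ⟨L, hL⟩ := exists_left_inverse_of_ker (G := Gᵀ) fun v hv => h v (by
    rwa [Matrix.mulVec_transpose] at hv)
  exact ⟨Lᵀ, by rw [← Matrix.transpose_transpose G, ← Matrix.transpose_mul, hL,
    Matrix.transpose_one]⟩

/-- A matrix without self-extensions over a field is of full rank. -/
theorem full_rank {G : Matrix ι κ K} (h : ∀ X : Matrix ι κ K, ∃ (Z : Matrix κ κ K)
    (Y : Matrix ι ι K), X = G * Z + Y * G) :
    (∃ L : Matrix κ ι K, L * G = 1) ∨ ∃ L : Matrix κ ι K, G * L = 1 := by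
  by_cases h1 : ∀ v, G *ᵥ v = 0 → v = 0
  · exact Or.inl (exists_left_inverse_of_ker h1)
  refine Or.inr (exists_right_inverse_of_ker fun w hw => ?_)
  push Not at h1
  obtain ⟨v, hv, hv0⟩ := h1
  obtain ⟨k, hk⟩ := Function.ne_iff.1 hv0
  funext i
  obtain ⟨Z, Y, hX⟩ := h (Matrix.single i k 1)
  have e1 : w ᵥ* (Matrix.single i k (1 : K)) ⬝ᵥ v = 0 := by
    rw [hX, Matrix.vecMul_add, ← Matrix.vecMul_vecMul, hw, Matrix.zero_vecMul, zero_add,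
      ← Matrix.dotProduct_mulVec, ← Matrix.mulVec_mulVec, hv, Matrix.mulVec_zero, dotProduct_zero]
  rw [← Matrix.dotProduct_mulVec, Matrix.single_mulVec, one_mul] at e1
  have e2 : w i = 0 ∨ v k = 0 := by simpa [Function.update_apply, dotProduct] using e1
  exact e2.resolve_right hk

/-- Row reduction of an injective matrix. -/
theorem row_reduction {G : Matrix ι κ K} {L : Matrix κ ι K} (h : L * G = 1) :
    ∃ (n : ℕ) (U : Matrix (κ ⊕ Fin n) ι K) (U' : Matrix ι (κ ⊕ Fin n) K),
      U * U' = 1 ∧ U' * U = 1 ∧ U * G = fromRows 1 0 := by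
  let p : (ι → K) →ₗ[K] (ι → K) := LinearMap.id - Matrix.toLin' G ∘ₗ Matrix.toLin' L
  have hp : ∀ v, p v ∈ LinearMap.ker (Matrix.toLin' L) := fun v => by
    simp [p, Matrix.mulVec_sub, Matrix.mulVec_mulVec, ← Matrix.mul_assoc, h]
  let φ := (Module.finBasis K (LinearMap.ker (Matrix.toLin' L))).equivFun
  let M := LinearMap.toMatrix' (φ.toLinearMap ∘ₗ p.codRestrict _ hp)
  let N := LinearMap.toMatrix' ((LinearMap.ker (Matrix.toLin' L)).subtype ∘ₗ φ.symm.toLinearMap)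
  have hLN : L * N = 0 := Matrix.toLin'.injective (LinearMap.ext fun v => by
    rw [Matrix.toLin'_mul, Matrix.toLin'_toMatrix', map_zero]
    exact (φ.symm v).2)
  have hMG : M * G = 0 := Matrix.toLin'.injective (LinearMap.ext fun v => by
    rw [Matrix.toLin'_mul, Matrix.toLin'_toMatrix', map_zero]
    refine (congrArg φ (Subtype.ext ?_)).trans (map_zero φ)
    change p (Matrix.toLin' G v) = 0
    simp [p, Matrix.mulVec_mulVec, h])
  have hMN : M * N = 1 := Matrix.toLin'.injective (LinearMap.ext fun v => by
    rw [Matrix.toLin'_mul, Matrix.toLin'_toMatrix', Matrix.toLin'_toMatrix', Matrix.toLin'_one]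
    refine (congrArg φ (Subtype.ext ?_)).trans (φ.apply_symm_apply v)
    change (φ.symm v : ι → K) - Matrix.toLin' G (Matrix.toLin' L (φ.symm v : ι → K)) = _
    rw [show Matrix.toLin' L (φ.symm v : ι → K) = 0 from (φ.symm v).2, map_zero, sub_zero])
  have hNM : N * M = 1 - G * L := Matrix.toLin'.injective (LinearMap.ext fun v => by
    rw [Matrix.toLin'_mul, Matrix.toLin'_toMatrix', Matrix.toLin'_toMatrix', map_sub,
      Matrix.toLin'_one, Matrix.toLin'_mul]
    change ((φ.symm (φ ⟨p v, hp v⟩) : LinearMap.ker (Matrix.toLin' L)) : ι → K) = _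
    rw [φ.symm_apply_apply])
  refine ⟨_, fromRows L M, fromCols G N, ?_, ?_, ?_⟩
  · rw [fromRows_mul_fromCols, h, hLN, hMG, hMN, fromBlocks_one]
  · rw [fromCols_mul_fromRows, hNM, add_sub_cancel]
  · rw [fromRows_mul, h, hMG]

/-- Column reduction of a surjective matrix. -/
theorem col_reduction {G : Matrix ι κ K} {L : Matrix κ ι K} (h : G * L = 1) :
    ∃ (n : ℕ) (V : Matrix κ (ι ⊕ Fin n) K) (V' : Matrix (ι ⊕ Fin n) κ K),
      V * V' = 1 ∧ V' * V = 1 ∧ G * V = fromCols 1 0 := by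
  obtain ⟨n, U, U', h1, h2, h3⟩ := row_reduction (G := Gᵀ) (L := Lᵀ) (by
    rw [← Matrix.transpose_mul, h, Matrix.transpose_one])
  refine ⟨n, Uᵀ, U'ᵀ, ?_, ?_, ?_⟩
  · rw [← Matrix.transpose_mul, h2, Matrix.transpose_one]
  · rw [← Matrix.transpose_mul, h1, Matrix.transpose_one]
  · rw [← Matrix.transpose_transpose G, ← Matrix.transpose_mul, h3, transpose_fromRows,
      Matrix.transpose_one, Matrix.transpose_zero]

end FieldMatrices

end TwoPoint

namespace TwoPoint

open Matrix

section ScalarMultiples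

variable {K S : Type} [Field K] [Ring S] [Algebra K S] {m n p q : Type}

/-- A matrix of multiples of a ring element. -/
def sm (G : Matrix m n K) (a : S) : Matrix m n S := G.map fun g => g • a

theorem sm_zero (a : S) : sm (0 : Matrix m n K) a = 0 := by ext; simp [sm]

theorem sm_zero_right (G : Matrix m n K) : sm G (0 : S) = 0 := by ext; simp [sm]

theorem sm_add (G H : Matrix m n K) (a : S) : sm (G + H) a = sm G a + sm H a := by
  ext; simp [sm, add_smul]

theorem sm_sub (G H : Matrix m n K) (a : S) : sm (G - H) a = sm G a - sm H a := by
  ext; simp [sm, sub_smul]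

theorem sm_neg (G : Matrix m n K) (a : S) : sm (-G) a = -sm G a := by
  ext; simp [sm]

theorem sm_mul_sm [Fintype n] (G : Matrix m n K) (H : Matrix n p K) (a b : S) :
    sm G a * sm H b = sm (G * H) (a * b) := by
  ext i j
  simp [sm, Matrix.mul_apply, Finset.sum_smul, smul_smul, mul_comm]

theorem sm_one [DecidableEq n] (a : S) : sm (1 : Matrix n n K) a = dg n a := by
  ext i j
  by_cases h : i = j
  · subst h; simp [sm, dg]
  · simp [sm, dg, h]

theorem isC_sm {a b r : S} (G : Matrix m n K) (h : a * r = r) (h' : r * b = r) :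
    IsC a b (sm G r) := by
  constructor <;> intro i j <;> simp [sm, h, h']

theorem sm_fromRows (G : Matrix m n K) (H : Matrix p n K) (a : S) :
    sm (fromRows G H) a = fromRows (sm G a) (sm H a) := fromRows_map _ _ _

theorem sm_fromBlocks (A : Matrix m n K) (B : Matrix m p K) (C : Matrix q n K) (E : Matrix q p K)
    (a : S) : sm (fromBlocks A B C E) a = fromBlocks (sm A a) (sm B a) (sm C a) (sm E a) :=
  fromBlocks_map _ _ _ _ _

theorem sm_submatrix (G : Matrix m n K) (a : S) (r : p → m) (s : q → n) :
    sm (G.submatrix r s) a = (sm G a).submatrix r s := rfl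

theorem IsC.fromRows {a b : S} {M : Matrix m n S} {N : Matrix p n S} (hM : IsC a b M)
    (hN : IsC a b N) : IsC a b (fromRows M N) := by
  constructor <;> rintro (i | i) j <;> simp [hM.1, hM.2, hN.1, hN.2]

theorem IsC.fromCols {a b : S} {M : Matrix m n S} {N : Matrix m p S} (hM : IsC a b M)
    (hN : IsC a b N) : IsC a b (fromCols M N) := by
  constructor <;> rintro i (j | j) <;> simp [hM.1, hM.2, hN.1, hN.2]

end ScalarMultiples

namespace TwoVertex

section Invertible

variable {K S : Type} [Field K] [Ring S] [Algebra K S] [Module.Finite K S] (D : TwoVertex K S)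
  {n : Type} [Fintype n] [DecidableEq n]

/-- Matrices congruent to the identity modulo the radical are invertible. -/
theorem exists_inverse {c : Fin 2} {W : Matrix n n S} (hW : IsC (D.e c) (D.e c) W)
    (h : ∀ i j, W i j ∈ D.J) : ∃ W' : Matrix n n S, IsC (D.e c) (D.e c) W' ∧
      (dg n (D.e c) + W) * W' = dg n (D.e c) ∧ W' * (dg n (D.e c) + W) = dg n (D.e c) := by
  obtain ⟨N, hN⟩ := D.J_nilpotent
  have hmem : ∀ k : ℕ, ∀ i j, (W ^ k) i j ∈ D.J ^ k := by
    intro k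
    induction k with
    | zero =>
      intro i j
      have h1 : D.J ^ 0 = ⊤ := (Submodule.pow_zero D.J).trans Ideal.one_eq_top
      rw [h1]; trivial
    | succ k ih =>
      intro i j
      have h1 : D.J ^ (k + 1) = D.J ^ k * D.J := Submodule.pow_succ D.J
      rw [pow_succ, Matrix.mul_apply, h1]
      exact Ideal.sum_mem _ fun l _ => Ideal.mul_mem_mul (ih i l) (h l j)
  have hnil : W ^ N = 0 := Matrix.ext fun i j => by simpa [hN] using hmem N i j
  obtain ⟨u, hu⟩ := IsNilpotent.isUnit_one_add ⟨N, hnil⟩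
  have hd := isC_dg (n := n) (D.idem c)
  have e1 : dg n (D.e c) + W = dg n (D.e c) * (u : Matrix n n S) := by
    rw [hu, mul_add, mul_one, dg_mul hW]
  have e2 : dg n (D.e c) + W = (u : Matrix n n S) * dg n (D.e c) := by
    rw [hu, add_mul, one_mul, mul_dg hW]
  have hcomm : (↑u⁻¹ : Matrix n n S) * dg n (D.e c) = dg n (D.e c) * (↑u⁻¹ : Matrix n n S) := by
    rw [Units.inv_mul_eq_iff_eq_mul, ← mul_assoc, ← e2, e1, mul_assoc, Units.mul_inv, mul_one]
  refine ⟨dg n (D.e c) * (↑u⁻¹ : Matrix n n S) * dg n (D.e c), ⟨fun i j => ?_, fun i j => ?_⟩,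
    ?_, ?_⟩
  · simp [dg, ← mul_assoc, D.idem]
  · simp [dg, mul_assoc, D.idem]
  · rw [e2, mul_assoc, ← mul_assoc (dg n (D.e c)), ← mul_assoc (dg n (D.e c)), dg_mul hd,
      ← hcomm, mul_assoc, dg_mul hd, ← mul_assoc, Units.mul_inv, one_mul]
  · rw [e1, mul_assoc, ← mul_assoc (dg n (D.e c)) (dg n (D.e c)), dg_mul hd, mul_assoc,
      ← mul_assoc (↑u⁻¹ : Matrix n n S), hcomm, mul_assoc, Units.inv_mul, mul_one, dg_mul hd]

end Invertible

/-- One half of a corner bimodule `e_d S e_c`: generated by an element `m`, with a uniserial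
right action of a nilpotent element `x`, up to a left multiplication by radical elements. -/
structure Half {K S : Type} [Field K] [Ring S] [Algebra K S] (D : TwoVertex K S) (c d : Fin 2)
    (r : ℕ) (m x : S) where
  fm : D.e d * m = m
  me : m * D.e c = m
  ex : D.e c * x = x
  xe : x * D.e c = x
  χx : D.χ c x = 0
  z1 : r < 1 → m * x = 0
  z2 : r < 2 → ∃ b, D.e d * b = b ∧ b * D.e d = b ∧ D.χ d b = 0 ∧ m * x * x = b * m
  z3 : m * x * x * x = 0
  span : ∀ h, D.e d * h = h → h * D.e c = h → ∃ (a : Fin 3 → K) (b : S), D.e d * b = b ∧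
    b * D.e d = b ∧ D.χ d b = 0 ∧ b * (m * x) = 0 ∧
    h = a 0 • m + a 1 • (m * x) + a 2 • (m * x * x) + b * m
  /-- coordinates -/
  h : Fin 3 → S →ₗ[K] K
  /-- coordinates on the endomorphism ring -/
  p : Fin 2 → S →ₗ[K] K
  mul0 : ∀ y z, D.e d * y = y → y * D.e c = y → z * D.e c = z → D.e c * z = z →
    h 0 (y * z) = h 0 y * D.χ c z
  mul1 : 1 ≤ r → ∀ y z, D.e d * y = y → y * D.e c = y → z * D.e c = z → D.e c * z = z →
    h 1 (y * z) = h 0 y * p 0 z + h 1 y * D.χ c z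
  mul2 : 2 ≤ r → ∀ y z, D.e d * y = y → y * D.e c = y → z * D.e c = z → D.e c * z = z →
    h 2 (y * z) = h 0 y * p 1 z + h 1 y * p 0 z + h 2 y * D.χ c z
  left : ∀ i w y, D.e d * w = w → w * D.e d = w → D.e d * y = y → y * D.e c = y →
    h i (w * y) = D.χ d w * h i y
  hm : ∀ i, h i m = if i = 0 then 1 else 0
  px0 : 1 ≤ r → p 0 x = 1
  px1 : 2 ≤ r → p 1 x = 0

end TwoVertex
end TwoPoint

namespace TwoPoint

open Matrix

/-- The normal form of a matrix over a half of a corner. -/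
def std {K S : Type} [Field K] [Ring S] [Algebra K S] {ι κ : Type} [DecidableEq κ] (m x : S)
    (G G' : Matrix ι κ K) : Matrix (κ ⊕ ι) κ S :=
  fromRows (sm (1 : Matrix κ κ K) m) (sm G (m * x) + sm G' (m * x * x))

namespace TwoVertex
namespace Half

variable {K S : Type} [Field K] [Ring S] [Algebra K S] {D : TwoVertex K S} {c d : Fin 2}
  {r : ℕ} {m x : S} (Q : D.Half c d r m x) {ι κ ι' κ' : Type}

include Q

theorem fmx : D.e d * (m * x) = m * x := by rw [← mul_assoc, Q.fm]

theorem mxe : m * x * D.e c = m * x := by rw [mul_assoc, Q.xe]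

theorem fmxx : D.e d * (m * x * x) = m * x * x := by rw [← mul_assoc, Q.fmx]

theorem mxxe : m * x * x * D.e c = m * x * x := by rw [mul_assoc, Q.xe]

theorem h0mx : Q.h 0 (m * x) = 0 := by
  rw [Q.mul0 _ _ Q.fm Q.me Q.xe Q.ex, Q.χx, mul_zero]

theorem h0mxx : Q.h 0 (m * x * x) = 0 := by
  rw [Q.mul0 _ _ Q.fmx Q.mxe Q.xe Q.ex, Q.χx, mul_zero]

theorem h1mx (hr : 1 ≤ r) : Q.h 1 (m * x) = 1 := by
  rw [Q.mul1 hr _ _ Q.fm Q.me Q.xe Q.ex, Q.χx, Q.hm, Q.px0 hr]; simp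

theorem h1mxx (hr : 1 ≤ r) : Q.h 1 (m * x * x) = 0 := by
  rw [Q.mul1 hr _ _ Q.fmx Q.mxe Q.xe Q.ex, Q.χx, Q.h0mx]; simp

theorem h2mx (hr : 2 ≤ r) : Q.h 2 (m * x) = 0 := by
  rw [Q.mul2 hr _ _ Q.fm Q.me Q.xe Q.ex, Q.χx, Q.hm, Q.hm, Q.px1 hr]; simp

theorem h2mxx (hr : 2 ≤ r) : Q.h 2 (m * x * x) = 1 := by
  rw [Q.mul2 hr _ _ Q.fmx Q.mxe Q.xe Q.ex, Q.χx, Q.h0mx, Q.h1mx (by omega),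
    Q.px0 (by omega)]; simp

theorem isC_std [DecidableEq κ] (G G' : Matrix ι κ K) : IsC (D.e d) (D.e c) (std m x G G') :=
  IsC.fromRows (isC_sm _ Q.fm Q.me) ((isC_sm _ Q.fmx Q.mxe).add (isC_sm _ Q.fmxx Q.mxxe))

section Coordinates

variable [Fintype κ] {F : Matrix ι κ S} {Z : Matrix κ κ' S}

theorem map0 (hF : IsC (D.e d) (D.e c) F) (hZ : IsC (D.e c) (D.e c) Z) :
    (F * Z).map (Q.h 0) = F.map (Q.h 0) * Z.map (D.χ c) := by
  ext i j
  simp only [Matrix.mul_apply, Matrix.map_apply, map_sum]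
  exact Finset.sum_congr rfl fun k _ => Q.mul0 _ _ (hF.1 _ _) (hF.2 _ _) (hZ.2 _ _) (hZ.1 _ _)

theorem map1 (hr : 1 ≤ r) (hF : IsC (D.e d) (D.e c) F) (hZ : IsC (D.e c) (D.e c) Z) :
    (F * Z).map (Q.h 1) = F.map (Q.h 0) * Z.map (Q.p 0) + F.map (Q.h 1) * Z.map (D.χ c) := by
  ext i j
  simp only [Matrix.mul_apply, Matrix.map_apply, map_sum, Matrix.add_apply,
    ← Finset.sum_add_distrib]
  exact Finset.sum_congr rfl fun k _ =>
    Q.mul1 hr _ _ (hF.1 _ _) (hF.2 _ _) (hZ.2 _ _) (hZ.1 _ _)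

theorem map2 (hr : 2 ≤ r) (hF : IsC (D.e d) (D.e c) F) (hZ : IsC (D.e c) (D.e c) Z) :
    (F * Z).map (Q.h 2) = F.map (Q.h 0) * Z.map (Q.p 1) + F.map (Q.h 1) * Z.map (Q.p 0) +
      F.map (Q.h 2) * Z.map (D.χ c) := by
  ext i j
  simp only [Matrix.mul_apply, Matrix.map_apply, map_sum, Matrix.add_apply,
    ← Finset.sum_add_distrib]
  exact Finset.sum_congr rfl fun k _ =>
    Q.mul2 hr _ _ (hF.1 _ _) (hF.2 _ _) (hZ.2 _ _) (hZ.1 _ _)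

theorem map_left (i : Fin 3) {Y : Matrix ι' κ S} {F : Matrix κ κ' S}
    (hY : IsC (D.e d) (D.e d) Y) (hF : IsC (D.e d) (D.e c) F) :
    (Y * F).map (Q.h i) = Y.map (D.χ d) * F.map (Q.h i) := by
  ext k j
  simp only [Matrix.mul_apply, Matrix.map_apply, map_sum]
  exact Finset.sum_congr rfl fun k _ => Q.left i _ _ (hY.1 _ _) (hY.2 _ _) (hF.1 _ _) (hF.2 _ _)

end Coordinates

theorem map_sm (i : Fin 3) (G : Matrix ι κ K) (a : S) :
    (sm G a).map (Q.h i) = Q.h i a • G := by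
  ext; simp [sm, mul_comm]

theorem map_add' (i : Fin 3) (F G : Matrix ι κ S) :
    (F + G).map (Q.h i) = F.map (Q.h i) + G.map (Q.h i) := by
  ext; simp

theorem std_map0 [DecidableEq κ] (G G' : Matrix ι κ K) :
    (std m x G G').map (Q.h 0) = fromRows 1 0 := by
  rw [std, fromRows_map, Q.map_add', Q.map_sm, Q.map_sm, Q.map_sm, Q.hm, Q.h0mx, Q.h0mxx]
  simp

theorem std_map1 (hr : 1 ≤ r) [DecidableEq κ] (G G' : Matrix ι κ K) :
    (std m x G G').map (Q.h 1) = fromRows 0 G := by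
  rw [std, fromRows_map, Q.map_add', Q.map_sm, Q.map_sm, Q.map_sm, Q.hm, Q.h1mx hr, Q.h1mxx hr]
  simp

theorem std_map2 (hr : 2 ≤ r) [DecidableEq κ] (G G' : Matrix ι κ K) :
    (std m x G G').map (Q.h 2) = fromRows 0 G' := by
  rw [std, fromRows_map, Q.map_add', Q.map_sm, Q.map_sm, Q.map_sm, Q.hm, Q.h2mx hr, Q.h2mxx hr]
  simp

/-- Extensions between normal forms, in coordinates. -/
theorem ext_coordinates [Fintype ι] [Fintype ι'] [Fintype κ] [Fintype κ'] [DecidableEq κ]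
    [DecidableEq κ'] {G₀ G₁ : Matrix ι κ K} {H₀ H₁ : Matrix ι' κ' K} {Z : Matrix κ κ' S}
    {Y : Matrix (κ ⊕ ι) (κ' ⊕ ι') S} {X₁ X₂ : Matrix ι κ' K} (hZ : IsC (D.e c) (D.e c) Z)
    (hY : IsC (D.e d) (D.e d) Y)
    (h : fromRows 0 (sm X₁ (m * x) + sm X₂ (m * x * x)) =
      std m x G₀ G₁ * Z + Y * std m x H₀ H₁) :
    ∃ (A : Matrix κ κ' K) (W : Matrix κ ι' K) (B : Matrix ι ι' K), Z.map (D.χ c) = A ∧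
      Y.map (D.χ d) = fromBlocks (-A) W 0 B ∧ (1 ≤ r → X₁ = G₀ * A + B * H₀) ∧
      (2 ≤ r → X₂ = G₁ * A - G₀ * W * H₀ + B * H₁) := by
  have hs := Q.isC_std G₀ G₁
  have hs' := Q.isC_std H₀ H₁
  obtain ⟨Y₁, W, Y₂, B, hYb⟩ : ∃ Y₁ W Y₂ B, Y.map (D.χ d) = fromBlocks Y₁ W Y₂ B :=
    ⟨_, _, _, _, (fromBlocks_toBlocks _).symm⟩
  have e0 := congrArg (fun M => M.map (Q.h 0)) h
  simp only [Q.map_add', Q.map0 hs hZ, Q.map_left 0 hY hs', Q.std_map0, fromRows_map, Q.map_sm,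
    hYb, fromRows_mul, fromBlocks_mul_fromRows, Q.h0mx, Q.h0mxx] at e0
  have e0' := fun i => congrFun (congrFun e0 i)
  have h1 : Y₁ = -Z.map (D.χ c) := by
    ext i j
    have := e0' (Sum.inl i) j
    simp at this
    simpa [eq_neg_iff_add_eq_zero, add_comm] using this.symm
  have h2 : Y₂ = 0 := by
    ext i j
    have := e0' (Sum.inr i) j
    simpa using this.symm
  refine ⟨_, W, B, rfl, by rw [hYb, h1, h2], fun hr => ?_, fun hr => ?_⟩
  · have e1 := congrArg (fun M => M.map (Q.h 1)) h
    simp only [Q.map_add', Q.map1 hr hs hZ, Q.map_left 1 hY hs', Q.std_map0, Q.std_map1 hr,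
      fromRows_map, Q.map_sm, hYb, fromRows_mul, fromBlocks_mul_fromRows, Q.h1mx hr, Q.h1mxx hr]
      at e1
    ext i j
    have := congrFun (congrFun e1 (Sum.inr i)) j
    simpa using this
  · have hr' : 1 ≤ r := by omega
    have e1 := congrArg (fun M => M.map (Q.h 1)) h
    simp only [Q.map_add', Q.map1 hr' hs hZ, Q.map_left 1 hY hs', Q.std_map0, Q.std_map1 hr',
      fromRows_map, Q.map_sm, hYb, fromRows_mul, fromBlocks_mul_fromRows, Q.h1mx hr', Q.h1mxx hr']
      at e1
    have hP : Z.map (Q.p 0) = -(W * H₀) := by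
      ext i j
      have := congrFun (congrFun e1 (Sum.inl i)) j
      simp at this
      simp [eq_neg_iff_add_eq_zero, this.symm]
    have e2 := congrArg (fun M => M.map (Q.h 2)) h
    simp only [Q.map_add', Q.map2 hr hs hZ, Q.map_left 2 hY hs', Q.std_map0, Q.std_map1 hr',
      Q.std_map2 hr, fromRows_map, Q.map_sm, hYb, fromRows_mul, fromBlocks_mul_fromRows,
      Q.h2mx hr, Q.h2mxx hr, hP] at e2
    ext i j
    have := congrFun (congrFun e2 (Sum.inr i)) j
    simp at this
    simp [this, Matrix.mul_assoc]
    ring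

/-- The coordinates of a matrix over the corner. -/
theorem decompose [Fintype κ] [DecidableEq κ] {F : Matrix ι κ S} (hF : IsC (D.e d) (D.e c) F) :
    ∃ (F₀ F₁ F₂ : Matrix ι κ K) (B : Matrix ι κ S), IsC (D.e d) (D.e d) B ∧
      (∀ i j, D.χ d (B i j) = 0) ∧ (∀ i j, B i j * (m * x) = 0) ∧
      F = sm F₀ m + sm F₁ (m * x) + sm F₂ (m * x * x) + B * sm (1 : Matrix κ κ K) m := by
  choose a b h1 h2 h3 h4 h5 using fun i j => Q.span (F i j) (hF.1 i j) (hF.2 i j)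
  refine ⟨of fun i j => a i j 0, of fun i j => a i j 1, of fun i j => a i j 2, of b, ⟨h1, h2⟩, h3,
    h4, ?_⟩
  ext i j
  rw [sm_one]
  simpa [sm, dg] using h5 i j

/-- Multiples of `m * x * x` which play no role are absorbed by the generator. -/
theorem sm_mxx_congr [Fintype κ] [DecidableEq κ] {G G' : Matrix ι κ K} (h : 2 ≤ r → G = G') :
    ∃ C : Matrix ι κ S, IsC (D.e d) (D.e d) C ∧
      sm G (m * x * x) = sm G' (m * x * x) + C * sm (1 : Matrix κ κ K) m := by
  rcases Nat.lt_or_ge r 2 with hr | hr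
  · obtain ⟨b, hb, hb', -, hm⟩ := Q.z2 hr
    refine ⟨sm (G - G') b, isC_sm _ hb hb', ?_⟩
    rw [sm_mul_sm, Matrix.mul_one, ← hm, sm_sub, add_sub_cancel]
  · exact ⟨0, IsC.zero, by rw [h hr, Matrix.zero_mul, add_zero]⟩

/-- Vanishing of extensions between normal forms, from coordinates. -/
theorem evan_std [Fintype ι] [Fintype ι'] [Fintype κ] [Fintype κ'] [DecidableEq κ]
    [DecidableEq κ'] {G₀ G₁ : Matrix ι κ K} {H₀ H₁ : Matrix ι' κ' K}
    (h : ∀ X₁ X₂ : Matrix ι κ' K, ∃ (A : Matrix κ κ' K) (B : Matrix ι ι' K) (W : Matrix κ ι' K),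
      (1 ≤ r → X₁ = G₀ * A + B * H₀) ∧ (2 ≤ r → X₂ = G₁ * A + B * H₁ - G₀ * W * H₀)) :
    EVan (D.e c) (D.e d) (std m x G₀ G₁) (std m x H₀ H₁) := by
  intro X hX
  obtain ⟨X₀, X₁, X₂, C, hC, -, -, rfl⟩ := Q.decompose hX
  obtain ⟨A, B, W, hr1, hr2⟩ := h X₁.toRows₂ (X₂.toRows₂ - G₀ * X₁.toRows₁)
  have s1 : sm X₁.toRows₂ (m * x) = sm (G₀ * A) (m * x) + sm (B * H₀) (m * x) := by
    rcases Nat.lt_or_ge r 1 with hr | hr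
    · simp [Q.z1 hr, sm_zero_right]
    · rw [hr1 hr, sm_add]
  obtain ⟨C', hC', s2⟩ := Q.sm_mxx_congr
    (G' := G₁ * A + B * H₁ - G₀ * W * H₀ + G₀ * X₁.toRows₁)
    fun hr => sub_eq_iff_eq_add.1 (hr2 hr)
  rw [sm_add, sm_sub, sm_add] at s2
  refine ⟨sm A (D.e c) + sm (X₁.toRows₁ - W * H₀) x + sm (X₂.toRows₁ - W * H₁) (x * x),
    sm (fromBlocks (X₀.toRows₁ - A) W X₀.toRows₂ B) (D.e d) +
      (fromCols (C + fromRows 0 C') (0 : Matrix (κ ⊕ ι) ι' S) : Matrix (κ ⊕ ι) (κ' ⊕ ι') S),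
    ((isC_sm _ (D.idem c) (D.idem c)).add (isC_sm _ Q.ex Q.xe)).add
      (isC_sm _ (by rw [← mul_assoc, Q.ex]) (by rw [mul_assoc, Q.xe])),
    (isC_sm _ (D.idem d) (D.idem d)).add ((hC.add (IsC.zero.fromRows hC')).fromCols IsC.zero), ?_⟩
  have c1 : ∀ M : Matrix (κ ⊕ ι) κ' K, ∀ a : S, sm M a = fromRows (sm M.toRows₁ a) (sm M.toRows₂ a) :=
    fun M a => by rw [← sm_fromRows, fromRows_toRows]
  have c2 : (fromCols (C + fromRows 0 C') (0 : Matrix (κ ⊕ ι) ι' S) : Matrix (κ ⊕ ι) (κ' ⊕ ι') S) *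
      std m x H₀ H₁ =
        fromRows 0 (C' * sm (1 : Matrix κ' κ' K) m) + C * sm (1 : Matrix κ' κ' K) m := by
    rw [std, fromCols_mul_fromRows, Matrix.zero_mul, add_zero, Matrix.add_mul, fromRows_mul,
      Matrix.zero_mul, add_comm]
  rw [Matrix.add_mul, c2, ← add_assoc, ← add_assoc]
  congr 1
  rw [c1 X₀, c1 X₁, c1 X₂, s1, s2, std, std, fromRows_mul, sm_fromBlocks, fromBlocks_mul_fromRows]
  ext (i | i) j
  · simp only [Matrix.mul_add, Matrix.add_mul, sm_mul_sm, Q.me, Q.fm, Q.mxe, Q.mxxe, Q.fmx, Q.fmxx,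
      sm_sub, Matrix.sub_mul, Matrix.one_mul, Matrix.mul_one, ← mul_assoc, Matrix.add_apply,
      fromRows_apply_inl, Matrix.sub_apply, Matrix.mul_sub, Matrix.zero_apply]
    abel
  · simp only [Matrix.mul_add, Matrix.add_mul, sm_mul_sm, Q.me, Q.fm, Q.mxe, Q.mxxe, Q.fmx, Q.fmxx,
      Q.z3, sm_sub, Matrix.sub_mul, Matrix.one_mul, Matrix.mul_one, ← mul_assoc, Matrix.add_apply,
      fromRows_apply_inr, Matrix.sub_apply, Matrix.mul_sub, sm_zero_right, Matrix.zero_apply,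
      zero_mul, ← Matrix.mul_assoc]
    abel

end Half
end TwoVertex
end TwoPoint

namespace TwoPoint

open Matrix

section ScalarEquivalences

variable {K S : Type} [Field K] [Ring S] [Algebra K S] {ι κ ι' κ' : Type} [Fintype κ] [Fintype ι]
  [Fintype κ'] [Fintype ι'] [DecidableEq κ] [DecidableEq ι] [DecidableEq κ'] [DecidableEq ι']
  {e f : S}

theorem MEquiv.mul_left {F : Matrix ι κ S} (he : e * e = e) (hF : IsC f e F) {U : Matrix ι' ι S}
    {U' : Matrix ι ι' S} (hU : IsC f f U) (hU' : IsC f f U') (h : U * U' = dg ι' f)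
    (h' : U' * U = dg ι f) : MEquiv e f F (U * F) :=
  ⟨U, U', dg κ e, dg κ e, hU, hU', isC_dg he, isC_dg he, h, h', dg_mul (isC_dg he),
    dg_mul (isC_dg he), (mul_dg (hU.mul hF)).symm⟩

theorem MEquiv.mul_right {F : Matrix ι κ S} (hf : f * f = f) (hF : IsC f e F) {V : Matrix κ κ' S}
    {V' : Matrix κ' κ S} (hV : IsC e e V) (hV' : IsC e e V') (h : V * V' = dg κ e)
    (h' : V' * V = dg κ' e) : MEquiv e f F (F * V) :=
  ⟨dg ι f, dg ι f, V, V', isC_dg hf, isC_dg hf, hV, hV', dg_mul (isC_dg hf),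
    dg_mul (isC_dg hf), h, h', by rw [dg_mul hF]⟩

theorem MEquiv.sm_mul {F : Matrix ι κ S} (he : e * e = e) (hf : f * f = f) (hF : IsC f e F)
    {U : Matrix ι' ι K} {U' : Matrix ι ι' K} (h : U * U' = 1) (h' : U' * U = 1) :
    MEquiv e f F (sm U f * F) :=
  .mul_left he hF (isC_sm U hf hf) (isC_sm U' hf hf) (by rw [sm_mul_sm, h, hf, sm_one])
    (by rw [sm_mul_sm, h', hf, sm_one])

theorem MEquiv.mul_sm {F : Matrix ι κ S} (he : e * e = e) (hf : f * f = f) (hF : IsC f e F)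
    {V : Matrix κ κ' K} {V' : Matrix κ' κ K} (h : V * V' = 1) (h' : V' * V = 1) :
    MEquiv e f F (F * sm V e) :=
  .mul_right hf hF (isC_sm V he he) (isC_sm V' he he) (by rw [sm_mul_sm, h, he, sm_one])
    (by rw [sm_mul_sm, h', he, sm_one])

theorem MEquiv.submatrix {F : Matrix ι κ S} (he : e * e = e) (hf : f * f = f) (hF : IsC f e F)
    (r : ι' ≃ ι) (s : κ' ≃ κ) : MEquiv e f F (F.submatrix r s) := by
  have h1 : (dg ι f).submatrix r id * F = F.submatrix r id := by
    ext i j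
    simp [Matrix.mul_apply, dg, Matrix.diagonal_apply, hF.1]
  have h2 : F.submatrix r id * (dg κ e).submatrix id s = F.submatrix r s := by
    ext i j
    simp [Matrix.mul_apply, dg, Matrix.diagonal_apply, hF.2]
  have hr : ∀ r : ι' ≃ ι, (dg ι f).submatrix r r = dg ι' f := fun r => by simp [dg]
  have hs : ∀ s : κ' ≃ κ, (dg κ e).submatrix s s = dg κ' e := fun s => by simp [dg]
  rw [← h2, ← h1]
  have a1 := MEquiv.mul_left (U := (dg ι f).submatrix r id) (U' := (dg ι f).submatrix id r) he hF
    ((isC_dg hf).submatrix _ _) ((isC_dg hf).submatrix _ _)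
    (by rw [← submatrix_mul _ _ _ _ _ Function.bijective_id, dg_mul (isC_dg hf), hr])
    (by rw [submatrix_mul_equiv, dg_mul (isC_dg hf), submatrix_id_id])
  refine a1.trans (MEquiv.mul_right (V' := (dg κ e).submatrix s id) hf (a1.isC hF)
    ((isC_dg he).submatrix _ _) ((isC_dg he).submatrix _ _) ?_ ?_)
  · rw [submatrix_mul_equiv, dg_mul (isC_dg he), submatrix_id_id]
  · rw [← submatrix_mul _ _ _ _ _ Function.bijective_id, dg_mul (isC_dg he), hs]

end ScalarEquivalences

namespace TwoVertex
namespace Half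

variable {K S : Type} [Field K] [Ring S] [Algebra K S] {D : TwoVertex K S} {c d : Fin 2}
  {r : ℕ} {m x : S} (Q : D.Half c d r m x) {ι κ ι' κ' : Type} [Fintype ι] [Fintype κ]
  [Fintype ι'] [Fintype κ'] [DecidableEq ι] [DecidableEq κ] [DecidableEq ι'] [DecidableEq κ']

include Q

theorem x_mem : x ∈ D.J := by
  rw [D.mem_J]
  intro i
  by_cases h : i = c
  · rw [h, Q.χx]
  · rw [← Q.ex, map_mul, D.χe, if_neg h, zero_mul]

section

variable [Module.Finite K S]

theorem clear (P₁ P₂ : Matrix κ κ K) (G₀ G₁ : Matrix ι κ K) : MEquiv (D.e c) (D.e d)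
    (fromRows (sm (1 : Matrix κ κ K) m + sm P₁ (m * x) + sm P₂ (m * x * x))
      (sm G₀ (m * x) + sm G₁ (m * x * x))) (std m x G₀ (G₁ - G₀ * P₁)) := by
  set E := fromRows (sm (1 : Matrix κ κ K) m + sm P₁ (m * x) + sm P₂ (m * x * x))
      (sm G₀ (m * x) + sm G₁ (m * x * x)) with hE
  have hEC : IsC (D.e d) (D.e c) E :=
    (((isC_sm _ Q.fm Q.me).add (isC_sm _ Q.fmx Q.mxe)).add (isC_sm _ Q.fmxx Q.mxxe)).fromRows
      ((isC_sm _ Q.fmx Q.mxe).add (isC_sm _ Q.fmxx Q.mxxe))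
  have hxx : D.e c * (x * x) = x * x := by rw [← mul_assoc, Q.ex]
  have hxx' : x * x * D.e c = x * x := by rw [mul_assoc, Q.xe]
  obtain ⟨W, hW, h1, h2⟩ := D.exists_inverse (c := c)
    (W := sm (-P₁) x + sm (P₁ * P₁ - P₂) (x * x)) ((isC_sm _ Q.ex Q.xe).add (isC_sm _ hxx hxx'))
    (fun i j => D.J.add_mem (Submodule.smul_of_tower_mem _ _ Q.x_mem)
      (Submodule.smul_of_tower_mem _ _ (D.J.mul_mem_left _ Q.x_mem)))
  convert MEquiv.mul_right (D.idem d) hEC ((isC_dg (D.idem c)).add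
    ((isC_sm _ Q.ex Q.xe).add (isC_sm _ hxx hxx'))) hW h1 h2 using 1
  rw [← sm_one (K := K), hE, fromRows_mul, std]
  congr 1
  · simp only [Matrix.mul_add, Matrix.add_mul, sm_mul_sm, Q.me, Q.mxe, Q.mxxe, Q.z3, ← mul_assoc,
      sm_zero_right, Matrix.one_mul, Matrix.mul_one, sm_sub, sm_neg, zero_mul, Matrix.mul_sub,
      Matrix.mul_neg]
    abel
  · simp only [Matrix.mul_add, Matrix.add_mul, sm_mul_sm, Q.me, Q.mxe, Q.mxxe, Q.z3, ← mul_assoc,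
      sm_zero_right, Matrix.one_mul, Matrix.mul_one, sm_sub, sm_neg, zero_mul, Matrix.mul_sub,
      Matrix.mul_neg]
    abel

/-- Reduction to the normal form. -/
theorem mequiv_std {F : Matrix ι κ S} (hF : IsC (D.e d) (D.e c) F) {L : Matrix κ ι K}
    (hL : L * F.map (Q.h 0) = 1) : ∃ (n : ℕ) (G₀ G₁ : Matrix (Fin n) κ K),
      MEquiv (D.e c) (D.e d) F (std m x G₀ G₁) := by
  obtain ⟨F₀, F₁, F₂, B, hB, hχ, hBx, hFe⟩ := Q.decompose hF
  have h0 : F.map (Q.h 0) = F₀ := by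
    rw [hFe, Q.map_add', Q.map_add', Q.map_add', Q.map_left 0 hB (isC_sm _ Q.fm Q.me),
      Q.map_sm, Q.map_sm, Q.map_sm, Q.hm, Q.h0mx, Q.h0mxx,
      show B.map (D.χ d) = 0 from Matrix.ext hχ]
    simp
  rw [h0] at hL
  have hx0 : ∀ G : Matrix κ κ K, B * sm G (m * x) = 0 := fun G => by
    ext; simp [Matrix.mul_apply, sm, hBx]
  have hBx' : ∀ i j, B i j * (m * x * x) = 0 := fun i j => by rw [← mul_assoc, hBx, zero_mul]
  have hx1 : ∀ G : Matrix κ κ K, B * sm G (m * x * x) = 0 := fun G => by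
    ext; simp [Matrix.mul_apply, sm, hBx']
  set E := sm F₀ m + sm F₁ (m * x) + sm F₂ (m * x * x) with hE
  have hEC : IsC (D.e d) (D.e c) E :=
    ((isC_sm _ Q.fm Q.me).add (isC_sm _ Q.fmx Q.mxe)).add (isC_sm _ Q.fmxx Q.mxxe)
  have hWC : IsC (D.e d) (D.e d) (B * sm L (D.e d)) := hB.mul (isC_sm _ (D.idem d) (D.idem d))
  have hFE : (dg ι (D.e d) + B * sm L (D.e d)) * E = F := by
    rw [Matrix.add_mul, dg_mul hEC, hFe, hE, Matrix.mul_assoc]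
    simp only [Matrix.mul_add, sm_mul_sm, Q.fm, Q.fmx, Q.fmxx, hL, hx0, hx1, add_zero]
  have hBJ : ∀ i j, B i j ∈ D.J := fun i j => by
    rw [D.mem_J]
    intro k
    by_cases h : k = d
    · rw [h, hχ]
    · rw [← hB.1, map_mul, D.χe, if_neg h, zero_mul]
  obtain ⟨W', hW', h1, h2⟩ := D.exists_inverse hWC (fun i j => by
    rw [Matrix.mul_apply]
    exact D.J.sum_mem fun k _ => D.J_mul_right (hBJ i k) _)
  have hdC : IsC (D.e d) (D.e d) (dg ι (D.e d) + B * sm L (D.e d)) :=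
    (isC_dg (D.idem d)).add hWC
  have a1 : MEquiv (D.e c) (D.e d) F E :=
    MEquiv.symm hEC (hFE ▸ MEquiv.mul_left (D.idem c) hEC hdC hW' h1 h2)
  obtain ⟨n, U, U', hU, hU', hUF⟩ := row_reduction hL
  have a2 := MEquiv.sm_mul (D.idem c) (D.idem d) hEC hU hU'
  refine ⟨n, (U * F₁).toRows₂, (U * F₂).toRows₂ - (U * F₁).toRows₂ * (U * F₁).toRows₁,
    (a1.trans a2).trans ?_⟩
  convert Q.clear (U * F₁).toRows₁ (U * F₂).toRows₁ (U * F₁).toRows₂ (U * F₂).toRows₂ using 1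
  have c1 : ∀ M : Matrix (κ ⊕ Fin n) κ K, ∀ a : S,
      sm M a = fromRows (sm M.toRows₁ a) (sm M.toRows₂ a) :=
    fun M a => by rw [← sm_fromRows, fromRows_toRows]
  rw [hE]
  simp only [Matrix.mul_add, sm_mul_sm, Q.fm, Q.fmx, Q.fmxx, hUF]
  rw [c1 (U * F₁), c1 (U * F₂), sm_fromRows, sm_zero]
  ext (i | i) j <;> simp

omit [Fintype ι'] [DecidableEq ι'] in
theorem std_shift (G₀ G₁ : Matrix ι κ K) (W : Matrix κ ι K) :
    MEquiv (D.e c) (D.e d) (std m x G₀ G₁) (std m x G₀ (G₁ - G₀ * W * G₀)) := by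
  have a1 := MEquiv.sm_mul (D.idem c) (D.idem d) (Q.isC_std G₀ G₁)
    (U := fromBlocks 1 W 0 1) (U' := fromBlocks 1 (-W) 0 1)
    (by simp [fromBlocks_multiply]) (by simp [fromBlocks_multiply])
  refine a1.trans ?_
  have := Q.clear (W * G₀) (W * G₁) G₀ G₁
  rw [← Matrix.mul_assoc] at this
  convert this using 1
  rw [std, sm_fromBlocks, fromBlocks_mul_fromRows]
  simp only [Matrix.mul_add, sm_mul_sm, Q.fm, Q.fmx, Q.fmxx, sm_zero, Matrix.zero_mul, zero_add,
    Matrix.one_mul, add_assoc]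

end

theorem std_mul (G₀ G₁ : Matrix ι κ K) {P : Matrix ι' ι K} {P' : Matrix ι ι' K}
    {Z : Matrix κ κ' K} {Z' : Matrix κ' κ K} (h1 : P * P' = 1) (h2 : P' * P = 1) (h3 : Z * Z' = 1)
    (h4 : Z' * Z = 1) :
    MEquiv (D.e c) (D.e d) (std m x G₀ G₁) (std m x (P * G₀ * Z) (P * G₁ * Z)) := by
  have a1 := MEquiv.sm_mul (D.idem c) (D.idem d) (Q.isC_std G₀ G₁)
    (U := fromBlocks Z' 0 0 P) (U' := fromBlocks Z 0 0 P')
    (by simp [fromBlocks_multiply, h1, h4]) (by simp [fromBlocks_multiply, h2, h3])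
  have a2 := MEquiv.mul_sm (D.idem c) (D.idem d) (a1.isC (Q.isC_std G₀ G₁)) h3 h4
  refine a1.trans ?_
  convert a2 using 1
  rw [std, std, sm_fromBlocks, fromBlocks_mul_fromRows, fromRows_mul]
  simp only [Matrix.mul_add, Matrix.add_mul, sm_mul_sm, Q.fm, Q.fmx, Q.fmxx, Q.me, Q.mxe, Q.mxxe,
    sm_zero, Matrix.zero_mul, zero_add, add_zero, Matrix.mul_one, h4]

/-- Self-extensions vanish only if the leading coefficient has full rank. -/
theorem full_rank_of_evan {F : Matrix ι κ S} (hF : IsC (D.e d) (D.e c) F)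
    (h : EVan (D.e c) (D.e d) F F) :
    (∃ L : Matrix κ ι K, L * F.map (Q.h 0) = 1) ∨ ∃ L : Matrix κ ι K, F.map (Q.h 0) * L = 1 := by
  refine full_rank fun X => ?_
  obtain ⟨Z, Y, hZ, hY, hX⟩ := h (sm X m) (isC_sm _ Q.fm Q.me)
  refine ⟨Z.map (D.χ c), Y.map (D.χ d), ?_⟩
  have := congrArg (fun M => M.map (Q.h 0)) hX
  simpa [Q.map_add', Q.map0 hF hZ, Q.map_left 0 hY hF, Q.map_sm, Q.hm] using this

end Half
end TwoVertex
end TwoPoint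

namespace TwoPoint

open Matrix

/-- The coefficients of a matrix in normal form. -/
structure Shape (K : Type) where
  ι : Type
  κ : Type
  b : Type
  [finι : Fintype ι]
  [finκ : Fintype κ]
  [finb : Fintype b]
  [decι : DecidableEq ι]
  [decκ : DecidableEq κ]
  [decb : DecidableEq b]
  eb : b ≃ κ ⊕ ι
  G₀ : Matrix ι κ K
  G₁ : Matrix ι κ K

attribute [instance] Shape.finι Shape.finκ Shape.finb Shape.decι Shape.decκ Shape.decb

namespace Shape

variable {K : Type} [Field K]

/-- The matrix with given coefficients. -/
abbrev obj {S : Type} [Ring S] [Algebra K S] (m x : S) (t : Shape K) : MatObj S where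
  b := t.b
  a := t.κ
  F := (std m x t.G₀ t.G₁).submatrix t.eb id

/-- Vanishing of extensions in coordinates. -/
def Ext (r : ℕ) (s t : Shape K) : Prop :=
  ∀ X₁ X₂ : Matrix s.ι t.κ K, ∃ (A : Matrix s.κ t.κ K) (B : Matrix s.ι t.ι K)
    (W : Matrix s.κ t.ι K), (1 ≤ r → X₁ = s.G₀ * A + B * t.G₀) ∧
      (2 ≤ r → X₂ = s.G₁ * A + B * t.G₁ - s.G₀ * W * t.G₀)

/-- Homomorphisms in coordinates. -/
def Hom (r : ℕ) (s t : Shape K) (A : Matrix s.κ t.κ K) (W : Matrix s.κ t.ι K)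
    (B : Matrix s.ι t.ι K) : Prop :=
  (1 ≤ r → s.G₀ * A = B * t.G₀) ∧ (2 ≤ r → s.G₁ * A + s.G₀ * W * t.G₀ = B * t.G₁)

/-- Endomorphisms have only one eigenvalue. -/
def Indec (r : ℕ) (t : Shape K) : Prop :=
  ∀ A W B, Hom r t t A W B →
    ∃ (a : K) (n : ℕ), (fromBlocks A W 0 B - Matrix.scalar (t.κ ⊕ t.ι) a) ^ n = 0

/-- Two consecutive elements of a chain. -/
structure Pair (r : ℕ) (s t : Shape K) : Prop where
  ext : Ext r s s
  ext' : Ext r t t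
  ext1 : Ext r s t
  ext2 : Ext r t s
  fac : ∀ l, ∃ A B k, Hom 2 s t A 0 B ∧ ∀ j, A k j = if j = l then 1 else 0
  dfac : ∀ l, ∃ A W B k, Hom 2 s t A W B ∧
    ∀ j, (fromBlocks A W 0 B : Matrix _ _ K) j k = if j = l then 1 else 0
  ne : Fintype.card s.κ ≠ Fintype.card t.κ ∨ ∀ A W B, Hom r t s A W B → A = 0
  dne : Fintype.card (s.κ ⊕ s.ι) ≠ Fintype.card (t.κ ⊕ t.ι) ∨ ∀ A W B, Hom r t s A W B →
    (fromBlocks A W 0 B : Matrix _ _ K) = 0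
  nonempty : Nonempty s.κ
  indec : Indec r s
  indec' : Indec r t

variable (K)

/-- The simple presentation of a generator. -/
abbrev s11 : Shape K := ⟨Empty, Unit, Unit, (Equiv.sumEmpty Unit Empty).symm, 0, 0⟩

/-- The shifted projective. -/
abbrev s10 : Shape K := ⟨Unit, Empty, Unit, (Equiv.emptySum Empty Unit).symm, 0, 0⟩

/-- One generator, two relations. -/
abbrev s12 : Shape K := ⟨Unit, Unit, Unit ⊕ Unit, Equiv.refl _, 1, 0⟩

/-- One generator, three relations. -/
abbrev s13 : Shape K :=
  ⟨Unit ⊕ Unit, Unit, Unit ⊕ (Unit ⊕ Unit), Equiv.refl _, fromRows 1 0, fromRows 0 1⟩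

/-- Two generators, three relations. -/
abbrev s23 : Shape K :=
  ⟨Unit, Unit ⊕ Unit, (Unit ⊕ Unit) ⊕ Unit, Equiv.refl _, fromCols 1 0, fromCols 0 1⟩

variable {K} {r : ℕ}

theorem ext_of_isEmpty_left (s t : Shape K) [IsEmpty s.ι] : Ext r s t := fun _ _ =>
  ⟨0, 0, 0, fun _ => Matrix.ext fun i => isEmptyElim i, fun _ => Matrix.ext fun i => isEmptyElim i⟩

theorem ext_of_isEmpty_right (s t : Shape K) [IsEmpty t.κ] : Ext r s t := fun _ _ =>
  ⟨0, 0, 0, fun _ => Matrix.ext fun _ j => isEmptyElim j, fun _ => Matrix.ext fun _ j => isEmptyElim j⟩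

theorem ext_of_le {s t : Shape K} (hr : r ≤ 1)
    (h : ∀ X₁ : Matrix s.ι t.κ K, ∃ (A : Matrix s.κ t.κ K) (B : Matrix s.ι t.ι K),
      X₁ = s.G₀ * A + B * t.G₀) : Ext r s t := fun X₁ X₂ =>
  let ⟨A, B, h⟩ := h X₁
  ⟨A, B, 0, fun _ => h, fun _ => by omega⟩

theorem hom_of_isEmpty_left {s t : Shape K} [IsEmpty s.ι] {A : Matrix s.κ t.κ K}
    {W : Matrix s.κ t.ι K} {B : Matrix s.ι t.ι K} : Hom r s t A W B :=
  ⟨fun _ => Matrix.ext fun i => isEmptyElim i, fun _ => Matrix.ext fun i => isEmptyElim i⟩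

theorem hom_of_isEmpty_right {s t : Shape K} [IsEmpty t.κ] {A : Matrix s.κ t.κ K}
    {W : Matrix s.κ t.ι K} {B : Matrix s.ι t.ι K} : Hom r s t A W B :=
  ⟨fun _ => Matrix.ext fun _ j => isEmptyElim j, fun _ => Matrix.ext fun _ j => isEmptyElim j⟩

theorem indec_11 : Indec r (s11 K) := fun A W B _ => ⟨A () (), 1, by
  rw [pow_one]; ext (i | i) (j | j)
  · simp
  all_goals first | exact i.elim | exact j.elim⟩

theorem indec_10 : Indec r (s10 K) := fun A W B _ => ⟨B () (), 1, by
  rw [pow_one]; ext (i | i) (j | j)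
  on_goal 4 => simp
  all_goals first | exact i.elim | exact j.elim⟩

theorem indec_12 (hr : 1 ≤ r) : Indec r (s12 K) := fun A W B h => ⟨A () (), 2, by
  have h1 := h.1 hr
  simp only [Matrix.one_mul, Matrix.mul_one] at h1
  subst h1
  rw [pow_two]
  ext (i | i) (j | j) <;> simp [Matrix.mul_apply]⟩

theorem indec_13 (hr : 2 ≤ r) : Indec r (s13 K) := fun A W B h => ⟨A () (), 3, by
  have h1 := fun i j => congrFun (congrFun (h.1 (by omega)) i) j
  have h2 := fun i j => congrFun (congrFun (h.2 hr) i) j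
  simp [Matrix.mul_apply] at h1 h2
  rw [pow_succ, pow_two]
  ext (i | i | i) (j | j | j) <;>
    simp [Matrix.mul_apply, ← h1.1, ← h1.2, ← h2.1, ← h2.2]⟩

theorem indec_23 (hr : 2 ≤ r) : Indec r (s23 K) := fun A W B h => ⟨B () (), 3, by
  have h1 := fun i j => congrFun (congrFun (h.1 (by omega)) i) j
  have h2 := fun i j => congrFun (congrFun (h.2 hr) i) j
  simp [Matrix.mul_apply] at h1 h2
  rw [pow_succ, pow_two]
  ext ((i | i) | i) ((j | j) | j) <;>
    simp [Matrix.mul_apply, (h1 ()).1, (h1 ()).2, (h2 ()).2, eq_neg_of_add_eq_zero_left ((h2 ()).1 _)]⟩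

theorem dfac_10 {s : Shape K} (l : s.κ ⊕ s.ι) : ∃ A W B k, Hom 2 s (s10 K) A W B ∧
    ∀ j, (fromBlocks A W 0 B : Matrix _ _ K) j k = if j = l then 1 else 0 :=
  ⟨0, of fun i _ => if Sum.inl i = l then 1 else 0, of fun i _ => if Sum.inr i = l then 1 else 0,
    Sum.inr (), hom_of_isEmpty_right, by rintro (j | j) <;> rfl⟩

theorem pair_11_10 (hr : r < 1) : Pair r (s11 K) (s10 K) where
  ext := ext_of_isEmpty_left _ _
  ext' := ext_of_isEmpty_right _ _
  ext1 := ext_of_isEmpty_left _ _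
  ext2 := fun _ _ => ⟨0, 0, 0, fun _ => by omega, fun _ => by omega⟩
  fac := fun l => l.elim
  dfac := dfac_10
  ne := Or.inl (by simp)
  dne := Or.inr fun A W B _ => by
    ext (i | i) (j | j)
    all_goals first | exact i.elim | exact j.elim | rfl
  nonempty := inferInstance
  indec := indec_11
  indec' := indec_10

theorem fac_11 {t : Shape K} (l : t.κ) : ∃ A B k, Hom 2 (s11 K) t A 0 B ∧
    ∀ j, A k j = if j = l then 1 else 0 :=
  ⟨of fun _ j => if j = l then 1 else 0, 0, (), hom_of_isEmpty_left, fun _ => rfl⟩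

theorem dfac_11 {t : Shape K} (k : t.κ) (l : Unit ⊕ Empty) : ∃ A W B k, Hom 2 (s11 K) t A W B ∧
    ∀ j, (fromBlocks A W 0 B : Matrix _ _ K) j k = if j = l then 1 else 0 :=
  ⟨of fun _ _ => 1, 0, 0, Sum.inl k, hom_of_isEmpty_left, by
    rintro (j | j)
    · rcases l with l | l
      · rfl
      · exact l.elim
    · exact j.elim⟩

theorem pair_11_12 (hr : r = 1) : Pair r (s11 K) (s12 K) where
  ext := ext_of_isEmpty_left _ _
  ext' := ext_of_le hr.le fun X => ⟨X, 0, by simp⟩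
  ext1 := ext_of_isEmpty_left _ _
  ext2 := ext_of_le hr.le fun X => ⟨X, 0, by simp⟩
  fac := fac_11
  dfac := dfac_11 ()
  ne := Or.inr fun A W B h => by simpa using h.1 hr.ge
  dne := Or.inl (by simp)
  nonempty := inferInstance
  indec := indec_11
  indec' := indec_12 hr.ge

theorem pair_12_10 (hr : r = 1) : Pair r (s12 K) (s10 K) where
  ext := ext_of_le hr.le fun X => ⟨X, 0, by simp⟩
  ext' := ext_of_isEmpty_right _ _
  ext1 := ext_of_isEmpty_right _ _
  ext2 := ext_of_le hr.le fun X => ⟨0, X, by simp⟩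
  fac := fun l => l.elim
  dfac := dfac_10
  ne := Or.inl (by simp)
  dne := Or.inl (by simp)
  nonempty := inferInstance
  indec := indec_12 hr.ge
  indec' := indec_10

theorem ext_12_12 : Ext r (s12 K) (s12 K) := fun X₁ X₂ =>
  ⟨X₁, 0, -X₂, fun _ => by simp, fun _ => by simp⟩

theorem ext_13_13 : Ext r (s13 K) (s13 K) := fun X₁ X₂ =>
  ⟨0, fromCols X₁ X₂, 0, fun _ => by simp [fromCols_mul_fromRows],
    fun _ => by simp [fromCols_mul_fromRows]⟩

theorem ext_23_23 : Ext r (s23 K) (s23 K) := fun X₁ X₂ =>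
  ⟨fromRows X₁ X₂, 0, 0, fun _ => by simp [fromCols_mul_fromRows],
    fun _ => by simp [fromCols_mul_fromRows]⟩

theorem pair_11_23 (hr : 2 ≤ r) : Pair r (s11 K) (s23 K) where
  ext := ext_of_isEmpty_left _ _
  ext' := ext_23_23
  ext1 := ext_of_isEmpty_left _ _
  ext2 := fun X₁ X₂ => ⟨fromRows X₁ X₂, 0, 0, fun _ => by simp [fromCols_mul_fromRows],
    fun _ => by simp [fromCols_mul_fromRows]⟩
  fac := fac_11
  dfac := dfac_11 (Sum.inl ())
  ne := Or.inl (by simp)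
  dne := Or.inl (by simp)
  nonempty := inferInstance
  indec := indec_11
  indec' := indec_23 hr

theorem pair_23_12 (hr : 2 ≤ r) : Pair r (s23 K) (s12 K) where
  ext := ext_23_23
  ext' := ext_12_12
  ext1 := fun X₁ X₂ => ⟨fromRows X₁ X₂, 0, 0, fun _ => by simp [fromCols_mul_fromRows],
    fun _ => by simp [fromCols_mul_fromRows]⟩
  ext2 := fun X₁ X₂ => ⟨X₁ - fromCols X₂.toCols₂ 0, X₂.toCols₂, -X₂.toCols₁,
    fun _ => by simp [mul_fromCols], fun _ => by ext i (j | j) <;> simp [mul_fromCols]⟩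
  fac := fun l => ⟨fromRows 1 0, 1, Sum.inl (), ⟨fun _ => by simp [fromCols_mul_fromRows],
    fun _ => by simp [fromCols_mul_fromRows]⟩, fun _ => by simp⟩
  dfac := by
    rintro ((l | l) | l)
    · refine ⟨fromRows 1 0, 0, 1, Sum.inl (), ⟨fun _ => by simp [fromCols_mul_fromRows],
        fun _ => by simp [fromCols_mul_fromRows]⟩, ?_⟩
      rintro ((j | j) | j) <;> simp
    · refine ⟨fromRows 0 1, fromRows (-1) 0, 0, Sum.inl (),
        ⟨fun _ => by simp [fromCols_mul_fromRows], fun _ => by simp [fromCols_mul_fromRows]⟩, ?_⟩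
      rintro ((j | j) | j) <;> simp
    · refine ⟨fromRows 1 0, 0, 1, Sum.inr (), ⟨fun _ => by simp [fromCols_mul_fromRows],
        fun _ => by simp [fromCols_mul_fromRows]⟩, ?_⟩
      rintro ((j | j) | j) <;> simp
  ne := Or.inl (by simp)
  dne := Or.inl (by simp)
  nonempty := inferInstance
  indec := indec_23 hr
  indec' := indec_12 (by omega)

theorem pair_12_13 (hr : 2 ≤ r) : Pair r (s12 K) (s13 K) where
  ext := ext_12_12
  ext' := ext_13_13
  ext1 := fun X₁ X₂ => ⟨X₁, fromCols 0 X₂, 0, fun _ => by simp [fromCols_mul_fromRows],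
    fun _ => by simp [fromCols_mul_fromRows]⟩
  ext2 := fun X₁ X₂ => ⟨X₂.toRows₂, X₁ - fromRows X₂.toRows₂ 0, -X₂.toRows₁,
    fun _ => by simp [fromRows_mul], fun _ => by ext (i | i) j <;> simp [fromRows_mul]⟩
  fac := fun l => ⟨1, fromCols 1 0, (), ⟨fun _ => by simp [fromCols_mul_fromRows],
    fun _ => by simp [fromCols_mul_fromRows]⟩, fun _ => by simp⟩
  dfac := by
    rintro (l | l)
    · refine ⟨1, 0, fromCols 1 0, Sum.inl (), ⟨fun _ => by simp [fromCols_mul_fromRows],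
        fun _ => by simp [fromCols_mul_fromRows]⟩, ?_⟩
      rintro (j | j) <;> simp
    · refine ⟨1, 0, fromCols 1 0, Sum.inr (Sum.inl ()),
        ⟨fun _ => by simp [fromCols_mul_fromRows], fun _ => by simp [fromCols_mul_fromRows]⟩, ?_⟩
      rintro (j | j) <;> simp
  ne := Or.inr fun A W B h => by
    have h1 := h.2 hr
    ext i j
    have h2 := congrFun (congrFun h1 (Sum.inr ())) j
    simpa [fromRows_mul] using h2
  dne := Or.inl (by simp)
  nonempty := inferInstance
  indec := indec_12 (by omega)
  indec' := indec_13 hr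

theorem pair_13_10 (hr : 2 ≤ r) : Pair r (s13 K) (s10 K) where
  ext := ext_13_13
  ext' := ext_of_isEmpty_right _ _
  ext1 := ext_of_isEmpty_right _ _
  ext2 := fun X₁ X₂ => ⟨0, fromCols X₁ X₂, 0, fun _ => by simp [fromCols_mul_fromRows],
    fun _ => by simp [fromCols_mul_fromRows]⟩
  fac := fun l => l.elim
  dfac := dfac_10
  ne := Or.inl (by simp)
  dne := Or.inl (by simp)
  nonempty := inferInstance
  indec := indec_13 hr
  indec' := indec_10

variable (K)

/-- The indecomposable presentations over a half of a corner, in their natural order. -/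
def chain : ℕ → ℕ → Shape K
  | _, 0 => s11 K
  | 0, _ => s10 K
  | 1, 1 => s12 K
  | 1, _ => s10 K
  | _, 1 => s23 K
  | _, 2 => s12 K
  | _, 3 => s13 K
  | _, _ => s10 K

/-- The length of a chain. -/
def len : ℕ → ℕ
  | 0 => 1
  | 1 => 2
  | _ => 4

variable {K}

theorem chain_zero (r : ℕ) : chain K r 0 = s11 K := by
  rcases r with _ | _ | r <;> rfl

theorem chain_len (r : ℕ) : chain K r (len r) = s10 K := by
  rcases r with _ | _ | r <;> rfl

theorem pair_chain (r j : ℕ) (h : j < len r) : Pair r (chain K r j) (chain K r (j + 1)) := by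
  rcases r with _ | _ | r
  · obtain rfl : j = 0 := by simp only [len] at h; omega
    exact pair_11_10 zero_lt_one
  · obtain rfl | rfl : j = 0 ∨ j = 1 := by simp only [len] at h; omega
    · exact pair_11_12 rfl
    · exact pair_12_10 rfl
  · obtain rfl | rfl | rfl | rfl : j = 0 ∨ j = 1 ∨ j = 2 ∨ j = 3 := by
      simp only [len] at h; omega
    · exact pair_11_23 (by omega)
    · exact pair_23_12 (by omega)
    · exact pair_12_13 (by omega)
    · exact pair_13_10 (by omega)

end Shape
end TwoPoint

namespace TwoPoint

open Matrix

section Distribution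

variable {K τ τ' n : Type}

/-- Reindexing of a diagonal sum of two families of blocks. -/
def blockEquiv {a a' b b' c c' ι κ : Type} (e : b ≃ c ⊕ a) (e' : b' ≃ c' ⊕ a')
    (er : (τ × a) ⊕ (τ' × a') ≃ ι) (ec : (τ × c) ⊕ (τ' × c') ≃ κ) :
    (τ × b) ⊕ (τ' × b') ≃ κ ⊕ ι :=
  ((((Equiv.refl τ).prodCongr e).trans (Equiv.prodSumDistrib τ c a)).sumCongr
    (((Equiv.refl τ').prodCongr e').trans (Equiv.prodSumDistrib τ' c' a'))).trans
    ((Equiv.sumSumSumComm _ _ _ _).trans (ec.sumCongr er))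

/-- `τ × ∅ ⊔ n × 1 = n` -/
def eEmptyUnit : (τ × Empty) ⊕ (n × Unit) ≃ n where
  toFun
    | .inl p => p.2.elim
    | .inr p => p.1
  invFun i := .inr (i, ())
  left_inv := by rintro (⟨_, ⟨⟩⟩ | ⟨_, ⟨⟩⟩); rfl
  right_inv _ := rfl

/-- `τ × 1 ⊔ n × ∅ = τ` -/
def eUnitEmpty : (τ × Unit) ⊕ (n × Empty) ≃ τ where
  toFun
    | .inr p => p.2.elim
    | .inl p => p.1
  invFun i := .inl (i, ())
  left_inv := by rintro (⟨_, ⟨⟩⟩ | ⟨_, ⟨⟩⟩); rfl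
  right_inv _ := rfl

/-- `τ × 1 ⊔ n × 1 = τ ⊔ n` -/
def eUnitUnit : (τ × Unit) ⊕ (n × Unit) ≃ τ ⊕ n where
  toFun
    | .inl p => .inl p.1
    | .inr p => .inr p.1
  invFun
    | .inl i => .inl (i, ())
    | .inr i => .inr (i, ())
  left_inv := by rintro (⟨_, ⟨⟩⟩ | ⟨_, ⟨⟩⟩) <;> rfl
  right_inv := by rintro (_ | _) <;> rfl

/-- `τ × 1 ⊔ n × 1 = n ⊔ τ` -/
def eUnitUnit' : (τ × Unit) ⊕ (n × Unit) ≃ n ⊕ τ where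
  toFun
    | .inl p => .inr p.1
    | .inr p => .inl p.1
  invFun
    | .inr i => .inl (i, ())
    | .inl i => .inr (i, ())
  left_inv := by rintro (⟨_, ⟨⟩⟩ | ⟨_, ⟨⟩⟩) <;> rfl
  right_inv := by rintro (_ | _) <;> rfl

/-- `τ × 2 ⊔ n × 1 = τ ⊔ (τ ⊔ n)` -/
def eTwoUnit : (τ × (Unit ⊕ Unit)) ⊕ (n × Unit) ≃ τ ⊕ (τ ⊕ n) where
  toFun
    | .inl (i, .inl _) => .inl i
    | .inl (i, .inr _) => .inr (.inl i)
    | .inr p => .inr (.inr p.1)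
  invFun
    | .inl i => .inl (i, .inl ())
    | .inr (.inl i) => .inl (i, .inr ())
    | .inr (.inr i) => .inr (i, ())
  left_inv := by rintro (⟨_, ⟨⟩ | ⟨⟩⟩ | ⟨_, ⟨⟩⟩) <;> rfl
  right_inv := by rintro (_ | _ | _) <;> rfl

/-- `τ × 2 ⊔ n × 1 = (τ ⊔ n) ⊔ τ` -/
def eTwoUnit' : (τ × (Unit ⊕ Unit)) ⊕ (n × Unit) ≃ (τ ⊕ n) ⊕ τ where
  toFun
    | .inl (i, .inl _) => .inl (.inl i)
    | .inl (i, .inr _) => .inr i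
    | .inr p => .inl (.inr p.1)
  invFun
    | .inl (.inl i) => .inl (i, .inl ())
    | .inr i => .inl (i, .inr ())
    | .inl (.inr i) => .inr (i, ())
  left_inv := by rintro (⟨_, ⟨⟩ | ⟨⟩⟩ | ⟨_, ⟨⟩⟩) <;> rfl
  right_inv := by rintro ((_ | _) | _) <;> rfl

/-- `τ × 1 ⊔ n × 2 = (n ⊔ τ) ⊔ n` -/
def eUnitTwo : (τ × Unit) ⊕ (n × (Unit ⊕ Unit)) ≃ (n ⊕ τ) ⊕ n where
  toFun
    | .inr (i, .inl _) => .inl (.inl i)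
    | .inr (i, .inr _) => .inr i
    | .inl p => .inl (.inr p.1)
  invFun
    | .inl (.inl i) => .inr (i, .inl ())
    | .inr i => .inr (i, .inr ())
    | .inl (.inr i) => .inl (i, ())
  left_inv := by rintro (⟨_, ⟨⟩⟩ | ⟨_, ⟨⟩ | ⟨⟩⟩) <;> rfl
  right_inv := by rintro ((_ | _) | _) <;> rfl

/-- `τ × 1 ⊔ n × 2 = n ⊔ (n ⊔ τ)` -/
def eUnitTwo' : (τ × Unit) ⊕ (n × (Unit ⊕ Unit)) ≃ n ⊕ (n ⊕ τ) where
  toFun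
    | .inr (i, .inl _) => .inl i
    | .inr (i, .inr _) => .inr (.inl i)
    | .inl p => .inr (.inr p.1)
  invFun
    | .inl i => .inr (i, .inl ())
    | .inr (.inl i) => .inr (i, .inr ())
    | .inr (.inr i) => .inl (i, ())
  left_inv := by rintro (⟨_, ⟨⟩⟩ | ⟨_, ⟨⟩ | ⟨⟩⟩) <;> rfl
  right_inv := by rintro (_ | _ | _) <;> rfl

end Distribution

namespace Shape

/-- A pair of coefficient matrices is a diagonal sum of copies of two shapes. -/
def Splits {K : Type} [Field K] (r : ℕ) (s t : Shape K) {ι κ : Type} (G₀ G₁ : Matrix ι κ K) :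
    Prop :=
  ∃ (τ τ' : Type) (_ : Fintype τ) (_ : Fintype τ') (_ : DecidableEq τ)
    (_ : DecidableEq τ') (er : (τ × s.ι) ⊕ (τ' × t.ι) ≃ ι) (ec : (τ × s.κ) ⊕ (τ' × t.κ) ≃ κ),
    (1 ≤ r → G₀.submatrix er ec = fromBlocks (kron τ s.G₀) 0 0 (kron τ' t.G₀)) ∧
    (2 ≤ r → G₁.submatrix er ec = fromBlocks (kron τ s.G₁) 0 0 (kron τ' t.G₁))

variable {K : Type} [Field K] {r : ℕ} {ι κ n : Type} [Fintype ι] [Fintype κ] [Fintype n]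
  [DecidableEq ι] [DecidableEq κ] [DecidableEq n]

theorem splits_zero (G₀ G₁ : Matrix ι κ K) : Splits 0 (s11 K) (s10 K) G₀ G₁ :=
  ⟨κ, ι, inferInstance, inferInstance, inferInstance, inferInstance, eEmptyUnit, eUnitEmpty,
    fun h => absurd h (by decide), fun h => absurd h (by decide)⟩

theorem splits_one_tall (G₁ : Matrix (κ ⊕ n) κ K) : Splits 1 (s12 K) (s10 K)
    (fromRows 1 0)
    G₁ :=
  ⟨κ, n, inferInstance, inferInstance, inferInstance, inferInstance, eUnitUnit, eUnitEmpty,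
    fun _ => by
      ext (⟨i, _⟩ | ⟨i, _⟩) (⟨j, _⟩ | ⟨_, ⟨⟩⟩) <;> simp [kron, Matrix.one_apply, eUnitUnit, eUnitEmpty],
    fun h => absurd h (by decide)⟩

theorem splits_one_wide (G₁ : Matrix ι (ι ⊕ n) K) : Splits 1 (s11 K) (s12 K)
    (fromCols 1 0)
    G₁ :=
  ⟨n, ι, inferInstance, inferInstance, inferInstance, inferInstance, eEmptyUnit, eUnitUnit',
    fun _ => by
      ext (⟨_, ⟨⟩⟩ | ⟨i, _⟩) (⟨j, _⟩ | ⟨j, _⟩) <;> simp [kron, Matrix.one_apply, eEmptyUnit, eUnitUnit'],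
    fun h => absurd h (by decide)⟩

theorem splits_two_tall_tall : Splits r (s13 K) (s10 K)
    (fromRows 1 0 : Matrix (κ ⊕ (κ ⊕ n)) κ K)
    (fromRows 0 (fromRows 1 0)) :=
  ⟨κ, n, inferInstance, inferInstance, inferInstance, inferInstance, eTwoUnit, eUnitEmpty,
    fun _ => by
      ext (⟨i, ⟨⟩ | ⟨⟩⟩ | ⟨i, _⟩) (⟨j, _⟩ | ⟨_, ⟨⟩⟩) <;> simp [kron, Matrix.one_apply, eTwoUnit, eUnitEmpty],
    fun _ => by
      ext (⟨i, ⟨⟩ | ⟨⟩⟩ | ⟨i, _⟩) (⟨j, _⟩ | ⟨_, ⟨⟩⟩) <;> simp [kron, Matrix.one_apply, eTwoUnit, eUnitEmpty]⟩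

theorem splits_two_tall_wide : Splits r (s12 K) (s13 K)
    (fromRows 1 0 : Matrix ((ι ⊕ n) ⊕ ι) (ι ⊕ n) K)
    (fromRows 0 (fromCols 1 0)) :=
  ⟨n, ι, inferInstance, inferInstance, inferInstance, inferInstance, eUnitTwo, eUnitUnit',
    fun _ => by
      ext (⟨i, _⟩ | ⟨i, ⟨⟩ | ⟨⟩⟩) (⟨j, _⟩ | ⟨j, _⟩) <;> simp [kron, Matrix.one_apply, eUnitTwo, eUnitUnit'],
    fun _ => by
      ext (⟨i, _⟩ | ⟨i, ⟨⟩ | ⟨⟩⟩) (⟨j, _⟩ | ⟨j, _⟩) <;> simp [kron, Matrix.one_apply, eUnitTwo, eUnitUnit']⟩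

theorem splits_two_wide_tall : Splits r (s23 K) (s12 K)
    (fromCols 1 0 : Matrix (κ ⊕ n) ((κ ⊕ n) ⊕ κ) K)
    (fromCols 0 (fromRows 1 0)) :=
  ⟨κ, n, inferInstance, inferInstance, inferInstance, inferInstance, eUnitUnit, eTwoUnit',
    fun _ => by
      ext (⟨i, _⟩ | ⟨i, _⟩) (⟨j, ⟨⟩ | ⟨⟩⟩ | ⟨j, _⟩) <;> simp [kron, Matrix.one_apply, eUnitUnit, eTwoUnit'],
    fun _ => by
      ext (⟨i, _⟩ | ⟨i, _⟩) (⟨j, ⟨⟩ | ⟨⟩⟩ | ⟨j, _⟩) <;> simp [kron, Matrix.one_apply, eUnitUnit, eTwoUnit']⟩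

theorem splits_two_wide_wide : Splits r (s11 K) (s23 K)
    (fromCols 1 0 : Matrix ι (ι ⊕ (ι ⊕ n)) K)
    (fromCols 0 (fromCols 1 0)) :=
  ⟨n, ι, inferInstance, inferInstance, inferInstance, inferInstance, eEmptyUnit, eUnitTwo',
    fun _ => by
      ext (⟨_, ⟨⟩⟩ | ⟨i, _⟩) (⟨j, _⟩ | ⟨j, ⟨⟩ | ⟨⟩⟩) <;> simp [kron, Matrix.one_apply, eEmptyUnit, eUnitTwo'],
    fun _ => by
      ext (⟨_, ⟨⟩⟩ | ⟨i, _⟩) (⟨j, _⟩ | ⟨j, ⟨⟩ | ⟨⟩⟩) <;> simp [kron, Matrix.one_apply, eEmptyUnit, eUnitTwo']⟩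

end Shape
end TwoPoint

namespace TwoPoint

open Matrix

namespace TwoVertex
namespace Half

variable {K S : Type} [Field K] [Ring S] [Algebra K S] {D : TwoVertex K S} {c d : Fin 2}
  {r : ℕ} {m x : S} (Q : D.Half c d r m x) {ι κ ι' κ' : Type}

include Q

theorem sm_mx_congr {G G' : Matrix ι κ K} (h : 1 ≤ r → G = G') : sm G (m * x) = sm G' (m * x) := by
  rcases Nat.lt_or_ge r 1 with hr | hr
  · simp [Q.z1 hr, sm_zero_right]
  · rw [h hr]

theorem std_congr [Fintype ι] [Fintype κ] [DecidableEq ι] [DecidableEq κ] {G₀ G₁ : Matrix ι κ K}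
    {G₁' : Matrix ι κ K} (h : 2 ≤ r → G₁ = G₁') :
    MEquiv (D.e c) (D.e d) (std m x G₀ G₁) (std m x G₀ G₁') := by
  obtain ⟨C, hC, h1⟩ := Q.sm_mxx_congr h
  have hN : IsC (D.e d) (D.e d) (fromBlocks 0 0 C 0 : Matrix (κ ⊕ ι) (κ ⊕ ι) S) := by
    constructor <;> rintro (i | i) (j | j) <;> simp [hC.1, hC.2]
  have hd := isC_dg (n := κ ⊕ ι) (D.idem d)
  have hNN : (fromBlocks 0 0 C 0 : Matrix (κ ⊕ ι) (κ ⊕ ι) S) * fromBlocks 0 0 C 0 = 0 := by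
    simp [fromBlocks_multiply]
  convert MEquiv.mul_left (D.idem c) (Q.isC_std G₀ G₁) (hd.sub hN) (hd.add hN) ?_ ?_ using 1
  · rw [Matrix.sub_mul, dg_mul (Q.isC_std G₀ G₁), std, std, fromBlocks_mul_fromRows, h1]
    ext (i | i) j <;> simp ; abel
  · rw [Matrix.sub_mul, Matrix.mul_add, Matrix.mul_add, hNN, dg_mul hd, dg_mul hN, mul_dg hN]
    abel
  · rw [Matrix.add_mul, Matrix.mul_sub, Matrix.mul_sub, hNN, dg_mul hd, dg_mul hN, mul_dg hN]
    abel

/-- Homomorphisms in coordinates lift to commutative squares. -/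
theorem std_mul_of_hom {s t : Shape K} {A : Matrix s.κ t.κ K} {W : Matrix s.κ t.ι K}
    {B : Matrix s.ι t.ι K} (h : s.Hom 2 t A W B) :
    std m x s.G₀ s.G₁ * (sm A (D.e c) + sm (W * t.G₀) x + sm (W * t.G₁) (x * x)) =
      sm (fromBlocks A W 0 B) (D.e d) * std m x t.G₀ t.G₁ := by
  have h1 := congrArg (sm · (m * x)) (h.1 one_le_two)
  have h2 := congrArg (sm · (m * x * x)) (h.2 le_rfl)
  simp only [sm_add] at h1 h2
  rw [std, std, fromRows_mul, sm_fromBlocks, fromBlocks_mul_fromRows]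
  ext (i | i) j
  · simp only [Matrix.mul_add, sm_mul_sm, Q.me, Q.fm, Q.mxe, Q.mxxe, Q.fmx, Q.fmxx,
      Matrix.one_mul, Matrix.mul_one, ← mul_assoc, Matrix.add_apply, fromRows_apply_inl]
    abel
  · simp only [Matrix.mul_add, Matrix.add_mul, sm_mul_sm, Q.me, Q.fm, Q.mxe, Q.mxxe, Q.fmx,
      Q.fmxx, Q.z3, sm_zero_right, Matrix.zero_apply, zero_mul, ← mul_assoc, Matrix.add_apply,
      fromRows_apply_inr, sm_zero, Matrix.zero_mul, add_zero, zero_add, h1, ← h2, ← Matrix.mul_assoc]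
    abel

/-- Homomorphisms between normal forms, in coordinates. -/
theorem hom_of_std_mul {s t : Shape K} {Z : Matrix s.κ t.κ S}
    {Y : Matrix (s.κ ⊕ s.ι) (t.κ ⊕ t.ι) S} (hZ : IsC (D.e c) (D.e c) Z)
    (hY : IsC (D.e d) (D.e d) Y) (h : std m x s.G₀ s.G₁ * Z = Y * std m x t.G₀ t.G₁) :
    ∃ A W B, s.Hom r t A W B ∧ Z.map (D.χ c) = A ∧ Y.map (D.χ d) = fromBlocks A W 0 B := by
  obtain ⟨A, W, B, hA, hYb, h1, h2⟩ := Q.ext_coordinates (X₁ := 0) (X₂ := 0) hZ hY.neg (by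
    rw [h, Matrix.neg_mul, add_neg_cancel, sm_zero, sm_zero, add_zero, fromRows_zero])
  refine ⟨A, -W, -B, ⟨fun hr => ?_, fun hr => ?_⟩, hA, ?_⟩
  · rw [Matrix.neg_mul, eq_neg_iff_add_eq_zero, ← h1 hr]
  · rw [Matrix.neg_mul, eq_neg_iff_add_eq_zero, Matrix.mul_neg, Matrix.neg_mul, ← sub_eq_add_neg,
      ← h2 hr]
  · have := congrArg (fun M => -M) hYb
    rw [fromBlocks_neg] at this
    rw [← neg_neg (0 : Matrix s.ι t.κ K), ← neg_neg A, neg_zero, ← this]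
    ext i j
    simp

theorem mequiv_of_splits [Fintype ι] [Fintype κ] [DecidableEq ι] [DecidableEq κ] {s t : Shape K}
    {G₀ G₁ : Matrix ι κ K} (h : Shape.Splits r s t G₀ G₁) : ∃ (τ τ' : Type) (_ : Fintype τ)
      (_ : Fintype τ') (_ : DecidableEq τ) (_ : DecidableEq τ'),
      MEquiv (D.e c) (D.e d) (std m x G₀ G₁)
        (fromBlocks (kron τ (s.obj m x).F) 0 0 (kron τ' (t.obj m x).F)) := by
  obtain ⟨τ, τ', _, _, _, _, er, ec, h0, h1⟩ := h
  have h1' : 2 ≤ r → G₁ =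
      (fromBlocks (kron τ s.G₁) 0 0 (kron τ' t.G₁)).submatrix er.symm ec.symm := fun hr => by
    rw [← h1 hr]; simp
  refine ⟨τ, τ', inferInstance, inferInstance, inferInstance, inferInstance,
    (Q.std_congr h1').trans ?_⟩
  convert MEquiv.submatrix (D.idem c) (D.idem d) (Q.isC_std G₀ _) (blockEquiv s.eb t.eb er ec) ec
    using 1
  have h0' := fun i j => congrFun (congrFun (Q.sm_mx_congr h0) i) j
  simp only [sm_submatrix, Matrix.submatrix_apply] at h0'
  have e1 : ∀ i k, s.eb i = Sum.inl k → ∀ t₀, blockEquiv s.eb t.eb er ec (Sum.inl (t₀, i)) =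
      Sum.inl (ec (Sum.inl (t₀, k))) := fun i k h t₀ => by simp [blockEquiv, h]
  have e2 : ∀ i k, s.eb i = Sum.inr k → ∀ t₀, blockEquiv s.eb t.eb er ec (Sum.inl (t₀, i)) =
      Sum.inr (er (Sum.inl (t₀, k))) := fun i k h t₀ => by simp [blockEquiv, h]
  have e3 : ∀ i k, t.eb i = Sum.inl k → ∀ t₀, blockEquiv s.eb t.eb er ec (Sum.inr (t₀, i)) =
      Sum.inl (ec (Sum.inr (t₀, k))) := fun i k h t₀ => by simp [blockEquiv, h]
  have e4 : ∀ i k, t.eb i = Sum.inr k → ∀ t₀, blockEquiv s.eb t.eb er ec (Sum.inr (t₀, i)) =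
      Sum.inr (er (Sum.inr (t₀, k))) := fun i k h t₀ => by simp [blockEquiv, h]
  ext (⟨t₀, i⟩ | ⟨t₀, i⟩) (⟨u, j⟩ | ⟨u, j⟩)
  · rcases h : s.eb i with k | k
    · rw [Matrix.submatrix_apply, e1 i k h]
      by_cases ht : t₀ = u <;> by_cases hk : k = j <;>
        simp [std, kron, h, ht, hk, sm, Matrix.one_apply]
    · rw [Matrix.submatrix_apply, e2 i k h]
      by_cases ht : t₀ = u <;> simp [std, kron, h, ht, h0'] <;>
        simp [sm, kron, ht]
  · rcases h : s.eb i with k | k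
    · rw [Matrix.submatrix_apply, e1 i k h]
      simp [std, sm, Matrix.one_apply]
    · rw [Matrix.submatrix_apply, e2 i k h]
      simp [std, h0'] ; simp [sm]
  · rcases h : t.eb i with k | k
    · rw [Matrix.submatrix_apply, e3 i k h]
      simp [std, sm, Matrix.one_apply]
    · rw [Matrix.submatrix_apply, e4 i k h]
      simp [std, h0'] ; simp [sm]
  · rcases h : t.eb i with k | k
    · rw [Matrix.submatrix_apply, e3 i k h]
      by_cases ht : t₀ = u <;> by_cases hk : k = j <;>
        simp [std, kron, h, ht, hk, sm, Matrix.one_apply]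
    · rw [Matrix.submatrix_apply, e4 i k h]
      by_cases ht : t₀ = u <;> simp [std, kron, h, ht, h0'] <;>
        simp [sm, kron, ht]

/-- The coordinates of a rigid normal form. -/
theorem coordinates_of_evan [Fintype ι] [Fintype κ] [DecidableEq κ] {G₀ G₁ : Matrix ι κ K}
    (h : EVan (D.e c) (D.e d) (std m x G₀ G₁) (std m x G₀ G₁)) (X₁ X₂ : Matrix ι κ K) :
    ∃ (A : Matrix κ κ K) (W : Matrix κ ι K) (B : Matrix ι ι K), (1 ≤ r → X₁ = G₀ * A + B * G₀) ∧
      (2 ≤ r → X₂ = G₁ * A - G₀ * W * G₀ + B * G₁) := by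
  obtain ⟨Z, Y, hZ, hY, hX⟩ := h (fromRows 0 (sm X₁ (m * x) + sm X₂ (m * x * x)))
    (IsC.zero.fromRows ((isC_sm _ Q.fmx Q.mxe).add (isC_sm _ Q.fmxx Q.mxxe)))
  obtain ⟨A, W, B, -, -, h⟩ := Q.ext_coordinates hZ hY hX
  exact ⟨A, W, B, h⟩

end Half

/-- A matrix is equivalent to a normal form which splits into consecutive shapes. -/
def Reduces {K S : Type} [Field K] [Ring S] [Algebra K S] (D : TwoVertex K S) (c d : Fin 2)
    (r : ℕ) (m x : S) {ι κ : Type} [Fintype ι] [Fintype κ] [DecidableEq ι] [DecidableEq κ]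
    (F : Matrix ι κ S) : Prop :=
  ∃ j < Shape.len r, ∃ (ι' κ' : Type) (_ : Fintype ι') (_ : Fintype κ')
    (_ : DecidableEq ι') (_ : DecidableEq κ') (H₀ H₁ : Matrix ι' κ' K),
    MEquiv (D.e c) (D.e d) F (std m x H₀ H₁) ∧
      Shape.Splits r (Shape.chain K r j) (Shape.chain K r (j + 1)) H₀ H₁

namespace Half

section NormalForm

variable {K S : Type} [Field K] [Ring S] [Algebra K S] {D : TwoVertex K S} {c d : Fin 2}
  {r : ℕ} {m x : S} {ι κ : Type} [Fintype ι] [Fintype κ] [DecidableEq ι] [DecidableEq κ]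

theorem reduces_congr {F : Matrix ι κ S} {ι' κ' : Type} [Fintype ι'] [Fintype κ']
    [DecidableEq ι'] [DecidableEq κ'] {G : Matrix ι' κ' S} (h : MEquiv (D.e c) (D.e d) F G)
    (hG : D.Reduces c d r m x G) : D.Reduces c d r m x F := by
  obtain ⟨j, hj, ι', κ', _, _, _, _, H₀, H₁, h', hs⟩ := hG
  exact ⟨j, hj, ι', κ', inferInstance, inferInstance, inferInstance, inferInstance, H₀, H₁,
    h.trans h', hs⟩

theorem reduces_zero (Q : D.Half c d 0 m x) (G₀ G₁ : Matrix ι κ K) :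
    D.Reduces c d 0 m x (std m x G₀ G₁) :=
  ⟨0, zero_lt_one, ι, κ, inferInstance, inferInstance, inferInstance, inferInstance, G₀, G₁,
    MEquiv.refl (D.idem c) (D.idem d) (Q.isC_std _ _), Shape.splits_zero G₀ G₁⟩

theorem reduces_one (Q : D.Half c d 1 m x) {G₀ G₁ : Matrix ι κ K}
    (hE : EVan (D.e c) (D.e d) (std m x G₀ G₁) (std m x G₀ G₁)) :
    D.Reduces c d 1 m x (std m x G₀ G₁) := by
  rcases full_rank (G := G₀) (fun X => by
    obtain ⟨A, W, B, h, -⟩ := Q.coordinates_of_evan hE X 0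
    exact ⟨A, B, h le_rfl⟩) with ⟨L, hL⟩ | ⟨L, hL⟩
  · obtain ⟨n', U, U', h1, h2, h3⟩ := row_reduction hL
    have a := Q.std_mul G₀ G₁ (Z := (1 : Matrix κ κ K)) (Z' := 1) h1 h2
      (Matrix.one_mul 1) (Matrix.one_mul 1)
    rw [h3, Matrix.mul_one] at a
    exact ⟨1, one_lt_two, _, _, inferInstance, inferInstance, inferInstance, inferInstance, _, _,
      a, Shape.splits_one_tall _⟩
  · obtain ⟨n', V, V', h1, h2, h3⟩ := col_reduction hL
    have a := Q.std_mul G₀ G₁ (P := (1 : Matrix ι ι K)) (P' := 1) (Matrix.one_mul 1)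
      (Matrix.one_mul 1) h1 h2
    rw [Matrix.one_mul, h3] at a
    exact ⟨0, zero_lt_two, _, _, inferInstance, inferInstance, inferInstance, inferInstance, _, _,
      a, Shape.splits_one_wide _⟩

variable [Module.Finite K S]

theorem reduces_tall (Q : D.Half c d (r + 2) m x) {n : Type} [Fintype n] [DecidableEq n]
    {G₁ : Matrix (κ ⊕ n) κ K}
    (hE : EVan (D.e c) (D.e d) (std m x (fromRows 1 0) G₁) (std m x (fromRows 1 0) G₁)) :
    D.Reduces c d (r + 2) m x (std m x (fromRows 1 0) G₁) := by
  have a1 := Q.std_shift (fromRows 1 0) G₁ (fromCols G₁.toRows₁ 0)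
  have e1 : G₁ - (fromRows 1 0 : Matrix (κ ⊕ n) κ K) *
      (fromCols G₁.toRows₁ 0 : Matrix κ (κ ⊕ n) K) * (fromRows 1 0 : Matrix (κ ⊕ n) κ K) =
      fromRows 0 G₁.toRows₂ := by
    rw [Matrix.mul_assoc, fromCols_mul_fromRows]
    ext (i | i) j <;> simp [fromRows_mul]
  rw [e1] at a1
  refine reduces_congr a1 ?_
  generalize G₁.toRows₂ = b at a1 ⊢
  have hE' := EVan.of_mEquiv a1 a1 hE
  rcases full_rank (G := b) (fun X => by
    obtain ⟨A, W, B, -, h⟩ := Q.coordinates_of_evan hE' 0 (fromRows 0 X)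
    refine ⟨A, B.toBlocks₂₂, ?_⟩
    rw [← fromBlocks_toBlocks B] at h
    have h2 := congrArg toRows₂ (h (by omega))
    ext i j
    have h3 := congrFun (congrFun h2 i) j
    simpa [fromRows_mul, fromBlocks_mul_fromRows] using h3) with ⟨L, hL⟩ | ⟨L, hL⟩
  · obtain ⟨n', U, U', h1, h2, h3⟩ := row_reduction hL
    have a2 := Q.std_mul (fromRows 1 0) (fromRows 0 b)
      (P := (fromBlocks 1 0 0 U : Matrix (κ ⊕ (κ ⊕ Fin n')) (κ ⊕ n) K))
      (P' := fromBlocks 1 0 0 U') (Z := (1 : Matrix κ κ K)) (Z' := 1)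
      (by simp [fromBlocks_multiply, h1, Matrix.one_mul 1])
      (by simp [fromBlocks_multiply, h2, Matrix.one_mul 1]) (Matrix.one_mul 1) (Matrix.one_mul 1)
    have e2 : (fromBlocks 1 0 0 U : Matrix (κ ⊕ (κ ⊕ Fin n')) (κ ⊕ n) K) *
        (fromRows 1 0 : Matrix (κ ⊕ n) κ K) * (1 : Matrix κ κ K) = fromRows 1 0 := by
      simp [fromBlocks_mul_fromRows]
    have e3 : (fromBlocks 1 0 0 U : Matrix (κ ⊕ (κ ⊕ Fin n')) (κ ⊕ n) K) *
        (fromRows 0 b : Matrix (κ ⊕ n) κ K) * (1 : Matrix κ κ K) = fromRows 0 (fromRows 1 0) := by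
      simp [fromBlocks_mul_fromRows, h3]
    rw [e2, e3] at a2
    exact ⟨3, (by decide : 3 < 4), _, _, inferInstance, inferInstance, inferInstance,
      inferInstance, _, _, a2, Shape.splits_two_tall_tall⟩
  · obtain ⟨n', V, V', h1, h2, h3⟩ := col_reduction hL
    have a2 := Q.std_mul (fromRows 1 0) (fromRows 0 b)
      (P := (fromBlocks V' 0 0 1 : Matrix ((n ⊕ Fin n') ⊕ n) (κ ⊕ n) K))
      (P' := fromBlocks V 0 0 1) (Z := V) (Z' := V')
      (by simp [fromBlocks_multiply, h2, Matrix.one_mul 1])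
      (by simp [fromBlocks_multiply, h1, Matrix.one_mul 1]) h1 h2
    have e2 : (fromBlocks V' 0 0 1 : Matrix ((n ⊕ Fin n') ⊕ n) (κ ⊕ n) K) *
        (fromRows 1 0 : Matrix (κ ⊕ n) κ K) * V = fromRows 1 0 := by
      simp [fromBlocks_mul_fromRows, fromRows_mul, h2]
    have e3 : (fromBlocks V' 0 0 1 : Matrix ((n ⊕ Fin n') ⊕ n) (κ ⊕ n) K) *
        (fromRows 0 b : Matrix (κ ⊕ n) κ K) * V = fromRows 0 (fromCols 1 0) := by
      simp [fromBlocks_mul_fromRows, fromRows_mul, h3]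
    rw [e2, e3] at a2
    exact ⟨2, (by decide : 2 < 4), _, _, inferInstance, inferInstance, inferInstance,
      inferInstance, _, _, a2, Shape.splits_two_tall_wide⟩

theorem reduces_wide (Q : D.Half c d (r + 2) m x) {n : Type} [Fintype n] [DecidableEq n]
    {G₁ : Matrix ι (ι ⊕ n) K}
    (hE : EVan (D.e c) (D.e d) (std m x (fromCols 1 0) G₁) (std m x (fromCols 1 0) G₁)) :
    D.Reduces c d (r + 2) m x (std m x (fromCols 1 0) G₁) := by
  have a1 := Q.std_shift (fromCols 1 0) G₁ (fromRows G₁.toCols₁ 0)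
  have e1 : G₁ - (fromCols 1 0 : Matrix ι (ι ⊕ n) K) *
      (fromRows G₁.toCols₁ 0 : Matrix (ι ⊕ n) ι K) * (fromCols 1 0 : Matrix ι (ι ⊕ n) K) =
      fromCols 0 G₁.toCols₂ := by
    rw [fromCols_mul_fromRows]
    ext i (j | j) <;> simp [mul_fromCols]
  rw [e1] at a1
  refine reduces_congr a1 ?_
  generalize G₁.toCols₂ = b at a1 ⊢
  have hE' := EVan.of_mEquiv a1 a1 hE
  rcases full_rank (G := b) (fun X => by
    obtain ⟨A, W, B, -, h⟩ := Q.coordinates_of_evan hE' 0 (fromCols 0 X)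
    refine ⟨A.toBlocks₂₂, B, ?_⟩
    rw [← fromBlocks_toBlocks A] at h
    have h2 := congrArg toCols₂ (h (by omega))
    ext i j
    have h3 := congrFun (congrFun h2 i) j
    simpa [mul_fromCols, fromCols_mul_fromBlocks] using h3) with ⟨L, hL⟩ | ⟨L, hL⟩
  · obtain ⟨n', U, U', h1, h2, h3⟩ := row_reduction hL
    have a2 := Q.std_mul (fromCols 1 0) (fromCols 0 b) (P := U) (P' := U')
      (Z := (fromBlocks U' 0 0 1 : Matrix (ι ⊕ n) ((n ⊕ Fin n') ⊕ n) K))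
      (Z' := fromBlocks U 0 0 1) h1 h2
      (by simp [fromBlocks_multiply, h2, Matrix.one_mul 1])
      (by simp [fromBlocks_multiply, h1, Matrix.one_mul 1])
    have e2 : U * (fromCols 1 0 : Matrix ι (ι ⊕ n) K) *
        (fromBlocks U' 0 0 1 : Matrix (ι ⊕ n) ((n ⊕ Fin n') ⊕ n) K) = fromCols 1 0 := by
      simp [fromCols_mul_fromBlocks, mul_fromCols, h1]
    have e3 : U * (fromCols 0 b : Matrix ι (ι ⊕ n) K) *
        (fromBlocks U' 0 0 1 : Matrix (ι ⊕ n) ((n ⊕ Fin n') ⊕ n) K) =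
          fromCols 0 (fromRows 1 0) := by
      simp [fromCols_mul_fromBlocks, mul_fromCols, h3]
    rw [e2, e3] at a2
    exact ⟨1, (by decide : 1 < 4), _, _, inferInstance, inferInstance, inferInstance,
      inferInstance, _, _, a2, Shape.splits_two_wide_tall⟩
  · obtain ⟨n', V, V', h1, h2, h3⟩ := col_reduction hL
    have a2 := Q.std_mul (fromCols 1 0) (fromCols 0 b) (P := (1 : Matrix ι ι K)) (P' := 1)
      (Z := (fromBlocks 1 0 0 V : Matrix (ι ⊕ n) (ι ⊕ (ι ⊕ Fin n')) K))
      (Z' := fromBlocks 1 0 0 V') (Matrix.one_mul 1) (Matrix.one_mul 1)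
      (by simp [fromBlocks_multiply, h1, Matrix.one_mul 1])
      (by simp [fromBlocks_multiply, h2, Matrix.one_mul 1])
    have e2 : (1 : Matrix ι ι K) * (fromCols 1 0 : Matrix ι (ι ⊕ n) K) *
        (fromBlocks 1 0 0 V : Matrix (ι ⊕ n) (ι ⊕ (ι ⊕ Fin n')) K) = fromCols 1 0 := by
      simp [fromCols_mul_fromBlocks]
    have e3 : (1 : Matrix ι ι K) * (fromCols 0 b : Matrix ι (ι ⊕ n) K) *
        (fromBlocks 1 0 0 V : Matrix (ι ⊕ n) (ι ⊕ (ι ⊕ Fin n')) K) =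
          fromCols 0 (fromCols 1 0) := by
      simp [fromCols_mul_fromBlocks, h3]
    rw [e2, e3] at a2
    exact ⟨0, (by decide : 0 < 4), _, _, inferInstance, inferInstance, inferInstance,
      inferInstance, _, _, a2, Shape.splits_two_wide_wide⟩

theorem reduces_two (Q : D.Half c d (r + 2) m x) {G₀ G₁ : Matrix ι κ K}
    (hE : EVan (D.e c) (D.e d) (std m x G₀ G₁) (std m x G₀ G₁)) :
    D.Reduces c d (r + 2) m x (std m x G₀ G₁) := by
  rcases full_rank (G := G₀) (fun X => by
    obtain ⟨A, W, B, h, -⟩ := Q.coordinates_of_evan hE X 0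
    exact ⟨A, B, h (by omega)⟩) with ⟨L, hL⟩ | ⟨L, hL⟩
  · obtain ⟨n', U, U', h1, h2, h3⟩ := row_reduction hL
    have a := Q.std_mul G₀ G₁ (Z := (1 : Matrix κ κ K)) (Z' := 1) h1 h2
      (Matrix.one_mul 1) (Matrix.one_mul 1)
    rw [h3, Matrix.mul_one] at a
    exact reduces_congr a (Q.reduces_tall (EVan.of_mEquiv a a hE))
  · obtain ⟨n', V, V', h1, h2, h3⟩ := col_reduction hL
    have a := Q.std_mul G₀ G₁ (P := (1 : Matrix ι ι K)) (P' := 1) (Matrix.one_mul 1)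
      (Matrix.one_mul 1) h1 h2
    rw [Matrix.one_mul, h3] at a
    exact reduces_congr a (Q.reduces_wide (EVan.of_mEquiv a a hE))

/-- The normal form of rigid matrices of full row rank at the generator. -/
theorem normal_form (Q : D.Half c d r m x) {F : Matrix ι κ S} (hF : IsC (D.e d) (D.e c) F)
    (hE : EVan (D.e c) (D.e d) F F) {L : Matrix κ ι K} (hL : L * F.map (Q.h 0) = 1) :
    ∃ j < Shape.len r, ∃ (τ τ' : Type) (_ : Fintype τ) (_ : Fintype τ') (_ : DecidableEq τ)
      (_ : DecidableEq τ'), MEquiv (D.e c) (D.e d) F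
        (fromBlocks (kron τ ((Shape.chain K r j).obj m x).F) 0 0
          (kron τ' ((Shape.chain K r (j + 1)).obj m x).F)) := by
  obtain ⟨n, G₀, G₁, h⟩ := Q.mequiv_std hF hL
  have hE' := EVan.of_mEquiv h h hE
  have hr : D.Reduces c d r m x F := by
    refine reduces_congr h ?_
    rcases r with _ | _ | r
    · exact Q.reduces_zero _ _
    · exact Q.reduces_one hE'
    · exact Q.reduces_two hE'
  obtain ⟨j, hj, ι', κ', _, _, _, _, H₀, H₁, h', hs⟩ := hr
  obtain ⟨τ, τ', _, _, _, _, h''⟩ := Q.mequiv_of_splits hs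
  exact ⟨j, hj, τ, τ', inferInstance, inferInstance, inferInstance, inferInstance, h'.trans h''⟩

end NormalForm

end Half
end TwoVertex
end TwoPoint

namespace TwoPoint

open Matrix

section Commutation

variable {S : Type} [Ring S] {ι κ ι' κ' b b' : Type} [Fintype κ] [Fintype ι'] [Fintype b']

theorem submatrix_comm_iff {F : Matrix ι κ S} {F' : Matrix ι' κ' S} (r : b ≃ ι) (r' : b' ≃ ι')
    {Z : Matrix κ κ' S} {Y : Matrix ι ι' S} :
    F.submatrix r id * Z = Y.submatrix r r' * F'.submatrix r' id ↔ F * Z = Y * F' := by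
  rw [Matrix.submatrix_mul_equiv]
  constructor
  · intro h
    have := congrArg (fun M => M.submatrix r.symm id) h
    simpa [Matrix.submatrix_submatrix, Matrix.submatrix_mul _ _ _ _ _ Function.bijective_id]
      using this
  · intro h
    rw [← h, Matrix.submatrix_mul _ _ _ _ _ Function.bijective_id, Matrix.submatrix_id_id]

end Commutation

theorem pow_toBlocks_eq_zero {K ι κ : Type} [Field K] [Fintype ι] [Fintype κ] [DecidableEq ι]
    [DecidableEq κ] {A : Matrix κ κ K} {W : Matrix κ ι K} {B : Matrix ι ι K} {a : K} {n : ℕ}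
    (h : (fromBlocks A W 0 B - Matrix.scalar (κ ⊕ ι) a) ^ n = 0) :
    (A - Matrix.scalar κ a) ^ n = 0 := by
  have h1 : fromBlocks A W 0 B - Matrix.scalar (κ ⊕ ι) a =
      fromBlocks (A - Matrix.scalar κ a) W 0 (B - Matrix.scalar ι a) := by
    ext (i | i) (j | j) <;> simp [Matrix.scalar_apply, Matrix.diagonal_apply]
  have h2 : ∀ n : ℕ, ∃ X, (fromBlocks (A - Matrix.scalar κ a) W 0 (B - Matrix.scalar ι a)) ^ n =
      fromBlocks ((A - Matrix.scalar κ a) ^ n) X 0 ((B - Matrix.scalar ι a) ^ n) := by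
    intro n
    induction n with
    | zero => exact ⟨0, by simp⟩
    | succ n ih =>
      obtain ⟨X, hX⟩ := ih
      refine ⟨(A - Matrix.scalar κ a) ^ n * W + X * (B - Matrix.scalar ι a), ?_⟩
      rw [pow_succ, hX, fromBlocks_multiply]
      simp only [Matrix.mul_zero, Matrix.zero_mul, add_zero, zero_add, pow_succ]
  obtain ⟨X, hX⟩ := h2 n
  rw [← h1, h] at hX
  have := congrArg toBlocks₁₁ hX
  rw [toBlocks_fromBlocks₁₁] at this
  rw [← this]; rfl

namespace TwoVertex
namespace Half

variable {K S : Type} [Field K] [Ring S] [Algebra K S] {D : TwoVertex K S} {c d : Fin 2}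
  {r : ℕ} {m x : S} (Q : D.Half c d r m x)

include Q

theorem isC_obj (t : Shape K) : IsC (D.e d) (D.e c) (t.obj m x).F :=
  ⟨fun _ _ => (Q.isC_std t.G₀ t.G₁).1 _ _, fun _ _ => (Q.isC_std t.G₀ t.G₁).2 _ _⟩

theorem mequiv_obj (t : Shape K) :
    MEquiv (D.e c) (D.e d) (std m x t.G₀ t.G₁) (t.obj m x).F :=
  MEquiv.submatrix (D.idem c) (D.idem d) (Q.isC_std t.G₀ t.G₁) t.eb (Equiv.refl _)

theorem evan_obj {s t : Shape K} (h : s.Ext r t) :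
    EVan (D.e c) (D.e d) (s.obj m x).F (t.obj m x).F :=
  EVan.of_mEquiv (Q.mequiv_obj s) (Q.mequiv_obj t) (Q.evan_std h)

theorem exists_hom {s t : Shape K} {A : Matrix s.κ t.κ K} {W : Matrix s.κ t.ι K}
    {B : Matrix s.ι t.ι K} (h : s.Hom 2 t A W B) : ∃ Z, IsC (D.e c) (D.e c) Z ∧
      (∀ i j, W = 0 → Z i j = A i j • D.e c) ∧ (s.obj m x).F * Z =
        (sm (fromBlocks A W 0 B) (D.e d)).submatrix s.eb t.eb * (t.obj m x).F :=
  ⟨_, ((isC_sm A (D.idem c) (D.idem c)).add (isC_sm _ Q.ex Q.xe)).add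
    (isC_sm (r := x * x) _ (by rw [← mul_assoc, Q.ex]) (by rw [mul_assoc, Q.xe])),
    fun i j hW => by subst hW; simp [sm], (submatrix_comm_iff _ _).2 (Q.std_mul_of_hom h)⟩

theorem hom_of_obj_mul {s t : Shape K} {Z : Matrix s.κ t.κ S} {Y : Matrix s.b t.b S}
    (hZ : IsC (D.e c) (D.e c) Z) (hY : IsC (D.e d) (D.e d) Y)
    (h : (s.obj m x).F * Z = Y * (t.obj m x).F) :
    ∃ A W B, s.Hom r t A W B ∧ Z.map (D.χ c) = A ∧
      Y.map (D.χ d) = (fromBlocks A W 0 B).submatrix s.eb t.eb := by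
  have e : Y = (Y.submatrix s.eb.symm t.eb.symm).submatrix s.eb t.eb := by ext; simp
  rw [e] at h
  obtain ⟨A, W, B, h1, h2, h3⟩ := Q.hom_of_std_mul (Y := Y.submatrix s.eb.symm t.eb.symm) hZ
    ⟨fun i j => hY.1 _ _, fun i j => hY.2 _ _⟩ ((submatrix_comm_iff _ _).1 h)
  exact ⟨A, W, B, h1, h2, by rw [← h3]; ext; simp⟩

theorem fac_obj {s t : Shape K} (h : s.Pair r t) :
    InFac S (D.cok c (t.obj m x)) (D.cok c (s.obj m x)) := by
  choose A B k h1 h2 using h.fac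
  choose Z hZ hA hY using fun l => Q.exists_hom (h1 l)
  exact Cok.inFac (D.idem c) Z hZ (fun l => ⟨_, hY l⟩) fun l => ⟨l, k l, fun j => by
    rw [hA l _ _ rfl, h2]; split_ifs <;> simp⟩

theorem ne_obj (hcd : c ≠ d) {s t : Shape K} (h : s.Pair r t) :
    IsEmpty (D.cok c (s.obj m x) ≃ₗ[S] D.cok c (t.obj m x)) := by
  rcases h.ne with h1 | h1
  · exact D.isEmpty_equiv_of_card hcd (Q.isC_obj s) (Q.isC_obj t) h1
  · by_cases h0 : Fintype.card s.κ = Fintype.card t.κ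
    · have := h.nonempty
      have : Nonempty t.κ := Fintype.card_pos_iff.1 (h0 ▸ Fintype.card_pos)
      have := D.isEmpty_equiv_of_map_eq_zero hcd (Q.isC_obj t) (Q.isC_obj s) fun Z Y hZ hY hh => by
        obtain ⟨A, W, B, h2, h3, -⟩ := Q.hom_of_obj_mul hZ hY hh
        rw [h3, h1 A W B h2]
      exact ⟨fun f => this.false f.symm⟩
    · exact D.isEmpty_equiv_of_card hcd (Q.isC_obj s) (Q.isC_obj t) h0

theorem indec_obj (hcd : c ≠ d) {t : Shape K} [Nonempty t.κ] (h : t.Indec r) :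
    IsIndecModule S (D.cok c (t.obj m x)) :=
  D.isIndecModule_cok hcd (Q.isC_obj t) fun Z Y hZ hY hh => by
    obtain ⟨A, W, B, h2, h3, -⟩ := Q.hom_of_obj_mul hZ hY hh
    obtain ⟨a, n, h4⟩ := h A W B h2
    exact ⟨a, n, by rw [h3]; exact pow_toBlocks_eq_zero h4⟩

end Half
end TwoVertex

section Transpose

variable {S : Type} [Ring S] {ι κ ι' κ' : Type} {e f : S}

/-- The transposed matrix over the opposite ring. -/
def opT (F : Matrix ι κ S) : Matrix κ ι Sᵐᵒᵖ := of fun i j => MulOpposite.op (F j i)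

/-- The transposed matrix over the ring. -/
def unT (F : Matrix ι κ Sᵐᵒᵖ) : Matrix κ ι S := of fun i j => MulOpposite.unop (F j i)

theorem opT_unT (F : Matrix ι κ Sᵐᵒᵖ) : opT (unT F) = F := rfl

theorem unT_opT (F : Matrix ι κ S) : unT (opT F) = F := rfl

theorem opT_mul [Fintype κ] (F : Matrix ι κ S) (G : Matrix κ κ' S) :
    opT (F * G) = opT G * opT F := by
  ext; simp [opT, Matrix.mul_apply]

theorem unT_mul [Fintype κ] (F : Matrix ι κ Sᵐᵒᵖ) (G : Matrix κ κ' Sᵐᵒᵖ) :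
    unT (F * G) = unT G * unT F := by
  ext; simp [unT, Matrix.mul_apply]

theorem opT_dg [DecidableEq ι] : opT (dg ι e) = dg ι (.op e) := by
  ext i j
  by_cases h : i = j
  · subst h; simp [opT, dg]
  · simp [opT, dg, h, Ne.symm h]

theorem IsC.opT {F : Matrix ι κ S} (h : IsC f e F) : IsC (.op e) (.op f) (opT F) :=
  ⟨fun i j => congrArg MulOpposite.op (h.2 j i), fun i j => congrArg MulOpposite.op (h.1 j i)⟩

theorem IsC.unT {F : Matrix ι κ Sᵐᵒᵖ} (h : IsC (.op e) (.op f) F) : IsC f e (unT F) :=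
  ⟨fun i j => congrArg MulOpposite.unop (h.2 j i), fun i j => congrArg MulOpposite.unop (h.1 j i)⟩

theorem EVan.opT [Fintype κ] [Fintype ι'] {F : Matrix ι κ S} {F' : Matrix ι' κ' S}
    (h : EVan e f F F') : EVan (.op f) (.op e) (opT F') (opT F) := fun X hX => by
  obtain ⟨Z, Y, hZ, hY, hh⟩ := h (TwoPoint.unT X) hX.unT
  refine ⟨_, _, hY.opT, hZ.opT, ?_⟩
  rw [← opT_mul, ← opT_mul, add_comm, ← opT_unT X, hh]
  rfl

theorem EVan.unT [Fintype κ] [Fintype ι'] {F : Matrix ι κ Sᵐᵒᵖ} {F' : Matrix ι' κ' Sᵐᵒᵖ}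
    (h : EVan (.op e) (.op f) F F') : EVan f e (unT F') (unT F) := fun X hX => by
  obtain ⟨Z, Y, hZ, hY, hh⟩ := h (TwoPoint.opT X) hX.opT
  refine ⟨_, _, hY.unT, hZ.unT, ?_⟩
  rw [← unT_mul, ← unT_mul, add_comm, ← unT_opT X, hh]
  rfl

theorem MEquiv.opT [Fintype ι] [Fintype κ] [Fintype ι'] [Fintype κ'] [DecidableEq ι]
    [DecidableEq κ] [DecidableEq ι'] [DecidableEq κ'] {F : Matrix ι κ S} {F' : Matrix ι' κ' S}
    (h : MEquiv e f F F') : MEquiv (.op f) (.op e) (opT F) (opT F') := by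
  obtain ⟨U, U', V, V', hU, hU', hV, hV', h1, h2, h3, h4, rfl⟩ := h
  refine ⟨_, _, _, _, hV.opT, hV'.opT, hU.opT, hU'.opT, ?_, ?_, ?_, ?_, ?_⟩
  · rw [← opT_mul, h4, opT_dg]
  · rw [← opT_mul, h3, opT_dg]
  · rw [← opT_mul, h2, opT_dg]
  · rw [← opT_mul, h1, opT_dg]
  · rw [opT_mul, opT_mul, Matrix.mul_assoc]

theorem opT_kron {τ : Type} [DecidableEq τ] (F : Matrix ι κ S) :
    opT (kron τ F) = kron τ (opT F) := by
  ext ⟨i, j⟩ ⟨k, l⟩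
  by_cases h : i = k
  · subst h; simp [opT, kron]
  · simp [opT, kron, h, Ne.symm h]

theorem opT_fromBlocks {α β : Type} (F : Matrix ι κ S) (G : Matrix α β S) :
    opT (fromBlocks F 0 0 G) = fromBlocks (opT F) 0 0 (opT G) := by
  ext (i | i) (j | j) <;> simp [opT]

end Transpose

/-- The transposed object. -/
abbrev MatObj.dual {S : Type} (U : MatObj S) : MatObj Sᵐᵒᵖ := ⟨U.a, U.b, opT U.F⟩

namespace TwoVertex

variable {K S : Type} [Field K] [Ring S] [Algebra K S]

/-- The opposite structure. -/
def op (D : TwoVertex K S) : TwoVertex K Sᵐᵒᵖ where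
  e i := MulOpposite.op (D.e i)
  χ i := (D.χ i).fromOpposite fun _ _ => mul_comm _ _
  idem i := congrArg MulOpposite.op (D.idem i)
  orth i j h := congrArg MulOpposite.op (D.orth j i h.symm)
  sum := congrArg MulOpposite.op D.sum
  χe i j := D.χe i j
  nil r h0 h1 := by
    obtain ⟨n, hn⟩ := D.nil r.unop h0 h1
    exact ⟨n, MulOpposite.unop_injective (by simpa using hn)⟩

namespace Half

variable {D : TwoVertex K S} {c d : Fin 2} {r : ℕ} {m y : S} (Q : D.Half d c r m y)

include Q

theorem fac_dual {s t : Shape K} (h : s.Pair r t) :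
    InFac Sᵐᵒᵖ (D.op.cok c (s.obj m y).dual) (D.op.cok c (t.obj m y).dual) := by
  choose A W B k h1 h2 using h.dfac
  choose Z hZ hA hY using fun l => Q.exists_hom (h1 l)
  refine Cok.inFac (D.op.idem c) (fun l => opT ((sm (fromBlocks (A l) (W l) 0 (B l))
    (D.e c)).submatrix s.eb t.eb)) (fun l => IsC.opT ?_) (fun l => ⟨opT (Z l), ?_⟩)
    fun l => ⟨s.eb l, t.eb.symm (k (s.eb l)), fun j => ?_⟩
  · have := isC_sm (fromBlocks (A l) (W l) 0 (B l)) (D.idem c) (D.idem c)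
    exact ⟨fun i j => this.1 _ _, fun i j => this.2 _ _⟩
  · exact (opT_mul _ _).symm.trans ((congrArg opT (hY l)).symm.trans (opT_mul _ _))
  · have := h2 (s.eb l) (s.eb j)
    change MulOpposite.op ((fromBlocks _ _ 0 _ : Matrix _ _ K) (s.eb j)
      (t.eb (t.eb.symm (k (s.eb l)))) • D.e c) = _
    rw [Equiv.apply_symm_apply, this]
    by_cases hjl : j = l
    · subst hjl; simp [op]
    · simp [hjl]

theorem hom_of_dual_mul {s t : Shape K} {Z : Matrix t.b s.b Sᵐᵒᵖ} {Y : Matrix t.κ s.κ Sᵐᵒᵖ}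
    (hZ : IsC (D.op.e c) (D.op.e c) Z) (hY : IsC (D.op.e d) (D.op.e d) Y)
    (h : (t.obj m y).dual.F * Z = Y * (s.obj m y).dual.F) :
    ∃ A W B, s.Hom r t A W B ∧
      Z.map (D.op.χ c) = ((fromBlocks A W 0 B).submatrix s.eb t.eb)ᵀ := by
  obtain ⟨A, W, B, h1, -, h2⟩ := Q.hom_of_obj_mul (Z := unT Y) (Y := unT Z) hY.unT hZ.unT
    ((unT_mul _ _).symm.trans ((congrArg unT h).symm.trans (unT_mul _ _)))
  exact ⟨A, W, B, h1, by rw [← h2]; rfl⟩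

theorem isC_dual (t : Shape K) : IsC (D.op.e d) (D.op.e c) (t.obj m y).dual.F :=
  (Q.isC_obj t).opT

theorem evan_dual {s t : Shape K} (h : s.Ext r t) :
    EVan (D.op.e c) (D.op.e d) (t.obj m y).dual.F (s.obj m y).dual.F :=
  (Q.evan_obj h).opT

theorem ne_dual (hcd : c ≠ d) {s t : Shape K} (h : s.Pair r t) :
    IsEmpty (D.op.cok c (t.obj m y).dual ≃ₗ[Sᵐᵒᵖ] D.op.cok c (s.obj m y).dual) := by
  suffices hs : IsEmpty (D.op.cok c (s.obj m y).dual ≃ₗ[Sᵐᵒᵖ] D.op.cok c (t.obj m y).dual) from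
    ⟨fun f => hs.false f.symm⟩
  rcases h.dne with h1 | h1
  · refine D.op.isEmpty_equiv_of_card hcd (Q.isC_dual s) (Q.isC_dual t) ?_
    rwa [Fintype.card_congr s.eb, Fintype.card_congr t.eb]
  · have := h.nonempty
    have : Nonempty s.b := ⟨s.eb.symm (.inl (Classical.arbitrary _))⟩
    refine D.op.isEmpty_equiv_of_map_eq_zero hcd (Q.isC_dual s) (Q.isC_dual t)
      fun Z Y hZ hY hh => ?_
    obtain ⟨A, W, B, h2, h3⟩ := Q.hom_of_dual_mul hZ hY hh
    rw [h3, h1 A W B h2]; rfl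

theorem indec_dual (hcd : c ≠ d) {t : Shape K} [Nonempty t.b] (h : t.Indec r) :
    IsIndecModule Sᵐᵒᵖ (D.op.cok c (t.obj m y).dual) :=
  D.op.isIndecModule_cok hcd (Q.isC_dual t) fun Z Y hZ hY hh => by
    obtain ⟨A, W, B, h2, h3⟩ := Q.hom_of_dual_mul hZ hY hh
    obtain ⟨a, n, h4⟩ := h A W B h2
    refine ⟨a, n, ?_⟩
    have h5 := congrArg (Matrix.reindexAlgEquiv K K t.eb.symm) h4
    rw [map_pow, map_zero, map_sub] at h5
    have h6 : Matrix.reindexAlgEquiv K K t.eb.symm (Matrix.scalar (t.κ ⊕ t.ι) a) =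
        Matrix.scalar t.b a := by
      ext i j
      by_cases hij : i = j <;> simp [Matrix.diagonal_apply, hij]
    rw [h6] at h5
    have h7 := congrArg Matrix.transpose h5
    rw [Matrix.transpose_pow, Matrix.transpose_sub] at h7
    rw [h3]
    simpa [Matrix.reindex_apply] using h7

end Half
end TwoVertex
end TwoPoint

namespace TwoPoint

open Matrix

theorem Shape.len_pos (r : ℕ) : 0 < Shape.len r := by
  rcases r with _ | _ | r <;> exact Nat.succ_pos _

namespace TwoVertex

variable {K S : Type} [Field K] [Ring S] [Algebra K S] {D : TwoVertex K S} {c d : Fin 2}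

/-- The chain consisting of a projective module only. -/
def trivialChain (S : Type) [Ring S] : ℕ → MatObj S
  | 0 => ⟨Empty, Unit, 0⟩
  | _ + 1 => ⟨Unit, Empty, 0⟩

theorem matChain_trivial [Module.Finite K S] (hcd : c ≠ d)
    (h : ∀ a, D.e d * a = a → a * D.e c = a → a = 0) : D.MatChain c d 0 (trivialChain S) where
  isC j _ := by rcases j with _ | j <;> constructor <;> intro i j <;> (try cases i) <;> cases j
  ev j _ X hX := ⟨0, 0, by constructor <;> simp, by constructor <;> simp, by
    ext i j; simp [h _ (hX.1 i j) (hX.2 i j)]⟩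
  ev1 j _ X hX := ⟨0, 0, by constructor <;> simp, by constructor <;> simp, by
    ext i j; simp [h _ (hX.1 i j) (hX.2 i j)]⟩
  ev2 j _ X hX := ⟨0, 0, by constructor <;> simp, by constructor <;> simp, by
    ext i j; simp [h _ (hX.1 i j) (hX.2 i j)]⟩
  fac j hj := by
    obtain rfl : j = 0 := by omega
    have : Subsingleton (D.cok c (trivialChain S 1)) :=
      have : IsEmpty (trivialChain S 1).a := inferInstanceAs (IsEmpty Empty)
      Cok.subsingleton _ _
    exact InFac.of_subsingleton _ _
  ne j hj := by
    obtain rfl : j = 0 := by omega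
    refine D.isEmpty_equiv_of_card hcd (F := (trivialChain S 0).F) (F' := (trivialChain S 1).F)
      ⟨fun i => i.elim, fun i => i.elim⟩ ⟨fun _ j => j.elim, fun _ j => j.elim⟩ ?_
    change Fintype.card Unit ≠ Fintype.card Empty
    decide
  last_a := inferInstanceAs (IsEmpty Empty)
  last_b := inferInstanceAs (Nonempty Unit)
  indec j hj := by
    obtain rfl : j = 0 := by omega
    have : Nonempty (trivialChain S 0).a := inferInstanceAs (Nonempty Unit)
    refine D.isIndecModule_cok hcd (F := (trivialChain S 0).F) ⟨fun i => i.elim, fun i => i.elim⟩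
      fun Z Y hZ hY hh => ⟨D.χ c (Z () ()), 1, ?_⟩
    rw [pow_one]
    ext ⟨⟩ ⟨⟩
    exact sub_self _
  nf {ι κ} _ _ _ _ F hF _ := by
    refine ⟨0, le_rfl, κ, ι, inferInstance, inferInstance, inferInstance, inferInstance, ?_⟩
    have h1 := MEquiv.submatrix (D.idem c) (D.idem d) hF
      (eEmptyUnit : (κ × Empty) ⊕ (ι × Unit) ≃ ι) (eUnitEmpty : (κ × Unit) ⊕ (ι × Empty) ≃ κ)
    have h2 : F = 0 := by ext i j; exact h _ (hF.1 i j) (hF.2 i j)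
    have h3 : F.submatrix (eEmptyUnit : (κ × Empty) ⊕ (ι × Unit) ≃ ι)
        (eUnitEmpty : (κ × Unit) ⊕ (ι × Empty) ≃ κ) = fromBlocks (kron κ (trivialChain S 0).F) 0 0
          (kron ι (trivialChain S (0 + 1)).F) := by
      ext (⟨_, ⟨⟩⟩ | ⟨i, _⟩) (⟨j, _⟩ | ⟨_, ⟨⟩⟩)
      rw [h2]; rfl
    rw [← h3]
    exact h1

/-- The coordinates of both halves agree. -/
theorem Half.h_zero_eq {p q : ℕ} {m x y : S} (Qx : D.op.Half c d p (.op m) (.op x))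
    (Qy : D.Half d c q m y) {a : S} (h1 : D.e c * a = a) (h2 : a * D.e d = a) :
    Qx.h 0 (.op a) = Qy.h 0 a := by
  obtain ⟨t, b, b1, b2, b3, -, rfl⟩ := Qy.span a h1 h2
  have l1 : ∀ z, D.e d * z = z → z * D.e d = z → D.χ d z = 0 → Qy.h 0 (m * z) = 0 :=
    fun z z1 z2 z3 => by rw [Qy.mul0 m z Qy.fm Qy.me z2 z1, z3, mul_zero]
  have l2 : ∀ z, D.e d * z = z → z * D.e d = z → D.χ d z = 0 →
      Qx.h 0 (.op (m * z)) = 0 := fun z z1 z2 z3 => by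
    rw [MulOpposite.op_mul, Qx.left 0 (.op z) (.op m) (congrArg MulOpposite.op z2)
      (congrArg MulOpposite.op z1) Qx.fm Qx.me]
    exact mul_eq_zero_of_left z3 _
  have l3 : Qy.h 0 (b * m) = 0 := by rw [Qy.left 0 b m b1 b2 Qy.fm Qy.me, b3, zero_mul]
  have l4 : Qx.h 0 (.op (b * m)) = 0 := by
    rw [MulOpposite.op_mul, Qx.mul0 (.op m) (.op b) Qx.fm Qx.me (congrArg MulOpposite.op b1)
      (congrArg MulOpposite.op b2)]
    exact mul_eq_zero_of_right _ b3
  have y2 : D.χ d (y * y) = 0 := by rw [map_mul, Qy.χx, zero_mul]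
  have y3 : D.e d * (y * y) = y * y := by rw [← mul_assoc, Qy.ex]
  have y4 : y * y * D.e d = y * y := by rw [mul_assoc, Qy.xe]
  simp only [mul_assoc m, MulOpposite.op_add, MulOpposite.op_smul, map_add, map_smul,
    l1 _ Qy.ex Qy.xe Qy.χx, l1 _ y3 y4 y2, l2 _ Qy.ex Qy.xe Qy.χx, l2 _ y3 y4 y2, l3, l4, Qx.hm,
    Qy.hm]

/-- The two parts of a chain. -/
def glue (K : Type) [Field K] {S : Type} [Ring S] [Algebra K S] (p q : ℕ) (m x y : S) (j : ℕ) :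
    MatObj Sᵐᵒᵖ :=
  if j ≤ Shape.len q then ((Shape.chain K q (Shape.len q - j)).obj m y).dual
  else (Shape.chain K p (j - Shape.len q)).obj (.op m) (.op x)

section Glue

variable {p q : ℕ} {m x y : S}

theorem glue_low {i j : ℕ} (h : i + j = Shape.len q) :
    glue K p q m x y j = ((Shape.chain K q i).obj m y).dual := by
  rw [glue, if_pos (by omega), ← h, Nat.add_sub_cancel_right]

theorem glue_high (j : ℕ) :
    glue K p q m x y (Shape.len q + j) = (Shape.chain K p j).obj (.op m) (.op x) := by
  rcases j with _ | j
  · rw [Nat.add_zero, glue_low (i := 0) (zero_add _), Shape.chain_zero, Shape.chain_zero]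
    unfold MatObj.dual Shape.obj
    congr 1
  · rw [glue, if_neg (by omega), Nat.add_sub_cancel_left]

theorem matChain_glue [Module.Finite K S] (hcd : c ≠ d)
    (Qx : D.op.Half c d p (.op m) (.op x)) (Qy : D.Half d c q m y) :
    D.op.MatChain c d (Shape.len p + Shape.len q - 1) (glue K p q m x y) := by
  have hp := Shape.len_pos p
  have hq := Shape.len_pos q
  have cases1 : ∀ {P : MatObj Sᵐᵒᵖ → Prop}, (∀ i ≤ Shape.len q, P ((Shape.chain K q i).obj m y).dual) →
      (∀ i ≤ Shape.len p, P ((Shape.chain K p i).obj (.op m) (.op x))) →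
      ∀ j ≤ Shape.len p + Shape.len q, P (glue K p q m x y j) := by
    intro P h1 h2 j hj
    rcases le_total j (Shape.len q) with h | h
    · rw [glue_low (Nat.sub_add_cancel h)]
      exact h1 _ (Nat.sub_le _ _)
    · obtain ⟨i, rfl⟩ := Nat.exists_eq_add_of_le h
      rw [glue_high]
      exact h2 i (by omega)
  have cases2 : ∀ {P : MatObj Sᵐᵒᵖ → MatObj Sᵐᵒᵖ → Prop}, (∀ i < Shape.len q,
        P ((Shape.chain K q (i + 1)).obj m y).dual ((Shape.chain K q i).obj m y).dual) →
      (∀ i < Shape.len p, P ((Shape.chain K p i).obj (.op m) (.op x))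
        ((Shape.chain K p (i + 1)).obj (.op m) (.op x))) →
      ∀ j ≤ Shape.len p + Shape.len q - 1, P (glue K p q m x y j) (glue K p q m x y (j + 1)) := by
    intro P h1 h2 j hj
    rcases Nat.lt_or_ge j (Shape.len q) with h | h
    · obtain ⟨i, hi⟩ := Nat.exists_eq_add_of_lt h
      rw [glue_low (i := i + 1) (j := j) (by omega), glue_low (i := i) (j := j + 1) (by omega)]
      exact h1 i (by omega)
    · obtain ⟨i, rfl⟩ := Nat.exists_eq_add_of_le h
      rw [add_assoc, glue_high, glue_high]
      exact h2 i (by omega)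
  have ext_self : ∀ r, ∀ i ≤ Shape.len r, (Shape.chain K r i).Ext r (Shape.chain K r i) := by
    intro r i hi
    rcases hi.lt_or_eq with h | rfl
    · exact (Shape.pair_chain r i h).ext
    · have hr := Shape.len_pos r
      have := (Shape.pair_chain (K := K) r (Shape.len r - 1) (by omega)).ext'
      rwa [Nat.sub_add_cancel hr] at this
  have hk : Shape.len p + Shape.len q - 1 + 1 = Shape.len p + Shape.len q := by omega
  have last : glue K p q m x y (Shape.len p + Shape.len q - 1 + 1) =
      (Shape.s10 K).obj (.op m) (.op x) := by
    rw [hk, add_comm, glue_high, Shape.chain_len]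
  refine ⟨?_, ?_, ?_, ?_, ?_, ?_, ?_, ?_, ?_, ?_⟩
  · rw [hk]
    exact cases1 (P := fun U => IsC (D.op.e d) (D.op.e c) U.F) (fun i _ => Qy.isC_dual _)
      fun i _ => Qx.isC_obj _
  · rw [hk]
    exact cases1 (P := fun U => EVan (D.op.e c) (D.op.e d) U.F U.F)
      (fun i hi => Qy.evan_dual (ext_self q i hi)) fun i hi => Qx.evan_obj (ext_self p i hi)
  · exact cases2 (P := fun U V => EVan (D.op.e c) (D.op.e d) U.F V.F)
      (fun i hi => Qy.evan_dual (Shape.pair_chain q i hi).ext1)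
      fun i hi => Qx.evan_obj (Shape.pair_chain p i hi).ext1
  · exact cases2 (P := fun U V => EVan (D.op.e c) (D.op.e d) V.F U.F)
      (fun i hi => Qy.evan_dual (Shape.pair_chain q i hi).ext2)
      fun i hi => Qx.evan_obj (Shape.pair_chain p i hi).ext2
  · exact cases2 (P := fun U V => InFac Sᵐᵒᵖ (D.op.cok c V) (D.op.cok c U))
      (fun i hi => Qy.fac_dual (Shape.pair_chain q i hi))
      fun i hi => Qx.fac_obj (Shape.pair_chain p i hi)
  · exact cases2 (P := fun U V => IsEmpty (D.op.cok c U ≃ₗ[Sᵐᵒᵖ] D.op.cok c V))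
      (fun i hi => Qy.ne_dual hcd (Shape.pair_chain q i hi))
      fun i hi => Qx.ne_obj hcd (Shape.pair_chain p i hi)
  · rw [last]
    exact inferInstanceAs (IsEmpty Empty)
  · rw [last]
    exact inferInstanceAs (Nonempty Unit)
  · refine cases2 (P := fun U _ => IsIndecModule Sᵐᵒᵖ (D.op.cok c U)) (fun i hi => ?_)
      fun i hi => ?_
    · rcases (Nat.succ_le_of_lt hi).lt_or_eq with h | h
      · have := (Shape.pair_chain (K := K) q (i + 1) h).nonempty
        have : Nonempty (Shape.chain K q (i + 1)).b :=
          ⟨(Shape.chain K q (i + 1)).eb.symm (.inl (Classical.arbitrary _))⟩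
        exact Qy.indec_dual hcd (Shape.pair_chain q (i + 1) h).indec
      · rw [Nat.succ_eq_add_one] at h
        rw [h, Shape.chain_len]
        exact Qy.indec_dual hcd Shape.indec_10
    · have := (Shape.pair_chain (K := K) p i hi).nonempty
      exact Qx.indec_obj hcd (Shape.pair_chain p i hi).indec
  · intro ι κ _ _ _ _ F hF hE
    rcases Qx.full_rank_of_evan hF hE with ⟨L, hL⟩ | ⟨L, hL⟩
    · obtain ⟨j, hj, τ, τ', i1, i2, i3, i4, h⟩ := Qx.normal_form hF hE hL
      refine ⟨Shape.len q + j, by omega, τ, τ', i1, i2, i3, i4, ?_⟩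
      rw [add_assoc, glue_high, glue_high]
      exact h
    · have hF' : IsC (D.e c) (D.e d) (unT F) := IsC.unT hF
      have hL' : Lᵀ * (unT F).map (Qy.h 0) = 1 := by
        have : (unT F).map (Qy.h 0) = (F.map (Qx.h 0))ᵀ := by
          ext i j
          exact (Half.h_zero_eq Qx Qy (hF'.1 i j) (hF'.2 i j)).symm
        rw [this, ← Matrix.transpose_mul, hL, Matrix.transpose_one]
      obtain ⟨j, hj, τ, τ', i1, i2, i3, i4, h⟩ := Qy.normal_form hF' (EVan.unT hE) hL'
      refine ⟨Shape.len q - 1 - j, by omega, τ', τ, i2, i1, i4, i3, ?_⟩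
      rw [glue_low (i := j + 1) (by omega), glue_low (i := j) (by omega)]
      have h1 := h.opT
      rw [opT_unT, opT_fromBlocks, opT_kron, opT_kron] at h1
      have h2 := MEquiv.submatrix (D.op.idem c) (D.op.idem d) (IsC.fromBlocks
        (isC_kron (τ := τ) (Qy.isC_dual (Shape.chain K q j)))
        (isC_kron (τ := τ') (Qy.isC_dual (Shape.chain K q (j + 1)))))
        (Equiv.sumComm _ _) (Equiv.sumComm _ _)
      have h3 : MEquiv (D.op.e c) (D.op.e d) F _ := h1.trans h2
      convert h3 using 1
      ext (i | i) (j | j) <;> rfl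

end Glue

end TwoVertex
end TwoPoint

namespace TwoPoint

section Words

variable {n : ℕ}

/-- Word relations: a pair `(l, none)` encodes `l = 0` and `(l, some r)` encodes `l = r`. -/
abbrev Rules (n : ℕ) := List (List (Fin n) × Option (List (Fin n)))

/-- The word `l` occurs as a factor of the word `w`. -/
def hasFactor (l w : List (Fin n)) : Bool :=
  (List.range (w.length + 1)).any fun i => l.isPrefixOf (w.drop i)

/-- Some pair of consecutive arrows of the word is not composable. -/
def broken (s t : Fin n → Fin 2) : List (Fin n) → Bool
  | a :: b :: w => t a != s b || broken s t (b :: w)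
  | _ => false

/-- The word is visibly zero: it is not a path, or it contains a monomial relation. -/
def isZ (s t : Fin n → Fin 2) (R : Rules n) (w : List (Fin n)) : Bool :=
  broken s t w || R.any fun r => r.2.isNone && hasFactor r.1 w

/-- The word `v` is obtained from `u` by applying one of the commutativity relations. -/
def rewrites (R : Rules n) (u v : List (Fin n)) : Bool :=
  R.any fun r => r.2.any fun r' => (List.range (u.length + 1)).any fun i =>
    r.1.isPrefixOf (u.drop i) && v == u.take i ++ r' ++ u.drop (i + r.1.length)

/-- The words agree up to at most one application of a commutativity relation. -/
def isEq (R : Rules n) (u v : List (Fin n)) : Bool :=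
  u == v || rewrites R u v || rewrites R v u

/-- The relations of the opposite quiver. -/
def revRules (R : Rules n) : Rules n := R.map fun r => (r.1.reverse, r.2.map List.reverse)

theorem revRules_revRules (R : Rules n) : revRules (revRules R) = R := by
  simp [revRules, Function.comp_def]

/-- The value of a word. -/
def ev {B : Type} [Monoid B] (x : Fin n → B) (w : List (Fin n)) : B := (w.map x).prod

section

variable {B : Type} [Monoid B] (x : Fin n → B)

theorem ev_cons (a : Fin n) (w : List (Fin n)) : ev x (a :: w) = x a * ev x w := List.prod_cons

theorem ev_append (u v : List (Fin n)) : ev x (u ++ v) = ev x u * ev x v := by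
  simp [ev]

theorem ev_singleton (a : Fin n) : ev x [a] = x a := by simp [ev]

theorem map_ev {C : Type} [Monoid C] {F : Type} [FunLike F B C] [MonoidHomClass F B C] (φ : F)
    (w : List (Fin n)) : φ (ev x w) = ev (fun a => φ (x a)) w := by
  simp [ev, map_list_prod, Function.comp_def]

theorem ev_op (w : List (Fin n)) :
    ev (fun a => MulOpposite.op (x a)) w.reverse = MulOpposite.op (ev x w) := by
  induction w with
  | nil => rfl
  | cons a w ih => rw [List.reverse_cons, ev_append, ih, ev_singleton, ev_cons, MulOpposite.op_mul]

end

/-- A system of elements satisfying the relations of a bound quiver algebra. -/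
structure Marking (K : Type) [Field K] (s t : Fin n → Fin 2) (R : Rules n) (B : Type) [Ring B]
    [Algebra K B] where
  /-- vertices -/
  e : Fin 2 → B
  /-- arrows -/
  x : Fin n → B
  idem : ∀ i, e i * e i = e i
  orth : ∀ i j, i ≠ j → e i * e j = 0
  sum : e 0 + e 1 = 1
  src : ∀ a, e (s a) * x a = x a
  tgt : ∀ a, x a * e (t a) = x a
  rel : ∀ r ∈ R, ev x r.1 = r.2.elim 0 (ev x)

namespace Marking

variable {K : Type} [Field K] {s t : Fin n → Fin 2} {R : Rules n} {B : Type} [Ring B]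
  [Algebra K B] (M : Marking K s t R B)

/-- The opposite system. -/
def op {R' : Rules n} (h : revRules R = R') : Marking K t s R' Bᵐᵒᵖ where
  e i := MulOpposite.op (M.e i)
  x a := MulOpposite.op (M.x a)
  idem i := by rw [← MulOpposite.op_mul, M.idem]
  orth i j hij := by rw [← MulOpposite.op_mul, M.orth j i hij.symm, MulOpposite.op_zero]
  sum := by rw [← MulOpposite.op_add, M.sum, MulOpposite.op_one]
  src a := by rw [← MulOpposite.op_mul, M.tgt]
  tgt a := by rw [← MulOpposite.op_mul, M.src]
  rel := by
    subst h
    intro r hr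
    simp only [revRules, List.mem_map] at hr
    obtain ⟨⟨l, o⟩, hr, rfl⟩ := hr
    rw [ev_op, M.rel _ hr]
    cases o with
    | none => rfl
    | some w => exact (ev_op M.x w).symm

theorem e_mul_ev {a : Fin n} (w : List (Fin n)) (i : Fin 2) :
    M.e i * ev M.x (a :: w) = if i = s a then ev M.x (a :: w) else 0 := by
  rw [ev_cons, ← mul_assoc]
  split_ifs with h
  · rw [h, M.src]
  · rw [← M.src, ← mul_assoc, M.orth _ _ h, zero_mul, zero_mul]

theorem ev_mul_e {a : Fin n} (w : List (Fin n)) (i : Fin 2) :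
    ev M.x (w ++ [a]) * M.e i = if t a = i then ev M.x (w ++ [a]) else 0 := by
  rw [ev_append, ev_singleton, mul_assoc]
  split_ifs with h
  · rw [← h, M.tgt]
  · rw [← M.tgt, mul_assoc, M.orth _ _ h, mul_zero, mul_zero]

theorem ev_of_broken {w : List (Fin n)} (h : broken s t w = true) : ev M.x w = 0 := by
  induction w with
  | nil => simp [broken] at h
  | cons a w ih =>
    cases w with
    | nil => simp [broken] at h
    | cons b w =>
      simp only [broken, Bool.or_eq_true, bne_iff_ne] at h
      rcases h with h | h
      · rw [ev_cons, ← M.tgt, mul_assoc, M.e_mul_ev, if_neg h, mul_zero]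
      · rw [ev_cons, ih h, mul_zero]

theorem eq_append_of_isPrefixOf {l u : List (Fin n)} {i : ℕ}
    (h : l.isPrefixOf (u.drop i) = true) : u = u.take i ++ l ++ u.drop (i + l.length) := by
  obtain ⟨v, hv⟩ : l <+: u.drop i := by simpa using h
  rw [← List.drop_drop, ← hv, List.drop_left, List.append_assoc, hv, List.take_append_drop]

theorem ev_of_isZ {w : List (Fin n)} (h : isZ s t R w = true) : ev M.x w = 0 := by
  simp only [isZ, hasFactor, Bool.or_eq_true, List.any_eq_true, Bool.and_eq_true,
    Option.isNone_iff_eq_none] at h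
  rcases h with h | ⟨⟨l, o⟩, hr, rfl, i, -, h⟩
  · exact M.ev_of_broken h
  · have h0 : ev M.x l = 0 := M.rel _ hr
    rw [eq_append_of_isPrefixOf h, ev_append, ev_append, h0, mul_zero, zero_mul]

theorem ev_of_rewrites {u v : List (Fin n)} (h : rewrites R u v = true) :
    ev M.x u = ev M.x v := by
  simp only [rewrites, List.any_eq_true, Option.any_eq_true, Bool.and_eq_true,
    beq_iff_eq] at h
  obtain ⟨⟨l, o⟩, hr, r', rfl, i, -, h, hv⟩ := h
  have h0 : ev M.x l = ev M.x r' := M.rel _ hr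
  conv_lhs => rw [eq_append_of_isPrefixOf h]
  rw [hv]
  simp only [ev_append]
  rw [h0]

theorem ev_of_isEq {u v : List (Fin n)} (h : isEq R u v = true) : ev M.x u = ev M.x v := by
  simp only [isEq, Bool.or_eq_true, beq_iff_eq] at h
  rcases h with (rfl | h) | h
  · rfl
  · exact M.ev_of_rewrites h
  · exact (M.ev_of_rewrites h).symm

end Marking

/-- The word vanishes after at most one application of a commutativity relation; the candidate
for the rewritten word is supplied. -/
def derives (s t : Fin n → Fin 2) (R : Rules n) (p : List (Fin n) × List (Fin n)) : Bool :=
  isEq R p.1 p.2 && isZ s t R p.2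

/-- Adding derived monomial relations. -/
def addRules (R : Rules n) : List (List (Fin n) × List (Fin n)) → Rules n
  | [] => R
  | p :: L => addRules ((p.1, none) :: R) L

/-- All the added monomial relations follow from the previous ones. -/
def derivable (s t : Fin n → Fin 2) (R : Rules n) : List (List (Fin n) × List (Fin n)) → Bool
  | [] => true
  | p :: L => derives s t R p && derivable s t ((p.1, none) :: R) L

theorem mem_addRules {L : List (List (Fin n) × List (Fin n))} {R : Rules n} {r}
    (h : r ∈ R) : r ∈ addRules R L := by
  induction L generalizing R with
  | nil => exact h
  | cons p L ih => exact ih (List.mem_cons_of_mem _ h)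

section

variable {K : Type} [Field K] {s t : Fin n → Fin 2} {B : Type} [Ring B] [Algebra K B]

theorem Marking.rel_addRules {R : Rules n} (M : Marking K s t R B)
    {L : List (List (Fin n) × List (Fin n))} (h : derivable s t R L = true) :
    ∀ r ∈ addRules R L, ev M.x r.1 = r.2.elim 0 (ev M.x) := by
  induction L generalizing R with
  | nil => exact M.rel
  | cons p L ih =>
    simp only [derivable, derives, Bool.and_eq_true] at h
    refine ih { M with rel := ?_ } h.2
    intro r hr
    rcases List.mem_cons.1 hr with rfl | hr
    · exact (M.ev_of_isEq h.1.1).trans (M.ev_of_isZ h.1.2)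
    · exact M.rel r hr

end

end Words

end TwoPoint

namespace TwoPoint

open Matrix

section Words

variable {n : ℕ} {K : Type} [Field K]

/-- A bound quiver algebra, with a finite set of words spanning its radical. -/
structure Pres (K : Type) [Field K] (s t : Fin n → Fin 2) (R : Rules n)
    (ws : List (List (Fin n))) (S : Type) [Ring S] [Algebra K S] extends Marking K s t R S where
  gen : ∀ N : Submodule K S, (∀ i, e i ∈ N) → (∀ w ∈ ws, ev x w ∈ N) → N = ⊤
  lift : ∀ (B : Type) [Ring B] [Algebra K B] (M : Marking K s t R B),
    ∃ φ : S →ₐ[K] B, (∀ i, φ (e i) = M.e i) ∧ ∀ a, φ (x a) = M.x a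

namespace Pres

variable {s t : Fin n → Fin 2} {R : Rules n} {ws : List (List (Fin n))} {S : Type} [Ring S]
  [Algebra K S] (P : Pres K s t R ws S)

/-- The opposite algebra as a bound quiver algebra. -/
def op : Pres K t s (revRules R) (ws.map List.reverse) Sᵐᵒᵖ where
  toMarking := P.toMarking.op rfl
  gen N he hw := by
    have h := P.gen (N.comap (MulOpposite.opLinearEquiv K (M := S)).toLinearMap) (fun i => he i)
      (fun w hmem => by
        have := hw w.reverse (List.mem_map_of_mem hmem)
        rw [show (P.toMarking.op rfl).x = fun a => MulOpposite.op (P.x a) from rfl, ev_op] at this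
        exact this)
    rw [eq_top_iff]
    intro z _
    have hz : z.unop ∈ N.comap (MulOpposite.opLinearEquiv K (M := S)).toLinearMap := by
      rw [h]; trivial
    exact hz
  lift B _ _ M := by
    obtain ⟨φ, h1, h2⟩ := P.lift Bᵐᵒᵖ (M.op (revRules_revRules R))
    refine ⟨AlgHom.opComm φ, fun i => ?_, fun a => ?_⟩
    · exact congrArg MulOpposite.unop (h1 i)
    · exact congrArg MulOpposite.unop (h2 a)

theorem linear_ext {N : Type} [AddCommGroup N] [Module K N] {f g : S →ₗ[K] N}
    (he : ∀ i, f (P.e i) = g (P.e i)) (hw : ∀ w ∈ ws, f (ev P.x w) = g (ev P.x w)) : f = g := by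
  have h := P.gen (LinearMap.eqLocus f g) he hw
  ext z
  have : z ∈ LinearMap.eqLocus f g := by rw [h]; trivial
  exact this

end Pres

/-! ### Algebras acting on four-element sets by partial maps -/

/-- The matrix of a partial map. -/
def pmat (K : Type) [Field K] (f : Fin 4 → Option (Fin 4)) : Matrix (Fin 4) (Fin 4) K :=
  Matrix.of fun i j => if f i = some j then 1 else 0

theorem pmat_mul (f g : Fin 4 → Option (Fin 4)) :
    pmat K f * pmat K g = pmat K fun i => (f i).bind g := by
  ext i j
  rw [Matrix.mul_apply]
  rcases h : f i with _ | k
  · simp [pmat, h]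
  · rw [Finset.sum_eq_single k]
    · simp [pmat, h]
    · intro l _ hl
      simp [pmat, h, hl.symm]
    · simp

theorem pmat_some : pmat K some = 1 := by
  ext i j
  simp [pmat, Matrix.one_apply]

theorem pmat_none : pmat K (fun _ => none) = 0 := by
  ext i j
  simp [pmat]

/-- The partial map attached to a word. -/
def run (δ : Fin n → Fin 4 → Option (Fin 4)) : List (Fin n) → Fin 4 → Option (Fin 4)
  | [] => some
  | a :: w => fun i => (δ a i).bind (run δ w)

theorem ev_pmat (δ : Fin n → Fin 4 → Option (Fin 4)) (w : List (Fin n)) :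
    ev (fun a => pmat K (δ a)) w = pmat K (run δ w) := by
  induction w with
  | nil => exact pmat_some.symm
  | cons a w ih => rw [ev_cons, ih, pmat_mul]; rfl

/-- The partial maps are compatible with the colours and satisfy the relations. -/
def RunCheck (s t : Fin n → Fin 2) (R : Rules n) (δ : Fin n → Fin 4 → Option (Fin 4))
    (col : Fin 4 → Fin 2) : Prop :=
  (∀ a i j, δ a i = some j → col i = s a ∧ col j = t a) ∧
    ∀ r ∈ R, ∀ i, run δ r.1 i = r.2.elim none fun w => run δ w i

instance (s t : Fin n → Fin 2) (R : Rules n) (δ : Fin n → Fin 4 → Option (Fin 4))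
    (col : Fin 4 → Fin 2) : Decidable (RunCheck s t R δ col) :=
  inferInstanceAs (Decidable (_ ∧ _))

/-- The system of matrices defined by partial maps. -/
def RunCheck.marking (K : Type) [Field K] {s t : Fin n → Fin 2} {R : Rules n}
    {δ : Fin n → Fin 4 → Option (Fin 4)} {col : Fin 4 → Fin 2} (h : RunCheck s t R δ col) :
    Marking K s t R (Matrix (Fin 4) (Fin 4) K) where
  e k := Matrix.diagonal fun i => if col i = k then 1 else 0
  x a := pmat K (δ a)
  idem k := by simp
  orth j k hjk := by
    rw [Matrix.diagonal_mul_diagonal, ← Matrix.diagonal_zero]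
    congr 1
    ext i
    by_cases hi : col i = j
    · simp [hi, hjk]
    · simp [hi]
  sum := by
    rw [Matrix.diagonal_add, ← Matrix.diagonal_one]
    congr 1
    ext i
    generalize col i = k
    fin_cases k <;> simp
  src a := by
    ext i j
    rw [Matrix.diagonal_mul]
    by_cases hi : δ a i = some j
    · simp [(h.1 a i j hi).1]
    · simp [pmat, hi]
  tgt a := by
    ext i j
    rw [Matrix.mul_diagonal]
    by_cases hi : δ a i = some j
    · simp [(h.1 a i j hi).2]
    · simp [pmat, hi]
  rel := by
    rintro ⟨l, o⟩ hr
    have h1 := h.2 _ hr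
    rw [ev_pmat]
    cases o with
    | none => rw [funext h1]; exact pmat_none
    | some w => rw [funext h1]; exact (ev_pmat δ w).symm

/-! ### Corner bimodules of bound quiver algebras -/

/-- The action of the arrows on a uniserial quotient of a corner bimodule. -/
def halfStep (r : ℕ) (m : Fin n) (y : Option (Fin n)) (a : Fin n) (i : Fin 4) :
    Option (Fin 4) :=
  if a = m then (if i = 0 then some 1 else none)
  else if y = some a then
    (if i = 1 ∧ 1 ≤ r then some 2 else if i = 2 ∧ 2 ≤ r then some 3 else none)
  else none

/-- The numerical conditions ensuring that a corner of a bound quiver algebra is of the form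
described by `TwoVertex.Half`. -/
def HalfCheck (s t : Fin n → Fin 2) (R : Rules n) (ws : List (List (Fin n))) (c d : Fin 2) (r : ℕ)
    (m : Fin n) (y : Option (Fin n)) (bs : List (List (Fin n))) : Prop :=
  (d ≠ c ∧ s m = d ∧ t m = c ∧ (∀ a, y = some a → s a = c ∧ t a = c) ∧ (1 ≤ r → y ≠ none)) ∧
  RunCheck s t R (halfStep r m y) ![d, c, c, c] ∧
  (∀ a, y = some a → (r < 1 → isZ s t R [m, a]) ∧ (r < 2 → isZ s t R [m, a, a] ∨
    ∃ b ∈ bs, b.head?.map s = some d ∧ b.getLast?.map t = some d ∧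
      isEq R [m, a, a] (b ++ [m])) ∧ isZ s t R [m, a, a, a]) ∧
  (∀ v ∈ ws, v.head?.map s ≠ some d ∨ v.getLast?.map t ≠ some c ∨ v = [m] ∨
    (∃ a, y = some a ∧ (v = [m, a] ∨ v = [m, a, a])) ∨
    ∃ b ∈ bs, b.head?.map s = some d ∧ b.getLast?.map t = some d ∧
      isEq R v (b ++ [m]) ∧ ∀ a, y = some a → isZ s t R (b ++ [m, a])) ∧
  ∀ v ∈ ws, v ≠ [] ∧ (∀ i j, j ≤ i → run (halfStep r m y) v i ≠ some j) ∧
    (2 ≤ r → (run (halfStep r m y) v 2 = some 3 ↔ run (halfStep r m y) v 1 = some 2))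

set_option synthInstance.maxSize 512 in
set_option synthInstance.maxHeartbeats 200000 in
instance (s t : Fin n → Fin 2) (R : Rules n) (ws : List (List (Fin n))) (c d : Fin 2) (r : ℕ)
    (m : Fin n) (y : Option (Fin n)) (bs : List (List (Fin n))) :
    Decidable (HalfCheck s t R ws c d r m y bs) :=
  inferInstanceAs (Decidable (_ ∧ _))

end Words

end TwoPoint

namespace TwoPoint

open Matrix

section Words

variable {n : ℕ} {K : Type} [Field K] {s t : Fin n → Fin 2} {R : Rules n}
  {ws : List (List (Fin n))} {S : Type} [Ring S] [Algebra K S]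

theorem Marking.e_mul_of_head? (M : Marking K s t R S) {w : List (Fin n)} {i : Fin 2}
    (h : w.head?.map s = some i) : M.e i * ev M.x w = ev M.x w := by
  cases w with
  | nil => simp at h
  | cons a w =>
    rw [M.e_mul_ev, if_pos]
    simpa using h.symm

theorem Marking.e_mul_of_head?_ne (M : Marking K s t R S) {w : List (Fin n)} {i : Fin 2}
    (hw : w ≠ []) (h : w.head?.map s ≠ some i) : M.e i * ev M.x w = 0 := by
  cases w with
  | nil => exact absurd rfl hw
  | cons a w =>
    rw [M.e_mul_ev, if_neg]
    rintro rfl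
    exact h rfl

theorem Marking.mul_e_of_getLast? (M : Marking K s t R S) {w : List (Fin n)} {i : Fin 2}
    (h : w.getLast?.map t = some i) : ev M.x w * M.e i = ev M.x w := by
  rcases List.eq_nil_or_concat w with rfl | ⟨v, a, rfl⟩
  · simp at h
  · rw [List.concat_eq_append, M.ev_mul_e, if_pos]
    simpa using h

theorem Marking.mul_e_of_getLast?_ne (M : Marking K s t R S) {w : List (Fin n)} {i : Fin 2}
    (hw : w ≠ []) (h : w.getLast?.map t ≠ some i) : ev M.x w * M.e i = 0 := by
  rcases List.eq_nil_or_concat w with rfl | ⟨v, a, rfl⟩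
  · exact absurd rfl hw
  · rw [List.concat_eq_append, M.ev_mul_e, if_neg]
    rintro rfl
    exact h (by simp)

theorem map_ev_eq_zero {B : Type} [MonoidWithZero B] {x : Fin n → S} {f : S →* B}
    (h : ∀ a, f (x a) = 0) {w : List (Fin n)} (hw : w ≠ []) : f (ev x w) = 0 := by
  cases w with
  | nil => exact absurd rfl hw
  | cons a w => rw [ev_cons, map_mul, h, zero_mul]

/-- The element attached to an optional arrow. -/
def Marking.opt (M : Marking K s t R S) (y : Option (Fin n)) : S := y.elim 0 M.x

namespace Pres

variable (P : Pres K s t R ws S) {c d : Fin 2} {r : ℕ} {m : Fin n} {y : Option (Fin n)}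
  {bs : List (List (Fin n))}

include P in
theorem half_span {D : TwoVertex K S} (hDe : ∀ i, D.e i = P.e i) (hDx : ∀ i a, D.χ i (P.x a) = 0)
    (H : HalfCheck s t R ws c d r m y bs) {h : S} (h1 : D.e d * h = h) (h2 : h * D.e c = h) :
    ∃ (a : Fin 3 → K) (b : S), D.e d * b = b ∧ b * D.e d = b ∧ D.χ d b = 0 ∧
      b * (P.x m * P.opt y) = 0 ∧
      h = a 0 • P.x m + a 1 • (P.x m * P.opt y) + a 2 • (P.x m * P.opt y * P.opt y) +
        b * P.x m := by
  obtain ⟨⟨hdc, -, -, -, -⟩, -, -, hs, hr⟩ := H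
  let Bs : Submodule K S :=
    { carrier := {b | D.e d * b = b ∧ b * D.e d = b ∧ D.χ d b = 0 ∧ b * (P.x m * P.opt y) = 0}
      add_mem' := fun ha hb => ⟨by rw [mul_add, ha.1, hb.1], by rw [add_mul, ha.2.1, hb.2.1],
        by rw [map_add, ha.2.2.1, hb.2.2.1, add_zero],
        by rw [add_mul, ha.2.2.2, hb.2.2.2, add_zero]⟩
      zero_mem' := ⟨mul_zero _, zero_mul _, map_zero _, zero_mul _⟩
      smul_mem' := fun k b hb => ⟨by rw [mul_smul_comm, hb.1], by rw [smul_mul_assoc, hb.2.1],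
        by rw [map_smul, hb.2.2.1, smul_zero], by rw [smul_mul_assoc, hb.2.2.2, smul_zero]⟩ }
  let N : Submodule K S := Submodule.span K {P.x m, P.x m * P.opt y, P.x m * P.opt y * P.opt y} ⊔
    Bs.map (LinearMap.mulRight K (P.x m))
  let L : S →ₗ[K] S := LinearMap.mulRight K (D.e c) ∘ₗ LinearMap.mulLeft K (D.e d)
  have hL : ∀ z, L z = D.e d * z * D.e c := fun z => rfl
  have hspan : ∀ z ∈ ({P.x m, P.x m * P.opt y, P.x m * P.opt y * P.opt y} : Set S), z ∈ N :=
    fun z hz => Submodule.mem_sup_left (Submodule.subset_span hz)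
  have htop : N.comap L = ⊤ := by
    refine P.gen _ (fun i => ?_) (fun v hv => ?_)
    · rw [Submodule.mem_comap, hL, ← hDe]
      have : D.e d * D.e i * D.e c = 0 := by
        by_cases hi : d = i
        · rw [mul_assoc, ← hi, D.orth _ _ hdc, mul_zero]
        · rw [D.orth _ _ hi, zero_mul]
      rw [this]; exact N.zero_mem
    · rw [Submodule.mem_comap, hL, hDe, hDe]
      have hv0 := (hr v hv).1
      by_cases hh : v.head?.map s = some d
      swap
      · rw [P.e_mul_of_head?_ne hv0 hh, zero_mul]; exact N.zero_mem
      by_cases ht : v.getLast?.map t = some c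
      swap
      · rw [mul_assoc, P.mul_e_of_getLast?_ne hv0 ht, mul_zero]; exact N.zero_mem
      rw [P.e_mul_of_head? hh, P.mul_e_of_getLast? ht]
      rcases hs v hv with h | h | rfl | ⟨a, rfl, rfl | rfl⟩ | ⟨b, -, hb1, hb2, hb3, hb4⟩
      · exact absurd hh h
      · exact absurd ht h
      · rw [ev_singleton]; exact hspan _ (by simp)
      · rw [ev_cons, ev_singleton]; exact hspan _ (by simp [Marking.opt])
      · rw [ev_cons, ev_cons, ev_singleton, ← mul_assoc]; exact hspan _ (by simp [Marking.opt])
      · rw [P.ev_of_isEq hb3, ev_append, ev_singleton]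
        have hb0 : b ≠ [] := by rintro rfl; simp at hb1
        refine Submodule.mem_sup_right ⟨ev P.x b, ⟨?_, ?_, ?_, ?_⟩, rfl⟩
        · rw [hDe, P.e_mul_of_head? hb1]
        · rw [hDe, P.mul_e_of_getLast? hb2]
        · exact map_ev_eq_zero (f := (D.χ d : S →* K)) (hDx d) hb0
        · cases y with
          | none => exact (congrArg _ (mul_zero _)).trans (mul_zero _)
          | some a =>
            have := P.ev_of_isZ (hb4 a rfl)
            rwa [ev_append, ev_cons, ev_singleton] at this
  have hm : h ∈ N.comap L := by rw [htop]; trivial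
  rw [Submodule.mem_comap, hL, h1, h2] at hm
  obtain ⟨u, hu, _, ⟨b, hb, rfl⟩, rfl⟩ := Submodule.mem_sup.1 hm
  obtain ⟨a₀, a₁, a₂, rfl⟩ := Submodule.mem_span_triple.1 hu
  exact ⟨![a₀, a₁, a₂], b, hb.1, hb.2.1, hb.2.2.1, hb.2.2.2, rfl⟩

/-- The corner of a bound quiver algebra described by a successful check. -/
theorem nonempty_half (D : TwoVertex K S) (hDe : ∀ i, D.e i = P.e i)
    (hDx : ∀ i a, D.χ i (P.x a) = 0) (H : HalfCheck s t R ws c d r m y bs) :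
    Nonempty (D.Half c d r (P.x m) (P.opt y)) := by
  have hspan := fun h => P.half_span hDe hDx H (h := h)
  obtain ⟨⟨hdc, hsm, htm, hy, hry⟩, hrun, hz, -, hr⟩ := H
  obtain ⟨φ, hφe, hφx⟩ := P.lift _ (hrun.marking K)
  have hφe' : ∀ k, φ (P.e k) =
    Matrix.diagonal fun i => if (![d, c, c, c] : Fin 4 → Fin 2) i = k then 1 else 0 := hφe
  have hφw : ∀ w, φ (ev P.x w) = pmat K (run (halfStep r m y) w) := fun w => by
    rw [map_ev, ← ev_pmat]
    exact congrArg (fun f => ev f w) (funext hφx)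
  let E : Fin 4 → Fin 4 → S →ₗ[K] K := fun i j =>
    Matrix.entryLinearMap K K i j ∘ₗ φ.toLinearMap
  have hE : ∀ i j z, E i j z = φ z i j := fun _ _ _ => rfl
  have tri : ∀ i j, j < i → ∀ z, φ z i j = 0 := fun i j hij z => by
    rw [← hE, P.linear_ext (f := E i j) (g := 0)]
    · rfl
    · intro k; rw [hE, hφe', Matrix.diagonal_apply_ne _ hij.ne']; rfl
    · intro w hw; rw [hE, hφw]; simp [pmat, (hr w hw).2.1 i j hij.le]
  have diag : ∀ i z, φ z i i = D.χ (![d, c, c, c] i) z := fun i z => by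
    rw [← hE, P.linear_ext (f := E i i) (g := (D.χ (![d, c, c, c] i)).toLinearMap)]
    · rfl
    · intro k
      rw [hE, hφe', Matrix.diagonal_apply_eq, AlgHom.toLinearMap_apply, ← hDe, D.χe]
    · intro w hw
      rw [hE, hφw, AlgHom.toLinearMap_apply]
      rw [show D.χ (![d, c, c, c] i) (ev P.x w) = 0 from
        map_ev_eq_zero (f := (D.χ (![d, c, c, c] i) : S →* K)) (hDx _) (hr w hw).1]
      simp [pmat, (hr w hw).2.1 i i le_rfl]
  have toep : 2 ≤ r → ∀ z, φ z 2 3 = φ z 1 2 := fun h2 z => by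
    rw [← hE, ← hE, P.linear_ext (f := E 2 3) (g := E 1 2)]
    · intro k
      rw [hE, hE, hφe', Matrix.diagonal_apply_ne _ (by decide),
        Matrix.diagonal_apply_ne _ (by decide)]
    · intro w hw
      rw [hE, hE, hφw]
      simp [pmat, (hr w hw).2.2 h2]
  have d0 : ∀ z, φ z 0 0 = D.χ d z := diag 0
  have d1 : ∀ z, φ z 1 1 = D.χ c z := diag 1
  have d2 : ∀ z, φ z 2 2 = D.χ c z := diag 2
  have d3 : ∀ z, φ z 3 3 = D.χ c z := diag 3
  have row : ∀ z, z * D.e c = z → φ z 0 0 = 0 := fun z hz => by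
    rw [← hz, d0, map_mul, D.χe, if_neg hdc, mul_zero]
  have row' : ∀ z, z * D.e d = z → ∀ i, i ≠ 0 → φ z 0 i = 0 := fun z hz i hi => by
    rw [← hz, map_mul, hDe, hφe', Matrix.mul_diagonal, if_neg, mul_zero]
    fin_cases i
    · exact absurd rfl hi
    all_goals exact hdc.symm
  have hym : ∀ a, y = some a → a ≠ m := fun a ha h => hdc (by rw [← hsm, ← h, (hy a ha).1])
  have φx1 : 1 ≤ r → φ (P.opt y) 1 2 = 1 := fun h => by
    obtain ⟨a, rfl⟩ := Option.ne_none_iff_exists'.1 (hry h)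
    rw [show P.opt (some a) = P.x a from rfl, hφx]
    simp [RunCheck.marking, pmat, halfStep, hym a rfl, h]
  have φx2 : φ (P.opt y) 1 3 = 0 := by
    rcases y with _ | a
    · rw [show P.opt none = 0 from rfl, map_zero]; rfl
    · rw [show P.opt (some a) = P.x a from rfl, hφx]
      simp only [RunCheck.marking, pmat, halfStep, Matrix.of_apply, if_neg (hym a rfl)]
      by_cases h1 : 1 ≤ r <;> simp [h1]
  have φm : ∀ i : Fin 3, φ (P.x m) 0 i.succ = if i = 0 then 1 else 0 := fun i => by
    rw [hφx]
    simp only [RunCheck.marking, pmat, halfStep, Matrix.of_apply]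
    fin_cases i <;> simp
  refine ⟨{
    fm := by rw [hDe, ← hsm, P.src]
    me := by rw [hDe, ← htm, P.tgt]
    ex := ?_
    xe := ?_
    χx := ?_
    z1 := ?_
    z2 := ?_
    z3 := ?_
    span := fun h => hspan h
    h := fun i => E 0 i.succ
    p := fun i => E 1 i.succ.succ
    mul0 := fun y z hy1 hy2 hz1 hz2 => ?_
    mul1 := fun _ y z hy1 hy2 hz1 hz2 => ?_
    mul2 := fun h2 y z hy1 hy2 hz1 hz2 => ?_
    left := fun i w y hw1 hw2 hy1 hy2 => ?_
    hm := φm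
    px0 := φx1
    px1 := fun _ => φx2 }⟩
  · rcases y with _ | a
    · exact mul_zero _
    · rw [hDe, ← (hy a rfl).1]; exact P.src a
  · rcases y with _ | a
    · exact zero_mul _
    · rw [hDe, ← (hy a rfl).2]; exact P.tgt a
  · rcases y with _ | a
    · exact map_zero _
    · exact hDx c a
  · intro h
    rcases y with _ | a
    · exact mul_zero _
    · have := P.ev_of_isZ ((hz a rfl).1 h)
      rwa [ev_cons, ev_singleton] at this
  · intro h
    have h0 : P.x m * P.opt y * P.opt y = 0 → ∃ b, D.e d * b = b ∧ b * D.e d = b ∧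
        D.χ d b = 0 ∧ P.x m * P.opt y * P.opt y = b * P.x m := fun h =>
      ⟨0, mul_zero _, zero_mul _, map_zero _, by rw [h, zero_mul]⟩
    rcases y with _ | a
    · exact h0 (mul_zero _)
    rcases (hz a rfl).2.1 h with h1 | ⟨b, -, hb1, hb2, hb3⟩
    · have := P.ev_of_isZ h1
      rw [ev_cons, ev_cons, ev_singleton, ← mul_assoc] at this
      exact h0 this
    · have := P.ev_of_isEq hb3
      rw [ev_cons, ev_cons, ev_singleton, ← mul_assoc, ev_append, ev_singleton] at this
      exact ⟨ev P.x b, by rw [hDe, P.e_mul_of_head? hb1], by rw [hDe, P.mul_e_of_getLast? hb2],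
        map_ev_eq_zero (f := (D.χ d : S →* K)) (hDx d) (by rintro rfl; simp at hb1), this⟩
  · rcases y with _ | a
    · exact mul_zero _
    · have := P.ev_of_isZ (hz a rfl).2.2
      rwa [ev_cons, ev_cons, ev_cons, ev_singleton, ← mul_assoc, ← mul_assoc] at this
  · change φ (y * z) 0 1 = φ y 0 1 * _
    rw [map_mul, Matrix.mul_apply, Fin.sum_univ_four, row y hy2, tri 2 1 (by decide),
      tri 3 1 (by decide), d1]
    ring
  · change φ (y * z) 0 2 = φ y 0 1 * φ z 1 2 + φ y 0 2 * _
    rw [map_mul, Matrix.mul_apply, Fin.sum_univ_four, row y hy2, tri 3 2 (by decide), d2]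
    ring
  · change φ (y * z) 0 3 = φ y 0 1 * φ z 1 3 + φ y 0 2 * φ z 1 2 + φ y 0 3 * _
    rw [map_mul, Matrix.mul_apply, Fin.sum_univ_four, row y hy2, d3, toep h2]
    ring
  · change φ (w * y) 0 i.succ = _ * φ y 0 i.succ
    rw [map_mul, Matrix.mul_apply, Fin.sum_univ_four, row' w hw2 1 (by decide),
      row' w hw2 2 (by decide), row' w hw2 3 (by decide), d0]
    ring

end Pres

end Words

end TwoPoint

namespace TwoPoint

section Words

variable {n : ℕ} {K : Type} [Field K] {s t : Fin n → Fin 2} {R : Rules n}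
  {ws : List (List (Fin n))}

/-- Left multiplication by an arrow sends each word of the table to a later one, or to zero. -/
def closedWords (s t : Fin n → Fin 2) (R : Rules n) : List (List (Fin n)) → Bool
  | [] => true
  | w :: l => w != [] && decide (∀ a, isZ s t R (a :: w) || l.any (isEq R (a :: w))) &&
      closedWords s t R l

/-- The table of words spans the radical of the bound quiver algebra. -/
def TableCheck (s t : Fin n → Fin 2) (R : Rules n) (ws : List (List (Fin n))) : Prop :=
  closedWords s t R ws ∧ (∀ a, [a] ∈ ws) ∧ ∀ r ∈ R, r.1 ≠ [] ∧ r.2 ≠ some []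

instance (s t : Fin n → Fin 2) (R : Rules n) (ws : List (List (Fin n))) :
    Decidable (TableCheck s t R ws) :=
  inferInstanceAs (Decidable (_ ∧ _))

theorem ne_nil_of_closedWords {l : List (List (Fin n))} (h : closedWords s t R l = true) :
    ∀ w ∈ l, w ≠ [] := by
  induction l with
  | nil => simp
  | cons v l ih =>
    simp only [closedWords, Bool.and_eq_true, bne_iff_ne] at h
    intro w hw
    rcases List.mem_cons.1 hw with rfl | hw
    · exact h.1.1
    · exact ih h.2 w hw

section Span

variable {S : Type} [Ring S] [Algebra K S] (M : Marking K s t R S)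

/-- The span of a list of words. -/
def Marking.wordSpan (l : List (List (Fin n))) : Submodule K S :=
  Submodule.span K {z | ∃ w ∈ l, z = ev M.x w}

theorem Marking.ev_mem_wordSpan {l : List (List (Fin n))} {w : List (Fin n)} (h : w ∈ l) :
    ev M.x w ∈ M.wordSpan l := Submodule.subset_span ⟨w, h, rfl⟩

theorem Marking.wordSpan_le {l : List (List (Fin n))} {N : Submodule K S}
    (h : ∀ w ∈ l, ev M.x w ∈ N) : M.wordSpan l ≤ N := by
  refine Submodule.span_le.2 ?_
  rintro _ ⟨w, hw, rfl⟩
  exact h w hw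

theorem Marking.wordSpan_cons_le (w : List (Fin n)) (l : List (List (Fin n))) :
    M.wordSpan l ≤ M.wordSpan (w :: l) :=
  M.wordSpan_le fun _ hv => M.ev_mem_wordSpan (List.mem_cons_of_mem _ hv)

/-- The elements whose left multiplication maps one submodule into another. -/
def mulInto (N N' : Submodule K S) : Submodule K S where
  carrier := {r | ∀ z ∈ N, r * z ∈ N'}
  add_mem' ha hb z hz := by rw [add_mul]; exact N'.add_mem (ha z hz) (hb z hz)
  zero_mem' z _ := by rw [zero_mul]; exact N'.zero_mem
  smul_mem' k r hr z hz := by rw [smul_mul_assoc]; exact N'.smul_mem k (hr z hz)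

theorem Marking.mem_mulInto_wordSpan {r : S} {l : List (List (Fin n))} {N : Submodule K S}
    (h : ∀ w ∈ l, r * ev M.x w ∈ N) : r ∈ mulInto (M.wordSpan l) N := fun _ hz =>
  M.wordSpan_le (N := N.comap (LinearMap.mulLeft K r)) h hz

theorem Marking.arrow_mem_mulInto {l : List (List (Fin n))} (h : closedWords s t R l = true)
    (a : Fin n) : M.x a ∈ mulInto (M.wordSpan l) (M.wordSpan l) := by
  induction l with
  | nil => exact M.mem_mulInto_wordSpan (by simp)
  | cons w l ih =>
    simp only [closedWords, Bool.and_eq_true, decide_eq_true_eq, Bool.or_eq_true,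
      List.any_eq_true] at h
    refine M.mem_mulInto_wordSpan fun v hv => M.wordSpan_cons_le w l ?_
    rcases List.mem_cons.1 hv with rfl | hv
    · rw [← ev_cons]
      rcases h.1.2 a with h | ⟨u, hu, h⟩
      · rw [M.ev_of_isZ h]; exact Submodule.zero_mem _
      · rw [M.ev_of_isEq h]; exact M.ev_mem_wordSpan hu
    · exact ih h.2 _ (M.ev_mem_wordSpan hv)

theorem Marking.arrow_mem_mulInto_cons {w : List (Fin n)} {l : List (List (Fin n))}
    (h : closedWords s t R (w :: l) = true) (a : Fin n) :
    M.x a ∈ mulInto (M.wordSpan (w :: l)) (M.wordSpan l) := by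
  simp only [closedWords, Bool.and_eq_true, decide_eq_true_eq, Bool.or_eq_true,
    List.any_eq_true] at h
  refine M.mem_mulInto_wordSpan fun v hv => ?_
  rcases List.mem_cons.1 hv with rfl | hv
  · rw [← ev_cons]
    rcases h.1.2 a with h | ⟨u, hu, h⟩
    · rw [M.ev_of_isZ h]; exact Submodule.zero_mem _
    · rw [M.ev_of_isEq h]; exact M.ev_mem_wordSpan hu
  · exact M.arrow_mem_mulInto h.2 a _ (M.ev_mem_wordSpan hv)

theorem Marking.word_mem_mulInto_cons {w : List (Fin n)} {l : List (List (Fin n))}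
    (h : closedWords s t R (w :: l) = true) {v : List (Fin n)} (hv : v ≠ []) :
    ev M.x v ∈ mulInto (M.wordSpan (w :: l)) (M.wordSpan l) := by
  induction v with
  | nil => exact absurd rfl hv
  | cons a v ih =>
    rcases eq_or_ne v [] with rfl | hv'
    · rw [ev_singleton]; exact M.arrow_mem_mulInto_cons h a
    · intro z hz
      rw [ev_cons, mul_assoc]
      exact M.arrow_mem_mulInto_cons h a _ (M.wordSpan_cons_le w l (ih hv' z hz))

theorem Marking.pow_mul_eq_zero {r : S} (hw : ∀ w ∈ ws, w ≠ []) (hr : r ∈ M.wordSpan ws)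
    {l : List (List (Fin n))} (h : closedWords s t R l = true) :
    ∀ z ∈ M.wordSpan l, r ^ l.length * z = 0 := by
  induction l with
  | nil =>
    have : M.wordSpan [] ≤ ⊥ := M.wordSpan_le (by simp)
    intro z hz
    rw [(Submodule.mem_bot K).1 (this hz), mul_zero]
  | cons w l ih =>
    intro z hz
    have h1 : r ∈ mulInto (M.wordSpan (w :: l)) (M.wordSpan l) :=
      M.wordSpan_le (fun v hv => M.word_mem_mulInto_cons h (hw v hv)) hr
    rw [List.length_cons, pow_succ, mul_assoc]
    refine ih ?_ _ (h1 z hz)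
    simp only [closedWords, Bool.and_eq_true] at h
    exact h.2

end Span

/-- The simple module at a vertex, as a system of scalars. -/
def simpleMarking (K : Type) [Field K] (s t : Fin n → Fin 2)
    (hR : ∀ r ∈ R, r.1 ≠ [] ∧ r.2 ≠ some []) (i : Fin 2) : Marking K s t R K where
  e k := if i = k then 1 else 0
  x _ := 0
  idem k := by split_ifs <;> simp
  orth j k hjk := by
    by_cases h : i = j
    · simp [h, hjk]
    · simp [h]
  sum := by fin_cases i <;> simp
  src a := mul_zero _
  tgt a := zero_mul _
  rel := by
    have h : ∀ w : List (Fin n), w ≠ [] → ev (fun _ => (0 : K)) w = 0 := fun w hw =>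
      map_ev_eq_zero (x := fun _ => (0 : K)) (f := MonoidHom.id K) (fun _ => rfl) hw
    rintro ⟨l, o⟩ hr
    obtain ⟨h1, h2⟩ := hR _ hr
    rw [h l h1]
    cases o with
    | none => rfl
    | some w => exact (h w fun hw => h2 (congrArg some hw)).symm

namespace Pres

variable {S : Type} [Ring S] [Algebra K S] (P : Pres K s t R ws S)

include P in
theorem finite : Module.Finite K S := by
  classical
  let A : Finset S := Finset.univ.image P.e ∪ ws.toFinset.image (ev P.x)
  refine ⟨A, P.gen _ (fun i => Submodule.subset_span ?_) fun w hw => Submodule.subset_span ?_⟩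
  · simp [A]
  · simp only [A, Finset.coe_union, Finset.coe_image, List.coe_toFinset]
    exact Or.inr ⟨w, hw, rfl⟩

/-- A bound quiver algebra on two vertices is an algebra with two orthogonal idempotents. -/
theorem exists_twoVertex (h : TableCheck s t R ws) : ∃ D : TwoVertex K S,
    (∀ i, D.e i = P.e i) ∧ ∀ i a, D.χ i (P.x a) = 0 := by
  obtain ⟨hc, -, hR⟩ := h
  choose χ hχe hχx using fun i => P.lift K (simpleMarking K s t hR i)
  have hχe' : ∀ i j, χ i (P.e j) = if i = j then 1 else 0 := hχe
  have hw := ne_nil_of_closedWords hc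
  refine ⟨⟨P.e, χ, P.idem, P.orth, P.sum, hχe, fun r h0 h1 => ?_⟩, fun _ => rfl, hχx⟩
  have hχw : ∀ i, ∀ u ∈ P.wordSpan ws, χ i u = 0 := fun i u hu =>
    P.wordSpan_le (N := LinearMap.ker (χ i).toLinearMap)
      (fun w hmem => map_ev_eq_zero (f := (χ i : S →* K)) (hχx i) (hw w hmem)) hu
  have hr : r ∈ P.wordSpan ws := by
    let N := Submodule.span K {P.e 0, P.e 1} ⊔ P.wordSpan ws
    have hN : N = ⊤ := by
      refine P.gen _ (fun i => Submodule.mem_sup_left (Submodule.subset_span ?_))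
        fun w hmem => Submodule.mem_sup_right (P.ev_mem_wordSpan hmem)
      fin_cases i <;> simp
    have hm : r ∈ N := by rw [hN]; trivial
    obtain ⟨v, hv, u, hu, rfl⟩ := Submodule.mem_sup.1 hm
    obtain ⟨a, b, rfl⟩ := Submodule.mem_span_pair.1 hv
    have ha : a = 0 := by simpa [hχw 0 u hu, hχe'] using h0
    have hb : b = 0 := by simpa [hχw 1 u hu, hχe'] using h1
    rw [ha, hb, zero_smul, zero_smul, zero_add, zero_add]
    exact hu
  refine ⟨ws.length + 1, ?_⟩
  rw [pow_succ]
  exact P.pow_mul_eq_zero hw hr hc r hr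

end Pres

/-- Combinatorial data computing one of the two paths of the Hasse quiver. -/
inductive SideCheck (s t : Fin n → Fin 2) (R : Rules n) (ws : List (List (Fin n))) (c d : Fin 2) :
    ℕ → Prop
  | trivial (h : ∀ v ∈ ws, v.head?.map s ≠ some c ∨ v.getLast?.map t ≠ some d) :
      SideCheck s t R ws c d 1
  | glue (p q : ℕ) (m : Fin n) (x y : Option (Fin n)) (bx bs : List (List (Fin n)))
      (hx : HalfCheck t s (revRules R) (ws.map List.reverse) c d p m x bx)
      (hy : HalfCheck s t R ws d c q m y bs) :
      SideCheck s t R ws c d (Shape.len p + Shape.len q)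

theorem Pres.exists_matChain {S : Type} [Ring S] [Algebra K S] (P : Pres K s t R ws S)
    {D : TwoVertex K S} (hDe : ∀ i, D.e i = P.e i) (hDx : ∀ i a, D.χ i (P.x a) = 0)
    (hw : ∀ w ∈ ws, w ≠ []) {c d : Fin 2} (hcd : c ≠ d) {N : ℕ} (h : SideCheck s t R ws c d N) :
    ∃ (k : ℕ) (U : ℕ → MatObj Sᵐᵒᵖ), D.op.MatChain c d k U ∧ k + 1 = N := by
  have hfin := P.finite
  have hfin' := P.op.finite
  cases h with
  | trivial h =>
    refine ⟨0, TwoVertex.trivialChain Sᵐᵒᵖ, D.op.matChain_trivial hcd fun a h1 h2 => ?_, rfl⟩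
    have h1' : a.unop * D.e d = a.unop := congrArg MulOpposite.unop h1
    have h2' : D.e c * a.unop = a.unop := congrArg MulOpposite.unop h2
    have key : LinearMap.mulRight K (D.e d) ∘ₗ LinearMap.mulLeft K (D.e c) = 0 := by
      refine P.linear_ext (fun i => ?_) fun v hv => ?_
      · change D.e c * P.e i * D.e d = 0
        rw [← hDe]
        by_cases hi : c = i
        · rw [mul_assoc, ← hi, D.orth _ _ hcd, mul_zero]
        · rw [D.orth _ _ hi, zero_mul]
      · change D.e c * ev P.x v * D.e d = 0
        rw [hDe, hDe]
        rcases h v hv with h | h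
        · rw [P.e_mul_of_head?_ne (hw v hv) h, zero_mul]
        · rw [mul_assoc, P.mul_e_of_getLast?_ne (hw v hv) h, mul_zero]
    have h3 : D.e c * a.unop * D.e d = 0 := LinearMap.congr_fun key a.unop
    rw [h2', h1'] at h3
    exact MulOpposite.unop_injective h3
  | glue p q m x y bx bs hx hy =>
    obtain ⟨Qy⟩ := P.nonempty_half D hDe hDx hy
    obtain ⟨Qx⟩ := P.op.nonempty_half D.op (fun i => congrArg MulOpposite.op (hDe i)) hDx hx
    have hx' : P.op.opt x = MulOpposite.op (P.opt x) := by cases x <;> rfl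
    rw [hx'] at Qx
    have hp := Shape.len_pos p
    exact ⟨_, _, D.matChain_glue hcd Qx Qy, by omega⟩

theorem Pres.hasseType {S : Type} [Ring S] [Algebra K S] (P : Pres K s t R ws S)
    (hT : TableCheck s t R ws) {M N : ℕ} (h0 : SideCheck s t R ws 0 1 M)
    (h1 : SideCheck s t R ws 1 0 N) : HasseType S M N := by
  obtain ⟨D, hDe, hDx⟩ := P.exists_twoVertex hT
  have hw := ne_nil_of_closedWords hT.1
  have hfin := P.op.finite
  obtain ⟨k, U, hU, rfl⟩ := P.exists_matChain hDe hDx hw (by decide) h0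
  obtain ⟨l, V, hV, rfl⟩ := P.exists_matChain hDe hDx hw (by decide) h1
  refine TwoVertex.hasseType (D := D.op) (k := ![k, l]) (U := ![U, V]) fun c => ?_
  fin_cases c
  · exact hU
  · exact hV

/-! ### Bound quiver algebras -/

/-- The relations of the free algebra encoded by word relations. -/
def wordRels (K : Type) [Field K] (R : Rules n) :
    Set (FreeAlgebra K (TPGen (Fin n)) × FreeAlgebra K (TPGen (Fin n))) :=
  {p | ∃ r ∈ R, p = (ev (arr K) r.1, r.2.elim 0 (ev (arr K)))}

variable (K) in
/-- The vertices and arrows of a bound quiver algebra. -/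
def quiverMarking (s t : Fin n → Fin 2) (R : Rules n) :
    Marking K s t R (BoundQuiverAlgebra K (Fin n) s t (wordRels K R)) where
  e i := RingQuot.mkAlgHom K _ (vtx K i)
  x a := RingQuot.mkAlgHom K _ (arr K a)
  idem i := by rw [← map_mul]; exact RingQuot.mkAlgHom_rel K (.idem i)
  orth i j h := by
    rw [← map_mul, ← map_zero (RingQuot.mkAlgHom K (QuivRel K (Fin n) s t (wordRels K R)))]
    exact RingQuot.mkAlgHom_rel K (.orth i j h)
  sum := by
    rw [← map_add, ← map_one (RingQuot.mkAlgHom K (QuivRel K (Fin n) s t (wordRels K R)))]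
    exact RingQuot.mkAlgHom_rel K .vsum
  src a := by rw [← map_mul]; exact RingQuot.mkAlgHom_rel K (.src a)
  tgt a := by rw [← map_mul]; exact RingQuot.mkAlgHom_rel K (.tgt a)
  rel := by
    rintro ⟨l, o⟩ hr
    have h := RingQuot.mkAlgHom_rel K
      (QuivRel.rel (K := K) (s := s) (t := t) (rels := wordRels K R) _ ⟨_, hr, rfl⟩)
    rw [map_ev] at h
    rw [h]
    cases o with
    | none => exact map_zero _
    | some w => exact map_ev _ _ _

/-- Generation of a bound quiver algebra by the words of a table. -/
theorem quiver_gen {R' : Rules n}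
    (M : Marking K s t R' (BoundQuiverAlgebra K (Fin n) s t (wordRels K R)))
    (he : ∀ i, M.e i = RingQuot.mkAlgHom K _ (vtx K i))
    (hx : ∀ a, M.x a = RingQuot.mkAlgHom K _ (arr K a)) (hT : TableCheck s t R' ws)
    (N : Submodule K (BoundQuiverAlgebra K (Fin n) s t (wordRels K R)))
    (hNe : ∀ i, M.e i ∈ N) (hNw : ∀ w ∈ ws, ev M.x w ∈ N) : N = ⊤ := by
  obtain ⟨hc, hax, -⟩ := hT
  let N' := Submodule.span K {M.e 0, M.e 1} ⊔ M.wordSpan ws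
  have he' : ∀ i, M.e i ∈ N' := fun i =>
    Submodule.mem_sup_left (Submodule.subset_span (by fin_cases i <;> simp))
  have hx' : ∀ a, M.x a ∈ N' := fun a => Submodule.mem_sup_right (by
    have := M.ev_mem_wordSpan (hax a)
    rwa [ev_singleton] at this)
  have hle : N' ≤ N := by
    refine sup_le (Submodule.span_le.2 ?_) (M.wordSpan_le hNw)
    rintro _ (rfl | rfl)
    · exact hNe 0
    · exact hNe 1
  have hsplit : ∀ r, (∀ i, r * M.e i ∈ N') → (∀ w ∈ ws, r * ev M.x w ∈ N') →
      ∀ z ∈ N', r * z ∈ N' := fun r h1 h2 => by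
    change N' ≤ N'.comap (LinearMap.mulLeft K r)
    refine sup_le (Submodule.span_le.2 ?_) (M.wordSpan_le h2)
    rintro _ (rfl | rfl)
    · exact h1 0
    · exact h1 1
  have key : ∀ f : FreeAlgebra K (TPGen (Fin n)), ∀ z ∈ N',
      RingQuot.mkAlgHom K (QuivRel K (Fin n) s t (wordRels K R)) f * z ∈ N' := by
    intro f
    induction f using FreeAlgebra.induction with
    | grade0 k =>
      intro z hz
      rw [AlgHom.commutes, ← Algebra.smul_def]
      exact N'.smul_mem k hz
    | grade1 g =>
      cases g with
      | v i =>
        refine hsplit _ (fun j => ?_) fun w hw => ?_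
        · change RingQuot.mkAlgHom K _ (vtx K i) * _ ∈ N'
          rw [← he]
          by_cases hij : i = j
          · rw [hij, M.idem]; exact he' j
          · rw [M.orth _ _ hij]; exact N'.zero_mem
        · change RingQuot.mkAlgHom K _ (vtx K i) * _ ∈ N'
          rw [← he]
          rcases w with _ | ⟨b, w⟩
          · exact absurd rfl (ne_nil_of_closedWords hc _ hw)
          · rw [M.e_mul_ev]
            split_ifs
            · exact Submodule.mem_sup_right (M.ev_mem_wordSpan hw)
            · exact N'.zero_mem
      | ar a =>
        refine hsplit _ (fun j => ?_) fun w hw => ?_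
        · change RingQuot.mkAlgHom K _ (arr K a) * _ ∈ N'
          rw [← hx]
          by_cases hj : t a = j
          · rw [← hj, M.tgt]; exact hx' a
          · rw [← M.tgt, mul_assoc, M.orth _ _ hj, mul_zero]; exact N'.zero_mem
        · change RingQuot.mkAlgHom K _ (arr K a) * _ ∈ N'
          rw [← hx]
          exact Submodule.mem_sup_right (M.arrow_mem_mulInto hc a _ (M.ev_mem_wordSpan hw))
    | mul f g hf hg =>
      intro z hz
      rw [map_mul, mul_assoc]
      exact hf _ (hg z hz)
    | add f g hf hg =>
      intro z hz
      rw [map_add, add_mul]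
      exact N'.add_mem (hf z hz) (hg z hz)
  rw [eq_top_iff]
  intro z _
  obtain ⟨f, rfl⟩ := RingQuot.mkAlgHom_surjective K _ z
  have h1 : (1 : BoundQuiverAlgebra K (Fin n) s t (wordRels K R)) ∈ N' := by
    rw [← M.sum]; exact N'.add_mem (he' 0) (he' 1)
  have := key f 1 h1
  rw [mul_one] at this
  exact hle this

variable (K) in
/-- A bound quiver algebra, with derived monomial relations. -/
def quiverPres (L : List (List (Fin n) × List (Fin n))) (hL : derivable s t R L = true)
    (hT : TableCheck s t (addRules R L) ws) : Pres K s t (addRules R L) ws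
      (BoundQuiverAlgebra K (Fin n) s t (wordRels K R)) where
  toMarking := { quiverMarking K s t R with rel := (quiverMarking K s t R).rel_addRules hL }
  gen := quiver_gen _ (fun _ => rfl) (fun _ => rfl) hT
  lift B _ _ M := by
    let f : FreeAlgebra K (TPGen (Fin n)) →ₐ[K] B := FreeAlgebra.lift K fun g =>
      match g with
      | .v i => M.e i
      | .ar a => M.x a
    have fv : ∀ i, f (vtx K i) = M.e i := fun i => FreeAlgebra.lift_ι_apply _ _
    have fa : ∀ a, f (arr K a) = M.x a := fun a => FreeAlgebra.lift_ι_apply _ _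
    have hf : ∀ ⦃u v⦄, QuivRel K (Fin n) s t (wordRels K R) u v → f u = f v := by
      intro u v h
      cases h with
      | idem i => rw [map_mul, fv, M.idem]
      | orth i j h => rw [map_mul, fv, fv, M.orth i j h, map_zero]
      | vsum => rw [map_add, fv, fv, M.sum, map_one]
      | src a => rw [map_mul, fv, fa, M.src]
      | tgt a => rw [map_mul, fv, fa, M.tgt]
      | rel p hp =>
        obtain ⟨⟨l, o⟩, hr, rfl⟩ := hp
        have h := M.rel _ (mem_addRules hr)
        have hw : ∀ w, f (ev (arr K) w) = ev M.x w := fun w => by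
          rw [map_ev]; exact congrArg (fun g => ev g w) (funext fa)
        change f (ev (arr K) l) = f _
        rw [hw, h]
        cases o with
        | none => exact (map_zero f).symm
        | some w => exact (hw w).symm
    refine ⟨RingQuot.liftAlgHom K ⟨f, hf⟩, fun i => ?_, fun a => ?_⟩
    · exact (RingQuot.liftAlgHom_mkAlgHom_apply K f hf _).trans (fv i)
    · exact (RingQuot.liftAlgHom_mkAlgHom_apply K f hf _).trans (fa a)

/-- The Hasse quiver of a bound quiver algebra, from combinatorial data. -/
theorem hasseType_of_check
    {rels : Set (FreeAlgebra K (TPGen (Fin n)) × FreeAlgebra K (TPGen (Fin n)))}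
    (hrels : rels = wordRels K R) (L : List (List (Fin n) × List (Fin n)))
    (hL : derivable s t R L = true) (hT : TableCheck s t (addRules R L) ws) {M N : ℕ}
    (h0 : SideCheck s t (addRules R L) ws 0 1 M) (h1 : SideCheck s t (addRules R L) ws 1 0 N) :
    HasseType (BoundQuiverAlgebra K (Fin n) s t rels) M N := by
  subst hrels
  exact (quiverPres K L hL hT).hasseType hT h0 h1

end Words

end TwoPoint

namespace TwoPoint

variable (K : Type) [Field K]

theorem tabW4_data : TauTiltingData (TabW4 K) 5 1 2 :=
  HasseType.data (HasseType.swap (hasseType_of_check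
    (R := [([0, 0], none), ([1, 1], none), ([0, 1], none), ([1, 0], none), ([0, 2], none), ([1,
    2], none)])
    (ws := [[0], [1], [2]])
    (by ext; simp [wordRels, ev, QJ.a1, QJ.a2, QJ.mu, pow_succ, mul_assoc])
    [] (by decide +kernel) (by decide +kernel)
    (.glue 0 0 2 none none [] [] (by decide +kernel) (by decide +kernel))
    (.trivial (by decide +kernel)))) rfl

theorem tabW6_data : TauTiltingData (TabW6 K) 6 1 3 :=
  HasseType.data (HasseType.swap (hasseType_of_check
    (R := [([0, 0, 0, 0, 0, 0, 0], none), ([0, 0, 1], none)])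
    (ws := [[0], [1], [0, 0], [0, 1], [0, 0, 0], [0, 0, 0, 0], [0, 0, 0, 0, 0], [0, 0, 0, 0, 0,
    0]])
    (by ext; simp [wordRels, ev, QI.al, QI.mu, pow_succ, mul_assoc])
    [] (by decide +kernel) (by decide +kernel)
    (.glue 1 0 1 (some 0) none [] [[0]] (by decide +kernel) (by decide +kernel))
    (.trivial (by decide +kernel)))) rfl

theorem tabW7_data : TauTiltingData (TabW7 K) 8 1 5 :=
  HasseType.data (HasseType.swap (hasseType_of_check
    (R := [([0, 0, 0, 0], none), ([0, 0, 0, 1], none)])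
    (ws := [[0], [1], [0, 0], [0, 1], [0, 0, 0], [0, 0, 1]])
    (by ext; simp [wordRels, ev, QI.al, QI.mu, pow_succ, mul_assoc])
    [] (by decide +kernel) (by decide +kernel)
    (.glue 2 0 1 (some 0) none [] [[0], [0, 0]] (by decide +kernel) (by decide +kernel))
    (.trivial (by decide +kernel)))) rfl

theorem tabW8_data : TauTiltingData (TabW8 K) 8 1 5 :=
  HasseType.data (HasseType.swap (hasseType_of_check
    (R := [([0, 0], none), ([2, 2, 2], none), ([0, 1], none)])
    (ws := [[0], [1], [2], [1, 2], [2, 2], [1, 2, 2]])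
    (by ext; simp [wordRels, ev, QB.al, QB.mu, QB.be, pow_succ, mul_assoc])
    [] (by decide +kernel) (by decide +kernel)
    (.glue 0 2 1 none (some 2) [[2], [2, 2]] [] (by decide +kernel) (by decide +kernel))
    (.trivial (by decide +kernel)))) rfl

theorem tabW9_data : TauTiltingData (TabW9 K) 6 1 3 :=
  HasseType.data (HasseType.swap (hasseType_of_check
    (R := [([0, 0, 0], none), ([2, 2, 2], none), ([0, 1], none), ([1, 2, 2], none)])
    (ws := [[0], [1], [2], [0, 0], [1, 2], [2, 2]])
    (by ext; simp [wordRels, ev, QB.al, QB.mu, QB.be, pow_succ, mul_assoc])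
    [] (by decide +kernel) (by decide +kernel)
    (.glue 0 1 1 none (some 2) [[2]] [] (by decide +kernel) (by decide +kernel))
    (.trivial (by decide +kernel)))) rfl

theorem tabW10_data : TauTiltingData (TabW10 K) 6 1 3 :=
  HasseType.data (HasseType.swap (hasseType_of_check
    (R := [([0, 0], none), ([2, 2, 2, 2], none), ([0, 1], none), ([1, 2, 2], none)])
    (ws := [[0], [1], [2], [1, 2], [2, 2], [2, 2, 2]])
    (by ext; simp [wordRels, ev, QB.al, QB.mu, QB.be, pow_succ, mul_assoc])
    [] (by decide +kernel) (by decide +kernel)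
    (.glue 0 1 1 none (some 2) [[2]] [] (by decide +kernel) (by decide +kernel))
    (.trivial (by decide +kernel)))) rfl

theorem tabW11_data : TauTiltingData (TabW11 K) 7 1 4 :=
  HasseType.data (HasseType.swap (hasseType_of_check
    (R := [([0, 0], none), ([2, 2, 2], none), ([0, 1, 2], none), ([1, 2, 2], none)])
    (ws := [[0], [1], [2], [0, 1], [1, 2], [2, 2]])
    (by ext; simp [wordRels, ev, QB.al, QB.mu, QB.be, pow_succ, mul_assoc])
    [] (by decide +kernel) (by decide +kernel)
    (.glue 1 1 1 (some 0) (some 2) [[2]] [[0]] (by decide +kernel) (by decide +kernel))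
    (.trivial (by decide +kernel)))) rfl

theorem tabW12_data : TauTiltingData (TabW12 K) 5 1 2 :=
  HasseType.data (HasseType.swap (hasseType_of_check
    (R := [([0, 0, 0, 0], none), ([2, 2, 2, 2, 2], none), ([1, 2, 2], none), ([0, 1], some [1,
    2])])
    (ws := [[0], [1], [2], [0, 0], [1, 2], [2, 2], [0, 0, 0], [2, 2, 2], [2, 2, 2, 2]])
    (by ext; simp [wordRels, ev, QB.al, QB.mu, QB.be, pow_succ, mul_assoc])
    [([0, 1, 2], [1, 2, 2])] (by decide +kernel) (by decide +kernel)
    (.glue 0 0 1 none none [[2]] [[0]] (by decide +kernel) (by decide +kernel))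
    (.trivial (by decide +kernel)))) rfl

theorem tabW13_data : TauTiltingData (TabW13 K) 5 1 2 :=
  HasseType.data (HasseType.swap (hasseType_of_check
    (R := [([0, 0, 0], none), ([2, 2, 2, 2, 2, 2, 2], none), ([1, 2, 2], none), ([0, 1], some [1,
    2])])
    (ws := [[0], [1], [2], [0, 0], [1, 2], [2, 2], [2, 2, 2], [2, 2, 2, 2], [2, 2, 2, 2, 2], [2,
    2, 2, 2, 2, 2]])
    (by ext; simp [wordRels, ev, QB.al, QB.mu, QB.be, pow_succ, mul_assoc])
    [([0, 1, 2], [1, 2, 2])] (by decide +kernel) (by decide +kernel)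
    (.glue 0 0 1 none none [[2]] [[0]] (by decide +kernel) (by decide +kernel))
    (.trivial (by decide +kernel)))) rfl

theorem tabW14_data : TauTiltingData (TabW14 K) 10 3 5 :=
  HasseType.data (hasseType_of_check
    (R := [([0, 0, 0], none), ([1, 2], none), ([2, 1], none), ([0, 0, 1], none)])
    (ws := [[0], [1], [2], [0, 0], [0, 1], [2, 0], [2, 0, 0], [2, 0, 1]])
    (by ext; simp [wordRels, ev, QD.al, QD.mu, QD.nu, pow_succ, mul_assoc])
    [] (by decide +kernel) (by decide +kernel)
    (.glue 1 0 1 (some 0) none [] [[0]] (by decide +kernel) (by decide +kernel))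
    (.glue 0 2 2 none (some 0) [[0], [0, 0]] [] (by decide +kernel) (by decide +kernel))) rfl

theorem tabW15_data : TauTiltingData (TabW15 K) 9 2 5 :=
  HasseType.data (hasseType_of_check
    (R := [([0, 0, 0], none), ([1, 2], none), ([0, 1], none)])
    (ws := [[0], [1], [2], [0, 0], [2, 0], [2, 1], [2, 0, 0]])
    (by ext; simp [wordRels, ev, QD.al, QD.mu, QD.nu, pow_succ, mul_assoc])
    [] (by decide +kernel) (by decide +kernel)
    (.glue 0 0 1 none none [] [] (by decide +kernel) (by decide +kernel))
    (.glue 0 2 2 none (some 0) [[0], [0, 0]] [] (by decide +kernel) (by decide +kernel))) rfl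

theorem tabW16_data : TauTiltingData (TabW16 K) 8 3 3 :=
  HasseType.data (hasseType_of_check
    (R := [([0, 0, 0], none), ([1, 2], none), ([2, 0, 1], none), ([2, 0, 0], none), ([0, 0, 1],
    none)])
    (ws := [[0], [1], [2], [0, 0], [0, 1], [2, 0], [2, 1]])
    (by ext; simp [wordRels, ev, QD.al, QD.mu, QD.nu, pow_succ, mul_assoc])
    [] (by decide +kernel) (by decide +kernel)
    (.glue 1 0 1 (some 0) none [] [[0]] (by decide +kernel) (by decide +kernel))
    (.glue 0 1 2 none (some 0) [[0]] [] (by decide +kernel) (by decide +kernel))) rfl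

theorem tabW17_data : TauTiltingData (TabW17 K) 9 2 5 :=
  HasseType.data (hasseType_of_check
    (R := [([0, 0, 0, 0], none), ([1, 2], none), ([2, 1], none), ([0, 1], none), ([2, 0, 0, 0],
    none)])
    (ws := [[0], [1], [2], [0, 0], [2, 0], [0, 0, 0], [2, 0, 0]])
    (by ext; simp [wordRels, ev, QD.al, QD.mu, QD.nu, pow_succ, mul_assoc])
    [] (by decide +kernel) (by decide +kernel)
    (.glue 0 0 1 none none [] [] (by decide +kernel) (by decide +kernel))
    (.glue 0 2 2 none (some 0) [[0], [0, 0]] [] (by decide +kernel) (by decide +kernel))) rfl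

theorem tabW18_data : TauTiltingData (TabW18 K) 8 3 3 :=
  HasseType.data (hasseType_of_check
    (R := [([0, 0, 0, 0], none), ([1, 2], none), ([2, 1], none), ([2, 0, 1], none), ([2, 0, 0],
    none), ([0, 0, 1], none)])
    (ws := [[0], [1], [2], [0, 0], [0, 1], [2, 0], [0, 0, 0]])
    (by ext; simp [wordRels, ev, QD.al, QD.mu, QD.nu, pow_succ, mul_assoc])
    [] (by decide +kernel) (by decide +kernel)
    (.glue 1 0 1 (some 0) none [] [[0]] (by decide +kernel) (by decide +kernel))
    (.glue 0 1 2 none (some 0) [[0]] [] (by decide +kernel) (by decide +kernel))) rfl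

theorem tabW19_data : TauTiltingData (TabW19 K) 7 2 3 :=
  HasseType.data (HasseType.swap (hasseType_of_check
    (R := [([0, 0, 0, 0, 0], none), ([1, 2], none), ([2, 1], none), ([2, 0], none), ([0, 0, 1],
    none)])
    (ws := [[0], [1], [2], [0, 0], [0, 1], [0, 0, 0], [0, 0, 0, 0]])
    (by ext; simp [wordRels, ev, QD.al, QD.mu, QD.nu, pow_succ, mul_assoc])
    [] (by decide +kernel) (by decide +kernel)
    (.glue 1 0 1 (some 0) none [] [[0]] (by decide +kernel) (by decide +kernel))
    (.glue 0 0 2 none none [] [] (by decide +kernel) (by decide +kernel)))) rfl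

theorem tabW20_data : TauTiltingData (TabW20 K) 7 2 3 :=
  HasseType.data (HasseType.swap (hasseType_of_check
    (R := [([0, 0], none), ([2, 0], none), ([2, 1, 2], none), ([0, 1, 2], none)])
    (ws := [[0], [1], [2], [0, 1], [1, 2], [2, 1], [1, 2, 1]])
    (by ext; simp [wordRels, ev, QD.al, QD.mu, QD.nu, pow_succ, mul_assoc])
    [] (by decide +kernel) (by decide +kernel)
    (.glue 1 0 1 (some 0) none [[1, 2]] [[0], [1, 2]] (by decide +kernel) (by decide +kernel))
    (.glue 0 0 2 none none [] [] (by decide +kernel) (by decide +kernel)))) rfl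

theorem tabW21_data : TauTiltingData (TabW21 K) 7 2 3 :=
  HasseType.data (HasseType.swap (hasseType_of_check
    (R := [([0, 0], none), ([2, 0], none), ([1, 2, 1], none)])
    (ws := [[0], [1], [2], [0, 1], [1, 2], [2, 1], [0, 1, 2], [2, 1, 2]])
    (by ext; simp [wordRels, ev, QD.al, QD.mu, QD.nu, pow_succ, mul_assoc])
    [] (by decide +kernel) (by decide +kernel)
    (.glue 1 0 1 (some 0) none [] [[0]] (by decide +kernel) (by decide +kernel))
    (.glue 0 0 2 none none [[2, 1]] [[2, 1]] (by decide +kernel) (by decide +kernel)))) rfl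

theorem tabW22_data : TauTiltingData (TabW22 K) 7 2 3 :=
  HasseType.data (HasseType.swap (hasseType_of_check
    (R := [([0, 0, 0], none), ([2, 1], none), ([2, 0], none), ([0, 1, 2], none), ([0, 0, 1],
    none)])
    (ws := [[0], [1], [2], [0, 0], [0, 1], [1, 2]])
    (by ext; simp [wordRels, ev, QD.al, QD.mu, QD.nu, pow_succ, mul_assoc])
    [] (by decide +kernel) (by decide +kernel)
    (.glue 1 0 1 (some 0) none [] [[0]] (by decide +kernel) (by decide +kernel))
    (.glue 0 0 2 none none [] [] (by decide +kernel) (by decide +kernel)))) rfl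

theorem tabW23_data : TauTiltingData (TabW23 K) 8 3 3 :=
  HasseType.data (hasseType_of_check
    (R := [([0, 0], some [1, 2]), ([0, 0, 0], none), ([0, 0, 1], none)])
    (ws := [[0], [1], [2], [1, 2], [0, 1], [2, 0], [2, 1], [2, 1, 2], [2, 0, 1]])
    (by ext; simp [wordRels, ev, QD.al, QD.mu, QD.nu, pow_succ, mul_assoc])
    [([0, 1, 2], [0, 0, 0]), ([1, 2, 0], [0, 0, 0]), ([1, 2, 1], [0, 0, 1])] (by decide +kernel)
    (by decide +kernel)
    (.glue 1 0 1 (some 0) none [] [[0]] (by decide +kernel) (by decide +kernel))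
    (.glue 0 1 2 none (some 0) [[0], [2, 1]] [[2, 1]] (by decide +kernel) (by decide +kernel))) rfl

theorem tabW24_data : TauTiltingData (TabW24 K) 10 3 5 :=
  HasseType.data (HasseType.swap (hasseType_of_check
    (R := [([0, 0, 0], some [1, 2]), ([0, 0, 0, 0], none), ([2, 1], none), ([2, 0, 1], none),
    ([2, 0, 0], none)])
    (ws := [[0], [1], [2], [0, 0], [0, 1], [1, 2], [2, 0], [0, 0, 1]])
    (by ext; simp [wordRels, ev, QD.al, QD.mu, QD.nu, pow_succ, mul_assoc])
    [([0, 1, 2], [0, 0, 0, 0]), ([1, 2, 0], [0, 0, 0, 0]), ([0, 0, 0, 1], [1, 2, 1])]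
    (by decide +kernel) (by decide +kernel)
    (.glue 2 0 1 (some 0) none [] [[0], [0, 0]] (by decide +kernel) (by decide +kernel))
    (.glue 0 1 2 none (some 0) [[0]] [] (by decide +kernel) (by decide +kernel)))) rfl

theorem tabW25_data : TauTiltingData (TabW25 K) 7 2 3 :=
  HasseType.data (HasseType.swap (hasseType_of_check
    (R := [([0, 0, 0], none), ([1, 1], none), ([3, 2], none), ([2, 3], none), ([3, 0], none),
    ([2, 1], none), ([1, 3], none), ([0, 0, 2], none)])
    (ws := [[0], [1], [2], [3], [0, 0], [0, 2]])
    (by ext; simp [wordRels, ev, QE.al, QE.be, QE.mu, QE.nu, pow_succ, mul_assoc])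
    [] (by decide +kernel) (by decide +kernel)
    (.glue 1 0 2 (some 0) none [] [[0]] (by decide +kernel) (by decide +kernel))
    (.glue 0 0 3 none none [] [] (by decide +kernel) (by decide +kernel)))) rfl

theorem tabW26_data : TauTiltingData (TabW26 K) 7 2 3 :=
  HasseType.data (HasseType.swap (hasseType_of_check
    (R := [([0, 0], none), ([1, 1], none), ([3, 2], none), ([0, 2], none), ([3, 0], none), ([1,
    3], none)])
    (ws := [[0], [1], [2], [3], [2, 1], [2, 3]])
    (by ext; simp [wordRels, ev, QE.al, QE.be, QE.mu, QE.nu, pow_succ, mul_assoc])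
    [] (by decide +kernel) (by decide +kernel)
    (.glue 0 1 2 none (some 1) [[1]] [] (by decide +kernel) (by decide +kernel))
    (.glue 0 0 3 none none [] [] (by decide +kernel) (by decide +kernel)))) rfl

theorem tabW27_data : TauTiltingData (TabW27 K) 8 2 4 :=
  HasseType.data (hasseType_of_check
    (R := [([0, 0], some [2, 3]), ([1, 1], none), ([3, 2], none), ([0, 2], none), ([2, 1], none),
    ([1, 3, 0], none)])
    (ws := [[0], [1], [2], [3], [2, 3], [1, 3], [3, 0]])
    (by ext; simp [wordRels, ev, QE.al, QE.be, QE.mu, QE.nu, pow_succ, mul_assoc])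
    [([0, 0, 0], [0, 2, 3]), ([2, 3, 0], [0, 0, 0]), ([3, 0, 0], [3, 2, 3])] (by decide +kernel)
    (by decide +kernel)
    (.glue 0 0 2 none none [] [] (by decide +kernel) (by decide +kernel))
    (.glue 1 1 3 (some 1) (some 0) [[0]] [[1]] (by decide +kernel) (by decide +kernel))) rfl

theorem tabW28_data : TauTiltingData (TabW28 K) 8 3 3 :=
  HasseType.data (hasseType_of_check
    (R := [([0, 0], some [2, 3]), ([1, 1], none), ([3, 2], none), ([0, 2], none), ([1, 3],
    none)])
    (ws := [[0], [1], [2], [3], [2, 3], [2, 1], [3, 0]])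
    (by ext; simp [wordRels, ev, QE.al, QE.be, QE.mu, QE.nu, pow_succ, mul_assoc])
    [([0, 0, 0], [0, 2, 3]), ([2, 3, 0], [0, 0, 0]), ([3, 0, 0], [3, 2, 3])] (by decide +kernel)
    (by decide +kernel)
    (.glue 0 1 2 none (some 1) [[1]] [] (by decide +kernel) (by decide +kernel))
    (.glue 0 1 3 none (some 0) [[0]] [] (by decide +kernel) (by decide +kernel))) rfl

theorem tabW29_data : TauTiltingData (TabW29 K) 8 3 3 :=
  HasseType.data (hasseType_of_check
    (R := [([0, 0], some [2, 3]), ([1, 1], none), ([3, 2], none), ([3, 0], none), ([2, 1],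
    none)])
    (ws := [[0], [1], [2], [3], [2, 3], [0, 2], [1, 3]])
    (by ext; simp [wordRels, ev, QE.al, QE.be, QE.mu, QE.nu, pow_succ, mul_assoc])
    [([0, 0, 0], [2, 3, 0]), ([0, 0, 2], [2, 3, 2]), ([0, 2, 3], [0, 0, 0])] (by decide +kernel)
    (by decide +kernel)
    (.glue 1 0 2 (some 0) none [] [[0]] (by decide +kernel) (by decide +kernel))
    (.glue 1 0 3 (some 1) none [] [[1]] (by decide +kernel) (by decide +kernel))) rfl

theorem tabW30_data : TauTiltingData (TabW30 K) 8 2 4 :=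
  HasseType.data (HasseType.swap (hasseType_of_check
    (R := [([0, 0], some [2, 3]), ([1, 1], none), ([3, 2], none), ([3, 0], none), ([1, 3], none),
    ([0, 2, 1], none)])
    (ws := [[0], [1], [2], [3], [2, 3], [0, 2], [2, 1]])
    (by ext; simp [wordRels, ev, QE.al, QE.be, QE.mu, QE.nu, pow_succ, mul_assoc])
    [([0, 0, 0], [2, 3, 0]), ([0, 0, 2], [2, 3, 2]), ([0, 2, 3], [0, 0, 0])] (by decide +kernel)
    (by decide +kernel)
    (.glue 1 1 2 (some 0) (some 1) [[1]] [[0]] (by decide +kernel) (by decide +kernel))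
    (.glue 0 0 3 none none [] [] (by decide +kernel) (by decide +kernel)))) rfl

theorem tabW31_data : TauTiltingData (TabW31 K) 6 2 2 :=
  HasseType.data (hasseType_of_check
    (R := [([0, 2], some [2, 1]), ([0, 0], none), ([1, 1, 1], none), ([2, 3], none), ([3, 0],
    none), ([1, 3], none), ([2, 1, 1], none)])
    (ws := [[0], [1], [2], [3], [2, 1], [1, 1], [3, 2]])
    (by ext; simp [wordRels, ev, QE.al, QE.be, QE.mu, QE.nu, pow_succ, mul_assoc])
    [([0, 2, 1], [0, 0, 2]), ([3, 2, 1], [3, 0, 2])] (by decide +kernel) (by decide +kernel)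
    (.glue 0 0 2 none none [[1]] [[0]] (by decide +kernel) (by decide +kernel))
    (.glue 0 0 3 none none [] [] (by decide +kernel) (by decide +kernel))) rfl

theorem tabW32_data : TauTiltingData (TabW32 K) 6 2 2 :=
  HasseType.data (hasseType_of_check
    (R := [([0, 2], some [2, 1]), ([0, 0], none), ([1, 1], none), ([3, 0], none), ([1, 3], none),
    ([2, 3, 2], none), ([3, 2, 3], none)])
    (ws := [[0], [1], [2], [3], [2, 1], [2, 3], [3, 2]])
    (by ext; simp [wordRels, ev, QE.al, QE.be, QE.mu, QE.nu, pow_succ, mul_assoc])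
    [([0, 2, 1], [0, 0, 2]), ([0, 2, 3], [2, 1, 3]), ([3, 2, 1], [3, 0, 2])] (by decide +kernel)
    (by decide +kernel)
    (.glue 0 0 2 none none [[1]] [[0]] (by decide +kernel) (by decide +kernel))
    (.glue 0 0 3 none none [] [] (by decide +kernel) (by decide +kernel))) rfl

theorem tabW33_data : TauTiltingData (TabW33 K) 6 2 2 :=
  HasseType.data (hasseType_of_check
    (R := [([0, 2], some [2, 1]), ([0, 0, 0], none), ([1, 1, 1], none), ([3, 2], none), ([2, 3],
    none), ([3, 0], none), ([1, 3], none), ([2, 1, 1], none), ([0, 0, 2], none)])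
    (ws := [[0], [1], [2], [3], [0, 0], [2, 1], [1, 1]])
    (by ext; simp [wordRels, ev, QE.al, QE.be, QE.mu, QE.nu, pow_succ, mul_assoc])
    [([0, 2, 1], [0, 0, 2])] (by decide +kernel) (by decide +kernel)
    (.glue 0 0 2 none none [[1]] [[0]] (by decide +kernel) (by decide +kernel))
    (.glue 0 0 3 none none [] [] (by decide +kernel) (by decide +kernel))) rfl

theorem tabW34_data : TauTiltingData (TabW34 K) 6 2 2 :=
  HasseType.data (hasseType_of_check
    (R := [([0, 2], some [2, 1]), ([0, 0, 0], none), ([1, 1], none), ([3, 2], none), ([3, 0],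
    none), ([1, 3], none), ([0, 0, 2], none)])
    (ws := [[0], [1], [2], [3], [0, 0], [2, 1], [2, 3]])
    (by ext; simp [wordRels, ev, QE.al, QE.be, QE.mu, QE.nu, pow_succ, mul_assoc])
    [([0, 2, 1], [0, 0, 2]), ([0, 2, 3], [2, 1, 3])] (by decide +kernel) (by decide +kernel)
    (.glue 0 0 2 none none [[1]] [[0]] (by decide +kernel) (by decide +kernel))
    (.glue 0 0 3 none none [] [] (by decide +kernel) (by decide +kernel))) rfl

end TwoPoint

namespace TwoPoint

/-- Theorem 1.4(2), Table W part.  The listed Table W algebras are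
τ-tilting finite, with the indicated numbers of basic support τ-tilting modules and Hasse
quiver types. -/
theorem table_W_tau_tilting_finite (K : Type) [Field K] [IsAlgClosed K] :
    TauTiltingData (TabW4 K) 5 1 2 ∧
    TauTiltingData (TabW6 K) 6 1 3 ∧
    TauTiltingData (TabW7 K) 8 1 5 ∧
    TauTiltingData (TabW8 K) 8 1 5 ∧
    TauTiltingData (TabW9 K) 6 1 3 ∧
    TauTiltingData (TabW10 K) 6 1 3 ∧
    TauTiltingData (TabW11 K) 7 1 4 ∧
    TauTiltingData (TabW12 K) 5 1 2 ∧
    TauTiltingData (TabW13 K) 5 1 2 ∧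
    TauTiltingData (TabW14 K) 10 3 5 ∧
    TauTiltingData (TabW15 K) 9 2 5 ∧
    TauTiltingData (TabW16 K) 8 3 3 ∧
    TauTiltingData (TabW17 K) 9 2 5 ∧
    TauTiltingData (TabW18 K) 8 3 3 ∧
    TauTiltingData (TabW19 K) 7 2 3 ∧
    TauTiltingData (TabW20 K) 7 2 3 ∧
    TauTiltingData (TabW21 K) 7 2 3 ∧
    TauTiltingData (TabW22 K) 7 2 3 ∧
    TauTiltingData (TabW23 K) 8 3 3 ∧
    TauTiltingData (TabW24 K) 10 3 5 ∧
    TauTiltingData (TabW25 K) 7 2 3 ∧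
    TauTiltingData (TabW26 K) 7 2 3 ∧
    TauTiltingData (TabW27 K) 8 2 4 ∧
    TauTiltingData (TabW28 K) 8 3 3 ∧
    TauTiltingData (TabW29 K) 8 3 3 ∧
    TauTiltingData (TabW30 K) 8 2 4 ∧
    TauTiltingData (TabW31 K) 6 2 2 ∧
    TauTiltingData (TabW32 K) 6 2 2 ∧
    TauTiltingData (TabW33 K) 6 2 2 ∧
    TauTiltingData (TabW34 K) 6 2 2 := by
  exact ⟨tabW4_data K, tabW6_data K, tabW7_data K, tabW8_data K, tabW9_data K, tabW10_data K,
    tabW11_data K, tabW12_data K, tabW13_data K, tabW14_data K, tabW15_data K, tabW16_data K,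
    tabW17_data K, tabW18_data K, tabW19_data K, tabW20_data K, tabW21_data K, tabW22_data K,
    tabW23_data K, tabW24_data K, tabW25_data K, tabW26_data K, tabW27_data K, tabW28_data K,
    tabW29_data K, tabW30_data K, tabW31_data K, tabW32_data K, tabW33_data K, tabW34_data K⟩

end TwoPoint
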